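/- Assume in addition that u₀ ∈ L⁴(ℝ²). Then for every T > 0 there is a constant M(T), depending only on T, such that sup_{0≤t≤T} ∫_{ℝ²}|u(x,t)|⁴dx + ∫₀ᵀ∫_{ℝ²}|u|²|∇u|²dxdt ≤ M(T)(∫_{ℝ²}|u₀|⁴dx + ε₀ B(T)). -/

import Mathlib

open MeasureTheory Filter

noncomputable section

/-- Points/vectors in the plane, with Lebesgue measure. -/
abbrev V : Type := Fin 2 → ℝ

/-- 2×2 real matrices realized as nested functions. -/
abbrev M2 : Type := Fin 2 → Fin 2 → ℝ

/-- Partial derivative in the `i`-th coordinate direction. -/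
def pd (i : Fin 2) (f : V → ℝ) (x : V) : ℝ :=
  fderiv ℝ f x (Pi.single i 1)

/-- Laplacian of a scalar field. -/
def lap (f : V → ℝ) (x : V) : ℝ := ∑ i, pd i (pd i f) x

/-- Spatial gradient of a vector field: `(∇u)_{ij} = ∂_j u_i`. -/
def gradU (u : V → V) (x : V) : M2 := fun i j => pd j (fun y => u y i) x

/-- Divergence of a vector field. -/
def divV (u : V → V) (x : V) : ℝ := ∑ i, pd i (fun y => u y i) x

/-- Squared Frobenius norm of a 2×2 matrix. -/
def nsq (A : M2) : ℝ := ∑ i, ∑ j, (A i j) ^ 2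

/-- Squared Euclidean norm of a vector in the plane. -/
def vnsq (v : V) : ℝ := ∑ i, (v i) ^ 2

/-- The identity matrix. -/
def idM : M2 := fun i j => if i = j then 1 else 0

/-- The weight `σ(t) = min{1,t}`. -/
def sg (t : ℝ) : ℝ := min 1 t

/-- The material derivative `u̇ = ∂ₜ u + (u·∇)u`. -/
def mdot (u : ℝ → V → V) (t : ℝ) (x : V) : V :=
  fun i => deriv (fun s => u s x i) t + ∑ j, u t x j * pd j (fun y => u t y i) x

/-- `ε₀ = ‖F₀ − I‖²_{L^∞} + ∫ (|F₀ − I|² + |u₀|²)(1+|x|²) dx`. -/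
def eps0 (u0 : V → V) (F0 : V → M2) : ℝ :=
  (⨆ x : V, nsq (F0 x - idM)) +
    ∫ x : V, (nsq (F0 x - idM) + vnsq (u0 x)) * (1 + vnsq x)

/-- The incompressible viscoelastic system on the time interval `[0,T]`:
momentum equation, deformation-gradient transport equation, and `div u = 0`. -/
def IsSolution (u : ℝ → V → V) (F : ℝ → V → M2) (P : ℝ → V → ℝ) (T : ℝ) : Prop :=
  (∀ t ∈ Set.Icc (0:ℝ) T, ∀ (x : V) (i : Fin 2),
      deriv (fun s => u s x i) t + (∑ j, u t x j * pd j (fun y => u t y i) x)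
        - lap (fun y => u t y i) x + pd i (P t) x
        = ∑ j, pd j (fun y => ∑ k, F t y i k * F t y j k) x) ∧
  (∀ t ∈ Set.Icc (0:ℝ) T, ∀ (x : V) (i j : Fin 2),
      deriv (fun s => F s x i j) t + (∑ k, u t x k * pd k (fun y => F t y i j) x)
        = ∑ k, pd k (fun y => u t y i) x * F t x k j) ∧
  (∀ t ∈ Set.Icc (0:ℝ) T, ∀ x : V, divV (u t) x = 0)

/-- The quantity `A(T)` (with `w = 𝒫u̇` the Leray projection of the material
derivative, given as a separate argument). -/
def Afun (u : ℝ → V → V) (F : ℝ → V → M2) (w : ℝ → V → V) (T : ℝ) : ℝ :=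
  (⨆ t ∈ Set.Icc (0:ℝ) T, ∫ x : V,
      (vnsq (u t x) + nsq (F t x - idM) + sg t * nsq (gradU (u t) x)
        + (sg t) ^ 2 * vnsq (w t x))) +
  ∫ t in Set.Ioc (0:ℝ) T, ∫ x : V,
      (nsq (gradU (u t) x) + sg t * vnsq (mdot u t x)
        + (sg t) ^ 2 * nsq (gradU (w t) x))

/-- The quantity `B(T) = ‖F − I‖²_{L^∞(ℝ²×[0,T])}`. -/
def Bfun (F : ℝ → V → M2) (T : ℝ) : ℝ :=
  ⨆ t ∈ Set.Icc (0:ℝ) T, ⨆ x : V, nsq (F t x - idM)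

section
open Set
open Real (sin cos exp)
open ENNReal (ofReal)
open scoped Real

/-- The Cauchy transform of a density on the real line. -/
def cauchyTr (φ : ℝ → ℝ) (z : ℂ) : ℂ := ∫ t : ℝ, (φ t : ℂ) / (z - t)

lemma im_le_norm_sub_ofReal (z : ℂ) (t : ℝ) : z.im ≤ ‖z - t‖ := by
  have := Complex.abs_im_le_norm (z - t)
  simp at this
  exact (le_abs_self _).trans this

lemma sub_ofReal_ne_zero_of_im_pos {z : ℂ} (hz : 0 < z.im) (t : ℝ) : z - t ≠ 0 := by
  intro h
  have := im_le_norm_sub_ofReal z t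
  rw [h, norm_zero] at this
  linarith

lemma continuous_cauchyTr_integrand {φ : ℝ → ℝ} (hφ : Continuous φ) {z : ℂ} (hz : 0 < z.im) :
    Continuous (fun t : ℝ => (φ t : ℂ) / (z - t)) :=
  (Complex.continuous_ofReal.comp hφ).div (by fun_prop) (sub_ofReal_ne_zero_of_im_pos hz)

lemma hasCompactSupport_cauchyTr_integrand {φ : ℝ → ℝ} (hc : HasCompactSupport φ) (z : ℂ) :
    HasCompactSupport (fun t : ℝ => (φ t : ℂ) / (z - t)) := by
  refine hc.mono ?_
  intro t ht
  simp only [Function.mem_support] at ht ⊢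
  intro h
  simp [h] at ht

lemma differentiableAt_cauchyTr {φ : ℝ → ℝ} (hφ : Continuous φ) (hc : HasCompactSupport φ)
    {z : ℂ} (hz : 0 < z.im) : DifferentiableAt ℂ (cauchyTr φ) z := by
  have hs : {w : ℂ | z.im / 2 < w.im} ∈ nhds z :=
    (isOpen_lt continuous_const Complex.continuous_im).mem_nhds (by simp; linarith)
  have key := hasDerivAt_integral_of_dominated_loc_of_deriv_le (𝕜 := ℂ) (μ := volume)
    (F := fun (w : ℂ) (t : ℝ) => (φ t : ℂ) / (w - t))
    (F' := fun (w : ℂ) (t : ℝ) => -(φ t : ℂ) / (w - t) ^ 2)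
    (bound := fun t => ‖φ t‖ * (4 / z.im ^ 2)) (x₀ := z) hs ?_ ?_ ?_ ?_ ?_ ?_
  · exact key.2.differentiableAt
  · filter_upwards [hs] with w hw
    exact (continuous_cauchyTr_integrand hφ
      (lt_trans (by linarith) hw)).aestronglyMeasurable
  · exact (continuous_cauchyTr_integrand hφ hz).integrable_of_hasCompactSupport
      (hasCompactSupport_cauchyTr_integrand hc z)
  · apply Continuous.aestronglyMeasurable
    refine Continuous.div (by fun_prop) (by fun_prop) ?_
    intro t
    exact pow_ne_zero 2 (sub_ofReal_ne_zero_of_im_pos hz t)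
  · refine Eventually.of_forall fun t w hw => ?_
    simp only [mem_ofPred_eq] at hw
    rw [norm_div, norm_neg, norm_pow, Complex.norm_real, div_eq_mul_inv]
    refine mul_le_mul_of_nonneg_left ?_ (norm_nonneg _)
    have h1 : z.im / 2 ≤ ‖w - t‖ := hw.le.trans (im_le_norm_sub_ofReal w t)
    have h2 : (z.im / 2) ^ 2 ≤ ‖w - t‖ ^ 2 := pow_le_pow_left₀ (by linarith) h1 2
    have h3 := inv_anti₀ (by positivity) h2
    refine h3.trans (le_of_eq ?_)
    field_simp
    norm_num
  · exact ((hφ.norm.integrable_of_hasCompactSupport hc.norm)).mul_const _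
  · refine Eventually.of_forall fun t w hw => ?_
    simp only [mem_ofPred_eq] at hw
    have hne := sub_ofReal_ne_zero_of_im_pos (z := w) (by linarith) t
    have := ((hasDerivAt_id w).sub_const (t : ℂ)).inv hne
    have := this.const_mul (φ t : ℂ)
    refine (this.congr_deriv (by simp only [id]; ring)).congr_of_eventuallyEq (Eventually.of_forall fun y => ?_)
    simp [div_eq_mul_inv]

lemma norm_cauchyTr_le {φ : ℝ → ℝ} (hφ : Continuous φ) (hc : HasCompactSupport φ)
    {ε : ℝ} (hε : 0 < ε) :
    ∃ C : ℝ, 0 ≤ C ∧ ∀ z : ℂ, ε ≤ z.im → ‖cauchyTr φ z‖ ≤ C / (1 + ‖z‖) := by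
  obtain ⟨R, hR⟩ := hc.isCompact.isBounded.subset_closedBall (0 : ℝ)
  have hIt := hφ.norm.integrable_of_hasCompactSupport (μ := volume) hc.norm
  set K := 1 + (1 + |R|) / ε with hK
  have hKpos : 0 < K := by positivity
  refine ⟨(∫ t, ‖φ t‖) * K, by positivity, fun z hz => ?_⟩
  have hb : ∀ t, ‖(φ t : ℂ) / (z - t)‖ ≤ ‖φ t‖ * (K / (1 + ‖z‖)) := by
    intro t
    by_cases ht : φ t = 0
    · simp [ht]
    have htR : |t| ≤ |R| := by
      have := hR (subset_tsupport φ ht)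
      simp at this
      exact this.trans (le_abs_self R)
    rw [norm_div, Complex.norm_real, div_eq_mul_inv]
    refine mul_le_mul_of_nonneg_left ?_ (norm_nonneg _)
    have hn : ε ≤ ‖z - t‖ := hz.trans (im_le_norm_sub_ofReal z t)
    have h1 : 1 + ‖z‖ ≤ ‖z - t‖ * K := by
      have : ‖z‖ ≤ ‖z - t‖ + |t| := by
        have := norm_add_le (z - t) (t : ℂ)
        simpa using this
      have h2 : (1 + |R|) ≤ ‖z - t‖ * ((1 + |R|) / ε) := by
        calc (1 + |R|) = ε * ((1 + |R|) / ε) := by field_simp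
          _ ≤ _ := by gcongr
      rw [hK]; nlinarith
    rw [inv_le_comm₀ (by linarith) (by positivity), inv_div, div_le_iff₀ hKpos]
    exact h1
  calc ‖cauchyTr φ z‖ ≤ ∫ t, ‖φ t‖ * (K / (1 + ‖z‖)) :=
        norm_integral_le_of_norm_le (hIt.mul_const _) (Eventually.of_forall hb)
    _ = _ := by rw [integral_mul_const]; ring

lemma integrable_inv_one_add_abs_pow_four : Integrable (fun x : ℝ => ((1 + |x|) ^ 4)⁻¹) := by
  refine integrable_inv_one_add_sq.mono' (Continuous.aestronglyMeasurable ?_) ?_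
  · refine Continuous.inv₀ (by fun_prop) (fun x => by positivity)
  · refine Eventually.of_forall fun x => ?_
    rw [Real.norm_of_nonneg (by positivity)]
    refine inv_anti₀ (by positivity) ?_
    have := abs_nonneg x
    have h2 := sq_abs x
    nlinarith [sq_nonneg (|x|), pow_nonneg this 3, pow_nonneg this 4]

lemma continuous_cauchyTr_line {φ : ℝ → ℝ} (hφ : Continuous φ) (hc : HasCompactSupport φ)
    {ε : ℝ} (hε : 0 < ε) : Continuous (fun x : ℝ => cauchyTr φ (x + ε * Complex.I)) := by
  rw [continuous_iff_continuousAt]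
  intro x
  have h := (differentiableAt_cauchyTr hφ hc (z := x + ε * Complex.I) (by simpa)).continuousAt
  exact ContinuousAt.comp (f := fun x : ℝ => (x : ℂ) + ε * Complex.I) h (by fun_prop)

lemma integrable_cauchyTr_pow_four {φ : ℝ → ℝ} (hφ : Continuous φ) (hc : HasCompactSupport φ)
    {ε : ℝ} (hε : 0 < ε) :
    Integrable (fun x : ℝ => cauchyTr φ (x + ε * Complex.I) ^ 4) := by
  obtain ⟨C, hC0, hC⟩ := norm_cauchyTr_le hφ hc hε
  refine (integrable_inv_one_add_abs_pow_four.const_mul (C ^ 4)).mono'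
    ((continuous_cauchyTr_line hφ hc hε).pow 4).aestronglyMeasurable
    (Eventually.of_forall fun x => ?_)
  rw [norm_pow]
  calc ‖cauchyTr φ (x + ε * Complex.I)‖ ^ 4 ≤ (C / (1 + |x|)) ^ 4 := by
        refine pow_le_pow_left₀ (norm_nonneg _) ?_ 4
        refine (hC _ (by simp)).trans ?_
        have : |x| ≤ ‖(x : ℂ) + ε * Complex.I‖ := by
          have := Complex.abs_re_le_norm ((x : ℂ) + ε * Complex.I)
          simpa using this
        gcongr
    _ = _ := by rw [div_pow, div_eq_mul_inv]

lemma integral_cauchyTr_pow_four {φ : ℝ → ℝ} (hφ : Continuous φ) (hc : HasCompactSupport φ)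
    {ε : ℝ} (hε : 0 < ε) :
    ∫ x : ℝ, cauchyTr φ (x + ε * Complex.I) ^ 4 = 0 := by
  obtain ⟨C, hC0, hC⟩ := norm_cauchyTr_le hφ hc hε
  have hlim := intervalIntegral_tendsto_integral (integrable_cauchyTr_pow_four hφ hc hε)
    (tendsto_neg_atTop_atBot) (tendsto_id (α := ℝ) (x := atTop))
  refine tendsto_nhds_unique hlim ?_
  have hbd : ∀ L : ℝ, 0 < L → ∀ z : ℂ, ε ≤ z.im → L ≤ ‖z‖ →
      ‖cauchyTr φ z ^ 4‖ ≤ C ^ 4 / L ^ 4 := by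
    intro L hL z hz hn
    rw [norm_pow, ← div_pow]
    refine pow_le_pow_left₀ (norm_nonneg _) ((hC z hz).trans ?_) 4
    gcongr
    linarith
  have hmain : ∀ L : ℝ, 0 < L →
      ‖∫ x in (-L)..(id L), cauchyTr φ (x + ε * Complex.I) ^ 4‖ ≤ 4 * C ^ 4 / L ^ 3 := by
    intro L hL
    have hrect := Complex.integral_boundary_rect_eq_zero_of_differentiableOn
      (fun z => cauchyTr φ z ^ 4) (-L + ε * Complex.I) (L + (ε + L) * Complex.I) ?_
    · simp only [Complex.add_re, Complex.neg_re, Complex.ofReal_re, Complex.mul_re, Complex.I_re,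
        mul_zero, Complex.ofReal_im, Complex.I_im, mul_one, sub_self, add_zero, Complex.add_im,
        Complex.neg_im, neg_zero, Complex.mul_im, zero_add, smul_eq_mul] at hrect
      have hI : ∫ x in (-L)..L, cauchyTr φ (x + ε * Complex.I) ^ 4
          = (∫ x in (-L)..L, cauchyTr φ (x + (ε + L : ℝ) * Complex.I) ^ 4)
            - Complex.I * (∫ y in ε..(ε + L), cauchyTr φ (L + y * Complex.I) ^ 4)
            + Complex.I * (∫ y in ε..(ε + L), cauchyTr φ ((-L : ℝ) + y * Complex.I) ^ 4) := by
        linear_combination hrect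
      have h1 : ‖∫ x in (-L)..L, cauchyTr φ (x + (ε + L : ℝ) * Complex.I) ^ 4‖
          ≤ C ^ 4 / L ^ 4 * |L - (-L)| := by
        refine intervalIntegral.norm_integral_le_of_norm_le_const fun x _ => ?_
        refine hbd L hL _ (by simp; linarith) ?_
        have := Complex.abs_im_le_norm ((x : ℂ) + (ε + L : ℝ) * Complex.I)
        simp at this
        have h' := le_abs_self (ε + L)
        push_cast
        linarith
      have h2 : ∀ a : ℝ, |a| = L → ‖∫ y in ε..(ε + L), cauchyTr φ (a + y * Complex.I) ^ 4‖
          ≤ C ^ 4 / L ^ 4 * |ε + L - ε| := by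
        intro a ha
        refine intervalIntegral.norm_integral_le_of_norm_le_const fun y hy => ?_
        rw [uIoc_of_le (by linarith)] at hy
        refine hbd L hL _ (by simp; exact hy.1.le) ?_
        have := Complex.abs_re_le_norm ((a : ℂ) + y * Complex.I)
        simp at this
        linarith
      simp only [id]
      rw [hI]
      have h3 := h2 L (abs_of_pos hL)
      have h4 := h2 (-L) (by rw [abs_neg, abs_of_pos hL])
      refine (norm_add_le _ _).trans ?_
      refine (add_le_add (norm_sub_le _ _) le_rfl).trans ?_
      rw [norm_mul, norm_mul, Complex.norm_I, one_mul, one_mul]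
      have e1 : |L - (-L)| = 2 * L := by rw [abs_of_pos] <;> linarith
      have e2 : |ε + L - ε| = L := by rw [abs_of_pos] <;> linarith
      rw [e1] at h1
      rw [e2] at h3 h4
      have e3 : 4 * C ^ 4 / L ^ 3 = C ^ 4 / L ^ 4 * (2 * L) + C ^ 4 / L ^ 4 * L
        + C ^ 4 / L ^ 4 * L := by field_simp; ring
      rw [e3]
      exact add_le_add (add_le_add h1 h3) h4
    · intro z hz
      have hz' := (Complex.mem_reProdIm.1 hz).2
      simp only [Complex.add_im, Complex.neg_im, Complex.ofReal_im, neg_zero, Complex.mul_im,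
        Complex.ofReal_re, Complex.I_im, mul_one, Complex.I_re, mul_zero, zero_add,
        Complex.add_re, add_zero] at hz'
      rw [uIcc_of_le (by linarith)] at hz'
      exact ((differentiableAt_cauchyTr hφ hc (hε.trans_le hz'.1)).pow 4).differentiableWithinAt
  have hz : Tendsto (fun L : ℝ => 4 * C ^ 4 / L ^ 3) atTop (nhds 0) :=
    tendsto_const_nhds.div_atTop (tendsto_pow_atTop (by norm_num))
  refine squeeze_zero_norm' ?_ hz
  filter_upwards [eventually_gt_atTop 0] with L hL using hmain L hL

section CauchySchwarz
variable {α : Type*} [MeasurableSpace α] {μ : Measure α}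

lemma integrable_mul_of_sq {f g : α → ℝ} (hfm : AEStronglyMeasurable f μ)
    (hgm : AEStronglyMeasurable g μ) (hf : Integrable (fun x => f x ^ 2) μ)
    (hg : Integrable (fun x => g x ^ 2) μ) : Integrable (fun x => f x * g x) μ := by
  refine (hf.add hg).mono' (hfm.mul hgm) (Eventually.of_forall fun x => ?_)
  rw [Real.norm_eq_abs, abs_le]
  simp only [Pi.add_apply]
  constructor <;> nlinarith [sq_nonneg (f x + g x), sq_nonneg (f x - g x)]

/-- Cauchy–Schwarz for real integrals. -/
lemma integral_mul_sq_le {f g : α → ℝ} (hfm : AEStronglyMeasurable f μ)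
    (hgm : AEStronglyMeasurable g μ) (hf : Integrable (fun x => f x ^ 2) μ)
    (hg : Integrable (fun x => g x ^ 2) μ) :
    (∫ x, f x * g x ∂μ) ^ 2 ≤ (∫ x, f x ^ 2 ∂μ) * ∫ x, g x ^ 2 ∂μ := by
  have hfg := integrable_mul_of_sq hfm hgm hf hg
  have h : ∀ t : ℝ, 0 ≤ (∫ x, f x ^ 2 ∂μ) * (t * t) + (2 * ∫ x, f x * g x ∂μ) * t
      + ∫ x, g x ^ 2 ∂μ := by
    intro t
    have h0 : 0 ≤ ∫ x, (t * f x + g x) ^ 2 ∂μ := integral_nonneg fun x => sq_nonneg _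
    have e : ∀ x, (t * f x + g x) ^ 2 = (t * t) * f x ^ 2 + (2 * t) * (f x * g x) + g x ^ 2 :=
      fun x => by ring
    simp_rw [e] at h0
    rw [integral_add ((hf.const_mul _).fun_add (hfg.const_mul _)) hg,
      integral_add (hf.const_mul _) (hfg.const_mul _), integral_const_mul,
      integral_const_mul] at h0
    linarith
  have := discrim_le_zero h
  unfold discrim at this
  nlinarith

lemma abs_integral_mul_le {f g : α → ℝ} (hfm : AEStronglyMeasurable f μ)
    (hgm : AEStronglyMeasurable g μ) (hf : Integrable (fun x => f x ^ 2) μ)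
    (hg : Integrable (fun x => g x ^ 2) μ) :
    |∫ x, f x * g x ∂μ| ≤ √(∫ x, f x ^ 2 ∂μ) * √(∫ x, g x ^ 2 ∂μ) := by
  rw [← Real.sqrt_mul (integral_nonneg fun x => sq_nonneg _)]
  exact Real.abs_le_sqrt (integral_mul_sq_le hfm hgm hf hg)

/-- Weighted Jensen inequality for the fourth power. -/
lemma integral_mul_pow_four_le {w ψ : α → ℝ} (hw0 : ∀ x, 0 ≤ w x)
    (hψm : AEStronglyMeasurable ψ μ) (hw : Integrable w μ)
    (hwψ : Integrable (fun x => w x * ψ x ^ 4) μ) :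
    (∫ x, w x * ψ x ∂μ) ^ 4 ≤ (∫ x, w x ∂μ) ^ 3 * ∫ x, w x * ψ x ^ 4 ∂μ := by
  have hsm : AEStronglyMeasurable (fun x => √(w x)) μ :=
    Real.continuous_sqrt.comp_aestronglyMeasurable hw.aestronglyMeasurable
  have hs : ∀ x, √(w x) ^ 2 = w x := fun x => Real.sq_sqrt (hw0 x)
  have h2 : Integrable (fun x => w x * ψ x ^ 2) μ := by
    refine (hw.add hwψ).mono' (hw.aestronglyMeasurable.mul (hψm.pow 2))
      (Eventually.of_forall fun x => ?_)
    rw [Real.norm_of_nonneg (mul_nonneg (hw0 x) (sq_nonneg _))]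
    simp only [Pi.add_apply]
    nlinarith [mul_nonneg (hw0 x) (sq_nonneg (ψ x ^ 2 - 1)), hw0 x,
      mul_nonneg (hw0 x) (sq_nonneg (ψ x)), mul_nonneg (hw0 x) (sq_nonneg (ψ x ^ 2))]
  have a1 := integral_mul_sq_le (μ := μ) (f := fun x => √(w x)) (g := fun x => √(w x) * ψ x)
    hsm (hsm.mul hψm) (by simpa [hs] using hw) (by simpa [mul_pow, hs] using h2)
  have a2 := integral_mul_sq_le (μ := μ) (f := fun x => √(w x)) (g := fun x => √(w x) * ψ x ^ 2)
    hsm (hsm.mul (hψm.pow 2)) (by simpa [hs] using hw)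
    (by simpa [mul_pow, hs, ← pow_mul] using hwψ)
  simp only [mul_pow, hs, ← mul_assoc, Real.mul_self_sqrt (hw0 _), ← pow_mul] at a1 a2
  norm_num at a2
  have n1 : 0 ≤ ∫ x, w x ∂μ := integral_nonneg hw0
  have n2 : 0 ≤ ∫ x, w x * ψ x ^ 2 ∂μ := integral_nonneg fun x => mul_nonneg (hw0 x) (sq_nonneg _)
  calc (∫ x, w x * ψ x ∂μ) ^ 4 = ((∫ x, w x * ψ x ∂μ) ^ 2) ^ 2 := by ring
    _ ≤ ((∫ x, w x ∂μ) * ∫ x, w x * ψ x ^ 2 ∂μ) ^ 2 :=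
        pow_le_pow_left₀ (sq_nonneg _) a1 2
    _ = (∫ x, w x ∂μ) ^ 2 * (∫ x, w x * ψ x ^ 2 ∂μ) ^ 2 := by ring
    _ ≤ (∫ x, w x ∂μ) ^ 2 * ((∫ x, w x ∂μ) * ∫ x, w x * ψ x ^ 4 ∂μ) := by gcongr
    _ = _ := by ring

end CauchySchwarz

/-- The regularised Hilbert kernel. -/
def hker (ε s : ℝ) : ℝ := s / (s ^ 2 + ε ^ 2)

/-- The Poisson kernel (without normalisation). -/
def pker (ε s : ℝ) : ℝ := ε / (s ^ 2 + ε ^ 2)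

lemma continuous_hker {ε : ℝ} (hε : 0 < ε) : Continuous (hker ε) :=
  continuous_id.div (by fun_prop) (fun s => by positivity)

lemma continuous_pker {ε : ℝ} (hε : 0 < ε) : Continuous (pker ε) :=
  continuous_const.div (by fun_prop) (fun s => by positivity)

lemma pker_nonneg {ε : ℝ} (hε : 0 < ε) (s : ℝ) : 0 ≤ pker ε s := by
  unfold pker; positivity

lemma pker_eq {ε : ℝ} (hε : 0 < ε) (s : ℝ) : pker ε s = ε⁻¹ * (1 + (s / ε) ^ 2)⁻¹ := by
  unfold pker; field_simp; ring

lemma integrable_pker {ε : ℝ} (hε : 0 < ε) : Integrable (pker ε) := by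
  have := (integrable_inv_one_add_sq.comp_div hε.ne').const_mul ε⁻¹
  exact this.congr (Eventually.of_forall fun s => (pker_eq hε s).symm)

lemma integral_pker {ε : ℝ} (hε : 0 < ε) : ∫ s, pker ε s = π := by
  simp_rw [pker_eq hε]
  rw [integral_const_mul, Measure.integral_comp_div (fun x : ℝ => (1 + x ^ 2)⁻¹),
    integral_univ_inv_one_add_sq, abs_of_pos hε, smul_eq_mul]
  field_simp

lemma cauchyTr_eq {φ : ℝ → ℝ} (hφ : Continuous φ) (hc : HasCompactSupport φ)
    {ε : ℝ} (hε : 0 < ε) (x : ℝ) :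
    cauchyTr φ (x + ε * Complex.I)
      = (∫ t, φ t * hker ε (x - t) : ℝ) - (∫ t, φ t * pker ε (x - t) : ℝ) * Complex.I := by
  have i1 : Integrable (fun t => φ t * hker ε (x - t)) :=
    (hφ.mul ((continuous_hker hε).comp (by fun_prop))).integrable_of_hasCompactSupport hc.mul_right
  have i2 : Integrable (fun t => φ t * pker ε (x - t)) :=
    (hφ.mul ((continuous_pker hε).comp (by fun_prop))).integrable_of_hasCompactSupport hc.mul_right
  rw [← integral_complex_ofReal, ← integral_complex_ofReal, ← integral_mul_const,
    ← integral_sub i1.ofReal (i2.ofReal.mul_const _)]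
  unfold cauchyTr
  refine integral_congr_ae (Eventually.of_forall fun t => ?_)
  have hne : (x : ℂ) + ε * Complex.I - t ≠ 0 := sub_ofReal_ne_zero_of_im_pos (by simpa) t
  have hne2 : ((x - t) ^ 2 + ε ^ 2 : ℂ) ≠ 0 := by
    have : ((x - t) ^ 2 + ε ^ 2 : ℝ) ≠ 0 := by positivity
    exact_mod_cast this
  simp only [hker, pker]
  push_cast
  field_simp
  linear_combination ((φ t : ℂ) * ε ^ 2) * Complex.I_sq

lemma integral_conv_pker_pow_four_le {φ : ℝ → ℝ} (hφ : Continuous φ) (hc : HasCompactSupport φ)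
    {ε : ℝ} (hε : 0 < ε) :
    ∫ x, (∫ t, φ t * pker ε (x - t)) ^ 4 ≤ π ^ 4 * ∫ t, φ t ^ 4 := by
  have hc4 : HasCompactSupport (fun t => φ t ^ 4) :=
    hc.comp_left (g := fun y : ℝ => y ^ 4) (by simp)
  have hφ4 : Integrable (fun t => φ t ^ 4) :=
    (hφ.pow 4).integrable_of_hasCompactSupport hc4
  have hprod : Integrable (fun p : ℝ × ℝ => pker ε (p.1 - p.2) * φ p.2 ^ 4)
      (volume.prod volume) := by
    have := hφ4.convolution_integrand (ContinuousLinearMap.mul ℝ ℝ) (integrable_pker hε)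
    refine this.congr (Eventually.of_forall fun p => ?_)
    simp [mul_comm]
  have hx : ∀ x, (∫ t, φ t * pker ε (x - t)) ^ 4
      ≤ π ^ 3 * ∫ t, pker ε (x - t) * φ t ^ 4 := by
    intro x
    have hi : Integrable (fun t => pker ε (x - t)) := (integrable_pker hε).comp_sub_left x
    have e : ∫ t, pker ε (x - t) = π := by
      rw [integral_sub_left_eq_self (pker ε) volume x, integral_pker hε]
    have := integral_mul_pow_four_le (μ := volume) (w := fun t => pker ε (x - t)) (ψ := φ)
      (fun t => pker_nonneg hε _) hφ.aestronglyMeasurable hi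
      ((((continuous_pker hε).comp (by fun_prop)).mul (hφ.pow 4)).integrable_of_hasCompactSupport
        hc4.mul_left)
    rw [e] at this
    simpa only [mul_comm (φ _)] using this
  calc ∫ x, (∫ t, φ t * pker ε (x - t)) ^ 4
      ≤ ∫ x, π ^ 3 * ∫ t, pker ε (x - t) * φ t ^ 4 := by
        refine integral_mono_of_nonneg (Eventually.of_forall fun x => by positivity)
          (hprod.integral_prod_left.const_mul _) (Eventually.of_forall hx)
    _ = π ^ 3 * ∫ t, ∫ x, pker ε (x - t) * φ t ^ 4 := by
        rw [integral_const_mul, integral_integral_swap hprod]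
    _ = π ^ 3 * ∫ t, π * φ t ^ 4 := by
        congr 1
        refine integral_congr_ae (Eventually.of_forall fun t => ?_)
        simp only
        rw [integral_mul_const, integral_sub_right_eq_self (pker ε) t, integral_pker hε]
    _ = _ := by rw [integral_const_mul]; ring

/-- Uniform `L⁴` bound for the regularised Hilbert transform (Cotlar's argument). -/
theorem hilbert_pow_four {φ : ℝ → ℝ} (hφ : Continuous φ) (hc : HasCompactSupport φ)
    {ε : ℝ} (hε : 0 < ε) :
    Integrable (fun x => (∫ t, φ t * hker ε (x - t)) ^ 4) ∧
    ∫ x, (∫ t, φ t * hker ε (x - t)) ^ 4 ≤ 36 * π ^ 4 * ∫ t, φ t ^ 4 := by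
  set A := fun x => ∫ t, φ t * hker ε (x - t) with hA
  set B := fun x => ∫ t, φ t * pker ε (x - t) with hB
  have hF : ∀ x : ℝ, cauchyTr φ (x + ε * Complex.I) = (A x : ℂ) - (B x : ℂ) * Complex.I :=
    fun x => cauchyTr_eq hφ hc hε x
  have hIt := integrable_cauchyTr_pow_four hφ hc hε
  have hcont := continuous_cauchyTr_line hφ hc hε
  have hAc : Continuous A := by
    have := Complex.continuous_re.comp hcont
    refine this.congr fun x => ?_
    simp [hF]
  have hBc : Continuous B := by
    have := (Complex.continuous_im.comp hcont).neg
    refine this.congr fun x => ?_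
    simp [hF]
  have hAle : ∀ x, |A x| ≤ ‖cauchyTr φ (x + ε * Complex.I)‖ := fun x => by
    have := Complex.abs_re_le_norm (cauchyTr φ (x + ε * Complex.I))
    simpa [hF] using this
  have hBle : ∀ x, |B x| ≤ ‖cauchyTr φ (x + ε * Complex.I)‖ := fun x => by
    have := Complex.abs_im_le_norm (cauchyTr φ (x + ε * Complex.I))
    simpa [hF] using this
  have iA : Integrable (fun x => A x ^ 4) := by
    refine hIt.norm.mono' (hAc.pow 4).aestronglyMeasurable (Eventually.of_forall fun x => ?_)
    rw [norm_pow, norm_pow]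
    exact pow_le_pow_left₀ (norm_nonneg _) (hAle x) 4
  have iB : Integrable (fun x => B x ^ 4) := by
    refine hIt.norm.mono' (hBc.pow 4).aestronglyMeasurable (Eventually.of_forall fun x => ?_)
    rw [norm_pow, norm_pow]
    exact pow_le_pow_left₀ (norm_nonneg _) (hBle x) 4
  refine ⟨iA, ?_⟩
  have iAB : Integrable (fun x => A x ^ 2 * B x ^ 2) :=
    integrable_mul_of_sq (hAc.pow 2).aestronglyMeasurable (hBc.pow 2).aestronglyMeasurable
      (by simpa [← pow_mul] using iA) (by simpa [← pow_mul] using iB)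
  have hzero : ∫ x, (A x ^ 4 - 6 * (A x ^ 2 * B x ^ 2) + B x ^ 4) = 0 := by
    have h0 := congrArg Complex.re (integral_cauchyTr_pow_four hφ hc hε)
    have h1 := integral_re (𝕜 := ℂ) hIt
    simp only [RCLike.re_eq_complex_re] at h1
    rw [← h1] at h0
    rw [← Complex.zero_re, ← h0]
    refine integral_congr_ae (Eventually.of_forall fun x => ?_)
    simp only [hF]
    have : ((A x : ℂ) - (B x : ℂ) * Complex.I) ^ 4
        = ((A x ^ 4 - 6 * (A x ^ 2 * B x ^ 2) + B x ^ 4 : ℝ) : ℂ)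
          + ((4 * A x * B x ^ 3 - 4 * A x ^ 3 * B x : ℝ) : ℂ) * Complex.I := by
      push_cast
      linear_combination (6 * (A x : ℂ) ^ 2 * B x ^ 2 - 4 * A x * B x ^ 3 * Complex.I
        + (B x : ℂ) ^ 4 * (Complex.I ^ 2 - 1)) * Complex.I_sq
    rw [this, Complex.add_re, Complex.ofReal_re, Complex.re_ofReal_mul, Complex.I_re]
    ring
  have iS : Integrable (fun x => A x ^ 4 - 6 * (A x ^ 2 * B x ^ 2)) := iA.sub (iAB.const_mul 6)
  rw [integral_add iS iB, integral_sub iA (iAB.const_mul 6),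
    integral_const_mul] at hzero
  have hB4 := integral_conv_pker_pow_four_le hφ hc hε
  have hAB : ∫ x, A x ^ 2 * B x ^ 2 ≤ ∫ x, ((1 / 12) * A x ^ 4 + 3 * B x ^ 4) := by
    refine integral_mono iAB ((iA.const_mul _).add (iB.const_mul _)) fun x => ?_
    simp only
    nlinarith [sq_nonneg (A x ^ 2 - 6 * B x ^ 2)]
  rw [integral_add (iA.const_mul _) (iB.const_mul _), integral_const_mul,
    integral_const_mul] at hAB
  have hBn : 0 ≤ ∫ x, B x ^ 4 := integral_nonneg fun x => by positivity
  change ∫ x, A x ^ 4 ≤ _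
  change ∫ x, B x ^ 4 ≤ _ at hB4
  linarith

/-- The constant in the `L⁴` bound for the regularised Hilbert transform. -/
def cotC : ℝ := 36 * π ^ 4

lemma cotC_nonneg : 0 ≤ cotC := by unfold cotC; positivity

lemma lintegral_hilbert_pow_four {φ : ℝ → ℝ} (hφ : Continuous φ) (hc : HasCompactSupport φ)
    {ε : ℝ} (hε : 0 < ε) :
    ∫⁻ x, ofReal ((∫ t, φ t * hker ε (x - t)) ^ 4)
      ≤ ofReal cotC * ∫⁻ t, ofReal (φ t ^ 4) := by
  obtain ⟨h1, h2⟩ := hilbert_pow_four hφ hc hε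
  have hc4 : HasCompactSupport (fun t => φ t ^ 4) :=
    hc.comp_left (g := fun y : ℝ => y ^ 4) (by simp)
  have hφ4 : Integrable (fun t => φ t ^ 4) := (hφ.pow 4).integrable_of_hasCompactSupport hc4
  rw [← ofReal_integral_eq_lintegral_ofReal h1 (Eventually.of_forall fun x => by positivity),
    ← ofReal_integral_eq_lintegral_ofReal hφ4 (Eventually.of_forall fun x => by positivity),
    ← ENNReal.ofReal_mul cotC_nonneg]
  exact ENNReal.ofReal_le_ofReal h2

lemma continuous_integral_of_compact {X Y : Type*} [TopologicalSpace X]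
    [FirstCountableTopology X] [LocallyCompactSpace X] [TopologicalSpace Y]
    [MeasurableSpace Y] [OpensMeasurableSpace Y] [SecondCountableTopology Y] {μ : Measure Y}
    [IsLocallyFiniteMeasure μ] {f : X → Y → ℝ} (hf : Continuous f.uncurry) {K : Set Y}
    (hK : IsCompact K) (h0 : ∀ x, ∀ y ∉ K, f x y = 0) :
    Continuous (fun x => ∫ y, f x y ∂μ) := by
  have := continuous_parametric_integral_of_continuous (μ := μ) hf hK
  refine this.congr fun x => ?_
  exact setIntegral_eq_integral_of_forall_compl_eq_zero fun y hy => h0 x y hy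

lemma lintegral_double_hilbert {G : ℝ × ℝ → ℝ} (hG : Continuous G) (hc : HasCompactSupport G)
    {ε : ℝ} (hε : 0 < ε) :
    ∫⁻ x : ℝ × ℝ, ofReal
        ((∫ z : ℝ × ℝ, G z * (hker ε (x.1 - z.1) * hker ε (x.2 - z.2))) ^ 4)
      ≤ ofReal cotC ^ 2 * ∫⁻ z : ℝ × ℝ, ofReal (G z ^ 4) := by
  have hk := continuous_hker hε
  set K1 := Prod.fst '' tsupport G with hK1
  set K2 := Prod.snd '' tsupport G with hK2
  have cK1 : IsCompact K1 := hc.isCompact.image continuous_fst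
  have cK2 : IsCompact K2 := hc.isCompact.image continuous_snd
  have z1 : ∀ s t, s ∉ K1 → G (s, t) = 0 := fun s t hs => by
    by_contra h
    exact hs ⟨(s, t), subset_tsupport G h, rfl⟩
  have z2 : ∀ s t, t ∉ K2 → G (s, t) = 0 := fun s t hs => by
    by_contra h
    exact hs ⟨(s, t), subset_tsupport G h, rfl⟩
  set A : ℝ → ℝ → ℝ := fun x t => ∫ s, G (s, t) * hker ε (x - s) with hA
  have cA : Continuous A.uncurry := by
    have := continuous_integral_of_compact (μ := (volume : Measure ℝ))
      (f := fun (p : ℝ × ℝ) (s : ℝ) => G (s, p.2) * hker ε (p.1 - s))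
      (by fun_prop) cK1 (fun p s hs => by simp [z1 s p.2 hs])
    exact this.congr fun p => rfl
  have cpt2 : ∀ {φ : ℝ → ℝ}, (∀ t ∉ K2, φ t = 0) → HasCompactSupport φ :=
    fun h => HasCompactSupport.intro cK2 (fun t ht => h t ht)
  have cpt1 : ∀ {φ : ℝ → ℝ}, (∀ t ∉ K1, φ t = 0) → HasCompactSupport φ :=
    fun h => HasCompactSupport.intro cK1 (fun t ht => h t ht)
  have hA0 : ∀ x, ∀ t ∉ K2, A x t = 0 := fun x t ht => by simp [hA, z2 _ t ht]
  set B : ℝ → ℝ → ℝ := fun x y => ∫ t, A x t * hker ε (y - t) with hB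
  have cB : Continuous B.uncurry := by
    have := continuous_integral_of_compact (μ := (volume : Measure ℝ))
      (f := fun (p : ℝ × ℝ) (t : ℝ) => A.uncurry (p.1, t) * hker ε (p.2 - t))
      (by fun_prop) cK2 (fun p t ht => by simp [Function.uncurry, hA0 p.1 t ht])
    exact this.congr fun p => rfl
  have hBeq : ∀ x : ℝ × ℝ,
      ∫ z : ℝ × ℝ, G z * (hker ε (x.1 - z.1) * hker ε (x.2 - z.2)) = B x.1 x.2 := by
    intro x
    have hi : Integrable (fun z : ℝ × ℝ => G z * (hker ε (x.1 - z.1) * hker ε (x.2 - z.2)))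
        (volume.prod volume) :=
      Continuous.integrable_of_hasCompactSupport (by fun_prop) hc.mul_right
    rw [Measure.volume_eq_prod, integral_prod_symm _ hi]
    simp only [hB, hA]
    refine integral_congr_ae (Eventually.of_forall fun t => ?_)
    simp only
    rw [← integral_mul_const]
    refine integral_congr_ae (Eventually.of_forall fun s => ?_)
    simp only
    ring
  simp_rw [hBeq]
  have mA : Measurable (fun p : ℝ × ℝ => ofReal (A p.1 p.2 ^ 4)) :=
    (ENNReal.continuous_ofReal.comp (cA.pow 4)).measurable
  have mB : Measurable (fun p : ℝ × ℝ => ofReal (B p.1 p.2 ^ 4)) :=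
    (ENNReal.continuous_ofReal.comp (cB.pow 4)).measurable
  have mG : Measurable (fun p : ℝ × ℝ => ofReal (G p ^ 4)) :=
    (ENNReal.continuous_ofReal.comp (hG.pow 4)).measurable
  rw [Measure.volume_eq_prod, lintegral_prod _ mB.aemeasurable, lintegral_prod_symm _ mG.aemeasurable]
  calc ∫⁻ x, ∫⁻ y, ofReal (B x y ^ 4)
      ≤ ∫⁻ x, ofReal cotC * ∫⁻ t, ofReal (A x t ^ 4) := by
        refine lintegral_mono fun x => ?_
        exact lintegral_hilbert_pow_four (φ := A x) (cA.comp (by fun_prop : Continuous fun t => (x, t)))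
          (cpt2 (hA0 x)) hε
    _ = ofReal cotC * ∫⁻ t, ∫⁻ x, ofReal (A x t ^ 4) := by
        rw [lintegral_const_mul' _ _ ENNReal.ofReal_ne_top,
          lintegral_lintegral_swap (f := fun x t => ofReal (A x t ^ 4)) mA.aemeasurable]
    _ ≤ ofReal cotC * ∫⁻ t, ofReal cotC * ∫⁻ s, ofReal (G (s, t) ^ 4) := by
        gcongr with t
        exact lintegral_hilbert_pow_four (φ := fun s => G (s, t)) (by fun_prop)
          (cpt1 fun s hs => z1 s t hs) hε
    _ = _ := by rw [lintegral_const_mul' _ _ ENNReal.ofReal_ne_top, ← mul_assoc, pow_two]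

/-- Rotation of the plane by the angle `α`. -/
def rotM (α : ℝ) : Matrix (Fin 2) (Fin 2) ℝ :=
  !![cos α, -sin α; sin α, cos α]

lemma det_rotM (α : ℝ) : (rotM α).det = 1 := by
  rw [rotM, Matrix.det_fin_two_of]
  nlinarith [Real.sin_sq_add_cos_sq α]

/-- Rotation of the plane by the angle `α`, as a map. -/
def rot (α : ℝ) (x : V) : V :=
  ![cos α * x 0 - sin α * x 1, sin α * x 0 + cos α * x 1]

lemma rot_eq (α : ℝ) : rot α = Matrix.toLin' (rotM α) := by
  ext x i
  fin_cases i <;> simp [rot, rotM, Matrix.mulVec, dotProduct, Fin.sum_univ_two] ; ring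

lemma continuous_rot (α : ℝ) : Continuous (rot α) := by
  refine continuous_pi fun i => ?_
  fin_cases i <;> simp [rot] <;> fun_prop

lemma rot_neg_rot (α : ℝ) (x : V) : rot (-α) (rot α x) = x := by
  have h := Real.sin_sq_add_cos_sq α
  ext i
  fin_cases i <;> simp [rot] <;> ring_nf
  · linear_combination (x 0) * h
  · linear_combination (x 1) * h

lemma measurePreserving_rot (α : ℝ) : MeasurePreserving (rot α) := by
  refine ⟨(continuous_rot α).measurable, ?_⟩
  rw [rot_eq, Real.map_matrix_volume_pi_eq_smul_volume_pi (by rw [det_rotM]; norm_num), det_rotM]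
  simp

/-- The homeomorphism underlying a rotation. -/
def rotH (α : ℝ) : V ≃ₜ V where
  toFun := rot α
  invFun := rot (-α)
  left_inv := rot_neg_rot α
  right_inv := fun x => by simpa using rot_neg_rot (-α) x
  continuous_toFun := continuous_rot α
  continuous_invFun := continuous_rot (-α)

/-- Double regularised Hilbert transform along the axes rotated by `α`. -/
def dblHilb (ε α : ℝ) (g : V → ℝ) (x : V) : ℝ :=
  ∫ z : V, g z * (hker ε (rot (-α) (x - z) 0) * hker ε (rot (-α) (x - z) 1))

lemma rot_sub (α : ℝ) (x z : V) : rot α (x - z) = rot α x - rot α z := by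
  rw [rot_eq, map_sub]

lemma lintegral_dblHilb {g : V → ℝ} (hg : Continuous g) (hc : HasCompactSupport g)
    {ε : ℝ} (hε : 0 < ε) (α : ℝ) :
    ∫⁻ x, ofReal (dblHilb ε α g x ^ 4)
      ≤ ofReal cotC ^ 2 * ∫⁻ z, ofReal (g z ^ 4) := by
  have mp := measurePreserving_rot α
  have me : MeasurableEmbedding (rot α) := (rotH α).measurableEmbedding
  have mp2 := (volume_preserving_finTwoArrow ℝ).symm
  set Φ : ℝ × ℝ → V := ⇑(MeasurableEquiv.finTwoArrow (α := ℝ)).symm with hΦ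
  have hΦc : Continuous Φ := by
    refine continuous_pi fun i => ?_
    fin_cases i <;> simp [hΦ, MeasurableEquiv.finTwoArrow] <;> fun_prop
  have hΦe : ∀ p : ℝ × ℝ, Φ p 0 = p.1 ∧ Φ p 1 = p.2 := fun p => by
    simp [hΦ, MeasurableEquiv.finTwoArrow]
  have meΦ : MeasurableEmbedding Φ := MeasurableEquiv.measurableEmbedding _
  set G : ℝ × ℝ → ℝ := fun p => g (rot α (Φ p)) with hG
  have cG : Continuous G := hg.comp ((continuous_rot α).comp hΦc)
  have hGc : HasCompactSupport G := by
    have hcl : Topology.IsClosedEmbedding (fun p => rot α (Φ p)) := by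
      have e2 : (fun p => rot α (Φ p)) = ((Homeomorph.finTwoArrow (X := ℝ)).symm.trans (rotH α)) := by
        ext p; rfl
      rw [e2]
      exact Homeomorph.isClosedEmbedding _
    exact hc.comp_isClosedEmbedding hcl
  have key := lintegral_double_hilbert cG hGc hε
  rw [← mp.lintegral_comp_emb me, ← mp.lintegral_comp_emb me (fun z => ofReal (g z ^ 4)),
    ← mp2.lintegral_comp_emb meΦ, ← mp2.lintegral_comp_emb meΦ
      (fun z => ofReal (g (rot α z) ^ 4))]
  refine le_trans (le_of_eq ?_) key
  refine lintegral_congr fun p => ?_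
  congr 2
  unfold dblHilb
  rw [← mp.integral_comp me, ← mp2.integral_comp meΦ]
  refine integral_congr_ae (Eventually.of_forall fun z => ?_)
  simp only
  rw [← rot_sub, rot_neg_rot]
  change _ * (hker ε ((Φ p - Φ z) 0) * hker ε ((Φ p - Φ z) 1)) = _
  simp [hΦe, hG]

/-- Angular average of the rotated double Hilbert transforms with weight `w`. -/
def avgHilb (w : ℝ → ℝ) (ε : ℝ) (g : V → ℝ) (x : V) : ℝ :=
  ∫ α in Ioc (-π) π, w α * dblHilb ε α g x

/-- The kernel of `avgHilb`. -/
def avgKer (w : ℝ → ℝ) (ε : ℝ) (y : V) : ℝ :=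
  ∫ α in Ioc (-π) π, w α * (hker ε (rot (-α) y 0) * hker ε (rot (-α) y 1))

lemma continuous_rot_uncurry (i : Fin 2) : Continuous (fun p : ℝ × V => rot (-p.1) p.2 i) := by
  fin_cases i <;> simp [rot] <;> fun_prop

lemma continuous_dblKer {ε : ℝ} (hε : 0 < ε) : Continuous (fun p : ℝ × V =>
    hker ε (rot (-p.1) p.2 0) * hker ε (rot (-p.1) p.2 1)) :=
  ((continuous_hker hε).comp (continuous_rot_uncurry 0)).mul
    ((continuous_hker hε).comp (continuous_rot_uncurry 1))

lemma continuous_dblHilb {g : V → ℝ} (hg : Continuous g) (hc : HasCompactSupport g)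
    {ε : ℝ} (hε : 0 < ε) : Continuous (fun p : ℝ × V => dblHilb ε p.1 g p.2) := by
  refine continuous_integral_of_compact (μ := (volume : Measure V))
    (f := fun (p : ℝ × V) (z : V) =>
      g z * (hker ε (rot (-p.1) (p.2 - z) 0) * hker ε (rot (-p.1) (p.2 - z) 1)))
    ?_ hc.isCompact (fun p z hz => by simp [image_eq_zero_of_notMem_tsupport hz])
  have h1 : Continuous (fun q : (ℝ × V) × V => (q.1.1, q.1.2 - q.2)) := by fun_prop
  exact (hg.comp continuous_snd).mul ((continuous_dblKer hε).comp h1)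

lemma avgHilb_eq {w : ℝ → ℝ} (hw : Continuous w) {g : V → ℝ} (hg : Continuous g)
    (hc : HasCompactSupport g) {ε : ℝ} (hε : 0 < ε) (x : V) :
    avgHilb w ε g x = ∫ z, g z * avgKer w ε (x - z) := by
  unfold avgHilb avgKer dblHilb
  simp_rw [← integral_const_mul]
  rw [integral_integral_swap]
  · refine integral_congr_ae (Eventually.of_forall fun z => ?_)
    refine integral_congr_ae (Eventually.of_forall fun α => ?_)
    simp only
    ring
  · have h1 : Continuous (fun q : ℝ × V => (q.1, x - q.2)) := by fun_prop
    have hcont : Continuous (Function.uncurry fun (α : ℝ) (z : V) =>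
        w α * (g z * (hker ε (rot (-α) (x - z) 0) * hker ε (rot (-α) (x - z) 1)))) :=
      (hw.comp continuous_fst).mul
        ((hg.comp continuous_snd).mul ((continuous_dblKer hε).comp h1))
    have hK : IsCompact (Icc (-π) π ×ˢ tsupport g) :=
      isCompact_Icc.prod hc.isCompact
    have hI := hcont.continuousOn.integrableOn_compact (μ := volume.prod volume) hK
    rw [← Measure.restrict_univ (μ := (volume : Measure V)), Measure.prod_restrict]
    refine (hI.of_forall_sdiff_eq_zero (t := Icc (-π) π ×ˢ univ)
      (measurableSet_Icc.prod MeasurableSet.univ) ?_).mono_set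
      (prod_mono Ioc_subset_Icc_self subset_rfl)
    rintro ⟨α, z⟩ ⟨h, h'⟩
    have hz : z ∉ tsupport g := fun hz => h' ⟨h.1, hz⟩
    simp [image_eq_zero_of_notMem_tsupport hz]

/-- The constant in the `L⁴` bound for `avgHilb`. -/
def avgC : ENNReal := ofReal (2 * π) ^ 4 * ofReal cotC ^ 2

lemma lintegral_avgHilb {w : ℝ → ℝ} (hw : Continuous w) (hw1 : ∀ α, |w α| ≤ 1) {g : V → ℝ}
    (hg : Continuous g) (hc : HasCompactSupport g) {ε : ℝ} (hε : 0 < ε) :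
    ∫⁻ x, ofReal (avgHilb w ε g x ^ 4)
      ≤ avgC * ∫⁻ z, ofReal (g z ^ 4) := by
  have hD := continuous_dblHilb hg hc hε
  have hDx : ∀ x, Continuous (fun α => dblHilb ε α g x) := by
    intro x
    have h1 : Continuous (fun α : ℝ => (α, x)) := by fun_prop
    exact (hD.comp h1 :)
  have hI : ∀ {f : ℝ → ℝ}, Continuous f →
      Integrable f (volume.restrict (Ioc (-π) π)) := by
    intro f hf
    have h1 : IntegrableOn f (Icc (-π) π) volume :=
      hf.continuousOn.integrableOn_compact isCompact_Icc
    exact h1.mono_set Ioc_subset_Icc_self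
  have hpt : ∀ x, ofReal (avgHilb w ε g x ^ 4) ≤ ofReal (2 * π) ^ 3 *
      ∫⁻ α in Ioc (-π) π, ofReal (dblHilb ε α g x ^ 4) := by
    intro x
    have hc1 : Continuous (fun α => w α * dblHilb ε α g x) := hw.mul (hDx x)
    have hc4 : Continuous (fun α => dblHilb ε α g x ^ 4) := (hDx x).pow 4
    have := integral_mul_pow_four_le (μ := volume.restrict (Ioc (-π) π))
      (w := fun _ => 1) (ψ := fun α => w α * dblHilb ε α g x) (fun _ => zero_le_one)
      hc1.aestronglyMeasurable (hI continuous_const) (hI (by fun_prop))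
    simp only [one_mul] at this
    rw [← ENNReal.ofReal_pow (by positivity), ← ofReal_integral_eq_lintegral_ofReal
      (hI hc4) (Eventually.of_forall fun α => by positivity),
      ← ENNReal.ofReal_mul (by positivity)]
    refine ENNReal.ofReal_le_ofReal (this.trans ?_)
    have e : ∫ _ in Ioc (-π) π, (1 : ℝ) = 2 * π := by
      simp [Real.pi_pos.le]; ring
    rw [e]
    refine mul_le_mul_of_nonneg_left ?_ (by positivity)
    refine integral_mono (hI (by fun_prop)) (hI hc4) fun α => ?_
    simp only [mul_pow]
    have : w α ^ 4 ≤ 1 := by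
      rw [← Even.pow_abs (by decide)]
      exact pow_le_one₀ (abs_nonneg _) (hw1 α)
    have h4 : 0 ≤ dblHilb ε α g x ^ 4 := by positivity
    nlinarith
  calc ∫⁻ x, ofReal (avgHilb w ε g x ^ 4)
      ≤ ∫⁻ x, ofReal (2 * π) ^ 3 *
      ∫⁻ α in Ioc (-π) π, ofReal (dblHilb ε α g x ^ 4) :=
        lintegral_mono hpt
    _ = ofReal (2 * π) ^ 3 *
      ∫⁻ α in Ioc (-π) π, ∫⁻ x, ofReal (dblHilb ε α g x ^ 4) := by
        rw [lintegral_const_mul' _ _ (by finiteness)]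
        congr 1
        refine lintegral_lintegral_swap (Measurable.aemeasurable ?_)
        have h1 : Continuous (fun q : V × ℝ => (q.2, q.1)) := by fun_prop
        exact (ENNReal.continuous_ofReal.comp ((hD.comp h1).pow 4)).measurable
    _ ≤ ofReal (2 * π) ^ 3 * ∫⁻ α in Ioc (-π) π,
        ofReal cotC ^ 2 * ∫⁻ z, ofReal (g z ^ 4) := by
        gcongr with α
        exact lintegral_dblHilb hg hc hε α
    _ = _ := by
        rw [lintegral_const, Measure.restrict_apply_univ, Real.volume_Ioc, avgC]
        have : π - -π = 2 * π := by ring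
        rw [this]
        ring

/-- The angular profile `a cos 2α + b sin 2α`. -/
def ang (a b α : ℝ) : ℝ := a * cos (2 * α) + b * sin (2 * α)

/-- Angular mean of `π²/(π²+c)`. -/
def angMean (a b c : ℝ) : ℝ :=
  ∫ α in Ioc (-π) π, ang a b α ^ 2 / (ang a b α ^ 2 + c)

lemma continuous_ang (a b : ℝ) : Continuous (ang a b) := by unfold ang; fun_prop

lemma angMean_neg (a b c : ℝ) : angMean a (-b) c = angMean a b c := by
  unfold angMean
  have h : ∀ f : ℝ → ℝ, ∫ α in Ioc (-π) π, f (-α)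
      = ∫ α in Ioc (-π) π, f α := fun f => by
    rw [← intervalIntegral.integral_of_le (by linarith [Real.pi_pos]),
      ← intervalIntegral.integral_of_le (by linarith [Real.pi_pos]),
      intervalIntegral.integral_comp_neg, neg_neg]
  rw [← h]
  refine integral_congr_ae (Eventually.of_forall fun α => ?_)
  have : ang a (-b) (-α) = ang a b α := by simp [ang]
  simp only [this]

lemma angMean_neg_neg (a b c : ℝ) : angMean (-a) (-b) c = angMean a b c := by
  unfold angMean
  have : ∀ α, ang (-a) (-b) α ^ 2 = ang a b α ^ 2 := fun α => by simp only [ang]; ring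
  simp_rw [this]

lemma angMean_neg' (a b c : ℝ) : angMean (-a) b c = angMean a b c := by
  rw [← angMean_neg_neg, neg_neg, angMean_neg]

lemma abs_angMean_le (a b : ℝ) {c : ℝ} (hc : 0 < c) : |angMean a b c| ≤ 2 * π := by
  have h := norm_setIntegral_le_of_norm_le_const (μ := volume)
    (s := Ioc (-π) π) (C := 1)
    (f := fun α => ang a b α ^ 2 / (ang a b α ^ 2 + c)) (by simp) (fun α _ => by
      rw [Real.norm_of_nonneg (by positivity), div_le_one (by positivity)]
      linarith)
  have e : volume.real (Ioc (-π) π) = 2 * π := by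
    rw [Real.volume_real_Ioc_of_le (by linarith [Real.pi_pos])]; ring
  rw [e, one_mul] at h
  exact h

lemma countable_ang_zero {a b : ℝ} (h : a ≠ 0 ∨ b ≠ 0) : {α | ang a b α = 0}.Countable := by
  set z : ℂ := ⟨a, b⟩ with hz
  have hz0 : z ≠ 0 := by
    intro h0
    have h1 := congrArg Complex.re h0
    have h2 := congrArg Complex.im h0
    simp [hz] at h1 h2
    tauto
  have ha : a = ‖z‖ * cos z.arg := (Complex.norm_mul_cos_arg z).symm
  have hb : b = ‖z‖ * sin z.arg := (Complex.norm_mul_sin_arg z).symm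
  refine (countable_range (fun k : ℤ => ((2 * k + 1) * π / 2 + z.arg) / 2)).mono ?_
  intro α hα
  have hα' : ang a b α = 0 := hα
  have e : ang a b α = ‖z‖ * cos (2 * α - z.arg) := by
    rw [ang, Real.cos_sub]
    nth_rewrite 1 [ha]
    nth_rewrite 1 [hb]
    ring
  rw [e] at hα'
  have h3 := (mul_eq_zero.1 hα').resolve_left (norm_ne_zero_iff.2 hz0)
  obtain ⟨k, hk⟩ := Real.cos_eq_zero_iff.1 h3
  exact ⟨k, by simp only; linarith⟩

lemma tendsto_angMean {a b : ℝ} (h : a ≠ 0 ∨ b ≠ 0) {c : ℕ → ℝ} (hc : ∀ n, 0 < c n)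
    (hc0 : Tendsto c atTop (nhds 0)) :
    Tendsto (fun n => angMean a b (c n)) atTop (nhds (2 * π)) := by
  have e : 2 * π = ∫ _ in Ioc (-π) π, (1 : ℝ) := by
    simp [Real.pi_pos.le]; ring
  rw [e]
  refine tendsto_integral_of_dominated_convergence (fun _ => 1) (fun n => ?_) (by simp) ?_ ?_
  · refine Continuous.aestronglyMeasurable ?_
    have := continuous_ang a b
    exact Continuous.div (by fun_prop) (by fun_prop) (fun α => by have := hc n; positivity)
  · refine fun n => Eventually.of_forall fun α => ?_
    have := hc n
    rw [Real.norm_of_nonneg (by positivity), div_le_one (by positivity)]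
    linarith
  · refine ae_restrict_of_ae ?_
    have h0 := (countable_ang_zero h).ae_notMem volume
    filter_upwards [h0] with α hα
    have hα' : ang a b α ≠ 0 := hα
    have h2 : ang a b α ^ 2 ≠ 0 := pow_ne_zero 2 hα'
    have : Tendsto (fun n => ang a b α ^ 2 / (ang a b α ^ 2 + c n)) atTop
        (nhds (ang a b α ^ 2 / (ang a b α ^ 2 + 0))) :=
      tendsto_const_nhds.div (tendsto_const_nhds.add hc0) (by simpa using h2)
    simpa [div_self h2] using this

lemma integral_ang_deriv (a b : ℝ) {c : ℝ} (hc : 0 < c) :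
    ∫ α in Ioc (-π) π,
      ang a b α * (-2 * a * sin (2 * α) + 2 * b * cos (2 * α)) / (ang a b α ^ 2 + c)
      = 0 := by
  rw [← intervalIntegral.integral_of_le (by linarith [Real.pi_pos])]
  have hang : ∀ α, HasDerivAt (ang a b)
      (-2 * a * sin (2 * α) + 2 * b * cos (2 * α)) α := by
    intro α
    have h2 : HasDerivAt (fun α : ℝ => 2 * α) 2 α := by
      simpa using (hasDerivAt_id α).const_mul (2 : ℝ)
    have := (h2.cos.const_mul a).add (h2.sin.const_mul b)
    refine this.congr_deriv ?_
    ring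
  have hd : ∀ α, HasDerivAt (fun α => Real.log (ang a b α ^ 2 + c) / 2)
      (ang a b α * (-2 * a * sin (2 * α) + 2 * b * cos (2 * α)) / (ang a b α ^ 2 + c))
      α := by
    intro α
    have hne : ang a b α ^ 2 + c ≠ 0 := by positivity
    have := ((((hang α).pow 2).add_const c).log hne).div_const 2
    refine this.congr_deriv ?_
    simp only [Pi.pow_apply]
    field_simp
    push_cast
    ring
  rw [intervalIntegral.integral_eq_sub_of_hasDerivAt (fun α _ => hd α)]
  · have : ang a b π = ang a b (-π) := by simp [ang]
    rw [this, sub_self]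
  · refine Continuous.intervalIntegrable ?_ _ _
    have := continuous_ang a b
    exact Continuous.div (by fun_prop) (by fun_prop) (fun α => by positivity)

lemma vnsq_eq (y : V) : vnsq y = y 0 ^ 2 + y 1 ^ 2 := by simp [vnsq]

lemma vnsq_nonneg (y : V) : 0 ≤ vnsq y := by rw [vnsq_eq]; positivity

lemma continuous_vnsq : Continuous vnsq := by
  have : vnsq = fun y : V => y 0 ^ 2 + y 1 ^ 2 := funext vnsq_eq
  rw [this]; fun_prop

lemma sq_coord_le_vnsq (y : V) (i : Fin 2) : y i ^ 2 ≤ vnsq y := by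
  rw [vnsq_eq]; fin_cases i <;> simp <;> positivity

lemma abs_coord_le_sqrt (y : V) (i : Fin 2) : |y i| ≤ √(vnsq y) :=
  Real.abs_le_sqrt (sq_coord_le_vnsq y i)

lemma norm_sq_le_vnsq (y : V) : ‖y‖ ^ 2 ≤ vnsq y := by
  have h : ‖y‖ ≤ √(vnsq y) :=
    (pi_norm_le_iff_of_nonneg (Real.sqrt_nonneg _)).2 fun i => abs_coord_le_sqrt y i
  calc ‖y‖ ^ 2 ≤ √(vnsq y) ^ 2 := by gcongr
    _ = vnsq y := Real.sq_sqrt (vnsq_nonneg y)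

lemma vnsq_le_norm_sq (y : V) : vnsq y ≤ 2 * ‖y‖ ^ 2 := by
  have h : ∀ i, y i ^ 2 ≤ ‖y‖ ^ 2 := fun i => by
    rw [← sq_abs]; gcongr; exact norm_le_pi_norm y i
  rw [vnsq_eq]; linarith [h 0, h 1]

lemma vnsq_pos {y : V} (hy : y ≠ 0) : 0 < vnsq y :=
  lt_of_lt_of_le (by have := norm_pos_iff.2 hy; positivity) (norm_sq_le_vnsq y)

lemma integrableOn_ball_inv_norm (r : ℝ) :
    IntegrableOn (fun y : V => ‖y‖⁻¹) (Metric.ball 0 r) := by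
  refine integrableOn_ball_of_norm_le_rpow (C := 1) (α := 1) (by simp) (by simp)
    (Eventually.of_forall fun y => ?_) (by fun_prop : Measurable _).aestronglyMeasurable
  simp [Real.rpow_neg_one]

/-- A linear involution of the plane. -/
def invol (b : Bool) (y : V) : V := if b then ![-y 0, y 1] else ![y 1, y 0]

lemma invol_invol (b : Bool) (y : V) : invol b (invol b y) = y := by
  ext i; cases b <;> fin_cases i <;> simp [invol]

lemma measurePreserving_invol (b : Bool) : MeasurePreserving (invol b) := by
  have h : ∃ M : Matrix (Fin 2) (Fin 2) ℝ, invol b = Matrix.toLin' M ∧ |M.det| = 1 := by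
    cases b
    · refine ⟨!![0, 1; 1, 0], ?_, by rw [Matrix.det_fin_two_of]; norm_num⟩
      ext x i
      fin_cases i <;> simp [invol, Matrix.mulVec, dotProduct, Fin.sum_univ_two]
    · refine ⟨!![-1, 0; 0, 1], ?_, by rw [Matrix.det_fin_two_of]; norm_num⟩
      ext x i
      fin_cases i <;> simp [invol, Matrix.mulVec, dotProduct, Fin.sum_univ_two]
  obtain ⟨M, hM, hd⟩ := h
  have hd0 : M.det ≠ 0 := by intro h0; simp [h0] at hd
  rw [hM]
  refine ⟨(LinearMap.continuous_of_finiteDimensional _).measurable, ?_⟩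
  rw [Real.map_matrix_volume_pi_eq_smul_volume_pi hd0, abs_inv, hd]
  simp

lemma measurable_invol (b : Bool) : Measurable (invol b) := (measurePreserving_invol b).measurable

/-- The measurable equivalence underlying `invol`. -/
def involE (b : Bool) : V ≃ᵐ V where
  toFun := invol b
  invFun := invol b
  left_inv := invol_invol b
  right_inv := invol_invol b
  measurable_toFun := measurable_invol b
  measurable_invFun := measurable_invol b

lemma norm_invol (b : Bool) (y : V) : ‖invol b y‖ = ‖y‖ := by
  have h : ∀ z : V, ‖z‖ = max |z 0| |z 1| := fun z => by
    refine le_antisymm ((pi_norm_le_iff_of_nonneg (by positivity)).2 fun i => ?_)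
      (max_le (norm_le_pi_norm z 0) (norm_le_pi_norm z 1))
    fin_cases i <;> simp
  rw [h, h]
  cases b <;> simp [invol, max_comm]

lemma vnsq_invol (b : Bool) (y : V) : vnsq (invol b y) = vnsq y := by
  rw [vnsq_eq, vnsq_eq]; cases b <;> simp [invol]; ring

lemma setIntegral_ball_eq_zero_of_odd {D : V → ℝ} (b : Bool) (h : ∀ y, D (invol b y) = -D y)
    (r : ℝ) : ∫ y in Metric.ball 0 r, D y = 0 := by
  have h1 := (measurePreserving_invol b).setIntegral_preimage_emb
    (involE b).measurableEmbedding D (Metric.ball 0 r)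
  have h2 : invol b ⁻¹' Metric.ball 0 r = Metric.ball 0 r := by
    ext y; simp [norm_invol]
  rw [h2] at h1
  simp_rw [h] at h1
  rw [integral_neg] at h1
  linarith

/-- Convolution against cancelling kernels of Calderón–Zygmund size tending to zero. -/
lemma tendsto_integral_cancelling {D : ℕ → V → ℝ} (hDc : ∀ n, Continuous (D n)) {C : ℝ}
    (hD : ∀ n y, y ≠ 0 → |D n y| ≤ C / ‖y‖ ^ 2)
    (hD0 : ∀ y, y ≠ 0 → Tendsto (fun n => D n y) atTop (nhds 0)) {b : Bool}
    (hodd : ∀ n y, D n (invol b y) = -D n y) {g : V → ℝ} (hg : ContDiff ℝ 1 g)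
    (hc : HasCompactSupport g) (x : V) :
    Tendsto (fun n => ∫ z, g z * D n (x - z)) atTop (nhds 0) := by
  obtain ⟨L, hL⟩ := hg.lipschitzWith_of_hasCompactSupport hc (by simp)
  obtain ⟨R, hR⟩ := (hc.isCompact.isBounded).subset_closedBall (0 : V)
  set r := R + ‖x‖ + 1 with hr
  have hzero : ∀ y, y ∉ Metric.ball (0 : V) r → g (x - y) = 0 := by
    intro y hy
    refine image_eq_zero_of_notMem_tsupport fun hm => hy ?_
    have h1 := hR hm
    rw [mem_closedBall_zero_iff] at h1
    rw [mem_ball_zero_iff, hr]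
    have : ‖y‖ ≤ ‖x - y‖ + ‖x‖ := by
      have := norm_sub_le x (x - y)
      simp only [sub_sub_cancel] at this
      linarith
    linarith
  have hcpt : ∀ f : V → ℝ, Continuous f → IntegrableOn f (Metric.ball 0 r) := fun f hf =>
    (hf.continuousOn.integrableOn_compact (isCompact_closedBall (0 : V) r)).mono_set
      Metric.ball_subset_closedBall
  have e : ∀ n, ∫ z, g z * D n (x - z)
      = ∫ y in Metric.ball (0 : V) r, (g (x - y) - g x) * D n y := by
    intro n
    have h1 : ∫ z, g z * D n (x - z) = ∫ y, g (x - y) * D n y := by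
      rw [← integral_sub_left_eq_self _ volume x]
      simp
    have hgc := hg.continuous
    have hDn := hDc n
    rw [h1, ← setIntegral_eq_integral_of_forall_compl_eq_zero
      (s := Metric.ball (0 : V) r) (fun y hy => by rw [hzero y hy, zero_mul])]
    simp_rw [sub_mul]
    rw [integral_sub (hcpt _ (by fun_prop)) (hcpt _ (by fun_prop)), integral_const_mul,
      setIntegral_ball_eq_zero_of_odd b (hodd n)]
    simp
  simp_rw [e]
  have e0 : (0 : ℝ) = ∫ y in Metric.ball (0 : V) r, (0 : ℝ) := by simp
  rw [e0]
  have hne : ∀ᵐ y ∂(volume.restrict (Metric.ball (0 : V) r)), y ≠ 0 :=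
    ae_restrict_of_ae ((countable_singleton (0 : V)).ae_notMem volume)
  refine tendsto_integral_of_dominated_convergence (fun y => (L * C) * ‖y‖⁻¹) (fun n => ?_)
    ((integrableOn_ball_inv_norm r).const_mul _) (fun n => ?_) ?_
  · have hgc := hg.continuous
    have hDn := hDc n
    exact Continuous.aestronglyMeasurable (by fun_prop)
  · filter_upwards [hne] with y hy
    have hy' := norm_pos_iff.2 hy
    rw [norm_mul]
    have h1 : ‖g (x - y) - g x‖ ≤ L * ‖y‖ := by
      have := hL.dist_le_mul (x - y) x
      simpa [dist_eq_norm] using this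
    calc ‖g (x - y) - g x‖ * ‖D n y‖ ≤ (L * ‖y‖) * (C / ‖y‖ ^ 2) :=
          mul_le_mul h1 (hD n y hy) (norm_nonneg _) (by positivity)
      _ = L * C * ‖y‖⁻¹ := by field_simp
  · filter_upwards [hne] with y hy
    simpa using (hD0 y hy).const_mul (g (x - y) - g x)

lemma continuous_avgKer {w : ℝ → ℝ} (hw : Continuous w) {ε : ℝ} (hε : 0 < ε) :
    Continuous (avgKer w ε) := by
  have h : avgKer w ε = fun y => ∫ α in (-π)..Real.pi,
      w α * (hker ε (rot (-α) y 0) * hker ε (rot (-α) y 1)) := by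
    ext y
    rw [intervalIntegral.integral_of_le (by linarith [Real.pi_pos])]
    rfl
  rw [h]
  refine intervalIntegral.continuous_parametric_intervalIntegral_of_continuous' ?_ _ _
  have h1 : Continuous (fun q : V × ℝ => (q.2, q.1)) := by fun_prop
  have h2 := ((continuous_dblKer hε).comp h1 :)
  have h3 : Continuous (fun q : V × ℝ => w q.2) := hw.comp continuous_snd
  exact (h3.mul h2 :)

lemma hker_mul_hker (ε : ℝ) (y : V) (α : ℝ) :
    hker ε (rot (-α) y 0) * hker ε (rot (-α) y 1)
      = ang (y 0 * y 1) ((y 1 ^ 2 - y 0 ^ 2) / 2) α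
        / (ang (y 0 * y 1) ((y 1 ^ 2 - y 0 ^ 2) / 2) α ^ 2 + (ε ^ 2 * vnsq y + ε ^ 4)) := by
  have h := Real.sin_sq_add_cos_sq α
  have e1 : ang (y 0 * y 1) ((y 1 ^ 2 - y 0 ^ 2) / 2) α
      = rot (-α) y 0 * rot (-α) y 1 := by
    simp only [ang, rot, Real.cos_neg, Real.sin_neg, Real.cos_two_mul', Real.sin_two_mul,
      Matrix.cons_val_zero, Matrix.cons_val_one]
    ring
  have e2 : vnsq y = rot (-α) y 0 ^ 2 + rot (-α) y 1 ^ 2 := by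
    rw [vnsq_eq]
    simp only [rot, Real.cos_neg, Real.sin_neg, Matrix.cons_val_zero, Matrix.cons_val_one]
    linear_combination (-(y 0 ^ 2 + y 1 ^ 2)) * h
  rw [e1, e2, hker, hker, div_mul_div_comm]
  congr 1
  ring

lemma integrableOn_ang (a b : ℝ) {c : ℝ} (hc : 0 < c) :
    IntegrableOn (fun α => ang a b α ^ 2 / (ang a b α ^ 2 + c)) (Ioc (-π) π) ∧
    IntegrableOn (fun α => ang a b α * (-2 * a * sin (2 * α) + 2 * b * cos (2 * α))
      / (ang a b α ^ 2 + c)) (Ioc (-π) π) := by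
  have hca := continuous_ang a b
  constructor <;> exact ((Continuous.div (by fun_prop) (by fun_prop)
    (fun α => by positivity)).integrableOn_Icc).mono_set Ioc_subset_Icc_self

lemma avgKer_cos {ε : ℝ} (hε : 0 < ε) {y : V} (hy : y ≠ 0) :
    avgKer (fun α => cos (2 * α)) ε y = 4 * (y 0 * y 1) / vnsq y ^ 2
      * angMean (y 0 * y 1) ((y 1 ^ 2 - y 0 ^ 2) / 2) (ε ^ 2 * vnsq y + ε ^ 4) := by
  have hv := vnsq_pos hy
  set a := y 0 * y 1 with ha
  set b := (y 1 ^ 2 - y 0 ^ 2) / 2 with hb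
  set c := ε ^ 2 * vnsq y + ε ^ 4 with hc
  have hc0 : 0 < c := by positivity
  have hab : a ^ 2 + b ^ 2 = vnsq y ^ 2 / 4 := by rw [ha, hb, vnsq_eq]; ring
  obtain ⟨i1, i2⟩ := integrableOn_ang a b hc0
  have key : vnsq y ^ 2 / 4 * avgKer (fun α => cos (2 * α)) ε y = a * angMean a b c := by
    rw [avgKer, angMean, ← integral_const_mul, ← integral_const_mul]
    have := integral_ang_deriv a b hc0
    rw [← add_zero (∫ α in _, a * _), ← mul_zero (b / 2), ← this, ← integral_const_mul,
      ← integral_add (i1.const_mul a) (i2.const_mul (b / 2))]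
    refine integral_congr_ae (Eventually.of_forall fun α => ?_)
    simp only [hker_mul_hker ε]
    rw [← ha, ← hb, ← hc, ← hab]
    have : ang a b α ^ 2 + c ≠ 0 := by positivity
    field_simp
    simp only [ang]
    ring
  field_simp
  linarith

lemma avgKer_sin {ε : ℝ} (hε : 0 < ε) {y : V} (hy : y ≠ 0) :
    avgKer (fun α => sin (2 * α)) ε y = 4 * ((y 1 ^ 2 - y 0 ^ 2) / 2) / vnsq y ^ 2
      * angMean (y 0 * y 1) ((y 1 ^ 2 - y 0 ^ 2) / 2) (ε ^ 2 * vnsq y + ε ^ 4) := by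
  have hv := vnsq_pos hy
  set a := y 0 * y 1 with ha
  set b := (y 1 ^ 2 - y 0 ^ 2) / 2 with hb
  set c := ε ^ 2 * vnsq y + ε ^ 4 with hc
  have hc0 : 0 < c := by positivity
  have hab : a ^ 2 + b ^ 2 = vnsq y ^ 2 / 4 := by rw [ha, hb, vnsq_eq]; ring
  obtain ⟨i1, i2⟩ := integrableOn_ang a b hc0
  have key : vnsq y ^ 2 / 4 * avgKer (fun α => sin (2 * α)) ε y = b * angMean a b c := by
    rw [avgKer, angMean, ← integral_const_mul, ← integral_const_mul]
    have := integral_ang_deriv a b hc0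
    rw [← add_zero (∫ α in _, b * _), ← mul_zero (-a / 2), ← this, ← integral_const_mul,
      ← integral_add (i1.const_mul b) (i2.const_mul (-a / 2))]
    refine integral_congr_ae (Eventually.of_forall fun α => ?_)
    simp only [hker_mul_hker ε]
    rw [← ha, ← hb, ← hc, ← hab]
    have : ang a b α ^ 2 + c ≠ 0 := by positivity
    field_simp
    simp only [ang]
    ring
  field_simp
  linarith

/-- The regularisation parameters `1/(n+1)`. -/
def es (n : ℕ) : ℝ := 1 / ((n : ℝ) + 1)

lemma es_pos (n : ℕ) : 0 < es n := Nat.one_div_pos_of_nat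

lemma tendsto_es : Tendsto es atTop (nhds 0) := tendsto_one_div_add_atTop_nhds_zero_nat

lemma lintegral_limit_kernel {w : ℝ → ℝ} (hw : Continuous w) (hw1 : ∀ α, |w α| ≤ 1) {κ : ℝ}
    {T : ℝ → V → ℝ} (hT : ∀ ε, 0 < ε → Continuous (T ε)) {C : ℝ}
    (hD : ∀ n y, y ≠ 0 → |T (es n) y - κ * avgKer w (es n) y| ≤ C / ‖y‖ ^ 2)
    (hD0 : ∀ y, y ≠ 0 → Tendsto (fun n => T (es n) y - κ * avgKer w (es n) y) atTop (nhds 0))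
    {b : Bool} (hodd : ∀ n y, T (es n) (invol b y) - κ * avgKer w (es n) (invol b y)
      = -(T (es n) y - κ * avgKer w (es n) y))
    {g : V → ℝ} (hg : ContDiff ℝ 1 g) (hc : HasCompactSupport g) {L : V → ℝ}
    (hL : ∀ x, Tendsto (fun n => ∫ z, g z * T (es n) (x - z)) atTop (nhds (L x))) :
    ∫⁻ x, ofReal (L x ^ 4)
      ≤ ofReal (κ ^ 4) * avgC * ∫⁻ z, ofReal (g z ^ 4) := by
  have hgc := hg.continuous
  have hK : ∀ n, Continuous (avgKer w (es n)) := fun n => continuous_avgKer hw (es_pos n)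
  have hTn : ∀ n, Continuous (T (es n)) := fun n => hT _ (es_pos n)
  have lim : ∀ x, Tendsto (fun n => (κ * avgHilb w (es n) g x) ^ 4) atTop (nhds (L x ^ 4)) := by
    intro x
    have h1 := tendsto_integral_cancelling
      (D := fun n y => T (es n) y - κ * avgKer w (es n) y)
      (fun n => by have := hK n; have := hTn n; fun_prop) hD hD0 hodd hg hc x
    have h2 := (hL x).sub h1
    rw [sub_zero] at h2
    refine Tendsto.pow ?_ 4
    refine h2.congr fun n => ?_
    have := hK n
    have := hTn n
    have i1 : Integrable (fun z => g z * T (es n) (x - z)) :=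
      Continuous.integrable_of_hasCompactSupport (by fun_prop) hc.mul_right
    have i2 : Integrable (fun z => g z * (T (es n) (x - z) - κ * avgKer w (es n) (x - z))) :=
      Continuous.integrable_of_hasCompactSupport (by fun_prop) hc.mul_right
    rw [avgHilb_eq hw hgc hc (es_pos n), ← integral_sub i1 i2, ← integral_const_mul]
    refine integral_congr_ae (Eventually.of_forall fun z => ?_)
    simp only
    ring
  have hmeas : ∀ n, Measurable (fun x => ofReal ((κ * avgHilb w (es n) g x) ^ 4)) := by
    intro n
    have hm : Continuous (fun x => avgHilb w (es n) g x) := by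
      simp_rw [avgHilb_eq hw hgc hc (es_pos n)]
      have := hK n
      exact continuous_integral_of_compact (f := fun x z => g z * avgKer w (es n) (x - z))
        (by unfold Function.uncurry; fun_prop) hc.isCompact
        fun x z hz => by simp [image_eq_zero_of_notMem_tsupport hz]
    have hm4 : Continuous (fun x => (κ * avgHilb w (es n) g x) ^ 4) := by fun_prop
    exact (ENNReal.continuous_ofReal.comp hm4).measurable
  calc ∫⁻ x, ofReal (L x ^ 4)
      = ∫⁻ x, liminf (fun n => ofReal ((κ * avgHilb w (es n) g x) ^ 4)) atTop := by
        refine lintegral_congr fun x => ?_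
        exact (((ENNReal.continuous_ofReal.tendsto _).comp (lim x)).liminf_eq).symm
    _ ≤ liminf (fun n => ∫⁻ x, ofReal ((κ * avgHilb w (es n) g x) ^ 4)) atTop :=
        lintegral_liminf_le hmeas
    _ ≤ liminf (fun _ : ℕ => ofReal (κ ^ 4) * avgC * ∫⁻ z, ofReal (g z ^ 4))
          atTop := by
        refine liminf_le_liminf (Eventually.of_forall fun n => ?_)
        simp_rw [mul_pow, ENNReal.ofReal_mul (show (0 : ℝ) ≤ κ ^ 4 by positivity)]
        rw [lintegral_const_mul' _ _ (by finiteness), mul_assoc]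
        gcongr
        exact lintegral_avgHilb hw hw1 hgc hc (es_pos n)
    _ = _ := by simp

/-- Regularised off-diagonal Riesz-type kernel. -/
def offKer (ε : ℝ) (y : V) : ℝ := -2 * (y 0 * y 1) / (vnsq y + ε ^ 2) ^ 2

/-- Regularised diagonal Riesz-type kernel. -/
def diagKer (ε : ℝ) (y : V) : ℝ := 2 * (y 1 ^ 2 - y 0 ^ 2) / (vnsq y + ε ^ 2) ^ 2

lemma continuous_offKer {ε : ℝ} (hε : 0 < ε) : Continuous (offKer ε) := by
  have := continuous_vnsq
  refine Continuous.div (by fun_prop) (by fun_prop) fun y => ?_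
  have := vnsq_nonneg y
  positivity

lemma continuous_diagKer {ε : ℝ} (hε : 0 < ε) : Continuous (diagKer ε) := by
  have := continuous_vnsq
  refine Continuous.div (by fun_prop) (by fun_prop) fun y => ?_
  have := vnsq_nonneg y
  positivity

lemma ratio_le_one {v ε : ℝ} (hv : 0 < v) : v ^ 2 / (v + ε ^ 2) ^ 2 ≤ 1 := by
  rw [div_le_one (by positivity)]
  have : v ≤ v + ε ^ 2 := by nlinarith
  gcongr

lemma tendsto_ratio {v : ℝ} (hv : 0 < v) :
    Tendsto (fun n => v ^ 2 / (v + es n ^ 2) ^ 2) atTop (nhds 1) := by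
  have h : Tendsto (fun n => v ^ 2 / (v + es n ^ 2) ^ 2) atTop
      (nhds (v ^ 2 / (v + 0 ^ 2) ^ 2)) :=
    tendsto_const_nhds.div ((tendsto_const_nhds.add (tendsto_es.pow 2)).pow 2) (by positivity)
  have e : v ^ 2 / (v + 0 ^ 2) ^ 2 = 1 := by field_simp; ring
  rwa [e] at h

lemma tendsto_angMean_es {y : V} (hy : y ≠ 0) :
    Tendsto (fun n => angMean (y 0 * y 1) ((y 1 ^ 2 - y 0 ^ 2) / 2)
      (es n ^ 2 * vnsq y + es n ^ 4)) atTop (nhds (2 * π)) := by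
  have hv := vnsq_pos hy
  refine tendsto_angMean ?_ (fun n => by have := es_pos n; positivity) ?_
  · by_contra! h
    have : vnsq y ^ 2 = 4 * ((y 0 * y 1) ^ 2 + ((y 1 ^ 2 - y 0 ^ 2) / 2) ^ 2) := by
      rw [vnsq_eq]; ring
    rw [h.1, h.2] at this
    have : 0 < vnsq y ^ 2 := by positivity
    linarith
  · have := ((tendsto_es.pow 2).mul_const (vnsq y)).add (tendsto_es.pow 4)
    simpa using this

lemma off_sub_avg {ε : ℝ} (hε : 0 < ε) {y : V} (hy : y ≠ 0) :
    offKer ε y - (-1 / (4 * π)) * avgKer (fun α => cos (2 * α)) ε y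
      = (y 0 * y 1) / vnsq y ^ 2 * (angMean (y 0 * y 1) ((y 1 ^ 2 - y 0 ^ 2) / 2)
        (ε ^ 2 * vnsq y + ε ^ 4) / π - 2 * (vnsq y ^ 2 / (vnsq y + ε ^ 2) ^ 2)) := by
  have hv := vnsq_pos hy
  have := Real.pi_pos
  rw [avgKer_cos hε hy, offKer]
  field_simp
  ring

lemma diag_sub_avg {ε : ℝ} (hε : 0 < ε) {y : V} (hy : y ≠ 0) :
    diagKer ε y - (1 / (2 * π)) * avgKer (fun α => sin (2 * α)) ε y
      = ((y 1 ^ 2 - y 0 ^ 2) / 2) / vnsq y ^ 2 * (4 * (vnsq y ^ 2 / (vnsq y + ε ^ 2) ^ 2)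
        - 2 * angMean (y 0 * y 1) ((y 1 ^ 2 - y 0 ^ 2) / 2)
        (ε ^ 2 * vnsq y + ε ^ 4) / π) := by
  have hv := vnsq_pos hy
  have := Real.pi_pos
  rw [avgKer_sin hε hy, diagKer]
  field_simp
  ring

lemma abs_angle_quot_le {y : V} (hy : y ≠ 0) :
    |(y 0 * y 1) / vnsq y ^ 2| ≤ 1 / ‖y‖ ^ 2 ∧
      |((y 1 ^ 2 - y 0 ^ 2) / 2) / vnsq y ^ 2| ≤ 1 / ‖y‖ ^ 2 := by
  have hv := vnsq_pos hy
  have hn := norm_pos_iff.2 hy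
  have h1 : 1 / vnsq y ≤ 1 / ‖y‖ ^ 2 := one_div_le_one_div_of_le (by positivity) (norm_sq_le_vnsq y)
  have h : ∀ a : ℝ, |a| ≤ vnsq y → |a / vnsq y ^ 2| ≤ 1 / ‖y‖ ^ 2 := by
    intro a ha
    rw [abs_div, abs_of_pos (by positivity : (0 : ℝ) < vnsq y ^ 2)]
    calc |a| / vnsq y ^ 2 ≤ vnsq y / vnsq y ^ 2 := by gcongr
      _ = 1 / vnsq y := by field_simp
      _ ≤ _ := h1
  constructor <;> refine h _ (abs_le.2 ⟨?_, ?_⟩) <;> rw [vnsq_eq] <;>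
    nlinarith [sq_nonneg (y 0 + y 1), sq_nonneg (y 0 - y 1), sq_nonneg (y 0), sq_nonneg (y 1)]

/-- `L⁴` bound for limits of convolutions with `offKer`. -/
theorem lintegral_offKer {g : V → ℝ} (hg : ContDiff ℝ 1 g) (hc : HasCompactSupport g) {L : V → ℝ}
    (hL : ∀ x, Tendsto (fun n => ∫ z, g z * offKer (es n) (x - z)) atTop (nhds (L x))) :
    ∫⁻ x, ofReal (L x ^ 4)
      ≤ ofReal ((-1 / (4 * π)) ^ 4) * avgC * ∫⁻ z, ofReal (g z ^ 4) := by
  have hpi := Real.pi_pos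
  refine lintegral_limit_kernel (w := fun α => cos (2 * α)) (by fun_prop)
    (fun α => Real.abs_cos_le_one _) (fun ε => continuous_offKer) (C := 4) (fun n y hy => ?_)
    (fun y hy => ?_) (b := true) (fun n y => ?_) hg hc hL
  · rw [off_sub_avg (es_pos n) hy, abs_mul]
    have h1 := (abs_angle_quot_le hy).1
    have hv := vnsq_pos hy
    have hp := es_pos n
    have h2 := abs_angMean_le (y 0 * y 1) ((y 1 ^ 2 - y 0 ^ 2) / 2)
      (c := es n ^ 2 * vnsq y + es n ^ 4) (by positivity)
    have h3 := ratio_le_one (ε := es n) hv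
    have h3' : 0 ≤ vnsq y ^ 2 / (vnsq y + es n ^ 2) ^ 2 := by positivity
    set m := angMean (y 0 * y 1) ((y 1 ^ 2 - y 0 ^ 2) / 2) (es n ^ 2 * vnsq y + es n ^ 4)
    have h4 : |m / π| ≤ 2 := by
      rw [abs_div, abs_of_pos hpi, div_le_iff₀ hpi]; exact h2
    have h5 : |m / π - 2 * (vnsq y ^ 2 / (vnsq y + es n ^ 2) ^ 2)| ≤ 4 := by
      rw [abs_le] at h4 ⊢; constructor <;> linarith
    calc _ ≤ 1 / ‖y‖ ^ 2 * 4 := mul_le_mul h1 h5 (abs_nonneg _) (by positivity)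
      _ = 4 / ‖y‖ ^ 2 := by ring
  · simp_rw [off_sub_avg (es_pos _) hy]
    have hv := vnsq_pos hy
    have := (((tendsto_angMean_es hy).div_const π).sub
      ((tendsto_ratio hv).const_mul 2)).const_mul ((y 0 * y 1) / vnsq y ^ 2)
    refine this.trans (le_of_eq ?_)
    congr 1
    field_simp
    ring
  · by_cases hy : y = 0
    · subst hy
      have : invol true (0 : V) = 0 := by ext i; fin_cases i <;> simp [invol]
      rw [this, offKer, avgKer]
      simp [rot, hker]
    · have hy' : invol true y ≠ 0 := fun h => hy (by
        rw [← norm_eq_zero, ← norm_invol true, h, norm_zero])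
      rw [off_sub_avg (es_pos n) hy, off_sub_avg (es_pos n) hy', vnsq_invol]
      have e0 : invol true y 0 = -y 0 := by simp [invol]
      have e1 : invol true y 1 = y 1 := by simp [invol]
      rw [e0, e1, neg_mul, neg_sq, angMean_neg']
      ring

/-- `L⁴` bound for limits of convolutions with `diagKer`. -/
theorem lintegral_diagKer {g : V → ℝ} (hg : ContDiff ℝ 1 g) (hc : HasCompactSupport g) {L : V → ℝ}
    (hL : ∀ x, Tendsto (fun n => ∫ z, g z * diagKer (es n) (x - z)) atTop (nhds (L x))) :
    ∫⁻ x, ofReal (L x ^ 4)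
      ≤ ofReal ((1 / (2 * π)) ^ 4) * avgC * ∫⁻ z, ofReal (g z ^ 4) := by
  have hpi := Real.pi_pos
  refine lintegral_limit_kernel (w := fun α => sin (2 * α)) (by fun_prop)
    (fun α => Real.abs_sin_le_one _) (fun ε => continuous_diagKer) (C := 8) (fun n y hy => ?_)
    (fun y hy => ?_) (b := false) (fun n y => ?_) hg hc hL
  · rw [diag_sub_avg (es_pos n) hy, abs_mul]
    have h1 := (abs_angle_quot_le hy).2
    have hv := vnsq_pos hy
    have hp := es_pos n
    have h2 := abs_angMean_le (y 0 * y 1) ((y 1 ^ 2 - y 0 ^ 2) / 2)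
      (c := es n ^ 2 * vnsq y + es n ^ 4) (by positivity)
    have h3 := ratio_le_one (ε := es n) hv
    have h3' : 0 ≤ vnsq y ^ 2 / (vnsq y + es n ^ 2) ^ 2 := by positivity
    set m := angMean (y 0 * y 1) ((y 1 ^ 2 - y 0 ^ 2) / 2) (es n ^ 2 * vnsq y + es n ^ 4)
    have h4 : |m / π| ≤ 2 := by
      rw [abs_div, abs_of_pos hpi, div_le_iff₀ hpi]; exact h2
    have h5 : |4 * (vnsq y ^ 2 / (vnsq y + es n ^ 2) ^ 2) - 2 * m / π| ≤ 8 := by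
      rw [mul_div_assoc]
      rw [abs_le] at h4 ⊢; constructor <;> linarith
    calc _ ≤ 1 / ‖y‖ ^ 2 * 8 := mul_le_mul h1 h5 (abs_nonneg _) (by positivity)
      _ = 8 / ‖y‖ ^ 2 := by ring
  · simp_rw [diag_sub_avg (es_pos _) hy]
    have hv := vnsq_pos hy
    have := (((tendsto_ratio hv).const_mul 4).sub
      (((tendsto_angMean_es hy).const_mul 2).div_const π)).const_mul
      (((y 1 ^ 2 - y 0 ^ 2) / 2) / vnsq y ^ 2)
    refine this.trans (le_of_eq ?_)
    congr 1
    field_simp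
    ring
  · by_cases hy : y = 0
    · subst hy
      have : invol false (0 : V) = 0 := by ext i; fin_cases i <;> simp [invol]
      rw [this, diagKer, avgKer]
      simp [rot, hker]
    · have hy' : invol false y ≠ 0 := fun h => hy (by
        rw [← norm_eq_zero, ← norm_invol false, h, norm_zero])
      rw [diag_sub_avg (es_pos n) hy, diag_sub_avg (es_pos n) hy', vnsq_invol]
      have e0 : invol false y 0 = y 1 := by simp [invol]
      have e1 : invol false y 1 = y 0 := by simp [invol]
      have e2 : (y 0 ^ 2 - y 1 ^ 2) / 2 = -((y 1 ^ 2 - y 0 ^ 2) / 2) := by ring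
      rw [e0, e1, e2, angMean_neg, mul_comm (y 1) (y 0)]
      ring

/-- Smooth maps. -/
abbrev Sm {E F : Type*} [NormedAddCommGroup E] [NormedSpace ℝ E] [NormedAddCommGroup F]
    [NormedSpace ℝ F] (f : E → F) : Prop := ContDiff ℝ (⊤ : ℕ∞) f

lemma Sm.differentiable {E F : Type*} [NormedAddCommGroup E] [NormedSpace ℝ E]
    [NormedAddCommGroup F] [NormedSpace ℝ F] {f : E → F} (hf : Sm f) : Differentiable ℝ f :=
  ContDiff.differentiable hf (by simp)

lemma Sm.pd {f : V → ℝ} (hf : Sm f) (i : Fin 2) : Sm (pd i f) :=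
  (hf.fderiv_right (m := (⊤ : ℕ∞)) le_rfl).clm_apply contDiff_const

lemma Sm.cont {E F : Type*} [NormedAddCommGroup E] [NormedSpace ℝ E]
    [NormedAddCommGroup F] [NormedSpace ℝ F] {f : E → F} (hf : Sm f) : Continuous f :=
  ContDiff.continuous hf

lemma Sm.add {f g : V → ℝ} (hf : Sm f) (hg : Sm g) : Sm (fun x => f x + g x) := ContDiff.add hf hg

lemma Sm.sub {f g : V → ℝ} (hf : Sm f) (hg : Sm g) : Sm (fun x => f x - g x) := ContDiff.sub hf hg

lemma Sm.neg {f : V → ℝ} (hf : Sm f) : Sm (fun x => -f x) := ContDiff.neg hf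

lemma Sm.mul {f g : V → ℝ} (hf : Sm f) (hg : Sm g) : Sm (fun x => f x * g x) := ContDiff.mul hf hg

lemma Sm.const (c : ℝ) : Sm (fun _ : V => c) := contDiff_const

lemma Sm.const_mul {f : V → ℝ} (hf : Sm f) (c : ℝ) : Sm (fun x => c * f x) :=
  (Sm.const c).mul hf

lemma Sm.pow {f : V → ℝ} (hf : Sm f) (n : ℕ) : Sm (fun x => f x ^ n) := ContDiff.pow hf n

lemma Sm.sum {ι : Type*} {s : Finset ι} {f : ι → V → ℝ} (hf : ∀ k, Sm (f k)) :
    Sm (fun x => ∑ k ∈ s, f k x) := ContDiff.sum fun k _ => hf k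

lemma two_le_top : (2 : WithTop ℕ∞) ≤ ((⊤ : ℕ∞) : WithTop ℕ∞) := by
  exact WithTop.coe_le_coe.2 (le_top : (2 : ℕ∞) ≤ ⊤)

lemma pd_add {f g : V → ℝ} (hf : Sm f) (hg : Sm g) (i : Fin 2) (x : V) :
    pd i (fun y => f y + g y) x = pd i f x + pd i g x := by
  unfold pd
  rw [fderiv_fun_add (hf.differentiable x) (hg.differentiable x)]; simp

lemma pd_sub {f g : V → ℝ} (hf : Sm f) (hg : Sm g) (i : Fin 2) (x : V) :
    pd i (fun y => f y - g y) x = pd i f x - pd i g x := by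
  unfold pd
  rw [fderiv_fun_sub (hf.differentiable x) (hg.differentiable x)]; simp

lemma pd_const (c : ℝ) (i : Fin 2) (x : V) : pd i (fun _ => c) x = 0 := by
  unfold pd; simp

lemma pd_mul {f g : V → ℝ} (hf : Sm f) (hg : Sm g) (i : Fin 2) (x : V) :
    pd i (fun y => f y * g y) x = pd i f x * g x + f x * pd i g x := by
  unfold pd
  rw [fderiv_fun_mul (hf.differentiable x) (hg.differentiable x)]
  simp; ring

lemma pd_const_mul {f : V → ℝ} (hf : Sm f) (c : ℝ) (i : Fin 2) (x : V) :
    pd i (fun y => c * f y) x = c * pd i f x := by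
  rw [pd_mul contDiff_const hf, pd_const]; ring

lemma pd_sum {ι : Type*} (s : Finset ι) {f : ι → V → ℝ} (hf : ∀ k, Sm (f k)) (i : Fin 2) (x : V) :
    pd i (fun y => ∑ k ∈ s, f k y) x = ∑ k ∈ s, pd i (f k) x := by
  unfold pd
  rw [fderiv_fun_sum fun k _ => (hf k).differentiable x]
  simp

lemma pd_sq {f : V → ℝ} (hf : Sm f) (i : Fin 2) (x : V) :
    pd i (fun y => f y ^ 2) x = 2 * f x * pd i f x := by
  simp_rw [pow_two]
  rw [pd_mul hf hf]; ring

lemma pd_comm {f : V → ℝ} (hf : Sm f) (i j : Fin 2) (x : V) :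
    pd i (pd j f) x = pd j (pd i f) x := by
  have h1 : ∀ a b : Fin 2, pd a (pd b f) x = fderiv ℝ (fderiv ℝ f) x (Pi.single a 1) (Pi.single b 1) := by
    intro a b
    have hd : DifferentiableAt ℝ (fderiv ℝ f) x :=
      (hf.fderiv_right (m := (⊤ : ℕ∞)) le_rfl).differentiable (by simp) x
    change fderiv ℝ (fun y => fderiv ℝ f y (Pi.single b 1)) x (Pi.single a 1) = _
    rw [fderiv_clm_apply hd (differentiableAt_const _)]
    simp
  rw [h1, h1]
  exact (hf.contDiffAt.isSymmSndFDerivAt (by simpa using two_le_top)) _ _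

lemma pd_congr_of_eventuallyEq {f g : V → ℝ} {x : V} (h : f =ᶠ[nhds x] g) (i : Fin 2) :
    pd i f x = pd i g x := by unfold pd; rw [h.fderiv_eq]

lemma tsupport_pd_subset (f : V → ℝ) (i : Fin 2) : tsupport (pd i f) ⊆ tsupport f := by
  exact (tsupport_fderiv_apply_subset ℝ (Pi.single i 1))

lemma HasCompactSupport.pd {f : V → ℝ} (hf : HasCompactSupport f) (i : Fin 2) :
    HasCompactSupport (pd i f) :=
  hf.of_isClosed_subset (isClosed_tsupport _) (tsupport_pd_subset f i)

lemma integral_mul_pd {f g : V → ℝ} (hf : Sm f) (hg : Sm g) (i : Fin 2)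
    (h1 : Integrable (fun x => pd i f x * g x)) (h2 : Integrable (fun x => f x * pd i g x))
    (h3 : Integrable (fun x => f x * g x)) :
    ∫ x, f x * pd i g x = -∫ x, pd i f x * g x :=
  integral_mul_fderiv_eq_neg_fderiv_mul_of_integrable h1 h2 h3
    (fun x _ => hf.differentiable x) (fun x _ => hg.differentiable x)

lemma integral_pd_eq_zero {h : V → ℝ} (hh : Sm h) (i : Fin 2) (h1 : Integrable h)
    (h2 : Integrable (pd i h)) : ∫ x, pd i h x = 0 := by
  have := integral_mul_pd (f := fun _ => (1 : ℝ)) contDiff_const hh i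
    (by simp [pd_const]) (by simpa using h2) (by simpa using h1)
  simpa [pd_const] using this

lemma Sm.integrable {f : V → ℝ} (hf : Sm f) (hc : HasCompactSupport f) : Integrable f :=
  hf.cont.integrable_of_hasCompactSupport hc

lemma integral_mul_pd_of_left {f g : V → ℝ} (hf : Sm f) (hg : Sm g) (hc : HasCompactSupport f)
    (i : Fin 2) : ∫ x, f x * pd i g x = -∫ x, pd i f x * g x :=
  integral_mul_pd hf hg i (((hf.pd i).mul hg).integrable (hc.pd i).mul_right)
    ((hf.mul (hg.pd i)).integrable hc.mul_right) ((hf.mul hg).integrable hc.mul_right)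

lemma integral_mul_pd_of_right {f g : V → ℝ} (hf : Sm f) (hg : Sm g) (hc : HasCompactSupport g)
    (i : Fin 2) : ∫ x, f x * pd i g x = -∫ x, pd i f x * g x :=
  integral_mul_pd hf hg i (((hf.pd i).mul hg).integrable hc.mul_left)
    ((hf.mul (hg.pd i)).integrable (hc.pd i).mul_left) ((hf.mul hg).integrable hc.mul_left)

/-- Smooth space-time scalar fields. -/
abbrev STSm (u : ℝ → V → ℝ) : Prop := ContDiff ℝ (⊤ : ℕ∞) (Function.uncurry u)

/-- Time derivative of a space-time field. -/
def dt (u : ℝ → V → ℝ) (t : ℝ) (x : V) : ℝ := deriv (fun s => u s x) t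

lemma STSm.slice {u : ℝ → V → ℝ} (hu : STSm u) (t : ℝ) : Sm (u t) := by
  have h : ContDiff ℝ (⊤ : ℕ∞) (fun x : V => (t, x)) := by fun_prop
  exact (ContDiff.comp (g := Function.uncurry u) hu h :)

lemma STSm.time {u : ℝ → V → ℝ} (hu : STSm u) (x : V) : Sm (fun s => u s x) := by
  have h : ContDiff ℝ (⊤ : ℕ∞) (fun s : ℝ => (s, x)) := by fun_prop
  exact (ContDiff.comp (g := Function.uncurry u) hu h :)

lemma STSm.pd_eq {u : ℝ → V → ℝ} (hu : STSm u) (i : Fin 2) (t : ℝ) (x : V) :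
    pd i (u t) x = fderiv ℝ (Function.uncurry u) (t, x) (0, Pi.single i 1) := by
  have h1 : HasFDerivAt (fun x : V => (t, x)) (ContinuousLinearMap.inr ℝ ℝ V) x :=
    hasFDerivAt_prodMk_right t x
  have h2 := ((ContDiff.differentiable hu (by simp)) (t, x)).hasFDerivAt.comp x h1
  have h3 : HasFDerivAt (u t) ((fderiv ℝ (Function.uncurry u) (t, x)).comp
    (ContinuousLinearMap.inr ℝ ℝ V)) x := h2
  unfold pd
  rw [h3.fderiv]
  simp

lemma STSm.dt_eq {u : ℝ → V → ℝ} (hu : STSm u) (t : ℝ) (x : V) :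
    dt u t x = fderiv ℝ (Function.uncurry u) (t, x) (1, 0) := by
  have h1 : HasFDerivAt (fun s : ℝ => (s, x)) (ContinuousLinearMap.inl ℝ ℝ V) t :=
    hasFDerivAt_prodMk_left t x
  have h2 := ((ContDiff.differentiable hu (by simp)) (t, x)).hasFDerivAt.comp t h1
  have h3 : HasFDerivAt (fun s => u s x) ((fderiv ℝ (Function.uncurry u) (t, x)).comp
    (ContinuousLinearMap.inl ℝ ℝ V)) t := h2
  unfold dt
  rw [h3.hasDerivAt.deriv]
  simp

lemma STSm.fderiv_apply {u : ℝ → V → ℝ} (hu : STSm u) (v : ℝ × V) :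
    ContDiff ℝ (⊤ : ℕ∞) (fun p => fderiv ℝ (Function.uncurry u) p v) :=
  (ContDiff.fderiv_right (m := (⊤ : ℕ∞)) hu le_rfl).clm_apply contDiff_const

lemma STSm.pd {u : ℝ → V → ℝ} (hu : STSm u) (i : Fin 2) : STSm (fun t => pd i (u t)) := by
  have : Function.uncurry (fun t => _root_.pd i (u t))
      = fun p => fderiv ℝ (Function.uncurry u) p (0, Pi.single i 1) :=
    funext fun p => hu.pd_eq i p.1 p.2
  unfold STSm
  rw [this]
  exact hu.fderiv_apply _

lemma STSm.dt {u : ℝ → V → ℝ} (hu : STSm u) : STSm (dt u) := by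
  have : Function.uncurry (_root_.dt u)
      = fun p => fderiv ℝ (Function.uncurry u) p (1, 0) :=
    funext fun p => hu.dt_eq p.1 p.2
  unfold STSm
  rw [this]
  exact hu.fderiv_apply _

lemma STSm.dt_pd {u : ℝ → V → ℝ} (hu : STSm u) (i : Fin 2) (t : ℝ) (x : V) :
    _root_.dt (fun s => _root_.pd i (u s)) t x = _root_.pd i (_root_.dt u t) x := by
  have h1 : ∀ a b : ℝ × V, fderiv ℝ (fun p => fderiv ℝ (Function.uncurry u) p b) (t, x) a
      = fderiv ℝ (fderiv ℝ (Function.uncurry u)) (t, x) a b := by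
    intro a b
    have hd : DifferentiableAt ℝ (fderiv ℝ (Function.uncurry u)) (t, x) :=
      (ContDiff.fderiv_right (m := (⊤ : ℕ∞)) hu le_rfl).differentiable (by simp) _
    rw [fderiv_clm_apply hd (differentiableAt_const _)]
    simp
  rw [(hu.pd i).dt_eq, hu.dt.pd_eq]
  have e1 : Function.uncurry (fun t => _root_.pd i (u t))
      = fun p => fderiv ℝ (Function.uncurry u) p (0, Pi.single i 1) :=
    funext fun p => hu.pd_eq i p.1 p.2
  have e2 : Function.uncurry (_root_.dt u)
      = fun p => fderiv ℝ (Function.uncurry u) p (1, 0) :=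
    funext fun p => hu.dt_eq p.1 p.2
  rw [e1, e2, h1, h1]
  exact (ContDiff.contDiffAt hu).isSymmSndFDerivAt (by simpa using two_le_top) _ _

lemma STSm.const {f : V → ℝ} (hf : Sm f) : STSm (fun _ => f) := by
  have h : ContDiff ℝ (⊤ : ℕ∞) (fun p : ℝ × V => p.2) := by fun_prop
  exact ContDiff.comp hf h

lemma STSm.add {u w : ℝ → V → ℝ} (hu : STSm u) (hw : STSm w) : STSm (fun t x => u t x + w t x) :=
  ContDiff.add hu hw

lemma STSm.mul {u w : ℝ → V → ℝ} (hu : STSm u) (hw : STSm w) : STSm (fun t x => u t x * w t x) :=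
  ContDiff.mul hu hw

lemma STSm.pow {u : ℝ → V → ℝ} (hu : STSm u) (n : ℕ) : STSm (fun t x => u t x ^ n) :=
  ContDiff.pow hu n

lemma STSm.sum {ι : Type*} {s : Finset ι} {u : ι → ℝ → V → ℝ} (hu : ∀ k, STSm (u k)) :
    STSm (fun t x => ∑ k ∈ s, u k t x) := by
  have : Function.uncurry (fun t x => ∑ k ∈ s, u k t x)
      = fun p => ∑ k ∈ s, Function.uncurry (u k) p := rfl
  unfold STSm
  rw [this]
  exact ContDiff.sum fun k _ => hu k

lemma STSm.hasDerivAt {u : ℝ → V → ℝ} (hu : STSm u) (t : ℝ) (x : V) :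
    HasDerivAt (fun s => u s x) (_root_.dt u t x) t :=
  ((hu.time x).differentiable t).hasDerivAt

lemma STSm.continuous_integral {G : ℝ → V → ℝ} (hG : STSm G) {K : Set V} (hK : IsCompact K)
    (h0 : ∀ t, ∀ x ∉ K, G t x = 0) : Continuous (fun t => ∫ x, G t x) :=
  continuous_integral_of_compact (μ := (volume : Measure V)) (ContDiff.continuous hG) hK h0

lemma STSm.integral_sub {G : ℝ → V → ℝ} (hG : STSm G) {K : Set V} (hK : IsCompact K)
    (h0 : ∀ t, ∀ x ∉ K, G t x = 0) {a b : ℝ} (hab : a ≤ b) :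
    (∫ x, G b x) - ∫ x, G a x = ∫ s in Ioc a b, ∫ x, _root_.dt G s x := by
  have h0' : ∀ t, ∀ x ∉ K, _root_.dt G t x = 0 := by
    intro t x hx
    unfold _root_.dt
    simp [h0 _ x hx]
  have hIt : ∀ t, Integrable (G t) := fun t =>
    (hG.slice t).integrable (HasCompactSupport.intro hK (h0 t))
  have hpt : ∀ x, G b x - G a x = ∫ s in Ioc a b, _root_.dt G s x := by
    intro x
    rw [← intervalIntegral.integral_of_le hab,
      intervalIntegral.integral_eq_sub_of_hasDerivAt (fun s _ => hG.hasDerivAt s x)]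
    exact (hG.dt.time x).cont.intervalIntegrable _ _
  rw [← MeasureTheory.integral_sub (hIt b) (hIt a)]
  simp_rw [hpt]
  rw [integral_integral_swap]
  have hcont : Continuous (Function.uncurry fun (x : V) (s : ℝ) => _root_.dt G s x) := by
    have h1 : Continuous (fun q : V × ℝ => (q.2, q.1)) := by fun_prop
    exact ((ContDiff.continuous hG.dt).comp h1 :)
  have hI := hcont.continuousOn.integrableOn_compact (μ := volume.prod volume)
    (hK.prod (isCompact_Icc (a := a) (b := b)))
  rw [← Measure.restrict_univ (μ := (volume : Measure V)), Measure.prod_restrict]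
  refine (hI.of_forall_sdiff_eq_zero (t := univ ×ˢ Icc a b)
    (MeasurableSet.univ.prod measurableSet_Icc) ?_).mono_set
    (prod_mono subset_rfl Ioc_subset_Icc_self)
  rintro ⟨x, s⟩ ⟨h, h'⟩
  exact h0' s x fun hx => h' ⟨hx, h.2⟩

/-- A smooth bump function equal to one on the unit ball and supported in the ball of radius two. -/
def chi : V → ℝ := (⟨1, 2, one_pos, one_lt_two⟩ : ContDiffBump (0 : V))

lemma sm_chi : Sm chi := ContDiffBump.contDiff _

lemma hasCompactSupport_chi : HasCompactSupport chi := ContDiffBump.hasCompactSupport _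

lemma chi_nonneg (x : V) : 0 ≤ chi x := ContDiffBump.nonneg _

lemma chi_le_one (x : V) : chi x ≤ 1 := ContDiffBump.le_one _

lemma chi_eq_one {x : V} (hx : ‖x‖ ≤ 1) : chi x = 1 :=
  ContDiffBump.one_of_mem_closedBall _ (by simpa using hx)

lemma chi_eq_zero {x : V} (hx : 2 ≤ ‖x‖) : chi x = 0 :=
  ContDiffBump.zero_of_le_dist _ (by simpa using hx)

/-- The rescaled cutoff `χ(x/r)`. -/
def cut (r : ℝ) (x : V) : ℝ := chi (r⁻¹ • x)

lemma pd_comp_smul {φ : V → ℝ} (hφ : Sm φ) (c : ℝ) (i : Fin 2) (x : V) :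
    pd i (fun y => φ (c • y)) x = c * pd i φ (c • x) := by
  unfold pd
  have h1 : HasFDerivAt (fun y : V => c • y) (c • ContinuousLinearMap.id ℝ V) x :=
    (hasFDerivAt_id x).const_smul c
  have h2 := (hφ.differentiable (c • x)).hasFDerivAt.comp x h1
  have h3 : HasFDerivAt (fun y => φ (c • y))
    ((fderiv ℝ φ (c • x)).comp (c • ContinuousLinearMap.id ℝ V)) x := h2
  rw [h3.fderiv]
  simp

lemma Sm.comp_smul {φ : V → ℝ} (hφ : Sm φ) (c : ℝ) : Sm (fun y : V => φ (c • y)) := by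
  have h : ContDiff ℝ (⊤ : ℕ∞) (fun y : V => c • y) := by fun_prop
  exact (ContDiff.comp (g := φ) hφ h :)

lemma sm_cut (r : ℝ) : Sm (cut r) := sm_chi.comp_smul r⁻¹

lemma cut_nonneg (r : ℝ) (x : V) : 0 ≤ cut r x := chi_nonneg _

lemma cut_le_one (r : ℝ) (x : V) : cut r x ≤ 1 := chi_le_one _

lemma norm_inv_smul {r : ℝ} (hr : 0 < r) (x : V) : ‖r⁻¹ • x‖ = ‖x‖ / r := by
  rw [norm_smul, norm_inv, Real.norm_of_nonneg hr.le]; field_simp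

lemma cut_eq_one {r : ℝ} (hr : 0 < r) {x : V} (hx : ‖x‖ ≤ r) : cut r x = 1 :=
  chi_eq_one (by rw [norm_inv_smul hr]; exact (div_le_one hr).2 hx)

lemma cut_eq_zero {r : ℝ} (hr : 0 < r) {x : V} (hx : 2 * r ≤ ‖x‖) : cut r x = 0 :=
  chi_eq_zero (by rw [norm_inv_smul hr]; exact (le_div_iff₀ hr).2 hx)

lemma hasCompactSupport_cut {r : ℝ} (hr : 0 < r) : HasCompactSupport (cut r) :=
  HasCompactSupport.intro (isCompact_closedBall (0 : V) (2 * r)) fun x hx => by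
    rw [mem_closedBall_zero_iff, not_le] at hx
    exact cut_eq_zero hr hx.le

lemma pd_cut (r : ℝ) (i : Fin 2) (x : V) : pd i (cut r) x = r⁻¹ * pd i chi (r⁻¹ • x) :=
  pd_comp_smul sm_chi r⁻¹ i x

lemma pd_pd_cut (r : ℝ) (i j : Fin 2) (x : V) :
    pd i (pd j (cut r)) x = r⁻¹ ^ 2 * pd i (pd j chi) (r⁻¹ • x) := by
  have : pd j (cut r) = fun y => r⁻¹ * pd j chi (r⁻¹ • y) := funext (pd_cut r j)
  rw [this, pd_const_mul ((sm_chi.pd j).comp_smul _), pd_comp_smul (sm_chi.pd j)]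
  ring

lemma pd_pd_pd_cut (r : ℝ) (i j k : Fin 2) (x : V) :
    pd i (pd j (pd k (cut r))) x = r⁻¹ ^ 3 * pd i (pd j (pd k chi)) (r⁻¹ • x) := by
  have : pd j (pd k (cut r)) = fun y => r⁻¹ ^ 2 * pd j (pd k chi) (r⁻¹ • y) :=
    funext (pd_pd_cut r j k)
  rw [this, pd_const_mul (((sm_chi.pd k).pd j).comp_smul _), pd_comp_smul ((sm_chi.pd k).pd j)]
  ring

lemma exists_bound_of_cpt {f : V → ℝ} (hf : Continuous f) (hc : HasCompactSupport f) :
    ∃ C, 0 ≤ C ∧ ∀ x, |f x| ≤ C := by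
  obtain ⟨C, hC⟩ := hf.bounded_above_of_compact_support hc
  exact ⟨C, (norm_nonneg _).trans (hC 0), hC⟩

lemma exists_chi_bound : ∃ C : ℝ, 1 ≤ C ∧ (∀ i x, |pd i chi x| ≤ C) ∧
    (∀ i j x, |pd i (pd j chi) x| ≤ C) ∧ ∀ i j k x, |pd i (pd j (pd k chi)) x| ≤ C := by
  have h1 := fun i : Fin 2 => exists_bound_of_cpt (sm_chi.pd i).cont (hasCompactSupport_chi.pd i)
  choose C1 hC1 h1 using h1
  have h2 := fun i j : Fin 2 => exists_bound_of_cpt ((sm_chi.pd j).pd i).cont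
    ((hasCompactSupport_chi.pd j).pd i)
  choose C2 hC2 h2 using h2
  have h3 := fun i j k : Fin 2 => exists_bound_of_cpt (((sm_chi.pd k).pd j).pd i).cont
    (((hasCompactSupport_chi.pd k).pd j).pd i)
  choose C3 hC3 h3 using h3
  have n1 : 0 ≤ ∑ i, C1 i := Finset.sum_nonneg fun i _ => hC1 i
  have n2 : 0 ≤ ∑ i, ∑ j, C2 i j := Finset.sum_nonneg fun i _ => Finset.sum_nonneg fun j _ => hC2 i j
  have n3 : 0 ≤ ∑ i, ∑ j, ∑ k, C3 i j k := Finset.sum_nonneg fun i _ =>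
    Finset.sum_nonneg fun j _ => Finset.sum_nonneg fun k _ => hC3 i j k
  refine ⟨1 + ∑ i, C1 i + ∑ i, ∑ j, C2 i j + ∑ i, ∑ j, ∑ k, C3 i j k, by linarith, ?_, ?_, ?_⟩
  · intro i x
    have := Finset.single_le_sum (f := C1) (fun i _ => hC1 i) (Finset.mem_univ i)
    linarith [h1 i x]
  · intro i j x
    have e1 := Finset.single_le_sum (f := fun j => C2 i j) (fun j _ => hC2 i j) (Finset.mem_univ j)
    have e2 := Finset.single_le_sum (f := fun i => ∑ j, C2 i j)
      (fun i _ => Finset.sum_nonneg fun j _ => hC2 i j) (Finset.mem_univ i)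
    linarith [h2 i j x]
  · intro i j k x
    have e0 := Finset.single_le_sum (f := fun k => C3 i j k) (fun k _ => hC3 i j k)
      (Finset.mem_univ k)
    have e1 := Finset.single_le_sum (f := fun j => ∑ k, C3 i j k)
      (fun j _ => Finset.sum_nonneg fun k _ => hC3 i j k) (Finset.mem_univ j)
    have e2 := Finset.single_le_sum (f := fun i => ∑ j, ∑ k, C3 i j k)
      (fun i _ => Finset.sum_nonneg fun j _ => Finset.sum_nonneg fun k _ => hC3 i j k)
      (Finset.mem_univ i)
    linarith [h3 i j k x]

/-- A bound for the first three derivatives of `chi`. -/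
def cX : ℝ := exists_chi_bound.choose

lemma one_le_cX : 1 ≤ cX := exists_chi_bound.choose_spec.1

lemma cX_pos : 0 < cX := lt_of_lt_of_le one_pos one_le_cX

lemma abs_pd_cut_le {r : ℝ} (hr : 0 < r) (i : Fin 2) (x : V) : |pd i (cut r) x| ≤ cX / r := by
  rw [pd_cut, abs_mul, abs_of_pos (inv_pos.2 hr), div_eq_inv_mul]
  gcongr
  exact exists_chi_bound.choose_spec.2.1 i _

lemma abs_pd_pd_cut_le {r : ℝ} (hr : 0 < r) (i j : Fin 2) (x : V) :
    |pd i (pd j (cut r)) x| ≤ cX / r ^ 2 := by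
  rw [pd_pd_cut, abs_mul, abs_of_pos (by positivity), div_eq_inv_mul, inv_pow]
  gcongr
  exact exists_chi_bound.choose_spec.2.2.1 i j _

lemma abs_pd_pd_pd_cut_le {r : ℝ} (hr : 0 < r) (i j k : Fin 2) (x : V) :
    |pd i (pd j (pd k (cut r))) x| ≤ cX / r ^ 3 := by
  rw [pd_pd_pd_cut, abs_mul, abs_of_pos (by positivity), div_eq_inv_mul, inv_pow]
  gcongr
  exact exists_chi_bound.choose_spec.2.2.2 i j k _

lemma tsupport_pd_cut_subset {r : ℝ} (hr : 0 < r) (i : Fin 2) :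
    tsupport (pd i (cut r)) ⊆ {x | r ≤ ‖x‖ ∧ ‖x‖ ≤ 2 * r} := by
  refine closure_minimal ?_ ((isClosed_le continuous_const continuous_norm).inter
    (isClosed_le continuous_norm continuous_const))
  intro x hx
  rw [Function.mem_support] at hx
  constructor
  · by_contra! h
    refine hx ?_
    have : cut r =ᶠ[nhds x] fun _ => 1 := by
      filter_upwards [Metric.isOpen_ball.mem_nhds (mem_ball_zero_iff.2 h)] with y hy
      exact cut_eq_one hr (mem_ball_zero_iff.1 hy).le
    rw [pd_congr_of_eventuallyEq this, pd_const]
  · by_contra! h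
    refine hx ?_
    have : cut r =ᶠ[nhds x] fun _ => 0 := by
      filter_upwards [(isOpen_lt continuous_const continuous_norm).mem_nhds h] with y hy
      exact cut_eq_zero hr (le_of_lt hy)
    rw [pd_congr_of_eventuallyEq this, pd_const]

lemma pd_cut_eq_zero {r : ℝ} (hr : 0 < r) (i : Fin 2) {x : V}
    (hx : x ∉ {x : V | r ≤ ‖x‖ ∧ ‖x‖ ≤ 2 * r}) : pd i (cut r) x = 0 :=
  image_eq_zero_of_notMem_tsupport fun h => hx (tsupport_pd_cut_subset hr i h)

lemma pd_pd_cut_eq_zero {r : ℝ} (hr : 0 < r) (i j : Fin 2) {x : V}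
    (hx : x ∉ {x : V | r ≤ ‖x‖ ∧ ‖x‖ ≤ 2 * r}) : pd i (pd j (cut r)) x = 0 :=
  image_eq_zero_of_notMem_tsupport fun h =>
    hx (tsupport_pd_cut_subset hr j (tsupport_pd_subset _ i h))

lemma pd_pd_pd_cut_eq_zero {r : ℝ} (hr : 0 < r) (i j k : Fin 2) {x : V}
    (hx : x ∉ {x : V | r ≤ ‖x‖ ∧ ‖x‖ ≤ 2 * r}) : pd i (pd j (pd k (cut r))) x = 0 :=
  image_eq_zero_of_notMem_tsupport fun h =>
    hx (tsupport_pd_cut_subset hr k (tsupport_pd_subset _ j (tsupport_pd_subset _ i h)))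

lemma tendsto_cut (x : V) : Tendsto (fun n : ℕ => cut ((n : ℝ) + 1) x) atTop (nhds 1) := by
  refine tendsto_const_nhds.congr' ?_
  obtain ⟨N, hN⟩ := exists_nat_ge ‖x‖
  filter_upwards [eventually_ge_atTop N] with n hn
  have : (N : ℝ) ≤ n := by exact_mod_cast hn
  exact (cut_eq_one (by positivity) (by linarith)).symm

/-- Convolution of a kernel with a test function. -/
def cv (κ g : V → ℝ) (x : V) : ℝ := ∫ y, κ y * g (x - y)

lemma cv_eq (κ g : V → ℝ) :
    cv κ g = MeasureTheory.convolution κ g (ContinuousLinearMap.mul ℝ ℝ) volume := by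
  ext x; simp [cv, MeasureTheory.convolution]

lemma hasCompactSupport_sub_left {g : V → ℝ} (hc : HasCompactSupport g) (x : V) :
    HasCompactSupport (fun y => g (x - y)) :=
  hc.comp_isClosedEmbedding (Homeomorph.subLeft x).isClosedEmbedding

lemma integrable_cv {κ g : V → ℝ} (hκ : LocallyIntegrable κ) (hg : Continuous g)
    (hc : HasCompactSupport g) (x : V) : Integrable (fun y => κ y * g (x - y)) := by
  have := hc.convolutionExists_right (ContinuousLinearMap.mul ℝ ℝ) hκ hg x
  simpa [ConvolutionExistsAt] using this

lemma continuous_cv {κ g : V → ℝ} (hκ : LocallyIntegrable κ) (hg : Continuous g)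
    (hc : HasCompactSupport g) : Continuous (cv κ g) := by
  rw [cv_eq]
  exact hc.continuous_convolution_right _ hκ hg

lemma sm_cv {κ g : V → ℝ} (hκ : LocallyIntegrable κ) (hg : Sm g)
    (hc : HasCompactSupport g) : Sm (cv κ g) := by
  rw [cv_eq]
  exact hc.contDiff_convolution_right _ hκ hg

lemma pd_cv {κ g : V → ℝ} (hκ : LocallyIntegrable κ) (hg : Sm g)
    (hc : HasCompactSupport g) (i : Fin 2) (x : V) : pd i (cv κ g) x = cv κ (pd i g) x := by
  have hg1 : ContDiff ℝ 1 g := hg.of_le (by simp)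
  have h := hc.hasFDerivAt_convolution_right (ContinuousLinearMap.mul ℝ ℝ) hκ hg1 x
  unfold pd
  rw [cv_eq, h.fderiv, convolution_precompR_apply _ hκ (hc.fderiv ℝ)
    (hg1.continuous_fderiv (by simp)), cv_eq]

lemma pd_comp_sub {g : V → ℝ} (hg : Sm g) (x : V) (i : Fin 2) (y : V) :
    pd i (fun y => g (x - y)) y = - pd i g (x - y) := by
  unfold pd
  have h1 : HasFDerivAt (fun y : V => x - y) (-ContinuousLinearMap.id ℝ V) y :=
    (hasFDerivAt_id y).const_sub x
  have h3 : HasFDerivAt (fun y => g (x - y))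
    ((fderiv ℝ g (x - y)).comp (-ContinuousLinearMap.id ℝ V)) y :=
    (hg.differentiable (x - y)).hasFDerivAt.comp y h1
  rw [h3.fderiv]
  simp

lemma Sm.comp_sub {g : V → ℝ} (hg : Sm g) (x : V) : Sm (fun y => g (x - y)) := by
  have h : ContDiff ℝ (⊤ : ℕ∞) (fun y : V => x - y) := by fun_prop
  exact (ContDiff.comp (g := g) hg h :)

lemma cv_pd {κ g : V → ℝ} (hκ : Sm κ) (hg : Sm g) (hc : HasCompactSupport g) (i : Fin 2) (x : V) :
    cv κ (pd i g) x = cv (pd i κ) g x := by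
  unfold cv
  have h := integral_mul_pd_of_right hκ (hg.comp_sub x) (hasCompactSupport_sub_left hc x) i
  simp_rw [pd_comp_sub hg, mul_neg] at h
  rw [integral_neg] at h
  linarith

lemma cv_swap (κ g : V → ℝ) (x : V) : cv κ g x = ∫ z, g z * κ (x - z) := by
  unfold cv
  rw [← integral_sub_left_eq_self (fun y => κ y * g (x - y)) volume x]
  simp [mul_comm]

lemma cv_add_left {κ κ' g : V → ℝ} (hκ : LocallyIntegrable κ) (hκ' : LocallyIntegrable κ')
    (hg : Continuous g) (hc : HasCompactSupport g) (x : V) :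
    cv (fun y => κ y + κ' y) g x = cv κ g x + cv κ' g x := by
  unfold cv
  rw [← integral_add (integrable_cv hκ hg hc x) (integrable_cv hκ' hg hc x)]
  simp_rw [add_mul]

lemma cv_sub_left {κ κ' g : V → ℝ} (hκ : LocallyIntegrable κ) (hκ' : LocallyIntegrable κ')
    (hg : Continuous g) (hc : HasCompactSupport g) (x : V) :
    cv (fun y => κ y - κ' y) g x = cv κ g x - cv κ' g x := by
  unfold cv
  rw [← integral_sub (integrable_cv hκ hg hc x) (integrable_cv hκ' hg hc x)]
  simp_rw [sub_mul]

lemma cv_add_right {κ g h : V → ℝ} (hκ : LocallyIntegrable κ)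
    (hg : Continuous g) (hc : HasCompactSupport g) (hh : Continuous h) (hch : HasCompactSupport h)
    (x : V) : cv κ (fun y => g y + h y) x = cv κ g x + cv κ h x := by
  unfold cv
  rw [← integral_add (integrable_cv hκ hg hc x) (integrable_cv hκ hh hch x)]
  simp_rw [mul_add]

/-- The (unnormalised) mass of the regularised kernel. -/
def c0 : ℝ := ∫ y : V, 2 / (1 + vnsq y) ^ 2

lemma integrable_c0 : Integrable (fun y : V => 2 / (1 + vnsq y) ^ 2) := by
  have h := (integrable_rpow_neg_one_add_norm_sq (E := V) (μ := volume) (r := 4)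
    (by simp; norm_num)).const_mul 2
  have hv := continuous_vnsq
  refine h.mono' (Continuous.aestronglyMeasurable
    (Continuous.div (by fun_prop) (by fun_prop) fun y => by have := vnsq_nonneg y; positivity))
    (Eventually.of_forall fun y => ?_)
  have h1 := vnsq_nonneg y
  have h2 := norm_sq_le_vnsq y
  rw [Real.norm_of_nonneg (by positivity)]
  have : ((1 : ℝ) + ‖y‖ ^ 2) ^ (-(4 : ℝ) / 2) = 1 / (1 + ‖y‖ ^ 2) ^ 2 := by
    rw [show (-(4 : ℝ) / 2) = -((2 : ℕ) : ℝ) by norm_num, Real.rpow_neg (by positivity),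
      Real.rpow_natCast, one_div]
  rw [this, mul_one_div]
  gcongr

lemma c0_pos : 0 < c0 := by
  refine (integral_pos_iff_support_of_nonneg (fun y => ?_) integrable_c0).2 ?_
  · have := vnsq_nonneg y
    simp only [Pi.zero_apply]
    positivity
  · have : Function.support (fun y : V => 2 / (1 + vnsq y) ^ 2) = univ := by
      ext y
      have := vnsq_nonneg y
      simp only [Function.mem_support, mem_univ, iff_true]
      positivity
    rw [this]
    simp

/-- Gradient of the Newtonian kernel. -/
def kN (l : Fin 2) (y : V) : ℝ := y l / (c0 * vnsq y)

/-- `1/(|y|²+ε²)`. -/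
def rh (ε : ℝ) (y : V) : ℝ := (vnsq y + ε ^ 2)⁻¹

/-- Regularised gradient of the Newtonian kernel. -/
def kE (ε : ℝ) (l : Fin 2) (y : V) : ℝ := c0⁻¹ * (y l * rh ε y)

lemma sm_coord (l : Fin 2) : Sm (fun y : V => y l) := contDiff_apply ℝ ℝ l

lemma sm_vnsq : Sm vnsq := by
  have : vnsq = fun y : V => y 0 ^ 2 + y 1 ^ 2 := funext vnsq_eq
  rw [this]
  exact ((sm_coord 0).pow 2).add ((sm_coord 1).pow 2)

lemma pd_coord (i l : Fin 2) (x : V) : pd i (fun y : V => y l) x = if l = i then 1 else 0 := by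
  unfold pd
  have : HasFDerivAt (fun y : V => y l) (ContinuousLinearMap.proj (R := ℝ) l) x :=
    (ContinuousLinearMap.proj (R := ℝ) (φ := fun _ : Fin 2 => ℝ) l).hasFDerivAt
  rw [this.fderiv]
  simp [Pi.single_apply]

lemma pd_vnsq (i : Fin 2) (x : V) : pd i vnsq x = 2 * x i := by
  have : vnsq = fun y : V => y 0 ^ 2 + y 1 ^ 2 := funext vnsq_eq
  rw [this, pd_add ((sm_coord 0).pow 2) ((sm_coord 1).pow 2), pd_sq (sm_coord 0),
    pd_sq (sm_coord 1), pd_coord, pd_coord]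
  fin_cases i <;> simp

lemma rh_denom_pos {ε : ℝ} (hε : 0 < ε) (y : V) : 0 < vnsq y + ε ^ 2 := by
  have := vnsq_nonneg y; positivity

lemma rh_pos {ε : ℝ} (hε : 0 < ε) (y : V) : 0 < rh ε y := inv_pos.2 (rh_denom_pos hε y)

lemma sm_rh {ε : ℝ} (hε : 0 < ε) : Sm (rh ε) :=
  ContDiff.inv (ContDiff.add sm_vnsq contDiff_const) fun y => (rh_denom_pos hε y).ne'

lemma pd_rh {ε : ℝ} (hε : 0 < ε) (i : Fin 2) (x : V) :
    pd i (rh ε) x = -2 * x i * rh ε x ^ 2 := by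
  have h1 : pd i (fun y => rh ε y * (vnsq y + ε ^ 2)) x = 0 := by
    have : (fun y => rh ε y * (vnsq y + ε ^ 2)) = fun _ => 1 :=
      funext fun y => inv_mul_cancel₀ (rh_denom_pos hε y).ne'
    rw [this, pd_const]
  have hs : Sm (fun y => vnsq y + ε ^ 2) := sm_vnsq.add (Sm.const _)
  rw [pd_mul (sm_rh hε) hs, pd_add sm_vnsq (Sm.const _), pd_const, pd_vnsq] at h1
  have h2 : rh ε x * (vnsq x + ε ^ 2) = 1 := inv_mul_cancel₀ (rh_denom_pos hε x).ne'
  linear_combination rh ε x * h1 - pd i (rh ε) x * h2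

lemma sm_kE {ε : ℝ} (hε : 0 < ε) (l : Fin 2) : Sm (kE ε l) :=
  ((sm_coord l).mul (sm_rh hε)).const_mul _

/-- First derivatives of `kE`. -/
lemma pd_kE {ε : ℝ} (hε : 0 < ε) (i l : Fin 2) (x : V) :
    pd i (kE ε l) x
      = c0⁻¹ * ((if l = i then 1 else 0) * rh ε x + -2 * (x l * x i) * rh ε x ^ 2) := by
  unfold kE
  rw [pd_const_mul ((sm_coord l).mul (sm_rh hε)), pd_mul (sm_coord l) (sm_rh hε), pd_coord,
    pd_rh hε]
  ring

lemma pd_pd_kE {ε : ℝ} (hε : 0 < ε) (j i l : Fin 2) (x : V) :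
    pd j (pd i (kE ε l)) x
      = c0⁻¹ * (-2 * ((if l = i then 1 else 0) * x j + (if l = j then 1 else 0) * x i
        + (if i = j then 1 else 0) * x l) * rh ε x ^ 2 + 8 * (x l * x i * x j) * rh ε x ^ 3) := by
  have e : pd i (kE ε l) = fun x =>
      c0⁻¹ * ((if l = i then 1 else 0) * rh ε x + -2 * (x l * x i) * rh ε x ^ 2) :=
    funext (pd_kE hε i l)
  have s1 := sm_rh hε
  have s2 := (sm_coord l).mul (sm_coord i)
  rw [e, pd_const_mul ((s1.const_mul _).add ((s2.const_mul _).mul (s1.pow 2))),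
    pd_add (s1.const_mul _) ((s2.const_mul _).mul (s1.pow 2)), pd_const_mul s1,
    pd_mul (s2.const_mul _) (s1.pow 2), pd_const_mul s2, pd_mul (sm_coord l) (sm_coord i),
    pd_coord, pd_coord, pd_sq s1, pd_rh hε]
  ring

lemma rh_le (ε : ℝ) {y : V} (hy : y ≠ 0) : rh ε y ≤ 1 / ‖y‖ ^ 2 := by
  have := norm_pos_iff.2 hy
  rw [rh, ← one_div]
  refine one_div_le_one_div_of_le (by positivity) ?_
  have := norm_sq_le_vnsq y
  nlinarith

lemma abs_coord_le_norm (y : V) (i : Fin 2) : |y i| ≤ ‖y‖ := norm_le_pi_norm y i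

lemma abs_ite_le (p : Prop) [Decidable p] : |(if p then 1 else 0 : ℝ)| ≤ 1 := by
  split_ifs <;> simp

/-- A uniform constant for the kernel bounds. -/
def cK : ℝ := 14 * c0⁻¹

lemma cK_pos : 0 < cK := by have := c0_pos; unfold cK; positivity

lemma abs_kE_le {ε : ℝ} (hε : 0 < ε) (l : Fin 2) {y : V} (hy : y ≠ 0) :
    |kE ε l y| ≤ cK / ‖y‖ := by
  have hn := norm_pos_iff.2 hy
  have hc := inv_pos.2 c0_pos
  have h1 := rh_le ε hy
  have h2 := rh_pos hε y
  rw [kE, abs_mul, abs_of_pos hc, abs_mul, abs_of_pos h2]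
  calc c0⁻¹ * (|y l| * rh ε y) ≤ c0⁻¹ * (‖y‖ * (1 / ‖y‖ ^ 2)) := by
        gcongr; exact abs_coord_le_norm y l
    _ = c0⁻¹ * (1 / ‖y‖) := by field_simp
    _ ≤ 14 * c0⁻¹ * (1 / ‖y‖) := by gcongr; linarith
    _ = cK / ‖y‖ := by rw [cK]; ring

lemma abs_pd_kE_le {ε : ℝ} (hε : 0 < ε) (i l : Fin 2) {y : V} (hy : y ≠ 0) :
    |pd i (kE ε l) y| ≤ cK / ‖y‖ ^ 2 := by
  have hn := norm_pos_iff.2 hy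
  have hc := inv_pos.2 c0_pos
  have h1 := rh_le ε hy
  have h2 := rh_pos hε y
  rw [pd_kE hε, abs_mul, abs_of_pos hc]
  have e1 : |(if l = i then 1 else 0) * rh ε y| ≤ 1 * (1 / ‖y‖ ^ 2) := by
    rw [abs_mul, abs_of_pos h2]
    gcongr
    exact abs_ite_le _
  have e2 : |-2 * (y l * y i) * rh ε y ^ 2| ≤ 2 * (‖y‖ * ‖y‖) * (1 / ‖y‖ ^ 2) ^ 2 := by
    rw [abs_mul, abs_mul, abs_mul, abs_of_pos (pow_pos h2 2)]
    gcongr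
    · norm_num
    · exact abs_coord_le_norm y l
    · exact abs_coord_le_norm y i
  calc c0⁻¹ * |(if l = i then 1 else 0) * rh ε y + -2 * (y l * y i) * rh ε y ^ 2|
      ≤ c0⁻¹ * (1 * (1 / ‖y‖ ^ 2) + 2 * (‖y‖ * ‖y‖) * (1 / ‖y‖ ^ 2) ^ 2) := by
        gcongr; exact (abs_add_le _ _).trans (add_le_add e1 e2)
    _ = 3 * c0⁻¹ * (1 / ‖y‖ ^ 2) := by field_simp; ring
    _ ≤ 14 * c0⁻¹ * (1 / ‖y‖ ^ 2) := by gcongr; norm_num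
    _ = cK / ‖y‖ ^ 2 := by rw [cK]; ring

lemma abs_pd_pd_kE_le {ε : ℝ} (hε : 0 < ε) (j i l : Fin 2) {y : V} (hy : y ≠ 0) :
    |pd j (pd i (kE ε l)) y| ≤ cK / ‖y‖ ^ 3 := by
  have hn := norm_pos_iff.2 hy
  have hc := inv_pos.2 c0_pos
  have h1 := rh_le ε hy
  have h2 := rh_pos hε y
  rw [pd_pd_kE hε, abs_mul, abs_of_pos hc]
  have e0 : ∀ (p : Prop) [Decidable p] (m : Fin 2), |(if p then 1 else 0) * y m| ≤ 1 * ‖y‖ := by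
    intro p _ m
    rw [abs_mul]
    exact mul_le_mul (abs_ite_le p) (abs_coord_le_norm y m) (abs_nonneg _) zero_le_one
  have e3 : |(if l = i then 1 else 0) * y j + (if l = j then 1 else 0) * y i
        + (if i = j then 1 else 0) * y l| ≤ 3 * ‖y‖ := by
    refine (abs_add_le _ _).trans ?_
    have := (abs_add_le ((if l = i then 1 else 0) * y j) ((if l = j then 1 else 0) * y i))
    linarith [e0 (l = i) j, e0 (l = j) i, e0 (i = j) l]
  have e1 : |-2 * ((if l = i then 1 else 0) * y j + (if l = j then 1 else 0) * y i
        + (if i = j then 1 else 0) * y l) * rh ε y ^ 2| ≤ 2 * (3 * ‖y‖) * (1 / ‖y‖ ^ 2) ^ 2 := by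
    rw [abs_mul, abs_mul, abs_of_pos (pow_pos h2 2)]
    gcongr
    norm_num
  have e2 : |8 * (y l * y i * y j) * rh ε y ^ 3| ≤ 8 * (‖y‖ * ‖y‖ * ‖y‖) * (1 / ‖y‖ ^ 2) ^ 3 := by
    rw [abs_mul, abs_mul, abs_mul, abs_mul, abs_of_pos (pow_pos h2 3)]
    gcongr
    · norm_num
    · exact abs_coord_le_norm y l
    · exact abs_coord_le_norm y i
    · exact abs_coord_le_norm y j
  calc _ ≤ c0⁻¹ * (2 * (3 * ‖y‖) * (1 / ‖y‖ ^ 2) ^ 2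
          + 8 * (‖y‖ * ‖y‖ * ‖y‖) * (1 / ‖y‖ ^ 2) ^ 3) := by
        gcongr; exact (abs_add_le _ _).trans (add_le_add e1 e2)
    _ = 14 * c0⁻¹ * (1 / ‖y‖ ^ 3) := by field_simp; ring
    _ = cK / ‖y‖ ^ 3 := by rw [cK]; ring

lemma abs_kN_le (l : Fin 2) (y : V) : |kN l y| ≤ cK / ‖y‖ := by
  rcases eq_or_ne y 0 with rfl | hy
  · simp [kN]
  have hn := norm_pos_iff.2 hy
  have hc := inv_pos.2 c0_pos
  have hv : 0 < vnsq y := vnsq_pos hy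
  rw [kN, abs_div, abs_of_pos (mul_pos c0_pos hv)]
  calc |y l| / (c0 * vnsq y) ≤ ‖y‖ / (c0 * ‖y‖ ^ 2) := by
        have := c0_pos
        gcongr
        · exact abs_coord_le_norm y l
        · exact norm_sq_le_vnsq y
    _ = c0⁻¹ * (1 / ‖y‖) := by field_simp
    _ ≤ 14 * c0⁻¹ * (1 / ‖y‖) := by gcongr; linarith
    _ = cK / ‖y‖ := by rw [cK]; ring

lemma abs_kE_le' {ε : ℝ} (hε : 0 < ε) (l : Fin 2) (y : V) : |kE ε l y| ≤ cK / ‖y‖ := by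
  rcases eq_or_ne y 0 with rfl | hy
  · simp [kE]
  · exact abs_kE_le hε l hy

lemma locallyIntegrable_inv_norm : LocallyIntegrable (fun y : V => cK / ‖y‖) := by
  rw [locallyIntegrable_iff]
  intro K hK
  obtain ⟨r, hr⟩ := hK.isBounded.subset_ball 0
  have h : IntegrableOn (fun y : V => ‖y‖⁻¹) K := (integrableOn_ball_inv_norm r).mono_set hr
  simp only [div_eq_mul_inv]
  exact h.const_mul cK

lemma locallyIntegrable_kN (l : Fin 2) : LocallyIntegrable (kN l) := by
  refine locallyIntegrable_inv_norm.mono ?_ (Eventually.of_forall fun y => ?_)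
  · have := continuous_vnsq.measurable
    exact (Measurable.div (measurable_pi_apply l) (measurable_const.mul this)).aestronglyMeasurable
  · have h1 := abs_kN_le l y
    have : 0 ≤ cK / ‖y‖ := (abs_nonneg _).trans h1
    rwa [Real.norm_eq_abs, Real.norm_of_nonneg this]

lemma locallyIntegrable_kE {ε : ℝ} (hε : 0 < ε) (l : Fin 2) : LocallyIntegrable (kE ε l) :=
  (sm_kE hε l).cont.locallyIntegrable

lemma locallyIntegrable_pd_kE {ε : ℝ} (hε : 0 < ε) (i l : Fin 2) :
    LocallyIntegrable (pd i (kE ε l)) :=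
  ((sm_kE hε l).pd i).cont.locallyIntegrable

lemma tendsto_kE (l : Fin 2) (y : V) :
    Tendsto (fun n => kE (es n) l y) atTop (nhds (kN l y)) := by
  rcases eq_or_ne y 0 with rfl | hy
  · simp [kE, kN]
  have hv : 0 < vnsq y := vnsq_pos hy
  have h1 : Tendsto (fun n => vnsq y + es n ^ 2) atTop (nhds (vnsq y + 0 ^ 2)) :=
    (tendsto_es.pow 2).const_add _
  have h2 := ((h1.inv₀ (by simpa using hv.ne')).const_mul (y l)).const_mul c0⁻¹
  have e : kN l y = c0⁻¹ * (y l * (vnsq y + 0 ^ 2)⁻¹) := by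
    rw [kN]; simp; field_simp
  rw [e]
  exact h2

lemma tendsto_cv_kE (l : Fin 2) {g : V → ℝ} (hg : Continuous g) (hc : HasCompactSupport g) (x : V) :
    Tendsto (fun n => cv (kE (es n) l) g x) atTop (nhds (cv (kN l) g x)) := by
  refine tendsto_integral_of_dominated_convergence (fun y => cK / ‖y‖ * |g (x - y)|)
    (fun n => ?_) ?_ (fun n => Eventually.of_forall fun y => ?_)
    (Eventually.of_forall fun y => (tendsto_kE l y).mul_const _)
  · exact (integrable_cv (locallyIntegrable_kE (es_pos n) l) hg hc x).aestronglyMeasurable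
  · exact integrable_cv locallyIntegrable_inv_norm hg.abs (hc.comp_left (g := abs) abs_zero) x
  · rw [Real.norm_eq_abs, abs_mul]
    exact mul_le_mul_of_nonneg_right (abs_kE_le' (es_pos n) l y) (abs_nonneg _)

/-- The operator `∂_l Δ⁻¹` on test functions. -/
def pot (l : Fin 2) (g : V → ℝ) : V → ℝ := cv (kN l) g

lemma sm_pot (l : Fin 2) {g : V → ℝ} (hg : Sm g) (hc : HasCompactSupport g) : Sm (pot l g) :=
  sm_cv (locallyIntegrable_kN l) hg hc

lemma pd_pot (i l : Fin 2) {g : V → ℝ} (hg : Sm g) (hc : HasCompactSupport g) :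
    pd i (pot l g) = pot l (pd i g) :=
  funext (pd_cv (locallyIntegrable_kN l) hg hc i)

lemma pot_add (l : Fin 2) {g h : V → ℝ} (hg : Sm g) (hc : HasCompactSupport g) (hh : Sm h)
    (hch : HasCompactSupport h) : pot l (fun y => g y + h y) = fun x => pot l g x + pot l h x :=
  funext (cv_add_right (locallyIntegrable_kN l) hg.cont hc hh.cont hch)

lemma tendsto_pot (l : Fin 2) {g : V → ℝ} (hg : Sm g) (hc : HasCompactSupport g) (x : V) :
    Tendsto (fun n => cv (kE (es n) l) g x) atTop (nhds (pot l g x)) :=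
  tendsto_cv_kE l hg.cont hc x

lemma tendsto_pd_pot (i l : Fin 2) {g : V → ℝ} (hg : Sm g) (hc : HasCompactSupport g) (x : V) :
    Tendsto (fun n => cv (pd i (kE (es n) l)) g x) atTop (nhds (pd i (pot l g) x)) := by
  rw [pd_pot i l hg hc]
  refine (tendsto_pot l (hg.pd i) (hc.pd i) x).congr fun n => ?_
  exact cv_pd (sm_kE (es_pos n) l) hg hc i x

lemma tendsto_pd_pd_pot (j i l : Fin 2) {g : V → ℝ} (hg : Sm g) (hc : HasCompactSupport g) (x : V) :
    Tendsto (fun n => cv (pd j (pd i (kE (es n) l))) g x) atTop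
      (nhds (pd j (pd i (pot l g)) x)) := by
  rw [pd_pot i l hg hc]
  refine (tendsto_pd_pot j l (hg.pd i) (hc.pd i) x).congr fun n => ?_
  rw [cv_pd ((sm_kE (es_pos n) l).pd j) hg hc i x]
  congr 1
  exact funext fun y => pd_comm (sm_kE (es_pos n) l) i j y

lemma pd_kE_symm {ε : ℝ} (hε : 0 < ε) (i l : Fin 2) : pd i (kE ε l) = pd l (kE ε i) := by
  ext x
  rw [pd_kE hε, pd_kE hε]
  simp only [eq_comm (a := l) (b := i)]
  ring

lemma pd_pot_symm (i l : Fin 2) {g : V → ℝ} (hg : Sm g) (hc : HasCompactSupport g) (x : V) :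
    pd i (pot l g) x = pd l (pot i g) x := by
  refine tendsto_nhds_unique (tendsto_pd_pot i l hg hc x)
    ((tendsto_pd_pot l i hg hc x).congr fun n => ?_)
  rw [pd_kE_symm (es_pos n)]

lemma div_kE {ε : ℝ} (hε : 0 < ε) (x : V) :
    pd 0 (kE ε 0) x + pd 1 (kE ε 1) x = c0⁻¹ * (2 * ε ^ 2 * rh ε x ^ 2) := by
  rw [pd_kE hε, pd_kE hε]
  have h : rh ε x * (x 0 ^ 2 + x 1 ^ 2 + ε ^ 2) = 1 := by
    rw [← vnsq_eq]
    exact inv_mul_cancel₀ (rh_denom_pos hε x).ne'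
  simp only [if_true]
  linear_combination (-2 * c0⁻¹ * rh ε x) * h

lemma vnsq_smul (a : ℝ) (y : V) : vnsq (a • y) = a ^ 2 * vnsq y := by
  simp [vnsq_eq]; ring

lemma cv_div_kE {ε : ℝ} (hε : 0 < ε) (g : V → ℝ) (x : V) :
    cv (fun y => c0⁻¹ * (2 * ε ^ 2 * rh ε y ^ 2)) g x
      = ∫ y : V, c0⁻¹ * (2 / (1 + vnsq y) ^ 2) * g (x - ε • y) := by
  have h := Measure.integral_comp_smul (μ := (volume : Measure V))
    (fun y => c0⁻¹ * (2 * ε ^ 2 * rh ε y ^ 2) * g (x - y)) ε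
  have h2 : (Module.finrank ℝ V) = 2 := by simp
  rw [h2, abs_of_pos (by positivity), smul_eq_mul, eq_comm, inv_mul_eq_iff_eq_mul₀ (by positivity)]
    at h
  rw [cv, h, ← integral_const_mul]
  congr 1
  ext y
  have hp : 0 < 1 + vnsq y := by have := vnsq_nonneg y; positivity
  rw [rh, vnsq_smul, show ε ^ 2 * vnsq y + ε ^ 2 = ε ^ 2 * (1 + vnsq y) by ring]
  field_simp

lemma div_pot {g : V → ℝ} (hg : Sm g) (hc : HasCompactSupport g) (x : V) :
    pd 0 (pot 0 g) x + pd 1 (pot 1 g) x = g x := by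
  refine tendsto_nhds_unique ((tendsto_pd_pot 0 0 hg hc x).add (tendsto_pd_pot 1 1 hg hc x)) ?_
  have e : ∀ n, cv (pd 0 (kE (es n) 0)) g x + cv (pd 1 (kE (es n) 1)) g x
      = ∫ y : V, c0⁻¹ * (2 / (1 + vnsq y) ^ 2) * g (x - es n • y) := by
    intro n
    rw [← cv_add_left (locallyIntegrable_pd_kE (es_pos n) 0 0)
      (locallyIntegrable_pd_kE (es_pos n) 1 1) hg.cont hc, ← cv_div_kE (es_pos n)]
    simp_rw [div_kE (es_pos n)]
  simp_rw [e]
  obtain ⟨C, hC⟩ := hc.exists_bound_of_continuous hg.cont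
  have e2 : g x = ∫ y : V, c0⁻¹ * (2 / (1 + vnsq y) ^ 2) * g x := by
    rw [integral_mul_const, integral_const_mul]
    change g x = c0⁻¹ * c0 * g x
    rw [inv_mul_cancel₀ c0_pos.ne', one_mul]
  rw [e2]
  have hgc := hg.cont
  refine tendsto_integral_of_dominated_convergence
    (fun y => c0⁻¹ * (2 / (1 + vnsq y) ^ 2) * C) (fun n => ?_)
    ((integrable_c0.const_mul _).mul_const _) (fun n => Eventually.of_forall fun y => ?_)
    (Eventually.of_forall fun y => ?_)
  · refine (integrable_c0.const_mul c0⁻¹).aestronglyMeasurable.mul ?_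
    exact (Continuous.comp hgc (by fun_prop)).aestronglyMeasurable
  · have h1 := vnsq_nonneg y
    have h2 := inv_pos.2 c0_pos
    rw [norm_mul, Real.norm_of_nonneg (by positivity)]
    exact mul_le_mul_of_nonneg_left (hC _) (by positivity)
  · refine Tendsto.const_mul _ ((hgc.tendsto x).comp ?_)
    have : Tendsto (fun n => x - es n • y) atTop (nhds (x - (0 : ℝ) • y)) :=
      (tendsto_es.smul_const y).const_sub x
    simpa using this

lemma abs_cv_le_far {κ g : V → ℝ} {C R : ℝ} (k : ℕ)
    (hκC : ∀ y, y ≠ 0 → |κ y| ≤ C / ‖y‖ ^ k) (hg : Continuous g) (hc : HasCompactSupport g)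
    (hR : 0 < R) (hgR : ∀ x, R < ‖x‖ → g x = 0) {x : V} (hx : 2 * R ≤ ‖x‖) :
    |cv κ g x| ≤ 2 ^ k * C * (∫ z, |g z|) / ‖x‖ ^ k := by
  have hxp : 0 < ‖x‖ := by linarith
  have hC : 0 ≤ C := by
    have h := (abs_nonneg _).trans (hκC x (norm_pos_iff.1 hxp))
    by_contra hneg
    exact absurd h (not_le.2 (div_neg_of_neg_of_pos (not_le.1 hneg) (by positivity)))
  have hgi : Integrable (fun z => |g z|) :=
    (hg.integrable_of_hasCompactSupport hc).abs
  unfold cv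
  rw [← Real.norm_eq_abs]
  have hgi' : Integrable (fun y => 2 ^ k * C / ‖x‖ ^ k * |g (x - y)|) :=
    (hgi.comp_sub_left x).const_mul _
  have h := norm_integral_le_of_norm_le (f := fun y => κ y * g (x - y)) hgi'
    (Eventually.of_forall fun y => ?_)
  · rw [integral_const_mul, integral_sub_left_eq_self (fun z => |g z|) volume x] at h
    refine h.trans_eq ?_
    ring
  · rw [Real.norm_eq_abs, abs_mul]
    by_cases hy : R < ‖x - y‖
    · simp [hgR _ hy]
    · have h1 : ‖x‖ / 2 ≤ ‖y‖ := by
        have := norm_sub_norm_le x (x - y)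
        rw [sub_sub_cancel] at this
        linarith
      have hy0 : 0 < ‖y‖ := by linarith
      refine mul_le_mul_of_nonneg_right ((hκC y (norm_pos_iff.1 hy0)).trans ?_) (abs_nonneg _)
      calc C / ‖y‖ ^ k ≤ C / (‖x‖ / 2) ^ k := by gcongr
        _ = 2 ^ k * C / ‖x‖ ^ k := by rw [div_pow]; field_simp

section far
variable {g : V → ℝ} {R : ℝ} {x : V}

lemma abs_pot_le_far (l : Fin 2) (hg : Sm g) (hc : HasCompactSupport g) (hR : 0 < R)
    (hgR : ∀ x, R < ‖x‖ → g x = 0) (hx : 2 * R ≤ ‖x‖) :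
    |pot l g x| ≤ 2 * cK * (∫ z, |g z|) / ‖x‖ := by
  have := abs_cv_le_far 1 (fun y _ => by simpa using abs_kN_le l y)
    hg.cont hc hR hgR hx
  simpa [pot] using this

lemma abs_pd_pot_le_far (i l : Fin 2) (hg : Sm g) (hc : HasCompactSupport g) (hR : 0 < R)
    (hgR : ∀ x, R < ‖x‖ → g x = 0) (hx : 2 * R ≤ ‖x‖) :
    |pd i (pot l g) x| ≤ 2 ^ 2 * cK * (∫ z, |g z|) / ‖x‖ ^ 2 :=
  le_of_tendsto (tendsto_pd_pot i l hg hc x).abs (Eventually.of_forall fun n =>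
    abs_cv_le_far 2
      (fun _ hy => abs_pd_kE_le (es_pos n) i l hy) hg.cont hc hR hgR hx)

lemma abs_pd_pd_pot_le_far (j i l : Fin 2) (hg : Sm g) (hc : HasCompactSupport g) (hR : 0 < R)
    (hgR : ∀ x, R < ‖x‖ → g x = 0) (hx : 2 * R ≤ ‖x‖) :
    |pd j (pd i (pot l g)) x| ≤ 2 ^ 3 * cK * (∫ z, |g z|) / ‖x‖ ^ 3 :=
  le_of_tendsto (tendsto_pd_pd_pot j i l hg hc x).abs (Eventually.of_forall fun n =>
    abs_cv_le_far 3
      (fun _ hy => abs_pd_pd_kE_le (es_pos n) j i l hy) hg.cont hc hR hgR hx)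

end far

lemma exists_radius {g : V → ℝ} (hc : HasCompactSupport g) :
    ∃ R : ℝ, 1 ≤ R ∧ ∀ x, R < ‖x‖ → g x = 0 := by
  obtain ⟨R, hR⟩ := hc.isCompact.isBounded.subset_closedBall 0
  refine ⟨max R 1, le_max_right _ _, fun x hx => image_eq_zero_of_notMem_tsupport fun h => ?_⟩
  have := mem_closedBall_zero_iff.1 (hR h)
  exact absurd hx (not_lt.2 (this.trans (le_max_left _ _)))

/-- `|f(x)| ≤ C |x|^{-k}` outside a ball. -/
def Dec (k : ℕ) (f : V → ℝ) : Prop :=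
  ∃ C R : ℝ, 1 ≤ R ∧ 0 ≤ C ∧ ∀ x, R ≤ ‖x‖ → |f x| ≤ C / ‖x‖ ^ k

lemma Dec.mul {k l : ℕ} {f g : V → ℝ} (hf : Dec k f) (hg : Dec l g) :
    Dec (k + l) (fun x => f x * g x) := by
  obtain ⟨C, R, hR, hC, h⟩ := hf
  obtain ⟨D, S, hS, hD, h'⟩ := hg
  refine ⟨C * D, max R S, hR.trans (le_max_left _ _), by positivity, fun x hx => ?_⟩
  rw [abs_mul, pow_add, mul_div_mul_comm]
  exact mul_le_mul (h x ((le_max_left _ _).trans hx)) (h' x ((le_max_right _ _).trans hx))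
    (abs_nonneg _) (by positivity)

lemma Dec.add {k : ℕ} {f g : V → ℝ} (hf : Dec k f) (hg : Dec k g) :
    Dec k (fun x => f x + g x) := by
  obtain ⟨C, R, hR, hC, h⟩ := hf
  obtain ⟨D, S, hS, hD, h'⟩ := hg
  refine ⟨C + D, max R S, hR.trans (le_max_left _ _), by positivity, fun x hx => ?_⟩
  rw [add_div]
  exact (abs_add_le _ _).trans (add_le_add (h x ((le_max_left _ _).trans hx))
    (h' x ((le_max_right _ _).trans hx)))

lemma Dec.sub {k : ℕ} {f g : V → ℝ} (hf : Dec k f) (hg : Dec k g) :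
    Dec k (fun x => f x - g x) := by
  obtain ⟨D, S, hS, hD, h'⟩ := hg
  simpa only [sub_eq_add_neg] using hf.add (g := fun x => -g x)
    ⟨D, S, hS, hD, by simpa only [abs_neg] using h'⟩

lemma Dec.mono {k l : ℕ} {f : V → ℝ} (hf : Dec l f) (hkl : k ≤ l) : Dec k f := by
  obtain ⟨C, R, hR, hC, h⟩ := hf
  refine ⟨C, R, hR, hC, fun x hx => (h x hx).trans ?_⟩
  have : 1 ≤ ‖x‖ := hR.trans hx
  gcongr

lemma Dec.integrable {f : V → ℝ} (hf : Continuous f) (hd : Dec 3 f) : Integrable f := by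
  obtain ⟨C, R, hR, hC, h⟩ := hd
  obtain ⟨M, hM⟩ := (isCompact_closedBall (0 : V) R).exists_bound_of_continuousOn hf.continuousOn
  have hb := (integrable_one_add_norm (E := V) (μ := volume) (r := 3) (by simp; norm_num)).const_mul
    (8 * C + |M| * (1 + R) ^ 3)
  refine hb.mono' hf.aestronglyMeasurable (Eventually.of_forall fun x => ?_)
  have hn := norm_nonneg x
  have e : ((1 : ℝ) + ‖x‖) ^ (-(3 : ℝ)) = 1 / (1 + ‖x‖) ^ 3 := by
    rw [show (-(3 : ℝ)) = -((3 : ℕ) : ℝ) by norm_num, Real.rpow_neg (by positivity),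
      Real.rpow_natCast, one_div]
  rw [e, mul_one_div]
  rcases le_total R ‖x‖ with hx | hx
  · have hx1 : 1 ≤ ‖x‖ := hR.trans hx
    rw [Real.norm_eq_abs]
    calc |f x| ≤ C / ‖x‖ ^ 3 := h x hx
      _ ≤ C / ((1 + ‖x‖) / 2) ^ 3 := by gcongr; linarith
      _ = 8 * C / (1 + ‖x‖) ^ 3 := by field_simp; norm_num
      _ ≤ _ := by gcongr; exact le_add_of_nonneg_right (by positivity)
  · have h1 := hM x (mem_closedBall_zero_iff.2 hx)
    calc ‖f x‖ ≤ |M| := h1.trans (le_abs_self _)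
      _ = |M| * (1 + ‖x‖) ^ 3 / (1 + ‖x‖) ^ 3 := by field_simp
      _ ≤ (8 * C + |M| * (1 + R) ^ 3) / (1 + ‖x‖) ^ 3 := by
        gcongr
        have : |M| * (1 + ‖x‖) ^ 3 ≤ |M| * (1 + R) ^ 3 := by gcongr
        linarith

section potdec
variable {g : V → ℝ}

lemma dec_of_far {f : V → ℝ} {C R : ℝ} (k : ℕ) (hR : 1 ≤ R)
    (h : ∀ x, 2 * R ≤ ‖x‖ → |f x| ≤ C / ‖x‖ ^ k) : Dec k f :=
  ⟨|C|, 2 * R, by linarith, abs_nonneg _, fun x hx =>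
    (h x hx).trans (by gcongr; exact le_abs_self C)⟩

lemma dec_pot (l : Fin 2) (hg : Sm g) (hc : HasCompactSupport g) : Dec 1 (pot l g) := by
  obtain ⟨R, hR, h⟩ := exists_radius hc
  exact dec_of_far 1 hR fun x hx => by
    simpa using abs_pot_le_far l hg hc (by linarith) h hx

lemma dec_pd_pot (i l : Fin 2) (hg : Sm g) (hc : HasCompactSupport g) :
    Dec 2 (pd i (pot l g)) := by
  obtain ⟨R, hR, h⟩ := exists_radius hc
  exact dec_of_far 2 hR fun x hx => abs_pd_pot_le_far i l hg hc (by linarith) h hx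

lemma dec_pd_pd_pot (j i l : Fin 2) (hg : Sm g) (hc : HasCompactSupport g) :
    Dec 3 (pd j (pd i (pot l g))) := by
  obtain ⟨R, hR, h⟩ := exists_radius hc
  exact dec_of_far 3 hR fun x hx => abs_pd_pd_pot_le_far j i l hg hc (by linarith) h hx

lemma integrable_pd_pot_sq (i l : Fin 2) (hg : Sm g) (hc : HasCompactSupport g) :
    Integrable (fun x => pd i (pot l g) x ^ 2) := by
  have h := ((dec_pd_pot i l hg hc).mul (dec_pd_pot i l hg hc)).mono (k := 3) (by norm_num)
  have := ((sm_pot l hg hc).pd i).cont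
  simp_rw [sq]
  exact h.integrable (this.mul this)

lemma integrable_pd_pot_four (i l : Fin 2) (hg : Sm g) (hc : HasCompactSupport g) :
    Integrable (fun x => pd i (pot l g) x ^ 4) := by
  have h2 := (dec_pd_pot i l hg hc).mul (dec_pd_pot i l hg hc)
  have h := (h2.mul h2).mono (k := 3) (by norm_num)
  have h3 := ((sm_pot l hg hc).pd i).cont
  refine (h.integrable ((h3.mul h3).mul (h3.mul h3))).congr (Eventually.of_forall fun x => ?_)
  simp only [Pi.mul_apply]
  ring

lemma integral_det_pot (hg : Sm g) (hc : HasCompactSupport g) :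
    ∫ x, (pd 0 (pot 0 g) x * pd 1 (pot 1 g) x - pd 1 (pot 0 g) x * pd 0 (pot 1 g) x) = 0 := by
  have s0 := sm_pot 0 hg hc
  have s1 := sm_pot 1 hg hc
  have hIt : ∀ i j : Fin 2, Integrable (pd i (fun y => pot 0 g y * pd j (pot 1 g) y)) := by
    intro i j
    refine Dec.integrable ((s0.mul (s1.pd j)).pd i).cont ?_
    have e : pd i (fun y => pot 0 g y * pd j (pot 1 g) y)
        = fun x => pd i (pot 0 g) x * pd j (pot 1 g) x + pot 0 g x * pd i (pd j (pot 1 g)) x :=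
        funext fun x => pd_mul s0 (s1.pd j) i x
    rw [e]
    exact (((dec_pd_pot i 0 hg hc).mul (dec_pd_pot j 1 hg hc)).add
        ((dec_pot 0 hg hc).mul (dec_pd_pd_pot i j 1 hg hc))).mono (by norm_num)
  have hz : ∀ i j : Fin 2, ∫ x, pd i (fun y => pot 0 g y * pd j (pot 1 g) y) x = 0 :=
    fun i j => integral_pd_eq_zero (s0.mul (s1.pd j)) i
      (((dec_pot 0 hg hc).mul (dec_pd_pot j 1 hg hc)).integrable (s0.mul (s1.pd j)).cont) (hIt i j)
  have h := integral_sub (hIt 0 1) (hIt 1 0)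
  rw [hz, hz, sub_zero] at h
  rw [← h]
  congr 1
  ext x
  rw [pd_mul s0 (s1.pd 1), pd_mul s0 (s1.pd 0), pd_comm s1 1 0]
  ring

/-- `L²` boundedness of the Riesz-type operators. -/
lemma integral_pd_pot_sq_le (i l : Fin 2) (hg : Sm g) (hc : HasCompactSupport g) :
    ∫ x, pd i (pot l g) x ^ 2 ≤ ∫ x, g x ^ 2 := by
  have h2 : ∀ i l, Integrable (fun x => pd i (pot l g) x ^ 2) :=
    fun i l => integrable_pd_pot_sq i l hg hc
  have hm : ∀ i l, AEStronglyMeasurable (pd i (pot l g)) volume :=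
    fun i l => ((sm_pot l hg hc).pd i).cont.aestronglyMeasurable
  have hdet := integral_det_pot hg hc
  have hdi : Integrable (fun x => pd 0 (pot 0 g) x * pd 1 (pot 1 g) x
      - pd 1 (pot 0 g) x * pd 0 (pot 1 g) x) :=
    (integrable_mul_of_sq (hm _ _) (hm _ _) (h2 _ _) (h2 _ _)).sub
      (integrable_mul_of_sq (hm _ _) (hm _ _) (h2 _ _) (h2 _ _))
  have hgi : Integrable (fun x => g x ^ 2) := by
    have := (hg.mul hg).integrable hc.mul_right
    simpa only [sq] using this
  have e : ∫ x, g x ^ 2 = ∫ x, (g x ^ 2 - 2 * (pd 0 (pot 0 g) x * pd 1 (pot 1 g) x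
      - pd 1 (pot 0 g) x * pd 0 (pot 1 g) x)) := by
    rw [integral_sub hgi (hdi.const_mul 2), integral_const_mul, hdet]
    simp
  rw [e]
  refine integral_mono (h2 i l) (hgi.sub (hdi.const_mul 2)) fun x => ?_
  have e1 := div_pot hg hc x
  have e2 := pd_pot_symm 0 1 hg hc x
  simp only
  rw [← e1, e2]
  fin_cases i <;> fin_cases l <;> simp only [Fin.zero_eta, Fin.mk_one, e2] <;>
    nlinarith [sq_nonneg (pd 0 (pot 0 g) x), sq_nonneg (pd 1 (pot 1 g) x),
      sq_nonneg (pd 1 (pot 0 g) x)]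

end potdec

lemma integral_four_le_of_lintegral {f g : V → ℝ} {C : ENNReal} (hC : C ≠ ⊤)
    (hf : Integrable (fun x => f x ^ 4)) (hg : Integrable (fun x => g x ^ 4))
    (h : ∫⁻ x, ofReal (f x ^ 4) ≤ C * ∫⁻ x, ofReal (g x ^ 4)) :
    ∫ x, f x ^ 4 ≤ C.toReal * ∫ x, g x ^ 4 := by
  rw [← ofReal_integral_eq_lintegral_ofReal hf (Eventually.of_forall fun x => by positivity),
    ← ofReal_integral_eq_lintegral_ofReal hg (Eventually.of_forall fun x => by positivity),
    ← ENNReal.ofReal_toReal hC, ← ENNReal.ofReal_mul ENNReal.toReal_nonneg] at h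
  exact (ENNReal.ofReal_le_ofReal_iff (mul_nonneg ENNReal.toReal_nonneg
    (integral_nonneg fun x => by positivity))).1 h

lemma integrable_four {g : V → ℝ} (hg : Sm g) (hc : HasCompactSupport g) :
    Integrable (fun x => g x ^ 4) := by
  have h := ((hg.mul hg).mul (hg.mul hg)).integrable (hc.mul_right.mul_right)
  refine h.congr (Eventually.of_forall fun x => ?_)
  simp only
  ring

/-- A bound for the operators with kernels of angular type `sin 2θ` and `cos 2θ` on `L⁴`. -/
def cS : ℝ := (ofReal ((-1 / (4 * π)) ^ 4) * avgC).toReal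
  + (ofReal ((1 / (2 * π)) ^ 4) * avgC).toReal

lemma cS_nonneg : 0 ≤ cS := add_nonneg ENNReal.toReal_nonneg ENNReal.toReal_nonneg

lemma avgC_ne_top : avgC ≠ ⊤ := by unfold avgC; finiteness

lemma offKer_eq {ε : ℝ} (hε : 0 < ε) (y : V) : offKer ε y = c0 * pd 1 (kE ε 0) y := by
  have hc := c0_pos.ne'
  have := (rh_denom_pos hε y).ne'
  rw [pd_kE hε, offKer, rh]
  simp
  field_simp

lemma diagKer_eq {ε : ℝ} (hε : 0 < ε) (y : V) :
    diagKer ε y = c0 * (pd 0 (kE ε 0) y - pd 1 (kE ε 1) y) := by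
  have hc := c0_pos.ne'
  have := (rh_denom_pos hε y).ne'
  rw [pd_kE hε, pd_kE hε, diagKer, rh]
  simp
  field_simp
  ring

section four
variable {g : V → ℝ}

lemma integral_off_four_le (hg : Sm g) (hc : HasCompactSupport g) :
    ∫ x, (c0 * pd 1 (pot 0 g) x) ^ 4 ≤ cS * ∫ x, g x ^ 4 := by
  have h := lintegral_offKer (hg.of_le (by simp)) hc (L := fun x => c0 * pd 1 (pot 0 g) x) ?_
  · have h2 := integral_four_le_of_lintegral (by have := avgC_ne_top; finiteness) ?_
      (integrable_four hg hc) h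
    · refine h2.trans (mul_le_mul_of_nonneg_right ?_ (integral_nonneg fun x => by positivity))
      exact le_add_of_nonneg_right ENNReal.toReal_nonneg
    · simp_rw [mul_pow]
      exact (integrable_pd_pot_four 1 0 hg hc).const_mul _
  · intro x
    refine ((tendsto_pd_pot 1 0 hg hc x).const_mul c0).congr fun n => ?_
    rw [cv_swap, ← integral_const_mul]
    congr 1
    ext z
    rw [offKer_eq (es_pos n)]
    ring

lemma integral_diag_four_le (hg : Sm g) (hc : HasCompactSupport g) :
    ∫ x, (c0 * (pd 0 (pot 0 g) x - pd 1 (pot 1 g) x)) ^ 4 ≤ cS * ∫ x, g x ^ 4 := by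
  have h := lintegral_diagKer (hg.of_le (by simp)) hc
    (L := fun x => c0 * (pd 0 (pot 0 g) x - pd 1 (pot 1 g) x)) ?_
  · have h2 := integral_four_le_of_lintegral (by have := avgC_ne_top; finiteness) ?_
      (integrable_four hg hc) h
    · refine h2.trans (mul_le_mul_of_nonneg_right ?_ (integral_nonneg fun x => by positivity))
      exact le_add_of_nonneg_left ENNReal.toReal_nonneg
    · simp_rw [mul_pow]
      have hd := (dec_pd_pot 0 0 hg hc).sub (dec_pd_pot 1 1 hg hc)
      have hcn := (((sm_pot 0 hg hc).pd 0).sub ((sm_pot 1 hg hc).pd 1)).cont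
      have := (((hd.mul hd).mul (hd.mul hd)).mono (k := 3) (by norm_num)).integrable
        ((hcn.mul hcn).mul (hcn.mul hcn))
      refine (this.congr (Eventually.of_forall fun x => ?_)).const_mul _
      simp only [Pi.mul_apply]
      ring
  · intro x
    refine (((tendsto_pd_pot 0 0 hg hc x).sub (tendsto_pd_pot 1 1 hg hc x)).const_mul c0).congr
      fun n => ?_
    rw [← cv_sub_left (locallyIntegrable_pd_kE (es_pos n) 0 0)
      (locallyIntegrable_pd_kE (es_pos n) 1 1) hg.cont hc, cv_swap, ← integral_const_mul]
    congr 1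
    ext z
    rw [diagKer_eq (es_pos n)]
    ring

/-- A bound for the operators `∂ᵢ∂ⱼΔ⁻¹` on `L⁴`. -/
def cR : ℝ := cS / c0 ^ 4 + 1

lemma cR_pos : 0 < cR := by
  have := cS_nonneg
  have := c0_pos
  unfold cR
  positivity

/-- `L⁴` boundedness of the Riesz-type operators. -/
lemma integral_pd_pot_four_le (i l : Fin 2) (hg : Sm g) (hc : HasCompactSupport g) :
    ∫ x, pd i (pot l g) x ^ 4 ≤ cR * ∫ x, g x ^ 4 := by
  have hI : 0 ≤ ∫ x, g x ^ 4 := integral_nonneg fun x => by positivity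
  have hc0 := c0_pos
  have off : ∫ x, pd 1 (pot 0 g) x ^ 4 ≤ cR * ∫ x, g x ^ 4 := by
    have h := integral_off_four_le hg hc
    simp_rw [mul_pow] at h
    rw [integral_const_mul, mul_comm, ← le_div_iff₀ (by positivity)] at h
    refine h.trans ?_
    rw [cR, add_mul, one_mul, div_mul_eq_mul_div]
    exact le_add_of_nonneg_right hI
  have hgd : ∫ x, (pd 0 (pot 0 g) x - pd 1 (pot 1 g) x) ^ 4 ≤ cS / c0 ^ 4 * ∫ x, g x ^ 4 := by
    have h := integral_diag_four_le hg hc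
    simp_rw [mul_pow] at h
    rwa [integral_const_mul, mul_comm, ← le_div_iff₀ (by positivity), mul_div_right_comm] at h
  have hdi : Integrable (fun x => (pd 0 (pot 0 g) x - pd 1 (pot 1 g) x) ^ 4) := by
    have hd := (dec_pd_pot 0 0 hg hc).sub (dec_pd_pot 1 1 hg hc)
    have hcn := (((sm_pot 0 hg hc).pd 0).sub ((sm_pot 1 hg hc).pd 1)).cont
    have := (((hd.mul hd).mul (hd.mul hd)).mono (k := 3) (by norm_num)).integrable
      ((hcn.mul hcn).mul (hcn.mul hcn))
    refine this.congr (Eventually.of_forall fun x => ?_)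
    simp only [Pi.mul_apply]
    ring
  have key : ∀ a b : ℝ, a ^ 4 ≤ (a - b) ^ 4 + (a + b) ^ 4 := by
    intro a b
    have e1 : a ^ 2 ≤ ((a - b) ^ 2 + (a + b) ^ 2) / 2 := by nlinarith [sq_nonneg b]
    nlinarith [sq_nonneg ((a - b) ^ 2 - (a + b) ^ 2), sq_nonneg a, sq_nonneg (a - b),
      sq_nonneg (a + b), mul_nonneg (sq_nonneg (a - b)) (sq_nonneg (a + b))]
  have diag : ∀ f : V → ℝ, Integrable (fun x => f x ^ 4) →
      (∀ x, f x ^ 4 ≤ (pd 0 (pot 0 g) x - pd 1 (pot 1 g) x) ^ 4 + g x ^ 4) →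
      ∫ x, f x ^ 4 ≤ cR * ∫ x, g x ^ 4 := by
    intro f hf hle
    refine (integral_mono hf (hdi.add (integrable_four hg hc)) hle).trans ?_
    rw [integral_add' hdi (integrable_four hg hc), cR, add_mul, one_mul]
    gcongr
  have sym : pd 0 (pot 1 g) = pd 1 (pot 0 g) := funext fun x => pd_pot_symm 0 1 hg hc x
  fin_cases i <;> fin_cases l
  · refine diag _ (integrable_pd_pot_four 0 0 hg hc) fun x => ?_
    rw [← div_pot hg hc x]
    exact key _ _
  · simp only [Fin.zero_eta, Fin.mk_one, sym]
    exact off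
  · exact off
  · refine diag _ (integrable_pd_pot_four 1 1 hg hc) fun x => ?_
    rw [← div_pot hg hc x]
    refine (key (pd 1 (pot 1 g) x) (pd 0 (pot 0 g) x)).trans_eq ?_
    ring

end four

section adj
variable {a b : V → ℝ}

lemma kE_neg (ε : ℝ) (l : Fin 2) (y : V) : kE ε l (-y) = -kE ε l y := by
  simp [kE, rh, vnsq_eq]

lemma integral_mul_cv_kE {ε : ℝ} (hε : 0 < ε) (l : Fin 2) (ha : Continuous a)
    (hca : HasCompactSupport a) (hb : Continuous b) (hcb : HasCompactSupport b) :
    ∫ x, a x * cv (kE ε l) b x = -∫ x, cv (kE ε l) a x * b x := by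
  have hk := (sm_kE hε l).cont
  simp_rw [cv_swap, ← integral_const_mul]
  rw [integral_integral_swap_of_hasCompactSupport
    (f := fun x z => a x * (b z * kE ε l (x - z))), ← integral_neg]
  · congr 1
    ext z
    rw [← integral_mul_const, ← integral_neg]
    congr 1
    ext x
    rw [← neg_sub z x, kE_neg]
    ring
  · exact (ha.comp continuous_fst).mul ((hb.comp continuous_snd).mul
      (hk.comp (continuous_fst.sub continuous_snd)))
  · refine HasCompactSupport.intro (hca.isCompact.prod hcb.isCompact) fun p hp => ?_
    rw [mem_prod, not_and_or] at hp
    rcases hp with hp | hp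
    · simp [Function.uncurry, image_eq_zero_of_notMem_tsupport hp]
    · simp [Function.uncurry, image_eq_zero_of_notMem_tsupport hp]

lemma tendsto_integral_mul_cv (l : Fin 2) (ha : Continuous a)
    (hca : HasCompactSupport a) (hb : Continuous b) (hcb : HasCompactSupport b) :
    Tendsto (fun n => ∫ x, a x * cv (kE (es n) l) b x) atTop (nhds (∫ x, a x * pot l b x)) := by
  have hcab : HasCompactSupport (fun y => |b y|) := hcb.comp_left (g := abs) abs_zero
  refine tendsto_integral_of_dominated_convergence
    (fun x => |a x| * cv (fun y => cK / ‖y‖) (fun y => |b y|) x) (fun n => ?_) ?_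
    (fun n => Eventually.of_forall fun x => ?_)
    (Eventually.of_forall fun x => (tendsto_cv_kE l hb hcb x).const_mul _)
  · exact (ha.mul (continuous_cv (locallyIntegrable_kE (es_pos n) l) hb hcb)).aestronglyMeasurable
  · have hcaa : HasCompactSupport (fun y => |a y|) := hca.comp_left (g := abs) abs_zero
    exact (ha.abs.mul (continuous_cv locallyIntegrable_inv_norm hb.abs
      hcab)).integrable_of_hasCompactSupport hcaa.mul_right
  · rw [norm_mul, Real.norm_eq_abs, Real.norm_eq_abs]
    refine mul_le_mul_of_nonneg_left ?_ (abs_nonneg _)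
    rw [cv, ← Real.norm_eq_abs]
    refine norm_integral_le_of_norm_le (integrable_cv locallyIntegrable_inv_norm hb.abs hcab x)
      (Eventually.of_forall fun y => ?_)
    rw [norm_mul]
    exact mul_le_mul_of_nonneg_right (abs_kE_le' (es_pos n) l y) (abs_nonneg _)

lemma integral_mul_pot (l : Fin 2) (ha : Continuous a)
    (hca : HasCompactSupport a) (hb : Continuous b) (hcb : HasCompactSupport b) :
    ∫ x, a x * pot l b x = -∫ x, pot l a x * b x := by
  refine tendsto_nhds_unique (tendsto_integral_mul_cv l ha hca hb hcb) ?_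
  simp_rw [mul_comm (pot l a _)]
  refine (tendsto_integral_mul_cv l hb hcb ha hca).neg.congr fun n => ?_
  rw [integral_mul_cv_kE (es_pos n) l ha hca hb hcb]
  simp_rw [mul_comm]

/-- Self-adjointness of `∂ᵢ∂ⱼΔ⁻¹`. -/
lemma integral_mul_pd_pot (i l : Fin 2) (ha : Sm a) (hca : HasCompactSupport a) (hb : Sm b)
    (hcb : HasCompactSupport b) :
    ∫ x, a x * pd i (pot l b) x = ∫ x, b x * pd i (pot l a) x := by
  rw [integral_mul_pd_of_left ha (sm_pot l hb hcb) hca, pd_pot i l ha hca,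
    integral_mul_pot l (ha.pd i).cont (hca.pd i) hb.cont hcb, neg_neg]
  simp_rw [mul_comm]

/-- Fourth-power Hölder duality bound for `∂ᵢ∂ⱼΔ⁻¹`. -/
lemma integral_mul_pd_pot_four_le (i l : Fin 2) (ha : Sm a) (hca : HasCompactSupport a)
    (hb : Sm b) (hcb : HasCompactSupport b) {p q : V → ℝ} (hp : AEStronglyMeasurable p volume)
    (hq : AEStronglyMeasurable q volume) (hp4 : Integrable (fun x => p x ^ 4))
    (hq2 : Integrable (fun x => q x ^ 2)) (hbpq : ∀ x, |b x| ≤ |p x * q x|) :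
    |∫ x, a x * pd i (pot l b) x|
      ≤ √(√(cR * ∫ x, a x ^ 4) * √(∫ x, p x ^ 4)) * √(∫ x, q x ^ 2) := by
  have hR := sm_pot l ha hca
  have hRm := (hR.pd i).cont.aestronglyMeasurable (μ := volume)
  have e4 : ∀ t : ℝ, (t ^ 2) ^ 2 = t ^ 4 := fun t => by ring
  have hpR : Integrable (fun x => p x ^ 2 * pd i (pot l a) x ^ 2) :=
    integrable_mul_of_sq (hp.pow 2) (hRm.pow 2) (by simpa only [e4, Pi.pow_apply] using hp4)
      (by simpa only [e4, Pi.pow_apply] using integrable_pd_pot_four i l ha hca)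
  have hpR2 : Integrable (fun x => |p x * pd i (pot l a) x| ^ 2) := by
    simpa only [sq_abs, mul_pow] using hpR
  have hpRm : AEStronglyMeasurable (fun x => |p x * pd i (pot l a) x|) volume :=
    (hp.mul hRm).norm
  have hq2' : Integrable (fun x => |q x| ^ 2) := by simpa only [sq_abs] using hq2
  have hqm : AEStronglyMeasurable (fun x => |q x|) volume := hq.norm
  rw [integral_mul_pd_pot i l ha hca hb hcb]
  calc |∫ x, b x * pd i (pot l a) x|
      ≤ ∫ x, |p x * pd i (pot l a) x| * |q x| := by
        rw [← Real.norm_eq_abs]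
        refine norm_integral_le_of_norm_le (integrable_mul_of_sq hpRm hqm hpR2 hq2')
          (Eventually.of_forall fun x => ?_)
        rw [Real.norm_eq_abs, abs_mul, abs_mul]
        calc |b x| * |pd i (pot l a) x| ≤ |p x * q x| * |pd i (pot l a) x| :=
              mul_le_mul_of_nonneg_right (hbpq x) (abs_nonneg _)
          _ = _ := by rw [abs_mul]; ring
    _ ≤ √(∫ x, |p x * pd i (pot l a) x| ^ 2) * √(∫ x, |q x| ^ 2) :=
        (le_abs_self _).trans (abs_integral_mul_le hpRm hqm hpR2 hq2')
    _ = √(∫ x, p x ^ 2 * pd i (pot l a) x ^ 2) * √(∫ x, q x ^ 2) := by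
        simp only [sq_abs, mul_pow]
    _ ≤ _ := by
        refine mul_le_mul_of_nonneg_right (Real.sqrt_le_sqrt ?_) (Real.sqrt_nonneg _)
        have h := abs_integral_mul_le (hp.pow 2) (hRm.pow 2)
          (by simpa only [e4, Pi.pow_apply] using hp4)
          (by simpa only [e4, Pi.pow_apply] using integrable_pd_pot_four i l ha hca)
        simp only [Pi.pow_apply, e4] at h
        refine (le_abs_self _).trans (h.trans ?_)
        rw [mul_comm]
        gcongr
        exact integral_pd_pot_four_le i l ha hca

end adj

/-- Rotated gradient `∇^⊥ = (-∂₁, ∂₀)`. -/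
def pg (i : Fin 2) (f : V → ℝ) (x : V) : ℝ := ![-1, 1] i * pd (i + 1) f x

/-- The divergence of a test field. -/
def dv (θ : Fin 2 → V → ℝ) (x : V) : ℝ := pd 0 (θ 0) x + pd 1 (θ 1) x

/-- Gradient part of the Helmholtz decomposition. -/
def qf (θ : Fin 2 → V → ℝ) (x : V) : ℝ := pot 0 (θ 0) x + pot 1 (θ 1) x

/-- Stream function of the Helmholtz decomposition. -/
def ps (θ : Fin 2 → V → ℝ) (x : V) : ℝ := pot 0 (θ 1) x - pot 1 (θ 0) x

/-- Smooth compactly supported vector fields. -/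
structure Tst (θ : Fin 2 → V → ℝ) : Prop where
  sm : ∀ i, Sm (θ i)
  cpt : ∀ i, HasCompactSupport (θ i)

section helm
variable {θ : Fin 2 → V → ℝ}

lemma Tst.sm_dv (h : Tst θ) : Sm (dv θ) := ((h.sm 0).pd 0).add ((h.sm 1).pd 1)

lemma Tst.cpt_dv (h : Tst θ) : HasCompactSupport (dv θ) :=
  ((h.cpt 0).pd 0).add ((h.cpt 1).pd 1)

lemma Tst.sm_qf (h : Tst θ) : Sm (qf θ) :=
  (sm_pot 0 (h.sm 0) (h.cpt 0)).add (sm_pot 1 (h.sm 1) (h.cpt 1))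

lemma Tst.sm_ps (h : Tst θ) : Sm (ps θ) :=
  (sm_pot 0 (h.sm 1) (h.cpt 1)).sub (sm_pot 1 (h.sm 0) (h.cpt 0))

lemma Sm.pg {f : V → ℝ} (hf : Sm f) (i : Fin 2) : Sm (pg i f) := (hf.pd (i + 1)).const_mul _

lemma Tst.pd_qf_eq (h : Tst θ) (i : Fin 2) (x : V) :
    pd i (qf θ) x = pd i (pot 0 (θ 0)) x + pd i (pot 1 (θ 1)) x :=
  pd_add (sm_pot 0 (h.sm 0) (h.cpt 0)) (sm_pot 1 (h.sm 1) (h.cpt 1)) i x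

lemma Tst.pd_ps_eq (h : Tst θ) (i : Fin 2) (x : V) :
    pd i (ps θ) x = pd i (pot 0 (θ 1)) x - pd i (pot 1 (θ 0)) x :=
  pd_sub (sm_pot 0 (h.sm 1) (h.cpt 1)) (sm_pot 1 (h.sm 0) (h.cpt 0)) i x

lemma Tst.pd_qf (h : Tst θ) (i : Fin 2) : pd i (qf θ) = pot i (dv θ) := by
  ext x
  have e : pot i (dv θ) x = pot i (pd 0 (θ 0)) x + pot i (pd 1 (θ 1)) x :=
    congrFun (pot_add i ((h.sm 0).pd 0) ((h.cpt 0).pd 0) ((h.sm 1).pd 1) ((h.cpt 1).pd 1)) x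
  rw [e, ← pd_pot 0 i (h.sm 0) (h.cpt 0), ← pd_pot 1 i (h.sm 1) (h.cpt 1), h.pd_qf_eq,
    pd_pot_symm i 0 (h.sm 0) (h.cpt 0), pd_pot_symm i 1 (h.sm 1) (h.cpt 1)]

lemma Tst.helmholtz (h : Tst θ) (i : Fin 2) (x : V) :
    θ i x = pd i (qf θ) x + pg i (ps θ) x := by
  rw [pg, h.pd_qf_eq, h.pd_ps_eq]
  have d0 := div_pot (h.sm 0) (h.cpt 0) x
  have d1 := div_pot (h.sm 1) (h.cpt 1) x
  have s0 := pd_pot_symm 0 1 (h.sm 0) (h.cpt 0) x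
  have s1 := pd_pot_symm 0 1 (h.sm 1) (h.cpt 1) x
  fin_cases i
  · simp
    linarith
  · simp
    linarith

end helm

/-- Localised gradient field. -/
def wf (θ : Fin 2 → V → ℝ) (r : ℝ) (i : Fin 2) (x : V) : ℝ :=
  cut r x * pd i (qf θ) x - ps θ x * pg i (cut r) x

/-- Localisation error field. -/
def ef (θ : Fin 2 → V → ℝ) (r : ℝ) (i : Fin 2) (x : V) : ℝ :=
  pd i (cut r) x * qf θ x + pg i (cut r) x * ps θ x

section loc
variable {θ : Fin 2 → V → ℝ} {r : ℝ}

lemma Tst.sm_wf (h : Tst θ) (r : ℝ) (i : Fin 2) : Sm (wf θ r i) :=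
  ((sm_cut r).mul (h.sm_qf.pd i)).sub (h.sm_ps.mul ((sm_cut r).pg i))

lemma Tst.sm_ef (h : Tst θ) (r : ℝ) (i : Fin 2) : Sm (ef θ r i) :=
  (((sm_cut r).pd i).mul h.sm_qf).add (((sm_cut r).pg i).mul h.sm_ps)

lemma HasCompactSupport.pg {f : V → ℝ} (hf : HasCompactSupport f) (i : Fin 2) :
    HasCompactSupport (pg i f) := HasCompactSupport.mul_left (f := fun _ => _) (hf.pd (i + 1))

lemma cpt_wf (hr : 0 < r) (i : Fin 2) : HasCompactSupport (wf θ r i) :=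
  (hasCompactSupport_cut hr).mul_right.sub ((hasCompactSupport_cut hr).pg i).mul_left

lemma cpt_ef (hr : 0 < r) (i : Fin 2) : HasCompactSupport (ef θ r i) :=
  ((hasCompactSupport_cut hr).pd i).mul_right.add ((hasCompactSupport_cut hr).pg i).mul_right

lemma Tst.wf_eq (h : Tst θ) (r : ℝ) (i : Fin 2) (x : V) :
    wf θ r i x = pd i (fun y => cut r y * qf θ y) x - ef θ r i x := by
  rw [pd_mul (sm_cut r) h.sm_qf, wf, ef]
  ring

lemma Tst.decomp (h : Tst θ) (hr : 0 < r) (hθ : ∀ i x, r < ‖x‖ → θ i x = 0) (i : Fin 2) (x : V) :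
    θ i x = wf θ r i x + pg i (fun y => cut r y * ps θ y) x := by
  have e : θ i x = cut r x * θ i x := by
    by_cases hx : ‖x‖ ≤ r
    · rw [cut_eq_one hr hx, one_mul]
    · rw [hθ i x (not_le.1 hx), mul_zero]
  rw [e, h.helmholtz, wf, pg, pg, pg, pd_mul (sm_cut r) h.sm_ps]
  ring

lemma integral_pd_mul_pg {p f : V → ℝ} (hp : Sm p) (hf : Sm f) (hc : HasCompactSupport f) :
    ∑ i, ∫ x, pd i p x * pg i f x = 0 := by
  have e0 : ∫ x, pd 0 p x * pg 0 f x = ∫ x, pd 1 (pd 0 p) x * f x := by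
    have := integral_mul_pd_of_right (hp.pd 0) hf hc 1
    simp only [pg, Matrix.cons_val_zero, zero_add, neg_mul, one_mul, mul_neg, integral_neg]
    linarith
  have e1 : ∫ x, pd 1 p x * pg 1 f x = -∫ x, pd 0 (pd 1 p) x * f x := by
    have := integral_mul_pd_of_right (hp.pd 1) hf hc 0
    simpa [pg] using this
  rw [Fin.sum_univ_two, e0, e1]
  simp_rw [pd_comm hp 0 1]
  ring

/-- Testing a gradient against a field only sees the localised gradient part. -/
lemma Tst.integral_grad (h : Tst θ) (hr : 0 < r) (hθ : ∀ i x, r < ‖x‖ → θ i x = 0) {p : V → ℝ}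
    (hp : Sm p) : ∑ i, ∫ x, pd i p x * θ i x = ∑ i, ∫ x, pd i p x * wf θ r i x := by
  have hs := (sm_cut r).mul h.sm_ps
  have hcs : HasCompactSupport (fun y => cut r y * ps θ y) :=
    (hasCompactSupport_cut hr).mul_right
  have e : ∀ i, ∫ x, pd i p x * θ i x = (∫ x, pd i p x * wf θ r i x)
      + ∫ x, pd i p x * pg i (fun y => cut r y * ps θ y) x := by
    intro i
    rw [← integral_add]
    · simp_rw [← mul_add, ← h.decomp hr hθ]
    · exact ((hp.pd i).mul (h.sm_wf r i)).integrable (cpt_wf hr i).mul_left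
    · exact ((hp.pd i).mul (hs.pg i)).integrable (hcs.pg i).mul_left
  simp_rw [e, Finset.sum_add_distrib, integral_pd_mul_pg hp hs hcs, add_zero]

end loc

/-- Supported in the shell `r ≤ |x| ≤ 2r` and bounded by `C`. -/
def Sh (r C : ℝ) (f : V → ℝ) : Prop :=
  ∀ x, |f x| ≤ C ∧ (x ∉ {x : V | r ≤ ‖x‖ ∧ ‖x‖ ≤ 2 * r} → f x = 0)

lemma Sh.add {r C D : ℝ} {f g : V → ℝ} (hf : Sh r C f) (hg : Sh r D g) :
    Sh r (C + D) (fun x => f x + g x) := fun x =>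
  ⟨(abs_add_le _ _).trans (add_le_add (hf x).1 (hg x).1), fun hx => by
    simp only [(hf x).2 hx, (hg x).2 hx, add_zero]⟩

lemma Sh.neg {r C : ℝ} {f : V → ℝ} (hf : Sh r C f) : Sh r C (fun x => -f x) := fun x =>
  ⟨by rw [abs_neg]; exact (hf x).1, fun hx => by simp only [(hf x).2 hx, neg_zero]⟩

lemma Sh.sub {r C D : ℝ} {f g : V → ℝ} (hf : Sh r C f) (hg : Sh r D g) :
    Sh r (C + D) (fun x => f x - g x) := by
  simpa only [sub_eq_add_neg] using hf.add hg.neg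

lemma Sh.mul {r C D : ℝ} {f g : V → ℝ} (hf : Sh r C f)
    (hg : ∀ x, r ≤ ‖x‖ → |g x| ≤ D) : Sh r (C * D) (fun x => f x * g x) := by
  intro x
  have h0 : 0 ≤ C := (abs_nonneg _).trans (hf x).1
  by_cases hx : x ∈ {x : V | r ≤ ‖x‖ ∧ ‖x‖ ≤ 2 * r}
  · refine ⟨?_, fun h => absurd hx h⟩
    rw [abs_mul]
    exact mul_le_mul (hf x).1 (hg x hx.1) (abs_nonneg _) h0
  · have hD : 0 ≤ D ∨ ∀ x : V, ¬ r ≤ ‖x‖ := by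
      by_cases hex : ∃ x : V, r ≤ ‖x‖
      · obtain ⟨z, hz⟩ := hex
        exact Or.inl ((abs_nonneg _).trans (hg z hz))
      · exact Or.inr (not_exists.1 hex)
    have hfx := (hf x).2 hx
    refine ⟨?_, fun _ => by simp only [hfx, zero_mul]⟩
    simp only [hfx, zero_mul, abs_zero]
    rcases hD with hD | hD
    · positivity
    · have : r ≤ ‖(fun _ => |r| : V)‖ := by
        rw [pi_norm_const]
        simpa using le_abs_self r
      exact absurd this (hD _)

lemma Sh.mono {r C D : ℝ} {f : V → ℝ} (hf : Sh r C f) (h : C ≤ D) : Sh r D f := fun x =>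
  ⟨(hf x).1.trans h, (hf x).2⟩

lemma Sh.congr {r C : ℝ} {f g : V → ℝ} (hf : Sh r C f) (h : ∀ x, g x = f x) : Sh r C g := by
  rwa [show g = f from funext h]

section shcut
variable {r : ℝ}

lemma sh_pd_cut (hr : 0 < r) (i : Fin 2) : Sh r (cX / r) (pd i (cut r)) := fun x =>
  ⟨abs_pd_cut_le hr i x, pd_cut_eq_zero hr i⟩

lemma sh_pd_pd_cut (hr : 0 < r) (i j : Fin 2) : Sh r (cX / r ^ 2) (pd i (pd j (cut r))) := fun x =>
  ⟨abs_pd_pd_cut_le hr i j x, pd_pd_cut_eq_zero hr i j⟩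

lemma sh_pd_pd_pd_cut (hr : 0 < r) (i j k : Fin 2) :
    Sh r (cX / r ^ 3) (pd i (pd j (pd k (cut r)))) := fun x =>
  ⟨abs_pd_pd_pd_cut_le hr i j k x, pd_pd_pd_cut_eq_zero hr i j k⟩

lemma sh_sign {C : ℝ} {f : V → ℝ} (i : Fin 2) (hf : Sh r C f) :
    Sh r C (fun x => ![-1, 1] i * f x) := by
  fin_cases i
  · simpa using hf.neg
  · simpa using hf

lemma sh_pg_cut (hr : 0 < r) (i : Fin 2) : Sh r (cX / r) (pg i (cut r)) :=
  sh_sign i (sh_pd_cut hr _)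

lemma pd_pg {f : V → ℝ} (hf : Sm f) (j i : Fin 2) :
    pd j (pg i f) = fun x => ![-1, 1] i * pd j (pd (i + 1) f) x :=
  funext fun x => pd_const_mul (hf.pd _) _ j x

lemma sh_pd_pg_cut (hr : 0 < r) (j i : Fin 2) : Sh r (cX / r ^ 2) (pd j (pg i (cut r))) := by
  rw [pd_pg (sm_cut r)]
  exact sh_sign i (sh_pd_pd_cut hr _ _)

lemma sh_pd_pd_pg_cut (hr : 0 < r) (k j i : Fin 2) :
    Sh r (cX / r ^ 3) (pd k (pd j (pg i (cut r)))) := by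
  rw [pd_pg (sm_cut r)]
  refine (sh_sign i (sh_pd_pd_pd_cut hr k j (i + 1))).congr fun x => ?_
  exact pd_const_mul (((sm_cut r).pd _).pd _) _ k x

end shcut

/-- Uniform decay of the potentials of a test field. -/
lemma Tst.exists_far {θ : Fin 2 → V → ℝ} (h : Tst θ) : ∃ C R : ℝ, 1 ≤ R ∧ 0 ≤ C ∧
    (∀ i x, R ≤ ‖x‖ → θ i x = 0) ∧
    ∀ f ∈ ({qf θ, ps θ} : Set (V → ℝ)), Sm f ∧ ∀ r, R ≤ r → ∀ x, r ≤ ‖x‖ → |f x| ≤ C / r ∧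
      (∀ i, |pd i f x| ≤ C / r ^ 2) ∧ ∀ j i, |pd j (pd i f) x| ≤ C / r ^ 3 := by
  obtain ⟨R0, hR0, h0⟩ := exists_radius (h.cpt 0)
  obtain ⟨R1, hR1, h1⟩ := exists_radius (h.cpt 1)
  set R := max R0 R1
  have hR : 1 ≤ R := hR0.trans (le_max_left _ _)
  have hz : ∀ i x, R < ‖x‖ → θ i x = 0 := by
    intro i x hx
    fin_cases i
    · exact h0 x ((le_max_left _ _).trans_lt hx)
    · exact h1 x ((le_max_right _ _).trans_lt hx)
  have hcK := cK_pos
  set I : Fin 2 → ℝ := fun i => ∫ z, |θ i z|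
  have hI : ∀ i, 0 ≤ I i := fun i => integral_nonneg fun _ => abs_nonneg _
  set C := 8 * cK * (I 0 + I 1)
  have hC : 0 ≤ C := by have := hI 0; have := hI 1; positivity
  have bd : ∀ (k : ℕ) (A B a : ℝ) (m : Fin 2), a ≤ 8 → ∀ r x, 2 * R ≤ r → r ≤ ‖(x : V)‖ →
      A ≤ a * cK * I m / ‖x‖ ^ k → A ≤ 8 * cK * I m / r ^ k := by
    intro k A _ a m ha r x hr hx hA
    have hr0 : 0 < r := by linarith
    refine hA.trans ?_
    have := hI m
    gcongr
  have key : ∀ l m : Fin 2, ∀ r, 2 * R ≤ r → ∀ x, r ≤ ‖x‖ →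
      |pot l (θ m) x| ≤ 8 * cK * I m / r ^ 1 ∧ (∀ i, |pd i (pot l (θ m)) x| ≤ 8 * cK * I m / r ^ 2) ∧
      ∀ j i, |pd j (pd i (pot l (θ m))) x| ≤ 8 * cK * I m / r ^ 3 := by
    intro l m r hr x hx
    have hx2 := hr.trans hx
    refine ⟨bd 1 _ 0 2 m (by norm_num) r x hr hx ?_, fun i => bd 2 _ 0 (2 ^ 2) m (by norm_num)
      r x hr hx ?_, fun j i => bd 3 _ 0 (2 ^ 3) m (by norm_num) r x hr hx ?_⟩
    · simpa using abs_pot_le_far l (h.sm m) (h.cpt m) (by linarith) (hz m) hx2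
    · exact abs_pd_pot_le_far i l (h.sm m) (h.cpt m) (by linarith) (hz m) hx2
    · exact abs_pd_pd_pot_le_far j i l (h.sm m) (h.cpt m) (by linarith) (hz m) hx2
  have comb : ∀ (k : ℕ) (a b r : ℝ), |a| ≤ 8 * cK * I 0 / r ^ k → |b| ≤ 8 * cK * I 1 / r ^ k →
      |a| + |b| ≤ C / r ^ k := by
    intro k a b r ha hb
    refine (add_le_add ha hb).trans_eq ?_
    simp only [C]
    ring
  refine ⟨C, 2 * R, by linarith, hC, fun i x hx => hz i x (by linarith), ?_⟩
  rintro f (rfl | rfl)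
  · refine ⟨h.sm_qf, fun r hr x hx => ⟨?_, fun i => ?_, fun j i => ?_⟩⟩
    · simpa [qf] using (abs_add_le _ _).trans (comb 1 _ _ r (key 0 0 r hr x hx).1 (key 1 1 r hr x hx).1)
    · rw [h.pd_qf_eq]
      exact (abs_add_le _ _).trans
        (comb 2 _ _ r ((key 0 0 r hr x hx).2.1 i) ((key 1 1 r hr x hx).2.1 i))
    · have e : pd i (qf θ) = fun x => pd i (pot 0 (θ 0)) x + pd i (pot 1 (θ 1)) x :=
        funext fun x => h.pd_qf_eq i x
      rw [e, pd_add ((sm_pot 0 (h.sm 0) (h.cpt 0)).pd i) ((sm_pot 1 (h.sm 1) (h.cpt 1)).pd i)]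
      exact (abs_add_le _ _).trans
        (comb 3 _ _ r ((key 0 0 r hr x hx).2.2 j i) ((key 1 1 r hr x hx).2.2 j i))
  · refine ⟨h.sm_ps, fun r hr x hx => ⟨?_, fun i => ?_, fun j i => ?_⟩⟩
    · refine (abs_sub _ _).trans ?_
      rw [add_comm]
      simpa using comb 1 _ _ r (key 1 0 r hr x hx).1 (key 0 1 r hr x hx).1
    · rw [h.pd_ps_eq]
      refine (abs_sub _ _).trans ?_
      rw [add_comm]
      exact comb 2 _ _ r ((key 1 0 r hr x hx).2.1 i) ((key 0 1 r hr x hx).2.1 i)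
    · have e : pd i (ps θ) = fun x => pd i (pot 0 (θ 1)) x - pd i (pot 1 (θ 0)) x :=
        funext fun x => h.pd_ps_eq i x
      rw [e, pd_sub ((sm_pot 0 (h.sm 1) (h.cpt 1)).pd i) ((sm_pot 1 (h.sm 0) (h.cpt 0)).pd i)]
      refine (abs_sub _ _).trans ?_
      rw [add_comm]
      exact comb 3 _ _ r ((key 1 0 r hr x hx).2.2 j i) ((key 0 1 r hr x hx).2.2 j i)

/-- The convective term `(u·∇)u`. -/
def nn (u : Fin 2 → V → ℝ) (i : Fin 2) (x : V) : ℝ := ∑ j, u j x * pd j (u i) x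

/-- The quadratic stress `E Eᵀ`. -/
def ff (E : Fin 2 → Fin 2 → V → ℝ) (i j : Fin 2) (x : V) : ℝ := ∑ k, E i k x * E j k x

lemma Sm.nn {u : Fin 2 → V → ℝ} (hu : ∀ i, Sm (u i)) (i : Fin 2) : Sm (nn u i) :=
  Sm.sum fun j => (hu j).mul ((hu i).pd j)

lemma Sm.ff {E : Fin 2 → Fin 2 → V → ℝ} (hE : ∀ i j, Sm (E i j)) (i j : Fin 2) : Sm (ff E i j) :=
  Sm.sum fun k => (hE i k).mul (hE j k)

lemma Sm.lap {f : V → ℝ} (hf : Sm f) : Sm (lap f) := Sm.sum fun i => (hf.pd i).pd i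

/-- The nonlinear terms tested against `w`. -/
def lam (u : Fin 2 → V → ℝ) (E : Fin 2 → Fin 2 → V → ℝ) (w : Fin 2 → V → ℝ) : ℝ :=
  -(∑ i, ∫ x, nn u i x * w i x) - ∑ i, ∑ j, ∫ x, ff E i j x * pd j (w i) x

section
variable {θ : Fin 2 → V → ℝ} {r : ℝ}

lemma Tst.integral_divFree (h : Tst θ) (hr : 0 < r) {g : Fin 2 → V → ℝ} (hg : ∀ i, Sm (g i))
    (hd : ∀ x, ∑ i, pd i (g i) x = 0) :
    ∑ i, ∫ x, g i x * wf θ r i x = -∑ i, ∫ x, g i x * ef θ r i x := by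
  have hs := (sm_cut r).mul h.sm_qf
  have hcs : HasCompactSupport (fun y => cut r y * qf θ y) :=
    (hasCompactSupport_cut hr).mul_right
  have e : ∀ i, ∫ x, g i x * wf θ r i x = (-∫ x, pd i (g i) x * (cut r x * qf θ x))
      - ∫ x, g i x * ef θ r i x := by
    intro i
    rw [← integral_mul_pd_of_right (hg i) hs hcs, ← integral_sub]
    · simp_rw [← mul_sub, ← h.wf_eq r i]
    · exact ((hg i).mul (hs.pd i)).integrable (hcs.pd i).mul_left
    · exact ((hg i).mul (h.sm_ef r i)).integrable (cpt_ef hr i).mul_left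
  simp_rw [e, Finset.sum_sub_distrib, Finset.sum_neg_distrib]
  rw [← integral_finsetSum]
  · simp_rw [← Finset.sum_mul, hd]
    simp
  · exact fun i _ => (((hg i).pd i).mul hs).integrable hcs.mul_left

lemma integral_lap_mul {f g : V → ℝ} (hf : Sm f) (hg : Sm g) (hc : HasCompactSupport g) :
    ∫ x, lap f x * g x = ∫ x, f x * lap g x := by
  simp_rw [lap, Finset.sum_mul, Finset.mul_sum]
  rw [integral_finsetSum, integral_finsetSum]
  · refine Finset.sum_congr rfl fun i _ => ?_
    have h1 := integral_mul_pd_of_right (hf.pd i) hg hc i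
    have h2 := integral_mul_pd_of_right hf (hg.pd i) (hc.pd i) i
    linarith
  · exact fun i _ => (hf.mul ((hg.pd i).pd i)).integrable ((hc.pd i).pd i).mul_left
  · exact fun i _ => (((hf.pd i).pd i).mul hg).integrable hc.mul_left

lemma pd_lap {f : V → ℝ} (hf : Sm f) (i : Fin 2) (x : V) : pd i (lap f) x = lap (pd i f) x := by
  have e : lap f = fun y => ∑ k, pd k (pd k f) y := rfl
  rw [e, pd_sum _ fun k => (hf.pd k).pd k, lap]
  refine Finset.sum_congr rfl fun k _ => ?_
  rw [pd_comm (hf.pd k)]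
  congr 1
  exact funext fun y => pd_comm hf i k y

lemma lap_sum_eq_zero {g : Fin 2 → V → ℝ} (hg : ∀ i, Sm (g i))
    (hd : ∀ x, ∑ i, pd i (g i) x = 0) (x : V) : ∑ i, pd i (lap (g i)) x = 0 := by
  have e : ∀ k, (fun y => ∑ i, pd k (pd i (g i)) y) = fun _ => 0 := by
    intro k
    ext y
    rw [← pd_sum _ fun i => (hg i).pd i]
    simp_rw [hd, pd_const]
  simp_rw [pd_lap (hg _), lap]
  rw [Finset.sum_comm]
  refine Finset.sum_eq_zero fun k _ => ?_
  rw [← pd_sum _ fun i => ((hg i).pd i).pd k, e, pd_const]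

/-- Fixed-time pressure identity: only nonlinear terms and localisation errors survive. -/
lemma Tst.integral_pressure (h : Tst θ) (hr : 0 < r) (hθ : ∀ i x, r < ‖x‖ → θ i x = 0)
    {g u : Fin 2 → V → ℝ} {E : Fin 2 → Fin 2 → V → ℝ} {p : V → ℝ}
    (hg : ∀ i, Sm (g i)) (hu : ∀ i, Sm (u i)) (hE : ∀ i j, Sm (E i j)) (hp : Sm p)
    (hdg : ∀ x, ∑ i, pd i (g i) x = 0) (hdu : ∀ x, ∑ i, pd i (u i) x = 0)
    (hdE : ∀ j x, ∑ i, pd i (E i j) x = 0)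
    (heq : ∀ i x, g i x + nn u i x - lap (u i) x + pd i p x
      = (∑ j, pd j (E i j) x) + ∑ j, pd j (ff E i j) x) :
    ∑ i, ∫ x, pd i p x * θ i x = (∑ i, ∫ x, g i x * ef θ r i x) + lam u E (wf θ r)
      - (∑ i, ∫ x, u i x * lap (ef θ r i) x)
      + ∑ i, ∑ j, ∫ x, E i j x * pd j (ef θ r i) x := by
  have sw := h.sm_wf r
  have cw : ∀ i, HasCompactSupport (wf θ r i) := fun i => cpt_wf hr i
  have se := h.sm_ef r
  have ce : ∀ i, HasCompactSupport (ef θ r i) := fun i => cpt_ef hr i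
  have I : ∀ {a : V → ℝ} (i : Fin 2), Sm a → Integrable (fun x => a x * wf θ r i x) :=
    fun i ha => (ha.mul (sw i)).integrable (cw i).mul_left
  have sM : ∀ i, Sm (fun x => ∑ j, pd j (E i j) x) := fun i => Sm.sum fun j => (hE i j).pd j
  have e : ∀ i, ∫ x, pd i p x * wf θ r i x = -(∫ x, g i x * wf θ r i x)
      - (∫ x, nn u i x * wf θ r i x) + (∫ x, lap (u i) x * wf θ r i x)
      + (∫ x, (∑ j, pd j (E i j) x) * wf θ r i x)
      + ∑ j, ∫ x, pd j (ff E i j) x * wf θ r i x := by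
    intro i
    have i1 : Integrable (fun x => -(g i x * wf θ r i x)) := (I i (hg i)).neg
    have i2 : Integrable (fun x => -(g i x * wf θ r i x) - nn u i x * wf θ r i x) :=
      i1.sub (I i (Sm.nn hu i))
    have i3 : Integrable (fun x => -(g i x * wf θ r i x) - nn u i x * wf θ r i x
      + lap (u i) x * wf θ r i x) := i2.add (I i (hu i).lap)
    have i4 : Integrable (fun x => -(g i x * wf θ r i x) - nn u i x * wf θ r i x
      + lap (u i) x * wf θ r i x + (∑ j, pd j (E i j) x) * wf θ r i x) := i3.add (I i (sM i))
    rw [← integral_finsetSum _ fun j _ => I i ((Sm.ff hE i j).pd j), ← integral_neg,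
      ← integral_sub i1 (I i (Sm.nn hu i)), ← integral_add i2 (I i (hu i).lap),
      ← integral_add i3 (I i (sM i)),
      ← integral_add i4 (integrable_finsetSum _ fun j _ => I i ((Sm.ff hE i j).pd j))]
    refine integral_congr_ae (ae_of_all _ fun x => ?_)
    have := heq i x
    simp only [← Finset.sum_mul]
    linear_combination wf θ r i x * this
  have hdM : ∀ x, ∑ i, pd i (fun x => ∑ j, pd j (E i j) x) x = 0 := by
    intro x
    have e1 : ∀ i, pd i (fun x => ∑ j, pd j (E i j) x) x = ∑ j, pd j (pd i (E i j)) x := by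
      intro i
      rw [pd_sum _ fun j => (hE i j).pd j]
      exact Finset.sum_congr rfl fun j _ => pd_comm (hE i j) i j x
    simp_rw [e1]
    rw [Finset.sum_comm]
    refine Finset.sum_eq_zero fun j _ => ?_
    rw [← pd_sum _ fun i => (hE i j).pd i]
    simp_rw [hdE, pd_const]
  have d1 := h.integral_divFree hr hg hdg
  have d2 := h.integral_divFree hr (fun i => (hu i).lap) (lap_sum_eq_zero hu hdu)
  have d3 := h.integral_divFree hr sM hdM
  have d4 : ∀ i, ∫ x, lap (u i) x * ef θ r i x = ∫ x, u i x * lap (ef θ r i) x :=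
    fun i => integral_lap_mul (hu i) (se i) (ce i)
  have d5 : ∀ i, ∫ x, (∑ j, pd j (E i j) x) * ef θ r i x
      = -∑ j, ∫ x, E i j x * pd j (ef θ r i) x := by
    intro i
    simp_rw [Finset.sum_mul]
    rw [integral_finsetSum _ fun j _ => (((hE i j).pd j).mul (se i)).integrable (ce i).mul_left,
      ← Finset.sum_neg_distrib]
    refine Finset.sum_congr rfl fun j _ => ?_
    rw [integral_mul_pd_of_right (hE i j) (se i) (ce i), neg_neg]
  have d6 : ∀ i j, ∫ x, pd j (ff E i j) x * wf θ r i x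
      = -∫ x, ff E i j x * pd j (wf θ r i) x := by
    intro i j
    rw [integral_mul_pd_of_right (Sm.ff hE i j) (sw i) (cw i), neg_neg]
  rw [h.integral_grad hr hθ hp]
  simp_rw [e, d6, Finset.sum_add_distrib, Finset.sum_sub_distrib, Finset.sum_neg_distrib]
  rw [d1, d2, d3]
  simp_rw [d4, d5, lam, Finset.sum_neg_distrib]
  ring

end

/-- Shell functions of the size of a first derivative of the cutoff. -/
structure CutLike (r : ℝ) (a : V → ℝ) : Prop where
  sm : Sm a
  b0 : Sh r (cX / r) a
  b1 : ∀ j, Sh r (cX / r ^ 2) (pd j a)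
  b2 : ∀ k j, Sh r (cX / r ^ 3) (pd k (pd j a))

/-- Smooth functions decaying like `1 / |x|` with two derivatives. -/
structure Far (r C : ℝ) (f : V → ℝ) : Prop where
  sm : Sm f
  b0 : ∀ x, r ≤ ‖x‖ → |f x| ≤ C / r
  b1 : ∀ j x, r ≤ ‖x‖ → |pd j f x| ≤ C / r ^ 2
  b2 : ∀ k j x, r ≤ ‖x‖ → |pd k (pd j f) x| ≤ C / r ^ 3

section
variable {r C : ℝ} {a f : V → ℝ}

lemma cutLike_pd (hr : 0 < r) (i : Fin 2) : CutLike r (pd i (cut r)) :=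
  ⟨(sm_cut r).pd i, sh_pd_cut hr i, fun j => sh_pd_pd_cut hr j i,
    fun k j => sh_pd_pd_pd_cut hr k j i⟩

lemma cutLike_pg (hr : 0 < r) (i : Fin 2) : CutLike r (pg i (cut r)) :=
  ⟨(sm_cut r).pg i, sh_pg_cut hr i, fun j => sh_pd_pg_cut hr j i,
    fun k j => sh_pd_pd_pg_cut hr k j i⟩

lemma CutLike.mul_b0 (ha : CutLike r a) (hf : Far r C f) :
    Sh r (cX * C / r ^ 2) (fun x => a x * f x) :=
  (ha.b0.mul hf.b0).mono (by rw [div_mul_div_comm, pow_two])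

lemma CutLike.mul_b1 (ha : CutLike r a) (hf : Far r C f) (j : Fin 2) :
    Sh r (2 * (cX * C) / r ^ 3) (pd j (fun x => a x * f x)) := by
  refine ((((ha.b1 j).mul hf.b0).add (ha.b0.mul (hf.b1 j))).mono (le_of_eq ?_)).congr
    fun x => pd_mul ha.sm hf.sm j x
  rw [div_mul_div_comm, div_mul_div_comm, ← pow_succ, ← pow_succ', ← add_div]
  ring

lemma CutLike.mul_b2 (ha : CutLike r a) (hf : Far r C f) (k j : Fin 2) :
    Sh r (4 * (cX * C) / r ^ 4) (pd k (pd j (fun x => a x * f x))) := by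
  have e : pd j (fun x => a x * f x) = fun x => pd j a x * f x + a x * pd j f x :=
    funext fun x => pd_mul ha.sm hf.sm j x
  rw [e]
  refine (((((ha.b2 k j).mul hf.b0).add ((ha.b1 j).mul (hf.b1 k))).add
    (((ha.b1 k).mul (hf.b1 j)).add (ha.b0.mul (hf.b2 k j)))).mono (le_of_eq ?_)).congr fun x => ?_
  · rw [div_mul_div_comm, div_mul_div_comm, div_mul_div_comm, ← pow_succ, ← pow_succ', ← pow_add]
    ring
  · rw [pd_add ((ha.sm.pd j).mul hf.sm) (ha.sm.mul (hf.sm.pd j)), pd_mul (ha.sm.pd j) hf.sm,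
      pd_mul ha.sm (hf.sm.pd j)]

end

/-- Shell bounds for the localisation errors of a test field. -/
lemma Tst.exists_shell {θ : Fin 2 → V → ℝ} (h : Tst θ) : ∃ C R : ℝ, 1 ≤ R ∧ 0 ≤ C ∧
    ∀ r, R ≤ r → (∀ i x, r < ‖x‖ → θ i x = 0) ∧
      (∀ i, Sh r (C / r ^ 2) (ef θ r i)) ∧ (∀ i j, Sh r (C / r ^ 3) (pd j (ef θ r i))) ∧
      (∀ i, Sh r (C / r ^ 4) (lap (ef θ r i))) ∧
      (∀ i, Sh r (C / r ^ 2) (fun x => ps θ x * pg i (cut r) x)) ∧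
      ∀ i j, Sh r (C / r ^ 3)
        (fun x => pd j (wf θ r i) x - cut r x * pd j (pd i (qf θ)) x) := by
  obtain ⟨C, R, hR, hC, hz, hf⟩ := h.exists_far
  have hcX := cX_pos
  refine ⟨16 * (cX * C), R, hR, by positivity, fun r hr => ?_⟩
  have hr0 : 0 < r := by linarith
  have fq : Far r C (qf θ) := by
    obtain ⟨h1, h2⟩ := hf (qf θ) (by simp)
    exact ⟨h1, fun x hx => (h2 r hr x hx).1, fun j x hx => (h2 r hr x hx).2.1 j,
      fun k j x hx => (h2 r hr x hx).2.2 k j⟩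
  have fp : Far r C (ps θ) := by
    obtain ⟨h1, h2⟩ := hf (ps θ) (by simp)
    exact ⟨h1, fun x hx => (h2 r hr x hx).1, fun j x hx => (h2 r hr x hx).2.1 j,
      fun k j x hx => (h2 r hr x hx).2.2 k j⟩
  have a1 := fun i => (cutLike_pd hr0 i).sm.mul fq.sm
  have a2 := fun i => (cutLike_pg hr0 i).sm.mul fp.sm
  have E : ∀ i, ef θ r i = fun x => (fun x => pd i (cut r) x * qf θ x) x
    + (fun x => pg i (cut r) x * ps θ x) x := fun i => rfl
  have E1 : ∀ i j, pd j (ef θ r i) = fun x => pd j (fun x => pd i (cut r) x * qf θ x) x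
      + pd j (fun x => pg i (cut r) x * ps θ x) x := by
    intro i j
    ext x
    rw [E, pd_add (a1 i) (a2 i)]
  have mon : ∀ (n : ℕ) (a : ℝ), a ≤ 16 → a * (cX * C) / r ^ n ≤ 16 * (cX * C) / r ^ n := by
    intro n a ha
    gcongr
  have mon1 : ∀ (n : ℕ), 1 * (cX * C) / r ^ n ≤ 16 * (cX * C) / r ^ n :=
    fun n => mon n 1 (by norm_num)
  simp only [one_mul] at mon1
  refine ⟨fun i x hx => hz i x (hr.trans hx.le), fun i => ?_, fun i j => ?_, fun i => ?_,
    fun i => ?_, fun i j => ?_⟩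
  · rw [E]
    refine (((cutLike_pd hr0 i).mul_b0 fq).add ((cutLike_pg hr0 i).mul_b0 fp)).mono ?_
    rw [← two_mul, ← mul_div_assoc]
    exact mon 2 2 (by norm_num)
  · rw [E1]
    refine (((cutLike_pd hr0 i).mul_b1 fq j).add ((cutLike_pg hr0 i).mul_b1 fp j)).mono ?_
    refine le_trans (le_of_eq ?_) (mon 3 4 (by norm_num))
    ring
  · have e : ∀ x, lap (ef θ r i) x = (pd 0 (pd 0 (fun x => pd i (cut r) x * qf θ x)) x
        + pd 0 (pd 0 (fun x => pg i (cut r) x * ps θ x)) x)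
        + (pd 1 (pd 1 (fun x => pd i (cut r) x * qf θ x)) x
        + pd 1 (pd 1 (fun x => pg i (cut r) x * ps θ x)) x) := by
      intro x
      rw [lap, Fin.sum_univ_two, E1, E1, pd_add ((a1 i).pd 0) ((a2 i).pd 0),
        pd_add ((a1 i).pd 1) ((a2 i).pd 1)]
    refine (((((cutLike_pd hr0 i).mul_b2 fq 0 0).add ((cutLike_pg hr0 i).mul_b2 fp 0 0)).add
      (((cutLike_pd hr0 i).mul_b2 fq 1 1).add ((cutLike_pg hr0 i).mul_b2 fp 1 1))).mono ?_).congr e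
    refine le_of_eq ?_
    ring
  · refine (((cutLike_pg hr0 i).mul_b0 fp).mono (mon1 2)).congr fun x => ?_
    ring
  · have e : ∀ x, pd j (wf θ r i) x - cut r x * pd j (pd i (qf θ)) x
        = pd j (cut r) x * pd i (qf θ) x - pd j (fun x => pg i (cut r) x * ps θ x) x := by
      intro x
      have e1 : wf θ r i = fun x => (fun x => cut r x * pd i (qf θ) x) x
          - (fun x => pg i (cut r) x * ps θ x) x := by
        ext x
        simp only [wf]
        ring
      rw [e1, pd_sub ((sm_cut r).mul (fq.sm.pd i)) (a2 i), pd_mul (sm_cut r) (fq.sm.pd i)]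
      ring
    refine ((((sh_pd_cut hr0 j).mul (fq.b1 i)).sub ((cutLike_pg hr0 i).mul_b1 fp j)).mono ?_).congr e
    refine le_trans (le_of_eq ?_) (mon 3 3 (by norm_num))
    rw [div_mul_div_comm, ← pow_succ']
    ring

lemma volume_real_ball {ρ : ℝ} (hρ : 0 ≤ ρ) :
    (volume : Measure V).real (Metric.closedBall 0 ρ) = (2 * ρ) ^ 2 := by
  rw [measureReal_def, Real.volume_pi_closedBall _ hρ, ENNReal.toReal_ofReal (by positivity)]
  simp

lemma integral_abs_le_of_ball {f : V → ℝ} {C ρ : ℝ} (hρ : 0 ≤ ρ) (hC : ∀ x, |f x| ≤ C)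
    (h0 : ∀ x, ρ < ‖x‖ → f x = 0) : ∫ x, |f x| ≤ C * (2 * ρ) ^ 2 := by
  have e : ∫ x, |f x| = ∫ x in Metric.closedBall 0 ρ, |f x| := by
    refine (setIntegral_eq_integral_of_forall_compl_eq_zero fun x hx => ?_).symm
    rw [h0 x (by simpa using hx), abs_zero]
  have hfin : volume (Metric.closedBall (0 : V) ρ) < ⊤ := measure_closedBall_lt_top
  have := norm_setIntegral_le_of_norm_le_const (f := fun x => |f x|) (C := C) hfin
    fun x _ => by simpa using hC x
  rw [e, ← volume_real_ball hρ]
  exact (le_abs_self _).trans this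

section
variable {r C : ℝ} {f : V → ℝ}

lemma Sh.zero_of_lt (hf : Sh r C f) (x : V) (hx : 2 * r < ‖x‖) : f x = 0 :=
  (hf x).2 fun h => absurd h.2 (not_le.2 hx)

lemma Sh.nonneg (hf : Sh r C f) : 0 ≤ C := (abs_nonneg _).trans (hf 0).1

lemma Sh.integral_abs_mul_le (hr : 0 ≤ r) (hf : Sh r C f) {g : V → ℝ} {D : ℝ}
    (hg : ∀ x, |g x| ≤ D) : |∫ x, g x * f x| ≤ D * C * (16 * r ^ 2) := by
  have h := integral_abs_le_of_ball (f := fun x => g x * f x) (C := D * C) (ρ := 2 * r)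
    (by positivity)
    (fun x => by
      rw [abs_mul]
      exact mul_le_mul (hg x) (hf x).1 (abs_nonneg _) ((abs_nonneg _).trans (hg x)))
    (fun x hx => by simp only [hf.zero_of_lt x hx, mul_zero])
  refine (abs_integral_le_integral_abs).trans (h.trans (le_of_eq ?_))
  ring

lemma Sh.integral_sq_le (hr : 0 ≤ r) (hf : Sh r C f) : ∫ x, f x ^ 2 ≤ C ^ 2 * (16 * r ^ 2) := by
  have h := (le_abs_self _).trans (hf.integral_abs_mul_le hr fun x => (hf x).1)
  simpa only [pow_two, mul_assoc] using h

lemma Sh.integral_mul_le_sqrt (hr : 0 ≤ r) (hf : Sh r C f) (hfc : Continuous f)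
    (hcs : HasCompactSupport f) {g : V → ℝ}
    (hg : Continuous g) (hg2 : Integrable fun x => g x ^ 2) :
    |∫ x, g x * f x| ≤ √(∫ x, g x ^ 2) * (C * (4 * r)) := by
  refine (abs_integral_mul_le hg.aestronglyMeasurable hfc.aestronglyMeasurable hg2 ?_).trans ?_
  · simp_rw [pow_two]
    exact (hfc.mul hfc).integrable_of_hasCompactSupport hcs.mul_left
  · refine mul_le_mul_of_nonneg_left (Real.sqrt_le_iff.2 ⟨?_, ?_⟩) (Real.sqrt_nonneg _)
    · have := hf.nonneg
      positivity
    · refine (hf.integral_sq_le hr).trans (le_of_eq ?_)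
      ring

lemma Sh.integral_mul_le_abs (hf : Sh r C f) {g : V → ℝ}
    (hg : Integrable g) : |∫ x, g x * f x| ≤ C * ∫ x, |g x| := by
  refine (abs_integral_le_integral_abs).trans ?_
  rw [← integral_const_mul]
  refine integral_mono_of_nonneg (ae_of_all _ fun x => abs_nonneg _) (hg.abs.const_mul _)
    (ae_of_all _ fun x => ?_)
  show |g x * f x| ≤ _
  rw [abs_mul, mul_comm]
  exact mul_le_mul_of_nonneg_right (hf x).1 (abs_nonneg _)

end

/-- Weight of the Hardy inequality. -/
def hw (x : V) : ℝ := ((1 + vnsq x) ^ 2)⁻¹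

lemma sm_hw : Sm hw := by
  have h : Sm (fun x : V => (1 + vnsq x) ^ 2) := ((Sm.const 1).add sm_vnsq).pow 2
  exact ContDiff.inv h fun x => by have := vnsq_nonneg x; positivity

lemma hw_pos (x : V) : 0 < hw x := by
  have := vnsq_nonneg x
  unfold hw
  positivity

lemma hw_le_one (x : V) : hw x ≤ 1 := by
  have := vnsq_nonneg x
  exact inv_le_one_of_one_le₀ (by nlinarith)

lemma pd_hw (i : Fin 2) (x : V) : pd i hw x = -4 * x i * ((1 + vnsq x) ^ 3)⁻¹ := by
  have hx := vnsq_nonneg x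
  have h : Sm (fun x : V => (1 + vnsq x) ^ 2) := ((Sm.const 1).add sm_vnsq).pow 2
  have h1 : Sm (fun x : V => 1 + vnsq x) := (Sm.const 1).add sm_vnsq
  have e : ∀ y, hw y * (1 + vnsq y) ^ 2 = 1 := fun y => by
    have := vnsq_nonneg y
    exact inv_mul_cancel₀ (by positivity)
  have e2 := pd_mul sm_hw h i x
  simp_rw [e, pd_const] at e2
  rw [pd_sq h1, pd_add (Sm.const 1) sm_vnsq, pd_const, pd_vnsq] at e2
  have e3 := e x
  have : pd i hw x * (1 + vnsq x) ^ 2 = -(hw x * (2 * (1 + vnsq x) * (2 * x i))) := by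
    linear_combination -e2
  rw [eq_mul_inv_iff_mul_eq₀ (by positivity)]
  rw [hw] at this
  rw [pow_succ, ← mul_assoc, this]
  field_simp
  ring

lemma hardy {v : V → ℝ} (hv : Sm v) (h2 : Integrable fun x => v x ^ 2)
    (hd : ∀ i, Integrable fun x => pd i v x ^ 2) :
    ∫ x, hw x * v x ^ 2 ≤ 2 * (∑ i, ∫ x, pd i v x ^ 2)
      + 4 * ∫ x in {x : V | vnsq x ≤ 7}, v x ^ 2 := by
  have hK : MeasurableSet {x : V | vnsq x ≤ 7} :=
    (isClosed_le continuous_vnsq continuous_const).measurableSet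
  set K := {x : V | vnsq x ≤ 7} with hKd
  have sX : ∀ i : Fin 2, Sm (fun x : V => x i * hw x) := fun i => (sm_coord i).mul sm_hw
  have sg : ∀ i : Fin 2, Sm (fun x : V => v x ^ 2 * (x i * hw x)) := fun i => (hv.pow 2).mul (sX i)
  have eX : ∀ (i : Fin 2) (x : V), pd i (fun x : V => v x ^ 2 * (x i * hw x)) x
      = 2 * v x * pd i v x * (x i * hw x)
        + v x ^ 2 * (hw x + x i * (-4 * x i * ((1 + vnsq x) ^ 3)⁻¹)) := by
    intro i x
    rw [pd_mul (hv.pow 2) (sX i), pd_sq hv, pd_mul (sm_coord i) sm_hw, pd_coord, pd_hw]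
    simp
  have b1 : ∀ (i : Fin 2) (x : V), |x i * hw x| ≤ 1 := by
    intro i x
    have h0 := vnsq_nonneg x
    have h1 := sq_coord_le_vnsq x i
    have h3 : |x i| ≤ 1 + vnsq x := abs_le_of_sq_le_sq (by nlinarith) (by linarith)
    rw [abs_mul, abs_of_pos (hw_pos x), hw, ← div_eq_mul_inv, div_le_one (by positivity)]
    nlinarith
  have b2 : ∀ (i : Fin 2) (x : V), |hw x + x i * (-4 * x i * ((1 + vnsq x) ^ 3)⁻¹)| ≤ 5 := by
    intro i x
    have h0 := vnsq_nonneg x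
    have h1 := sq_coord_le_vnsq x i
    have hh := hw_le_one x
    have hp := hw_pos x
    have h3 : x i ^ 2 * ((1 + vnsq x) ^ 3)⁻¹ ≤ 1 := by
      rw [← div_eq_mul_inv, div_le_one (by positivity)]
      nlinarith [pow_nonneg h0 2, pow_nonneg h0 3]
    have h4 : 0 ≤ x i ^ 2 * ((1 + vnsq x) ^ 3)⁻¹ := by positivity
    rw [abs_le]
    constructor <;> nlinarith
  have ig : ∀ i : Fin 2, Integrable (fun x : V => v x ^ 2 * (x i * hw x)) := fun i =>
    h2.mul_bdd (c := 1) (sX i).cont.aestronglyMeasurable (ae_of_all _ fun x => by simpa using b1 i x)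
  have idg : ∀ i : Fin 2, Integrable (pd i (fun x : V => v x ^ 2 * (x i * hw x))) := by
    intro i
    refine ((h2.add (hd i)).add (h2.mul_const 5)).mono' ((sg i).pd i).cont.aestronglyMeasurable
      (ae_of_all _ fun x => ?_)
    rw [Real.norm_eq_abs, eX]
    refine (abs_add_le _ _).trans (add_le_add ?_ ?_)
    · rw [abs_mul]
      have h5 : |2 * v x * pd i v x| ≤ v x ^ 2 + pd i v x ^ 2 := by
        rw [abs_le]
        constructor <;> nlinarith [sq_nonneg (v x - pd i v x), sq_nonneg (v x + pd i v x)]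
      exact (mul_le_of_le_one_right (abs_nonneg _) (b1 i x)).trans h5
    · rw [abs_mul, abs_of_nonneg (sq_nonneg (v x))]
      exact mul_le_mul_of_nonneg_left (b2 i x) (sq_nonneg _)
  have z : ∫ x, ∑ i : Fin 2, pd i (fun x : V => v x ^ 2 * (x i * hw x)) x = 0 := by
    rw [integral_finsetSum _ fun i _ => idg i]
    exact Finset.sum_eq_zero fun i _ => integral_pd_eq_zero (sg i) i (ig i) (idg i)
  have ih : Integrable (fun x => hw x * v x ^ 2) :=
    h2.bdd_mul (c := 1) sm_hw.cont.aestronglyMeasurable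
      (ae_of_all _ fun x => by rw [Real.norm_eq_abs, abs_of_pos (hw_pos x)]; exact hw_le_one x)
  have is : Integrable (fun x => ∑ i, pd i v x ^ 2) := integrable_finsetSum _ fun i _ => hd i
  have ik : Integrable (K.indicator fun x => v x ^ 2) := h2.indicator hK
  have pw : ∀ x, hw x * v x ^ 2 + ∑ i : Fin 2, pd i (fun x : V => v x ^ 2 * (x i * hw x)) x
      ≤ 2 * (∑ i, pd i v x ^ 2) + 4 * K.indicator (fun x => v x ^ 2) x := by
    intro x
    have h0 := vnsq_nonneg x
    have hp := hw_pos x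
    have hq := vnsq_eq x
    have e3 : ((1 + vnsq x) ^ 3)⁻¹ = hw x * (1 + vnsq x)⁻¹ := by rw [hw, pow_succ, mul_inv]
    have e4 : hw x * vnsq x * (1 + vnsq x)⁻¹ = hw x - hw x * (1 + vnsq x)⁻¹ := by
      field_simp
      ring
    have hhv : hw x * vnsq x ≤ 1 := by
      rw [hw, mul_comm, ← div_eq_mul_inv, div_le_one (by positivity)]
      nlinarith
    have h6 : 4 * hw x * (1 + vnsq x)⁻¹ * v x ^ 2
        ≤ 1 / 2 * hw x * v x ^ 2 + 4 * K.indicator (fun x => v x ^ 2) x := by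
      by_cases hx : x ∈ K
      · rw [indicator_of_mem hx]
        have h7 : (1 + vnsq x)⁻¹ ≤ 1 := inv_le_one_of_one_le₀ (by linarith)
        have h8 : hw x * (1 + vnsq x)⁻¹ ≤ 1 :=
          mul_le_one₀ (hw_le_one x) (by positivity) h7
        nlinarith [mul_nonneg hp.le (sq_nonneg (v x)), mul_le_mul_of_nonneg_right h8 (sq_nonneg (v x))]
      · rw [indicator_of_notMem hx]
        have hx' : 7 < vnsq x := not_le.1 hx
        have h7 : (1 + vnsq x)⁻¹ ≤ 1 / 8 := by
          rw [inv_le_comm₀ (by positivity) (by norm_num)]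
          norm_num
          linarith
        nlinarith [mul_le_mul_of_nonneg_left h7 (mul_nonneg hp.le (sq_nonneg (v x)))]
    simp_rw [eX, Fin.sum_univ_two, e3]
    have h9 : (pd 0 v x * x 0 + pd 1 v x * x 1) * (2 * v x)
        ≤ 1 / 2 * v x ^ 2 + 2 * (vnsq x * (pd 0 v x ^ 2 + pd 1 v x ^ 2)) := by
      rw [hq]
      nlinarith [sq_nonneg (v x - 2 * (pd 0 v x * x 0 + pd 1 v x * x 1)),
        sq_nonneg (pd 0 v x * x 1 - pd 1 v x * x 0)]
    have h10 := mul_le_mul_of_nonneg_left h9 hp.le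
    have h11 : hw x * vnsq x * (pd 0 v x ^ 2 + pd 1 v x ^ 2) ≤ pd 0 v x ^ 2 + pd 1 v x ^ 2 :=
      mul_le_of_le_one_left (by positivity) hhv
    have e5 : hw x * (x 0 ^ 2 + x 1 ^ 2) * (1 + vnsq x)⁻¹ = hw x - hw x * (1 + vnsq x)⁻¹ := by
      rw [← hq]
      exact e4
    linear_combination h10 + 2 * h11 + h6 - 4 * v x ^ 2 * e5
  have := integral_mono (ih.add (integrable_finsetSum _ fun i _ => idg i))
    ((is.const_mul 2).add (ik.const_mul 4)) pw
  rw [integral_add' ih (integrable_finsetSum _ fun i _ => idg i),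
    integral_add' (is.const_mul 2) (ik.const_mul 4), z, add_zero, integral_const_mul,
    integral_const_mul, integral_indicator hK, integral_finsetSum _ fun i _ => hd i] at this
  exact this

/-- Squared length of a vector field. -/
def sqv (u : Fin 2 → V → ℝ) (x : V) : ℝ := ∑ i, u i x ^ 2

/-- Squared Frobenius norm of a matrix field. -/
def sqm (E : Fin 2 → Fin 2 → V → ℝ) (x : V) : ℝ := ∑ i, ∑ j, E i j x ^ 2

/-- Squared Frobenius norm of the gradient of a vector field. -/
def gr (u : Fin 2 → V → ℝ) (x : V) : ℝ := ∑ i, ∑ j, pd j (u i) x ^ 2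

/-- Time slice of a vector field. -/
abbrev sl (U : Fin 2 → ℝ → V → ℝ) (t : ℝ) : Fin 2 → V → ℝ := fun i => U i t

/-- Time slice of a matrix field. -/
abbrev slm (E : Fin 2 → Fin 2 → ℝ → V → ℝ) (t : ℝ) : Fin 2 → Fin 2 → V → ℝ := fun i j => E i j t

/-- The weighted dissipation `∫ |u|² |∇u|²`. -/
def dis (U : Fin 2 → ℝ → V → ℝ) (t : ℝ) : ℝ := ∫ x, sqv (sl U t) x * gr (sl U t) x

/-- Componentwise form of the viscoelastic system for `u` and `E = F - I`. -/
structure Sol (U : Fin 2 → ℝ → V → ℝ) (E : Fin 2 → Fin 2 → ℝ → V → ℝ) (P : ℝ → V → ℝ) (T : ℝ) :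
    Prop where
  hT : 0 < T
  su : ∀ i, STSm (U i)
  sE : ∀ i j, STSm (E i j)
  sP : STSm P
  mom : ∀ t ∈ Icc 0 T, ∀ i x, dt (U i) t x + nn (sl U t) i x - lap (U i t) x + pd i (P t) x
    = (∑ j, pd j (E i j t) x) + ∑ j, pd j (ff (slm E t) i j) x
  tr : ∀ t ∈ Icc 0 T, ∀ i j x, dt (E i j) t x + ∑ k, U k t x * pd k (E i j t) x
    = pd j (U i t) x + ∑ k, pd k (U i t) x * E k j t x
  du : ∀ t ∈ Icc 0 T, ∀ x, ∑ i, pd i (U i t) x = 0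
  dE : ∀ t ∈ Icc 0 T, ∀ j x, ∑ i, pd i (E i j t) x = 0
  bE : ∀ t ∈ Icc 0 T, ∀ x, sqm (slm E t) x ≤ 1 / 4
  iu : ∀ t ∈ Icc 0 T, Integrable (sqv (sl U t))
  iuu : ∀ t ∈ Icc 0 T, Integrable (fun x => sqv (sl U t) x ^ 2)
  iE : ∀ t ∈ Icc 0 T, Integrable (sqm (slm E t))
  ig : ∀ t ∈ Icc 0 T, Integrable (gr (sl U t))
  id : ∀ t ∈ Icc 0 T, Integrable (fun x => sqv (sl U t) x * gr (sl U t) x)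
  idt : IntegrableOn (dis U) (Ioc 0 T)

section
variable {u : Fin 2 → V → ℝ} {E : Fin 2 → Fin 2 → V → ℝ}

lemma sq_nn (u : Fin 2 → V → ℝ) (x : V) : 0 ≤ sqv u x := Finset.sum_nonneg fun _ _ => sq_nonneg _

lemma gr_nn (u : Fin 2 → V → ℝ) (x : V) : 0 ≤ gr u x :=
  Finset.sum_nonneg fun _ _ => Finset.sum_nonneg fun _ _ => sq_nonneg _

lemma sqm_nn (E : Fin 2 → Fin 2 → V → ℝ) (x : V) : 0 ≤ sqm E x :=
  Finset.sum_nonneg fun _ _ => Finset.sum_nonneg fun _ _ => sq_nonneg _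

lemma dis_nn (U : Fin 2 → ℝ → V → ℝ) (t : ℝ) : 0 ≤ dis U t :=
  integral_nonneg fun x => mul_nonneg (sq_nn _ x) (gr_nn _ x)

lemma Sm.sqvv (hu : ∀ i, Sm (u i)) : Sm (sqv u) := Sm.sum fun i => (hu i).pow 2

lemma Sm.sqvm (hE : ∀ i j, Sm (E i j)) : Sm (sqm E) := Sm.sum fun i => Sm.sum fun j => (hE i j).pow 2

lemma Sm.gr (hu : ∀ i, Sm (u i)) : Sm (gr u) := Sm.sum fun i => Sm.sum fun j => ((hu i).pd j).pow 2

lemma coord_sq_le (u : Fin 2 → V → ℝ) (i : Fin 2) (x : V) : u i x ^ 2 ≤ sqv u x :=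
  Finset.single_le_sum (f := fun i => u i x ^ 2) (fun _ _ => sq_nonneg _) (Finset.mem_univ i)

lemma entry_sq_le (E : Fin 2 → Fin 2 → V → ℝ) (i j : Fin 2) (x : V) : E i j x ^ 2 ≤ sqm E x :=
  (Finset.single_le_sum (f := fun j => E i j x ^ 2) (fun _ _ => sq_nonneg _)
    (Finset.mem_univ j)).trans (Finset.single_le_sum (f := fun i => ∑ j, E i j x ^ 2)
      (fun _ _ => Finset.sum_nonneg fun _ _ => sq_nonneg _) (Finset.mem_univ i))

lemma grad_sq_le (u : Fin 2 → V → ℝ) (i j : Fin 2) (x : V) : pd j (u i) x ^ 2 ≤ gr u x :=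
  entry_sq_le (fun i j => pd j (u i)) i j x

lemma pd_sq_field (hu : ∀ i, Sm (u i)) (i : Fin 2) (x : V) :
    pd i (sqv u) x = ∑ k, 2 * u k x * pd i (u k) x := by
  have e : sqv u = fun y => ∑ k, u k y ^ 2 := rfl
  rw [e, pd_sum _ fun k => (hu k).pow 2]
  exact Finset.sum_congr rfl fun k _ => pd_sq (hu k) i x

lemma sum_pd_sq_le (hu : ∀ i, Sm (u i)) (x : V) :
    ∑ i, pd i (sqv u) x ^ 2 ≤ 4 * (sqv u x * gr u x) := by
  simp_rw [pd_sq_field hu, sqv, gr, Fin.sum_univ_two]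
  nlinarith [sq_nonneg (u 0 x * pd 0 (u 1) x - u 1 x * pd 0 (u 0) x),
    sq_nonneg (u 0 x * pd 1 (u 1) x - u 1 x * pd 1 (u 0) x)]

lemma nn_sq_le (u : Fin 2 → V → ℝ) (i : Fin 2) (x : V) : nn u i x ^ 2 ≤ sqv u x * gr u x := by
  have h1 : nn u i x ^ 2 ≤ sqv u x * ∑ j, pd j (u i) x ^ 2 := by
    simp_rw [nn, sqv, Fin.sum_univ_two]
    nlinarith [sq_nonneg (u 0 x * pd 1 (u i) x - u 1 x * pd 0 (u i) x)]
  refine h1.trans (mul_le_mul_of_nonneg_left ?_ (sq_nn u x))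
  exact Finset.single_le_sum (f := fun i => ∑ j, pd j (u i) x ^ 2)
    (fun _ _ => Finset.sum_nonneg fun _ _ => sq_nonneg _) (Finset.mem_univ i)

lemma abs_ff_le (E : Fin 2 → Fin 2 → V → ℝ) (i j : Fin 2) (x : V) : |ff E i j x| ≤ sqm E x := by
  simp_rw [ff, sqm, Fin.sum_univ_two]
  have : ∀ i j : Fin 2, |E i 0 x * E j 0 x + E i 1 x * E j 1 x|
      ≤ 1 / 2 * (E i 0 x ^ 2 + E i 1 x ^ 2) + 1 / 2 * (E j 0 x ^ 2 + E j 1 x ^ 2) := by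
    intro i j
    rw [abs_le]
    constructor <;> nlinarith [sq_nonneg (E i 0 x - E j 0 x), sq_nonneg (E i 1 x - E j 1 x),
      sq_nonneg (E i 0 x + E j 0 x), sq_nonneg (E i 1 x + E j 1 x)]
  refine (this i j).trans ?_
  fin_cases i <;> fin_cases j <;> simp <;>
    nlinarith [sq_nonneg (E 0 0 x), sq_nonneg (E 0 1 x), sq_nonneg (E 1 0 x), sq_nonneg (E 1 1 x)]

end

section
variable {U : Fin 2 → ℝ → V → ℝ} {E : Fin 2 → Fin 2 → ℝ → V → ℝ} {P : ℝ → V → ℝ} {T : ℝ}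

lemma Sol.smU (S : Sol U E P T) (t : ℝ) : ∀ i, Sm (sl U t i) := fun i => (S.su i).slice t

lemma Sol.smE (S : Sol U E P T) (t : ℝ) : ∀ i j, Sm (slm E t i j) := fun i j => (S.sE i j).slice t

lemma Sol.integrable_pd_sq (S : Sol U E P T) {t : ℝ} (ht : t ∈ Icc 0 T) (i : Fin 2) :
    Integrable (fun x => pd i (sqv (sl U t)) x ^ 2) := by
  refine ((S.id t ht).const_mul 4).mono'
    (((Sm.sqvv (S.smU t)).pd i).pow 2).cont.aestronglyMeasurable (ae_of_all _ fun x => ?_)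
  rw [Real.norm_of_nonneg (sq_nonneg _)]
  exact (Finset.single_le_sum (f := fun i => pd i (sqv (sl U t)) x ^ 2)
    (fun _ _ => sq_nonneg _) (Finset.mem_univ i)).trans (sum_pd_sq_le (S.smU t) x)

lemma Sol.integral_pd_sq_le (S : Sol U E P T) {t : ℝ} (ht : t ∈ Icc 0 T) :
    ∑ i, ∫ x, pd i (sqv (sl U t)) x ^ 2 ≤ 4 * dis U t := by
  rw [← integral_finsetSum _ fun i _ => S.integrable_pd_sq ht i, dis, ← integral_const_mul]
  exact integral_mono (integrable_finsetSum _ fun i _ => S.integrable_pd_sq ht i)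
    ((S.id t ht).const_mul 4) (sum_pd_sq_le (S.smU t))

lemma Sol.exists_hardy (S : Sol U E P T) : ∃ c, 0 ≤ c ∧ ∀ t ∈ Icc 0 T,
    ∫ x, hw x * sqv (sl U t) x ^ 2 ≤ 8 * dis U t + c := by
  have hK : IsCompact (Icc 0 T ×ˢ Metric.closedBall (0 : V) 3) :=
    isCompact_Icc.prod (isCompact_closedBall _ _)
  have hc : Continuous (fun p : ℝ × V => sqv (sl U p.1) p.2 ^ 2) := by
    have : Continuous (fun p : ℝ × V => ∑ i, Function.uncurry (U i) p ^ 2) :=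
      continuous_finsetSum _ fun i _ => (ContDiff.continuous (S.su i)).pow 2
    exact this.pow 2
  obtain ⟨M, hM⟩ := hK.exists_bound_of_continuousOn hc.continuousOn
  refine ⟨4 * (|M| * 36), by positivity, fun t ht => ?_⟩
  refine (hardy (Sm.sqvv (S.smU t)) (S.iuu t ht) (S.integrable_pd_sq ht)).trans ?_
  have h1 := S.integral_pd_sq_le ht
  have hsub : {x : V | vnsq x ≤ 7} ⊆ Metric.closedBall 0 3 := by
    intro x hx
    have h2 := norm_sq_le_vnsq x
    have h3 : vnsq x ≤ 7 := hx
    rw [mem_closedBall_zero_iff]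
    nlinarith [norm_nonneg x]
  have h4 : ∫ x in {x : V | vnsq x ≤ 7}, sqv (sl U t) x ^ 2 ≤ |M| * 36 := by
    refine (setIntegral_mono_set (S.iuu t ht).integrableOn (ae_of_all _ fun x => sq_nonneg _)
      (LE.le.eventuallyLE hsub)).trans ?_
    have h6 : volume (Metric.closedBall (0 : V) 3) < ⊤ := measure_closedBall_lt_top
    have h5 := norm_setIntegral_le_of_norm_le_const
      (f := fun x => sqv (sl U t) x ^ 2) (C := |M|) h6
      fun x hx => (hM (t, x) ⟨ht, hx⟩).trans (le_abs_self M)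
    rw [volume_real_ball (by norm_num)] at h5
    refine (le_abs_self _).trans (h5.trans (le_of_eq ?_))
    norm_num
  linarith

lemma Sol.abs_E_le (S : Sol U E P T) {t : ℝ} (ht : t ∈ Icc 0 T) (i j : Fin 2) (x : V) :
    |E i j t x| ≤ 1 / 2 := by
  have h1 := entry_sq_le (slm E t) i j x
  have h2 := S.bE t ht x
  exact abs_le_of_sq_le_sq (by linarith) (by norm_num)

lemma Sol.abs_ff_le (S : Sol U E P T) {t : ℝ} (ht : t ∈ Icc 0 T) (i j : Fin 2) (x : V) :
    |ff (slm E t) i j x| ≤ 1 / 4 := (_root_.abs_ff_le _ i j x).trans (S.bE t ht x)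

lemma Sol.abs_integral_shell_le (S : Sol U E P T) {c : ℝ}
    (hc : ∀ t ∈ Icc 0 T, ∫ x, hw x * sqv (sl U t) x ^ 2 ≤ 8 * dis U t + c)
    {t : ℝ} (ht : t ∈ Icc 0 T) {r C : ℝ} (hr : 1 ≤ r) {f : V → ℝ} (hf : Sh r (C / r ^ 4) f)
    (i : Fin 2) : |∫ x, U i t x * f x| ≤ C / r * (16 + 81 * (8 * dis U t + c)) := by
  have hr0 : 0 < r := by linarith
  have hC : 0 ≤ C / r ^ 4 := hf.nonneg
  set B := Metric.closedBall (0 : V) (2 * r)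
  have hB : MeasurableSet B := measurableSet_closedBall
  have iB : Integrable (B.indicator fun _ : V => r) :=
    (integrable_indicator_iff hB).2 (integrableOn_const measure_closedBall_lt_top.ne)
  have ih : Integrable (fun x => hw x * sqv (sl U t) x ^ 2) :=
    (S.iuu t ht).bdd_mul (c := 1) sm_hw.cont.aestronglyMeasurable
      (ae_of_all _ fun x => by rw [Real.norm_eq_abs, abs_of_pos (hw_pos x)]; exact hw_le_one x)
  have pw : ∀ x, |U i t x * f x|
      ≤ C / r ^ 4 * (B.indicator (fun _ => r) x + 81 * r * (hw x * sqv (sl U t) x ^ 2)) := by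
    intro x
    have hp := hw_pos x
    by_cases hx : x ∈ B
    · have hx' : ‖x‖ ≤ 2 * r := by simpa [B] using hx
      rw [indicator_of_mem hx, abs_mul, mul_comm]
      refine mul_le_mul (hf x).1 ?_ (abs_nonneg _) hC
      have hv : U i t x ^ 2 ≤ sqv (sl U t) x := coord_sq_le (sl U t) i x
      have hrx : 1 + vnsq x ≤ 9 * r ^ 2 := by
        have := vnsq_le_norm_sq x
        nlinarith [norm_nonneg x]
      have hw1 : 1 ≤ 81 * r ^ 4 * hw x := by
        have h0 := vnsq_nonneg x
        rw [hw, ← div_eq_mul_inv, le_div_iff₀ (by positivity)]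
        nlinarith
      have h5 : |U i t x| ≤ r ∨ r < |U i t x| := le_or_gt _ _
      rcases h5 with h5 | h5
      · have : 0 ≤ 81 * r * (hw x * sqv (sl U t) x ^ 2) := by positivity
        linarith
      · have h6 : r ^ 3 * |U i t x| ≤ sqv (sl U t) x ^ 2 := by
          have h7 : |U i t x| ^ 4 ≤ sqv (sl U t) x ^ 2 := by
            have : |U i t x| ^ 4 = (U i t x ^ 2) ^ 2 := by rw [← sq_abs (U i t x)]; ring
            rw [this]
            exact pow_le_pow_left₀ (sq_nonneg _) hv 2
          have h8 : r ^ 3 ≤ |U i t x| ^ 3 := pow_le_pow_left₀ hr0.le h5.le 3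
          nlinarith [abs_nonneg (U i t x)]
        have h9 : r ^ 3 * |U i t x| ≤ r ^ 3 * (81 * r * (hw x * sqv (sl U t) x ^ 2)) := by
          have := mul_le_mul_of_nonneg_left hw1 (sq_nonneg (sqv (sl U t) x))
          nlinarith
        have := le_of_mul_le_mul_left h9 (by positivity)
        linarith
    · have hx' : 2 * r < ‖x‖ := by simpa [B] using hx
      rw [hf.zero_of_lt x hx', mul_zero, abs_zero]
      have : 0 ≤ B.indicator (fun _ : V => r) x := indicator_nonneg (fun _ _ => hr0.le) x
      positivity
  have h := integral_mono_of_nonneg (ae_of_all _ fun x => abs_nonneg _)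
    ((iB.add (ih.const_mul (81 * r))).const_mul (C / r ^ 4)) (ae_of_all volume pw)
  rw [integral_const_mul, integral_add' iB (ih.const_mul _), integral_const_mul,
    integral_indicator hB, setIntegral_const, volume_real_ball (by positivity)] at h
  refine abs_integral_le_integral_abs.trans (h.trans ?_)
  have h3 := hc t ht
  have hC0 : 0 ≤ C := by
    have := mul_nonneg hC (pow_pos hr0 4).le
    rwa [div_mul_cancel₀ _ (by positivity)] at this
  have h4 : C / r ^ 4 * (81 * r * ∫ x, hw x * sqv (sl U t) x ^ 2)
      ≤ C / r * (81 * (8 * dis U t + c)) := by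
    have hH : 0 ≤ ∫ x, hw x * sqv (sl U t) x ^ 2 :=
      integral_nonneg fun x => mul_nonneg (hw_pos x).le (sq_nonneg _)
    have : C / r ^ 4 * (81 * r * ∫ x, hw x * sqv (sl U t) x ^ 2)
        = C / r ^ 3 * (81 * ∫ x, hw x * sqv (sl U t) x ^ 2) := by
      field_simp
    rw [this]
    refine mul_le_mul ?_ (by linarith) (by positivity) (by positivity)
    gcongr
    nlinarith
  rw [smul_eq_mul, mul_add, mul_add]
  refine add_le_add (le_of_eq ?_) h4
  field_simp
  ring

/-- The linear localisation errors are negligible, uniformly in time. -/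
lemma Sol.exists_rem (S : Sol U E P T) {θ : Fin 2 → V → ℝ} (h : Tst θ) :
    ∃ κ : ℝ, ∀ᶠ r in atTop, ∀ t ∈ Icc 0 T,
      |-(∑ i, ∫ x, U i t x * lap (ef θ r i) x) + ∑ i, ∑ j, ∫ x, E i j t x * pd j (ef θ r i) x|
        ≤ κ / r * (1 + dis U t) := by
  obtain ⟨c, hc0, hc⟩ := S.exists_hardy
  obtain ⟨C, R, hR, hC, hs⟩ := h.exists_shell
  refine ⟨2 * (C * (664 + 81 * c)) + 32 * C, ?_⟩
  filter_upwards [eventually_ge_atTop R] with r hr t ht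
  have hr1 : 1 ≤ r := hR.trans hr
  have hr0 : 0 < r := by linarith
  obtain ⟨-, -, s1, s2, -, -⟩ := hs r hr
  have hd := dis_nn U t
  have a1 : ∀ i, |∫ x, U i t x * lap (ef θ r i) x| ≤ C * (664 + 81 * c) / r * (1 + dis U t) := by
    intro i
    refine (S.abs_integral_shell_le hc ht hr1 (s2 i) i).trans ?_
    rw [mul_div_right_comm, mul_assoc]
    gcongr
    nlinarith [mul_nonneg hc0 hd]
  have a2 : ∀ i j, |∫ x, E i j t x * pd j (ef θ r i) x| ≤ 8 * C / r * (1 + dis U t) := by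
    intro i j
    refine ((s1 i j).integral_abs_mul_le hr0.le (S.abs_E_le ht i j)).trans ?_
    have : 1 / 2 * (C / r ^ 3) * (16 * r ^ 2) = 8 * C / r := by field_simp; ring
    rw [this]
    exact le_mul_of_one_le_right (by positivity) (by linarith)
  refine (abs_add_le _ _).trans ?_
  rw [abs_neg]
  refine (add_le_add (Finset.abs_sum_le_sum_abs _ _) ((Finset.abs_sum_le_sum_abs _ _).trans
    (Finset.sum_le_sum fun i _ => Finset.abs_sum_le_sum_abs _ _))).trans ?_
  simp_rw [Fin.sum_univ_two]
  have := a1 0; have := a1 1; have := a2 0 0; have := a2 0 1; have := a2 1 0; have := a2 1 1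
  have e : (2 * (C * (664 + 81 * c)) + 32 * C) / r * (1 + dis U t)
      = 2 * (C * (664 + 81 * c) / r * (1 + dis U t)) + 4 * (8 * C / r * (1 + dis U t)) := by ring
  linarith

end

section
variable {U : Fin 2 → ℝ → V → ℝ} {E : Fin 2 → Fin 2 → ℝ → V → ℝ} {P : ℝ → V → ℝ} {T : ℝ}

lemma Sol.integrable_sq (S : Sol U E P T) {t : ℝ} (ht : t ∈ Icc 0 T) (i : Fin 2) :
    Integrable (fun x => U i t x ^ 2) := by
  refine (S.iu t ht).mono' (((S.smU t i)).pow 2).cont.aestronglyMeasurable (ae_of_all _ fun x => ?_)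
  rw [Real.norm_of_nonneg (sq_nonneg _)]
  exact coord_sq_le (sl U t) i x

lemma Sol.sum_pd_dt (S : Sol U E P T) {t : ℝ} (ht : t ∈ Ioo 0 T) (x : V) :
    ∑ i, pd i (dt (U i) t) x = 0 := by
  have h1 : HasDerivAt (fun s => ∑ i, pd i (U i s) x) (∑ i, dt (fun s => pd i (U i s)) t x) t :=
    HasDerivAt.fun_sum fun i _ => ((S.su i).pd i).hasDerivAt t x
  have h2 : (fun s => ∑ i, pd i (U i s) x) =ᶠ[nhds t] fun _ => 0 := by
    filter_upwards [Ioo_mem_nhds ht.1 ht.2] with s hs using S.du s ⟨hs.1.le, hs.2.le⟩ x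
  have h3 := (h1.congr_of_eventuallyEq h2.symm).unique (hasDerivAt_const t (0 : ℝ))
  rw [← h3]
  exact Finset.sum_congr rfl fun i _ => ((S.su i).dt_pd i t x).symm

/-- Pairing of the pressure gradient with a test field. -/
def pr (P : ℝ → V → ℝ) (θ : Fin 2 → V → ℝ) (t : ℝ) : ℝ := ∑ i, ∫ x, pd i (P t) x * θ i x

lemma Tst.continuous_pr {θ : Fin 2 → V → ℝ} (h : Tst θ) (hP : STSm P) : Continuous (pr P θ) := by
  refine continuous_finsetSum _ fun i _ => ?_
  refine ((hP.pd i).mul (STSm.const (h.sm i))).continuous_integral (h.cpt i) fun t x hx => ?_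
  rw [image_eq_zero_of_notMem_tsupport hx, mul_zero]

lemma Sol.tendsto_boundary (S : Sol U E P T) {θ : Fin 2 → V → ℝ} (h : Tst θ) {t : ℝ}
    (ht : t ∈ Icc 0 T) :
    Tendsto (fun r => ∑ i, ∫ x, U i t x * ef θ r i x) atTop (nhds 0) := by
  obtain ⟨C, R, hR, hC, hs⟩ := h.exists_shell
  have : Tendsto (fun r => ∑ i : Fin 2, ∫ x, U i t x * ef θ r i x) atTop
      (nhds (∑ i : Fin 2, (0 : ℝ))) := by
    refine tendsto_finsetSum _ fun i _ => ?_
    have h0 : Tendsto (fun r : ℝ => √(∫ x, U i t x ^ 2) * (4 * C) * r⁻¹) atTop (nhds 0) := by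
      simpa using tendsto_inv_atTop_zero.const_mul (√(∫ x, U i t x ^ 2) * (4 * C))
    refine squeeze_zero_norm' ?_ h0
    filter_upwards [eventually_ge_atTop R] with r hr
    have hr0 : 0 < r := by linarith
    obtain ⟨-, s0, -⟩ := hs r hr
    refine ((s0 i).integral_mul_le_sqrt hr0.le (h.sm_ef r i).cont (cpt_ef hr0 i)
      (S.smU t i).cont (S.integrable_sq ht i)).trans (le_of_eq ?_)
    field_simp
  simpa using this

lemma Sol.abs_integral_pr_le (S : Sol U E P T) {α : ℝ → ℝ} (hα : IntegrableOn α (Ioc 0 T))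
    {θ : Fin 2 → V → ℝ} (h : Tst θ) {c : ℝ} {κ : ℝ → ℝ} (hκ : Tendsto κ atTop (nhds 0))
    (hl : ∀ᶠ r in atTop, ∀ τ ∈ Icc 0 T,
      |lam (sl U τ) (slm E τ) (wf θ r)| ≤ c * α τ + κ r * (1 + dis U τ))
    {s s' : ℝ} (hs : 0 < s) (hss : s ≤ s') (hs' : s' < T) :
    |∫ τ in Ioc s s', pr P θ τ| ≤ c * ∫ τ in Ioc s s', α τ := by
  obtain ⟨κ', hκ'⟩ := S.exists_rem h
  obtain ⟨C, R, hR, hC, hsh⟩ := h.exists_shell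
  have hsub : Ioc s s' ⊆ Ioc 0 T := fun x hx => ⟨hs.trans hx.1, hx.2.trans hs'.le⟩
  have iα := hα.mono_set hsub
  have i1 : IntegrableOn (fun τ => 1 + dis U τ) (Ioc s s') :=
    (integrableOn_const measure_Ioc_lt_top.ne).add (S.idt.mono_set hsub)
  have hp := h.continuous_pr S.sP
  set D := ∫ τ in Ioc s s', (1 + dis U τ) with hD
  have key : ∀ᶠ r in atTop, |∫ τ in Ioc s s', pr P θ τ|
      ≤ |(∑ i, ∫ x, U i s' x * ef θ r i x)| + |(∑ i, ∫ x, U i s x * ef θ r i x)|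
        + (c * (∫ τ in Ioc s s', α τ) + (κ r + κ' * r⁻¹) * D) := by
    filter_upwards [hl, hκ', eventually_ge_atTop R] with r hl hκ' hr
    have hr0 : 0 < r := by linarith
    have hθ := (hsh r hr).1
    have sG : ∀ i, STSm fun t x => U i t x * ef θ r i x := fun i =>
      (S.su i).mul (STSm.const (h.sm_ef r i))
    have zG : ∀ i, ∀ t x, x ∉ tsupport (ef θ r i) → U i t x * ef θ r i x = 0 := fun i t x hx => by
      rw [image_eq_zero_of_notMem_tsupport hx, mul_zero]
    have sD : ∀ i, STSm fun t x => dt (U i) t x * ef θ r i x := fun i =>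
      (S.su i).dt.mul (STSm.const (h.sm_ef r i))
    have zD : ∀ i, ∀ t x, x ∉ tsupport (ef θ r i) → dt (U i) t x * ef θ r i x = 0 :=
      fun i t x hx => by rw [image_eq_zero_of_notMem_tsupport hx, mul_zero]
    have cD : ∀ i, Continuous fun t => ∫ x, dt (U i) t x * ef θ r i x := fun i =>
      (sD i).continuous_integral (cpt_ef hr0 i) (zD i)
    have hq : (∑ i, ∫ x, U i s' x * ef θ r i x) - (∑ i, ∫ x, U i s x * ef θ r i x)
        = ∫ τ in Ioc s s', ∑ i, ∫ x, dt (U i) τ x * ef θ r i x := by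
      rw [← Finset.sum_sub_distrib, integral_finsetSum _ fun i _ =>
        ((cD i).integrableOn_Icc (a := s) (b := s')).mono_set Ioc_subset_Icc_self]
      refine Finset.sum_congr rfl fun i _ => ?_
      rw [(sG i).integral_sub (cpt_ef hr0 i) (zG i) hss]
      refine setIntegral_congr_fun measurableSet_Ioc fun τ _ => ?_
      refine integral_congr_ae (ae_of_all _ fun x => ?_)
      exact (((S.su i).hasDerivAt τ x).mul_const _).deriv
    have cq : Continuous fun τ => ∑ i, ∫ x, dt (U i) τ x * ef θ r i x :=
      continuous_finsetSum _ fun i _ => cD i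
    have ip : IntegrableOn (pr P θ) (Ioc s s') :=
      (hp.integrableOn_Icc (a := s) (b := s')).mono_set Ioc_subset_Icc_self
    have iq : IntegrableOn (fun τ => ∑ i, ∫ x, dt (U i) τ x * ef θ r i x) (Ioc s s') :=
      (cq.integrableOn_Icc (a := s) (b := s')).mono_set Ioc_subset_Icc_self
    have e : ∫ τ in Ioc s s', pr P θ τ = ((∑ i, ∫ x, U i s' x * ef θ r i x)
        - (∑ i, ∫ x, U i s x * ef θ r i x))
        + ∫ τ in Ioc s s', (pr P θ τ - ∑ i, ∫ x, dt (U i) τ x * ef θ r i x) := by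
      rw [hq, integral_sub ip iq]
      ring
    have i2 : IntegrableOn (fun τ => c * α τ + (κ r + κ' * r⁻¹) * (1 + dis U τ)) (Ioc s s') :=
      (iα.const_mul c).add (i1.const_mul _)
    have b : |∫ τ in Ioc s s', (pr P θ τ - ∑ i, ∫ x, dt (U i) τ x * ef θ r i x)|
        ≤ c * (∫ τ in Ioc s s', α τ) + (κ r + κ' * r⁻¹) * D := by
      rw [hD, ← integral_const_mul, ← integral_const_mul, ← integral_add (iα.const_mul c)
        (i1.const_mul _)]
      rw [← Real.norm_eq_abs]
      refine norm_integral_le_of_norm_le i2 ?_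
      filter_upwards [ae_restrict_mem measurableSet_Ioc] with τ hτ
      have hτ' : τ ∈ Ioo 0 T := ⟨hs.trans hτ.1, hτ.2.trans_lt hs'⟩
      have hτc : τ ∈ Icc 0 T := Ioo_subset_Icc_self hτ'
      have := h.integral_pressure hr0 hθ (g := fun i => dt (U i) τ) (p := P τ)
        (fun i => (S.su i).dt.slice τ) (S.smU τ) (S.smE τ) (S.sP.slice τ) (S.sum_pd_dt hτ')
        (S.du τ hτc) (S.dE τ hτc) (S.mom τ hτc)
      have h1 := hl τ hτc
      have h2 := hκ' τ hτc
      have e2 : pr P θ τ - ∑ i, ∫ x, dt (U i) τ x * ef θ r i x = lam (sl U τ) (slm E τ) (wf θ r)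
          + (-(∑ i, ∫ x, U i τ x * lap (ef θ r i) x)
            + ∑ i, ∑ j, ∫ x, E i j τ x * pd j (ef θ r i) x) := by
        rw [pr, this]
        ring
      rw [Real.norm_eq_abs, e2]
      refine (abs_add_le _ _).trans ((add_le_add h1 h2).trans (le_of_eq ?_))
      rw [div_eq_mul_inv]
      ring
    rw [e]
    refine (abs_add_le _ _).trans (add_le_add (abs_sub _ _) b)
  have l1 := (S.tendsto_boundary h (t := s) ⟨hs.le, hss.trans hs'.le⟩).abs
  have l2 := (S.tendsto_boundary h (t := s') ⟨(hs.trans_le hss).le, hs'.le⟩).abs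
  have l3 : Tendsto (fun r => c * (∫ τ in Ioc s s', α τ) + (κ r + κ' * r⁻¹) * D) atTop
      (nhds (c * (∫ τ in Ioc s s', α τ) + (0 + κ' * 0) * D)) :=
    ((hκ.add (tendsto_inv_atTop_zero.const_mul κ')).mul_const D).const_add _
  have := ge_of_tendsto ((l2.add l1).add l3) key
  simpa using this

/-- Passage from time-averaged to pointwise (a.e.) pressure bounds. -/
lemma Sol.pressure_ae (S : Sol U E P T) {α : ℝ → ℝ} (hα : IntegrableOn α (Ioc 0 T)) :
    ∀ᵐ s, s ∈ Ioo 0 T → ∀ θ : Fin 2 → V → ℝ, Tst θ → ∀ c : ℝ,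
      (∃ κ : ℝ → ℝ, Tendsto κ atTop (nhds 0) ∧ ∀ᶠ r in atTop, ∀ τ ∈ Icc 0 T,
        |lam (sl U τ) (slm E τ) (wf θ r)| ≤ c * α τ + κ r * (1 + dis U τ)) →
      |pr P θ s| ≤ c * α s := by
  have hi : IntervalIntegrable α volume 0 T := (intervalIntegrable_iff_integrableOn_Ioc_of_le
    S.hT.le).2 hα
  filter_upwards [hi.ae_hasDerivAt_integral] with s hs hsT θ h c ⟨κ, hκ, hl⟩
  have h0T : s ∈ uIcc 0 T := by
    rw [uIcc_of_le S.hT.le]; exact Ioo_subset_Icc_self hsT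
  have d1 := hs h0T s h0T
  have hp := h.continuous_pr S.sP
  have d2 : HasDerivAt (fun x => ∫ t in s..x, pr P θ t) (pr P θ s) s :=
    intervalIntegral.integral_hasDerivAt_right (by simp) (hp.stronglyMeasurableAtFilter _ _)
      hp.continuousAt
  have key : ∀ e : ℝ, |e| ≤ 1 → e * pr P θ s ≤ c * α s := by
    intro e he
    have d3 := (d1.const_mul c).sub (d2.const_mul e)
    have ht := (hasDerivAt_iff_tendsto_slope.1 d3).mono_left
      (nhdsWithin_mono s (fun x (hx : x ∈ Ioi s) => ne_of_gt hx) : nhdsWithin s (Ioi s) ≤ _)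
    have : 0 ≤ c * α s - e * pr P θ s := by
      refine ge_of_tendsto ht ?_
      filter_upwards [Ioo_mem_nhdsGT hsT.2] with x hx
      rw [slope_def_field]
      refine div_nonneg ?_ (by linarith [hx.1])
      have hb := S.abs_integral_pr_le hα h hκ hl hsT.1 hx.1.le hx.2
      simp only [Pi.sub_apply, intervalIntegral.integral_same, intervalIntegral.integral_of_le hx.1.le]
      have : e * ∫ τ in Ioc s x, pr P θ τ ≤ |∫ τ in Ioc s x, pr P θ τ| := by
        refine (le_abs_self _).trans ?_
        rw [abs_mul]
        exact mul_le_of_le_one_left (abs_nonneg _) he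
      linarith
    linarith
  rw [abs_le]
  have h1 := key 1 (by simp)
  have h2 := key (-1) (by simp)
  constructor <;> linarith

end

/-- The nonlinear stress `u ⊗ u - E Eᵀ`. -/
def gg (u : Fin 2 → V → ℝ) (E : Fin 2 → Fin 2 → V → ℝ) (i j : Fin 2) (x : V) : ℝ :=
  u i x * u j x - ff E i j x

section
variable {u : Fin 2 → V → ℝ} {E : Fin 2 → Fin 2 → V → ℝ}

lemma Sm.gg (hu : ∀ i, Sm (u i)) (hE : ∀ i j, Sm (E i j)) (i j : Fin 2) : Sm (gg u E i j) :=
  ((hu i).mul (hu j)).sub (Sm.ff hE i j)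

lemma abs_mul_le_sqv (u : Fin 2 → V → ℝ) (i j : Fin 2) (x : V) : |u i x * u j x| ≤ sqv u x := by
  rw [abs_mul]
  have h1 := coord_sq_le u i x
  have h2 := coord_sq_le u j x
  nlinarith [sq_abs (u i x), sq_abs (u j x), sq_nonneg (|u i x| - |u j x|)]

lemma abs_gg_le (u : Fin 2 → V → ℝ) (E : Fin 2 → Fin 2 → V → ℝ) (i j : Fin 2) (x : V) :
    |gg u E i j x| ≤ sqv u x + sqm E x :=
  (abs_sub _ _).trans (add_le_add (abs_mul_le_sqv u i j x) (abs_ff_le E i j x))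

lemma lam_eq (hu : ∀ i, Sm (u i)) (hE : ∀ i j, Sm (E i j)) (hd : ∀ x, ∑ i, pd i (u i) x = 0)
    {w : Fin 2 → V → ℝ} (hw : ∀ i, Sm (w i)) (hc : ∀ i, HasCompactSupport (w i)) :
    lam u E w = ∑ i, ∑ j, ∫ x, gg u E i j x * pd j (w i) x := by
  have I1 : ∀ i j, Integrable fun x => u i x * u j x * pd j (w i) x := fun i j =>
    (((hu i).mul (hu j)).mul ((hw i).pd j)).integrable ((hc i).pd j).mul_left
  have I2 : ∀ i j, Integrable fun x => ff E i j x * pd j (w i) x := fun i j =>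
    ((Sm.ff hE i j).mul ((hw i).pd j)).integrable ((hc i).pd j).mul_left
  have e1 : ∀ i, ∫ x, nn u i x * w i x = -∑ j, ∫ x, u i x * u j x * pd j (w i) x := by
    intro i
    have e2 : ∀ j, ∫ x, u i x * u j x * pd j (w i) x
        = -∫ x, pd j (fun y => u i y * u j y) x * w i x :=
      fun j => integral_mul_pd_of_right ((hu i).mul (hu j)) (hw i) (hc i) j
    simp_rw [e2, Finset.sum_neg_distrib, neg_neg]
    rw [← integral_finsetSum _ fun j _ =>
      ((((hu i).mul (hu j)).pd j).mul (hw i)).integrable (hc i).mul_left]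
    refine integral_congr_ae (ae_of_all _ fun x => ?_)
    have := hd x
    simp only [nn, pd_mul (hu i) (hu _)]
    simp only [Fin.sum_univ_two] at this ⊢
    linear_combination (-(u i x * w i x)) * this
  simp_rw [lam, e1, gg, sub_mul, integral_sub (I1 _ _) (I2 _ _), Finset.sum_sub_distrib,
    Finset.sum_neg_distrib, neg_neg]

/-- The nonlinear terms, localised at radius `r`, as a singular integral up to a small error. -/
lemma Tst.exists_lam_sub {θ : Fin 2 → V → ℝ} (h : Tst θ) : ∃ C R : ℝ, 1 ≤ R ∧ 0 ≤ C ∧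
    ∀ r, R ≤ r → ∀ (u : Fin 2 → V → ℝ) (E : Fin 2 → Fin 2 → V → ℝ), (∀ i, Sm (u i)) →
      (∀ i j, Sm (E i j)) → (∀ x, ∑ i, pd i (u i) x = 0) → Integrable (sqv u) →
      Integrable (sqm E) →
      |lam u E (wf θ r) - ∑ i, ∑ j, ∫ x, (cut r x * gg u E i j x) * pd j (pot i (dv θ)) x|
        ≤ C / r * ((∫ x, sqv u x) + ∫ x, sqm E x) := by
  obtain ⟨C, R, hR, hC, hs⟩ := h.exists_shell
  refine ⟨4 * C, R, hR, by positivity, fun r hr u E hu hE hd iu iE => ?_⟩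
  have hr1 : 1 ≤ r := hR.trans hr
  have hr0 : 0 < r := by linarith
  obtain ⟨-, -, -, -, -, s⟩ := hs r hr
  have sg := fun i j => Sm.gg hu hE i j
  have ig : ∀ i j, Integrable (gg u E i j) := fun i j => by
    refine (iu.add iE).mono' (sg i j).cont.aestronglyMeasurable (ae_of_all _ fun x => ?_)
    exact abs_gg_le u E i j x
  have I1 : ∀ i j, Integrable fun x => gg u E i j x * pd j (wf θ r i) x := fun i j =>
    ((sg i j).mul ((h.sm_wf r i).pd j)).integrable ((cpt_wf hr0 i).pd j).mul_left
  have I2 : ∀ i j, Integrable fun x => (cut r x * gg u E i j x) * pd j (pot i (dv θ)) x :=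
    fun i j => (((sm_cut r).mul (sg i j)).mul ((sm_pot i h.sm_dv h.cpt_dv).pd j)).integrable
      ((hasCompactSupport_cut hr0).mul_right).mul_right
  have b : ∀ i j, |(∫ x, gg u E i j x * pd j (wf θ r i) x)
      - ∫ x, (cut r x * gg u E i j x) * pd j (pot i (dv θ)) x|
      ≤ C / r * ((∫ x, sqv u x) + ∫ x, sqm E x) := by
    intro i j
    rw [← integral_sub (I1 i j) (I2 i j)]
    have e : ∀ x, gg u E i j x * pd j (wf θ r i) x
        - cut r x * gg u E i j x * pd j (pot i (dv θ)) x
        = gg u E i j x * (pd j (wf θ r i) x - cut r x * pd j (pd i (qf θ)) x) := by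
      intro x
      rw [h.pd_qf i]
      ring
    simp_rw [e]
    refine ((s i j).integral_mul_le_abs (ig i j)).trans ?_
    have h1 : C / r ^ 3 ≤ C / r :=
      div_le_div_of_nonneg_left hC hr0 (le_self_pow₀ hr1 (by norm_num))
    have h2 : ∫ x, |gg u E i j x| ≤ (∫ x, sqv u x) + ∫ x, sqm E x := by
      rw [← integral_add iu iE]
      exact integral_mono (ig i j).abs (iu.add iE) fun x => abs_gg_le u E i j x
    exact mul_le_mul h1 h2 (integral_nonneg fun x => abs_nonneg _) (by positivity)
  rw [lam_eq hu hE hd (h.sm_wf r) (fun i => cpt_wf hr0 i)]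
  simp_rw [← Finset.sum_sub_distrib]
  refine ((Finset.abs_sum_le_sum_abs _ _).trans
    (Finset.sum_le_sum fun i _ => Finset.abs_sum_le_sum_abs _ _)).trans ?_
  simp_rw [Fin.sum_univ_two]
  have := b 0 0; have := b 0 1; have := b 1 0; have := b 1 1
  have e : 4 * C / r * ((∫ x, sqv u x) + ∫ x, sqm E x)
      = 4 * (C / r * ((∫ x, sqv u x) + ∫ x, sqm E x)) := by ring
  linarith

end

section
variable {U : Fin 2 → ℝ → V → ℝ} {E : Fin 2 → Fin 2 → ℝ → V → ℝ} {P : ℝ → V → ℝ} {T : ℝ}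

/-- The fourth power integral of the velocity. -/
def xx (U : Fin 2 → ℝ → V → ℝ) (t : ℝ) : ℝ := ∫ x, sqv (sl U t) x ^ 2

lemma xx_nn (U : Fin 2 → ℝ → V → ℝ) (t : ℝ) : 0 ≤ xx U t := integral_nonneg fun _ => sq_nonneg _

lemma Sol.exists_lam_bound (S : Sol U E P T) {K : ℝ}
    (hK : ∀ t ∈ Icc 0 T, (∫ x, sqv (sl U t) x) + ∫ x, sqm (slm E t) x ≤ K)
    {θ : Fin 2 → V → ℝ} (h : Tst θ) {β : ℝ → ℝ}
    (hβ : ∀ r : ℝ, 0 < r → ∀ τ ∈ Icc 0 T, ∀ i j,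
      |∫ x, (cut r x * gg (sl U τ) (slm E τ) i j x) * pd j (pot i (dv θ)) x| ≤ β τ) :
    ∃ κ : ℝ → ℝ, Tendsto κ atTop (nhds 0) ∧ ∀ᶠ r in atTop, ∀ τ ∈ Icc 0 T,
      |lam (sl U τ) (slm E τ) (wf θ r)| ≤ 4 * β τ + κ r * (1 + dis U τ) := by
  obtain ⟨C, R, hR, hC, hs⟩ := h.exists_lam_sub
  refine ⟨fun r => C * K * r⁻¹, by simpa using tendsto_inv_atTop_zero.const_mul (C * K), ?_⟩
  filter_upwards [eventually_ge_atTop R] with r hr τ hτ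
  have hr0 : 0 < r := by linarith
  have h1 := hs r hr (sl U τ) (slm E τ) (S.smU τ) (S.smE τ) (S.du τ hτ) (S.iu τ hτ) (S.iE τ hτ)
  have h2 : |∑ i, ∑ j, ∫ x, (cut r x * gg (sl U τ) (slm E τ) i j x) * pd j (pot i (dv θ)) x|
      ≤ 4 * β τ := by
    refine ((Finset.abs_sum_le_sum_abs _ _).trans
      (Finset.sum_le_sum fun i _ => Finset.abs_sum_le_sum_abs _ _)).trans ?_
    simp_rw [Fin.sum_univ_two]
    have b := hβ r hr0 τ hτ
    have := b 0 0; have := b 0 1; have := b 1 0; have := b 1 1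
    linarith
  have h3 : C / r * ((∫ x, sqv (sl U τ) x) + ∫ x, sqm (slm E τ) x)
      ≤ C * K * r⁻¹ * (1 + dis U τ) := by
    have hd := dis_nn U τ
    have hK0 : 0 ≤ K := le_trans (add_nonneg (integral_nonneg (sq_nn _))
      (integral_nonneg (sqm_nn _))) (hK τ hτ)
    have : C / r * ((∫ x, sqv (sl U τ) x) + ∫ x, sqm (slm E τ) x) ≤ C / r * K :=
      mul_le_mul_of_nonneg_left (hK τ hτ) (by positivity)
    have e : C / r * K = C * K * r⁻¹ := by rw [div_eq_mul_inv]; ring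
    rw [e] at this
    exact this.trans (le_mul_of_one_le_right (by positivity) (by linarith))
  have h4 := abs_sub_abs_le_abs_sub (lam (sl U τ) (slm E τ) (wf θ r))
    (∑ i, ∑ j, ∫ x, (cut r x * gg (sl U τ) (slm E τ) i j x) * pd j (pot i (dv θ)) x)
  linarith

lemma Sol.gg_sq_le (S : Sol U E P T) {τ : ℝ} (hτ : τ ∈ Icc 0 T) (i j : Fin 2) (x : V) :
    gg (sl U τ) (slm E τ) i j x ^ 2 ≤ 2 * sqv (sl U τ) x ^ 2 + sqm (slm E τ) x := by
  have h1 := abs_gg_le (sl U τ) (slm E τ) i j x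
  have h2 := S.bE τ hτ x
  have h3 := sqm_nn (slm E τ) x
  have h4 := sq_nn (sl U τ) x
  have h5 : gg (sl U τ) (slm E τ) i j x ^ 2 ≤ (sqv (sl U τ) x + sqm (slm E τ) x) ^ 2 := by
    rw [← sq_abs]
    exact pow_le_pow_left₀ (abs_nonneg _) h1 2
  nlinarith [sq_nonneg (sqv (sl U τ) x - sqm (slm E τ) x)]

/-- Bound of the nonlinear terms through the `L²` norms of the stress and of the divergence. -/
lemma Sol.exists_lam_two (S : Sol U E P T) {K : ℝ}
    (hK : ∀ t ∈ Icc 0 T, (∫ x, sqv (sl U t) x) + ∫ x, sqm (slm E t) x ≤ K)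
    {θ : Fin 2 → V → ℝ} (h : Tst θ) :
    ∃ κ : ℝ → ℝ, Tendsto κ atTop (nhds 0) ∧ ∀ᶠ r in atTop, ∀ τ ∈ Icc 0 T,
      |lam (sl U τ) (slm E τ) (wf θ r)| ≤ 4 * (2 + K) * √(∫ x, dv θ x ^ 2) * (1 + xx U τ)
        + κ r * (1 + dis U τ) := by
  obtain ⟨κ, h1, h2⟩ := S.exists_lam_bound hK h
    (β := fun τ => (2 + K) * √(∫ x, dv θ x ^ 2) * (1 + xx U τ)) (by
    intro r hr τ hτ i j
    have sg := Sm.gg (S.smU τ) (S.smE τ) i j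
    have ig2 : Integrable fun x => 2 * sqv (sl U τ) x ^ 2 + sqm (slm E τ) x :=
      ((S.iuu τ hτ).const_mul 2).add (S.iE τ hτ)
    have pw : ∀ x, (cut r x * gg (sl U τ) (slm E τ) i j x) ^ 2
        ≤ 2 * sqv (sl U τ) x ^ 2 + sqm (slm E τ) x := by
      intro x
      refine le_trans ?_ (S.gg_sq_le hτ i j x)
      rw [mul_pow]
      exact mul_le_of_le_one_left (sq_nonneg _)
        (pow_le_one₀ (cut_nonneg r x) (cut_le_one r x))
    have i3 : Integrable fun x => (cut r x * gg (sl U τ) (slm E τ) i j x) ^ 2 :=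
      ig2.mono' (((sm_cut r).mul sg).pow 2).cont.aestronglyMeasurable
        (ae_of_all _ fun x => by rw [Real.norm_of_nonneg (sq_nonneg _)]; exact pw x)
    have hp := (sm_pot i h.sm_dv h.cpt_dv).pd j
    refine (abs_integral_mul_le ((sm_cut r).mul sg).cont.aestronglyMeasurable
      hp.cont.aestronglyMeasurable i3
      (integrable_pd_pot_sq j i h.sm_dv h.cpt_dv)).trans ?_
    have hX := xx_nn U τ
    have hE0 : 0 ≤ ∫ x, sqm (slm E τ) x := integral_nonneg (sqm_nn _)
    have hu0 : 0 ≤ ∫ x, sqv (sl U τ) x := integral_nonneg (sq_nn _)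
    have hKτ := hK τ hτ
    have a1 : √(∫ x, (cut r x * gg (sl U τ) (slm E τ) i j x) ^ 2) ≤ (2 + K) * (1 + xx U τ) := by
      have : ∫ x, (cut r x * gg (sl U τ) (slm E τ) i j x) ^ 2 ≤ 2 * xx U τ + K := by
        refine (integral_mono i3 ig2 pw).trans ?_
        rw [integral_add ((S.iuu τ hτ).const_mul 2) (S.iE τ hτ), integral_const_mul]
        simp only [xx]
        linarith
      refine (Real.sqrt_le_sqrt this).trans ?_
      have hK0 : 0 ≤ K := by linarith
      rw [Real.sqrt_le_left (by positivity)]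
      have h6 : 2 * xx U τ + K ≤ (2 + K) * (1 + xx U τ) := by nlinarith
      have h7 : 1 ≤ (2 + K) * (1 + xx U τ) := by nlinarith
      nlinarith
    have a2 : √(∫ x, pd j (pot i (dv θ)) x ^ 2) ≤ √(∫ x, dv θ x ^ 2) :=
      Real.sqrt_le_sqrt (integral_pd_pot_sq_le j i h.sm_dv h.cpt_dv)
    have := mul_le_mul a1 a2 (Real.sqrt_nonneg _) ((Real.sqrt_nonneg _).trans a1)
    linarith)
  refine ⟨κ, h1, h2.mono fun r hr τ hτ => (hr τ hτ).trans (le_of_eq (by ring))⟩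

/-- Bound of the nonlinear terms through the `L⁴` norm of the stress. -/
lemma Sol.exists_lam_four (S : Sol U E P T) {K : ℝ}
    (hK : ∀ t ∈ Icc 0 T, (∫ x, sqv (sl U t) x) + ∫ x, sqm (slm E t) x ≤ K)
    {θ : Fin 2 → V → ℝ} (h : Tst θ) {p q : V → ℝ} (hp : AEStronglyMeasurable p volume)
    (hq : AEStronglyMeasurable q volume) (hp4 : Integrable (fun x => p x ^ 4))
    (hq2 : Integrable (fun x => q x ^ 2)) (hpq : ∀ x, |dv θ x| ≤ |p x * q x|) {γ : ℝ → ℝ}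
    (hγ : ∀ τ ∈ Icc 0 T, ∀ i j, Integrable (fun x => gg (sl U τ) (slm E τ) i j x ^ 4) ∧
      ∫ x, gg (sl U τ) (slm E τ) i j x ^ 4 ≤ γ τ) :
    ∃ κ : ℝ → ℝ, Tendsto κ atTop (nhds 0) ∧ ∀ᶠ r in atTop, ∀ τ ∈ Icc 0 T,
      |lam (sl U τ) (slm E τ) (wf θ r)|
        ≤ 4 * √(√cR) * (√(√(∫ x, p x ^ 4)) * √(∫ x, q x ^ 2)) * √(√(γ τ))
        + κ r * (1 + dis U τ) := by
  obtain ⟨κ, h1, h2⟩ := S.exists_lam_bound hK h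
    (β := fun τ => √(√cR) * (√(√(∫ x, p x ^ 4)) * √(∫ x, q x ^ 2)) * √(√(γ τ))) (by
    intro r hr τ hτ i j
    have sg := Sm.gg (S.smU τ) (S.smE τ) i j
    have cg : HasCompactSupport fun x => cut r x * gg (sl U τ) (slm E τ) i j x :=
      (hasCompactSupport_cut hr).mul_right
    refine (integral_mul_pd_pot_four_le j i ((sm_cut r).mul sg) cg h.sm_dv h.cpt_dv hp hq hp4 hq2
      hpq).trans ?_
    have a : ∫ x, (cut r x * gg (sl U τ) (slm E τ) i j x) ^ 4 ≤ γ τ := by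
      refine le_trans (integral_mono_of_nonneg (ae_of_all _ fun x => by positivity)
        (hγ τ hτ i j).1 (ae_of_all _ fun x => ?_)) (hγ τ hτ i j).2
      simp only [mul_pow]
      exact mul_le_of_le_one_left (by positivity) (pow_le_one₀ (cut_nonneg r x) (cut_le_one r x))
    have hc := cR_pos.le
    have e : √(√cR) * (√(√(∫ x, p x ^ 4)) * √(∫ x, q x ^ 2)) * √(√(γ τ))
        = √(√(cR * γ τ) * √(∫ x, p x ^ 4)) * √(∫ x, q x ^ 2) := by
      rw [Real.sqrt_mul hc, Real.sqrt_mul (by positivity), Real.sqrt_mul (by positivity)]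
      ring
    rw [e]
    gcongr)
  refine ⟨κ, h1, h2.mono fun r hr τ hτ => (hr τ hτ).trans (le_of_eq (by ring))⟩

end

/-- The tail `‖x‖⁻³` outside the unit ball. -/
def tl (x : V) : ℝ := indicator {x : V | 1 ≤ ‖x‖} (fun x => (‖x‖ ^ 3)⁻¹) x

lemma tl_nonneg (x : V) : 0 ≤ tl x := indicator_nonneg (fun _ _ => by positivity) x

lemma integrable_tl : Integrable tl := by
  have h : Integrable (fun x : V => (1 + ‖x‖) ^ (-(3 : ℝ))) :=
    integrable_one_add_norm (by simp; norm_num)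
  refine (h.const_mul 8).mono' ?_ (ae_of_all _ fun x => ?_)
  · exact (Measurable.indicator (by fun_prop) (measurableSet_le measurable_const measurable_norm)
      ).aestronglyMeasurable
  rw [Real.norm_of_nonneg (tl_nonneg x), tl]
  by_cases hx : x ∈ {x : V | 1 ≤ ‖x‖}
  · rw [indicator_of_mem hx]
    have hx' : 1 ≤ ‖x‖ := hx
    rw [Real.rpow_neg (by positivity), show ((3 : ℝ)) = ((3 : ℕ) : ℝ) by norm_num,
      Real.rpow_natCast, ← div_eq_mul_inv, le_div_iff₀ (by positivity), inv_mul_le_iff₀ (by positivity)]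
    calc (1 + ‖x‖) ^ 3 ≤ (2 * ‖x‖) ^ 3 := pow_le_pow_left₀ (by positivity) (by linarith) 3
      _ = _ := by ring
  · rw [indicator_of_notMem hx]
    positivity

/-- Total mass of the tail. -/
def cT : ℝ := ∫ x, tl x

lemma cT_nonneg : 0 ≤ cT := integral_nonneg tl_nonneg

lemma integral_tl_smul {a : ℝ} (ha : 0 < a) : ∫ x, tl (a⁻¹ • x) = a ^ 2 * cT := by
  rw [Measure.integral_comp_inv_smul, cT]
  simp [abs_of_pos (pow_pos ha 2)]

lemma le_tl_smul {a : ℝ} (ha : 0 < a) {x : V} (hx : a ≤ ‖x‖) :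
    (‖x‖ ^ 3)⁻¹ = (a ^ 3)⁻¹ * tl (a⁻¹ • x) := by
  have h1 : a⁻¹ • x ∈ {x : V | 1 ≤ ‖x‖} := by
    rw [mem_ofPred_eq, norm_smul, norm_inv, Real.norm_of_nonneg ha.le, inv_mul_eq_div,
      le_div_iff₀ ha]
    linarith
  rw [tl, indicator_of_mem h1, norm_smul, norm_inv, Real.norm_of_nonneg ha.le]
  field_simp

section
variable {θ : Fin 2 → V → ℝ} {ρ : ℝ}

lemma Tst.integral_pd_qf_sq_le (h : Tst θ) (i : Fin 2) :
    Integrable (fun x => pd i (qf θ) x ^ 2) ∧ ∫ x, pd i (qf θ) x ^ 2 ≤ 2 * ∫ x, sqv θ x := by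
  have i0 := fun l => integrable_pd_pot_sq i l (h.sm l) (h.cpt l)
  have b0 := fun l => integral_pd_pot_sq_le i l (h.sm l) (h.cpt l)
  have iθ : ∀ l, Integrable (fun x => θ l x ^ 2) := fun l =>
    ((h.sm l).pow 2).integrable (by simp_rw [pow_two]; exact (h.cpt l).mul_left)
  have i2 : Integrable (fun x => 2 * (pd i (pot 0 (θ 0)) x ^ 2 + pd i (pot 1 (θ 1)) x ^ 2)) :=
    ((i0 0).add (i0 1)).const_mul 2
  have pw : ∀ x, pd i (qf θ) x ^ 2
      ≤ 2 * (pd i (pot 0 (θ 0)) x ^ 2 + pd i (pot 1 (θ 1)) x ^ 2) := fun x => by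
    rw [h.pd_qf_eq]
    nlinarith [sq_nonneg (pd i (pot 0 (θ 0)) x - pd i (pot 1 (θ 1)) x)]
  have i1 : Integrable (fun x => pd i (qf θ) x ^ 2) :=
    i2.mono' ((h.sm_qf.pd i).pow 2).cont.aestronglyMeasurable
      (ae_of_all _ fun x => by rw [Real.norm_of_nonneg (sq_nonneg _)]; exact pw x)
  refine ⟨i1, (integral_mono i1 i2 pw).trans ?_⟩
  simp_rw [sqv]
  rw [integral_const_mul, integral_add (i0 0) (i0 1), integral_finsetSum _ fun l _ => iθ l,
    Fin.sum_univ_two]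
  linarith [b0 0, b0 1]

/-- `L¹`-type bound for the Hessian of the potential, tested against bounded functions. -/
lemma Tst.abs_integral_hess_le (h : Tst θ) (hρ : 0 < ρ) (hθ : ∀ i x, ρ < ‖x‖ → θ i x = 0)
    {f : V → ℝ} {D : ℝ} (hf : ∀ x, |f x| ≤ D) (i j : Fin 2) :
    |∫ x, f x * pd j (pd i (qf θ)) x|
      ≤ D * (4 * ρ * √(∫ x, dv θ x ^ 2) + 4 * cK * cT * ((∫ x, |θ 0 x|) + ∫ x, |θ 1 x|) / ρ) := by
  have hD : 0 ≤ D := (abs_nonneg _).trans (hf 0)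
  set L := (∫ x, |θ 0 x|) + ∫ x, |θ 1 x| with hL
  have hL0 : 0 ≤ L := add_nonneg (integral_nonneg fun _ => abs_nonneg _)
    (integral_nonneg fun _ => abs_nonneg _)
  have hsm : Sm (pd j (pd i (qf θ))) := (h.sm_qf.pd i).pd j
  have hq2 : Integrable (fun x => pd j (pd i (qf θ)) x ^ 2) := by
    rw [h.pd_qf i]; exact integrable_pd_pot_sq j i h.sm_dv h.cpt_dv
  have hq2' : ∫ x, pd j (pd i (qf θ)) x ^ 2 ≤ ∫ x, dv θ x ^ 2 := by
    rw [h.pd_qf i]; exact integral_pd_pot_sq_le j i h.sm_dv h.cpt_dv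
  have far : ∀ x, 2 * ρ ≤ ‖x‖ → |pd j (pd i (qf θ)) x| ≤ 8 * cK * L * (‖x‖ ^ 3)⁻¹ := by
    intro x hx
    have e : pd i (qf θ) = fun x => pd i (pot 0 (θ 0)) x + pd i (pot 1 (θ 1)) x :=
      funext fun x => h.pd_qf_eq i x
    rw [e, pd_add ((sm_pot 0 (h.sm 0) (h.cpt 0)).pd i) ((sm_pot 1 (h.sm 1) (h.cpt 1)).pd i)]
    have a := fun l => abs_pd_pd_pot_le_far j i l (h.sm l) (h.cpt l) hρ (hθ l) hx
    refine (abs_add_le _ _).trans ((add_le_add (a 0) (a 1)).trans (le_of_eq ?_))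
    rw [hL, div_eq_mul_inv, div_eq_mul_inv]
    ring
  set B := Metric.closedBall (0 : V) (2 * ρ)
  have hB : MeasurableSet B := measurableSet_closedBall
  have iB : IntegrableOn (fun x => |pd j (pd i (qf θ)) x|) B :=
    (hsm.cont.abs.continuousOn).integrableOn_compact (isCompact_closedBall _ _)
  have iB' : Integrable (B.indicator fun x => |pd j (pd i (qf θ)) x|) :=
    (integrable_indicator_iff hB).2 iB
  have iT : Integrable (fun x : V => tl ((2 * ρ)⁻¹ • x)) :=
    integrable_tl.comp_smul (by positivity)
  have hcK : 0 ≤ 8 * cK * L * ((2 * ρ) ^ 3)⁻¹ := by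
    have : 0 ≤ cK := cK_pos.le
    positivity
  have pw : ∀ x, |f x * pd j (pd i (qf θ)) x| ≤ D * (B.indicator (fun x => |pd j (pd i (qf θ)) x|) x
      + 8 * cK * L * ((2 * ρ) ^ 3)⁻¹ * tl ((2 * ρ)⁻¹ • x)) := by
    intro x
    rw [abs_mul]
    refine mul_le_mul (hf x) ?_ (abs_nonneg _) hD
    by_cases hx : x ∈ B
    · rw [indicator_of_mem hx]
      have := mul_nonneg hcK (tl_nonneg ((2 * ρ)⁻¹ • x))
      linarith
    · have hx' : 2 * ρ < ‖x‖ := by simpa [B] using hx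
      rw [indicator_of_notMem hx, zero_add, mul_assoc, ← le_tl_smul (by positivity) hx'.le]
      exact far x hx'.le
  have cs : ∫ x in B, |pd j (pd i (qf θ)) x| ≤ 4 * ρ * √(∫ x, dv θ x ^ 2) := by
    have h1 := abs_integral_mul_le (μ := volume.restrict B) (f := fun _ => (1 : ℝ))
      (g := fun x => |pd j (pd i (qf θ)) x|) aestronglyMeasurable_const
      hsm.cont.abs.aestronglyMeasurable
      (by simp only [one_pow]; exact integrableOn_const measure_closedBall_lt_top.ne)
      (by simp only [sq_abs]; exact hq2.integrableOn)
    simp only [one_mul, one_pow, sq_abs] at h1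
    have h2 : ∫ _ in B, (1 : ℝ) = (4 * ρ) ^ 2 := by
      rw [setIntegral_const, volume_real_ball (by positivity), smul_eq_mul]
      ring
    rw [h2, Real.sqrt_sq (by positivity)] at h1
    refine (le_abs_self _).trans (h1.trans ?_)
    refine mul_le_mul_of_nonneg_left (Real.sqrt_le_sqrt ?_) (by positivity)
    exact (setIntegral_le_integral hq2 (ae_of_all _ fun x => sq_nonneg _)).trans hq2'
  refine abs_integral_le_integral_abs.trans ((integral_mono_of_nonneg
    (ae_of_all _ fun x => abs_nonneg _) ((iB'.add (iT.const_mul _)).const_mul D)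
    (ae_of_all _ pw)).trans ?_)
  rw [integral_const_mul, integral_add' iB' (iT.const_mul _), integral_indicator hB,
    integral_const_mul, integral_tl_smul (by positivity)]
  refine mul_le_mul_of_nonneg_left (add_le_add cs (le_of_eq ?_)) hD
  field_simp
  ring

/-- Bound of the nonlinear terms by the dissipation alone. -/
lemma Tst.exists_lam_le (h : Tst θ) (hρ : 0 < ρ) (hθ : ∀ i x, ρ < ‖x‖ → θ i x = 0) :
    ∃ C R : ℝ, 1 ≤ R ∧ 0 ≤ C ∧ ∀ r, R ≤ r → ∀ (u : Fin 2 → V → ℝ) (E : Fin 2 → Fin 2 → V → ℝ),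
      (∀ i, Sm (u i)) → (∀ i j, Sm (E i j)) → (∀ i j x, |ff E i j x| ≤ 1 / 4) →
      Integrable (fun x => sqv u x * gr u x) →
      |lam u E (wf θ r)| ≤ (2 * √(2 * ∫ x, sqv θ x) + (4 * ρ * √(∫ x, dv θ x ^ 2)
        + 4 * cK * cT * ((∫ x, |θ 0 x|) + ∫ x, |θ 1 x|) / ρ) + C / r)
          * (1 + ∫ x, sqv u x * gr u x) := by
  obtain ⟨C, R, hR, hC, hs⟩ := h.exists_shell
  refine ⟨24 * C, R, hR, by positivity, fun r hr u E hu hE hf id => ?_⟩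
  have hr1 : 1 ≤ r := hR.trans hr
  have hr0 : 0 < r := by linarith
  obtain ⟨-, -, -, -, s1, s2⟩ := hs r hr
  set d := ∫ x, sqv u x * gr u x
  have hd : 0 ≤ d := integral_nonneg fun x => mul_nonneg (sq_nn _ x) (gr_nn _ x)
  have hsd : √d ≤ 1 + d := by
    rw [Real.sqrt_le_left (by positivity)]
    nlinarith
  have iN : ∀ i, Integrable (fun x => nn u i x ^ 2) := fun i =>
    id.mono' ((Sm.nn hu i).pow 2).cont.aestronglyMeasurable
      (ae_of_all _ fun x => by rw [Real.norm_of_nonneg (sq_nonneg _)]; exact nn_sq_le u i x)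
  have bN : ∀ i, √(∫ x, nn u i x ^ 2) ≤ 1 + d := fun i =>
    (Real.sqrt_le_sqrt (integral_mono (iN i) id (nn_sq_le u i))).trans hsd
  have a1 : ∀ i, |∫ x, nn u i x * wf θ r i x| ≤ (√(2 * ∫ x, sqv θ x) + 4 * C / r) * (1 + d) := by
    intro i
    obtain ⟨iq, bq⟩ := h.integral_pd_qf_sq_le i
    have sq1 := (sm_cut r).mul (h.sm_qf.pd i)
    have sq2 := h.sm_ps.mul ((sm_cut r).pg i)
    have c1 : HasCompactSupport (fun x => cut r x * pd i (qf θ) x) :=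
      (hasCompactSupport_cut hr0).mul_right
    have c2 : HasCompactSupport (fun x => ps θ x * pg i (cut r) x) :=
      ((hasCompactSupport_cut hr0).pg i).mul_left
    have e : ∫ x, nn u i x * wf θ r i x = (∫ x, nn u i x * (cut r x * pd i (qf θ) x))
        - ∫ x, nn u i x * (ps θ x * pg i (cut r) x) := by
      rw [← integral_sub (((Sm.nn hu i).mul sq1).integrable c1.mul_left)
        (((Sm.nn hu i).mul sq2).integrable c2.mul_left)]
      simp_rw [wf, mul_sub]
    have pw : ∀ x, (cut r x * pd i (qf θ) x) ^ 2 ≤ pd i (qf θ) x ^ 2 := fun x => by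
      rw [mul_pow]
      exact mul_le_of_le_one_left (sq_nonneg _) (pow_le_one₀ (cut_nonneg r x) (cut_le_one r x))
    have i3 : Integrable (fun x => (cut r x * pd i (qf θ) x) ^ 2) :=
      iq.mono' (sq1.pow 2).cont.aestronglyMeasurable
        (ae_of_all _ fun x => by rw [Real.norm_of_nonneg (sq_nonneg _)]; exact pw x)
    have b1 : |∫ x, nn u i x * (cut r x * pd i (qf θ) x)| ≤ (1 + d) * √(2 * ∫ x, sqv θ x) := by
      refine (abs_integral_mul_le (Sm.nn hu i).cont.aestronglyMeasurable
        sq1.cont.aestronglyMeasurable (iN i) i3).trans ?_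
      exact mul_le_mul (bN i) (Real.sqrt_le_sqrt ((integral_mono i3 iq pw).trans bq))
        (Real.sqrt_nonneg _) (by positivity)
    have b2 : |∫ x, nn u i x * (ps θ x * pg i (cut r) x)| ≤ (1 + d) * (4 * C / r) := by
      refine ((s1 i).integral_mul_le_sqrt hr0.le sq2.cont c2 (Sm.nn hu i).cont (iN i)).trans ?_
      have : C / r ^ 2 * (4 * r) = 4 * C / r := by field_simp
      rw [this]
      exact mul_le_mul_of_nonneg_right (bN i) (by positivity)
    rw [e]
    refine (abs_sub _ _).trans ((add_le_add b1 b2).trans (le_of_eq (by ring)))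
  set Λ := 4 * ρ * √(∫ x, dv θ x ^ 2) + 4 * cK * cT * ((∫ x, |θ 0 x|) + ∫ x, |θ 1 x|) / ρ with hΛ
  have hΛ0 : 0 ≤ Λ := by
    have := cK_pos.le
    have := cT_nonneg
    have : 0 ≤ (∫ x, |θ 0 x|) + ∫ x, |θ 1 x| := add_nonneg (integral_nonneg fun _ => abs_nonneg _)
      (integral_nonneg fun _ => abs_nonneg _)
    positivity
  have a2 : ∀ i j, |∫ x, ff E i j x * pd j (wf θ r i) x| ≤ (1 / 4 * Λ + 4 * C / r) * (1 + d) := by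
    intro i j
    have sf := Sm.ff hE i j
    have I1 : Integrable fun x => ff E i j x * pd j (wf θ r i) x :=
      (sf.mul ((h.sm_wf r i).pd j)).integrable ((cpt_wf hr0 i).pd j).mul_left
    have I2 : Integrable fun x => (ff E i j x * cut r x) * pd j (pd i (qf θ)) x :=
      ((sf.mul (sm_cut r)).mul ((h.sm_qf.pd i).pd j)).integrable
        ((hasCompactSupport_cut hr0).mul_left).mul_right
    have e : ∫ x, ff E i j x * pd j (wf θ r i) x
        = (∫ x, (ff E i j x * cut r x) * pd j (pd i (qf θ)) x)
          + ∫ x, ff E i j x * (pd j (wf θ r i) x - cut r x * pd j (pd i (qf θ)) x) := by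
      rw [← sub_eq_iff_eq_add', ← integral_sub I1 I2]
      refine integral_congr_ae (ae_of_all _ fun x => ?_)
      simp only
      ring
    have b1 := h.abs_integral_hess_le hρ hθ (f := fun x => ff E i j x * cut r x) (D := 1 / 4)
      (fun x => by
        rw [abs_mul, abs_of_nonneg (cut_nonneg r x)]
        exact (mul_le_of_le_one_right (abs_nonneg _) (cut_le_one r x)).trans (hf i j x)) i j
    have b2 := (s2 i j).integral_abs_mul_le hr0.le (hf i j)
    have b3 : 1 / 4 * (C / r ^ 3) * (16 * r ^ 2) = 4 * C / r := by field_simp; ring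
    rw [b3] at b2
    rw [e]
    refine (abs_add_le _ _).trans ((add_le_add b1 b2).trans ?_)
    exact le_mul_of_one_le_right (by positivity) (by linarith)
  rw [lam]
  refine (abs_sub _ _).trans ?_
  rw [abs_neg]
  refine (add_le_add (Finset.abs_sum_le_sum_abs _ _) ((Finset.abs_sum_le_sum_abs _ _).trans
    (Finset.sum_le_sum fun i _ => Finset.abs_sum_le_sum_abs _ _))).trans ?_
  simp_rw [Fin.sum_univ_two]
  have := a1 0; have := a1 1; have := a2 0 0; have := a2 0 1; have := a2 1 0; have := a2 1 1
  have e : (2 * √(2 * ∫ x, sqv θ x) + Λ + 24 * C / r) * (1 + d)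
      = 2 * ((√(2 * ∫ x, sqv θ x) + 4 * C / r) * (1 + d))
        + 4 * ((1 / 4 * Λ + 4 * C / r) * (1 + d)) := by ring
  linarith

end

lemma integral_mul_exp_le {k : ℝ → ℝ} (hk : Integrable k) (h0 : ∀ s, 0 ≤ k s) {t : ℝ} (ht : 0 ≤ t) :
    IntegrableOn (fun s => k s * exp (∫ y in (0:ℝ)..s, k y)) (Ioc 0 t) ∧
    ∫ s in Ioc 0 t, k s * exp (∫ y in (0:ℝ)..s, k y)
      ≤ exp (∫ y in (0:ℝ)..t, k y) - 1 := by
  set K : ℝ → ℝ := fun s => ∫ y in (0:ℝ)..s, k y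
  have cK : Continuous K := intervalIntegral.continuous_primitive (fun a b => hk.intervalIntegrable) 0
  have mK : Monotone K := by
    intro a b hab
    have := intervalIntegral.integral_add_adjacent_intervals
      (hk.intervalIntegrable (a := 0) (b := a)) (hk.intervalIntegrable (a := a) (b := b))
    have h2 : 0 ≤ ∫ y in a..b, k y := intervalIntegral.integral_nonneg hab fun s _ => h0 s
    simp only [K]
    linarith
  have mE : Monotone (fun s => exp (K s)) := fun a b hab => Real.exp_le_exp.2 (mK hab)
  have h1 := (mE.monotoneOn (uIcc 0 t)).intervalIntegral_deriv_mem_uIcc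
  have hae : ∀ᵐ s, deriv (fun s => exp (K s)) s = k s * exp (K s) := by
    filter_upwards [LocallyIntegrable.ae_hasDerivAt_integral hk.locallyIntegrable] with s hs
    rw [((hs 0).exp).deriv, mul_comm]
  have h2 : ∫ s in (0:ℝ)..t, deriv (fun s => exp (K s)) s
      = ∫ s in Ioc 0 t, k s * exp (K s) := by
    rw [intervalIntegral.integral_of_le ht]
    exact integral_congr_ae (ae_restrict_of_ae hae)
  have hK0 : K 0 = 0 := intervalIntegral.integral_same
  have hKt : 0 ≤ K t := hK0 ▸ mK ht
  rw [h2, hK0, Real.exp_zero, uIcc_of_le (by linarith [Real.one_le_exp hKt])] at h1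
  refine ⟨?_, h1.2⟩
  refine Integrable.mul_bdd (c := exp (K t)) hk.integrableOn
    (Real.continuous_exp.comp cK).aestronglyMeasurable ?_
  rw [ae_restrict_iff' measurableSet_Ioc]
  refine ae_of_all _ fun s hs => ?_
  rw [Real.norm_eq_abs, Real.abs_exp]
  exact mE hs.2

/-- Grönwall's inequality in integral form with an integrable kernel. -/
lemma gronwall_integral {T A B : ℝ} {k X : ℝ → ℝ} (hk : IntegrableOn k (Ioc 0 T))
    (h0 : ∀ s ∈ Ioc 0 T, 0 ≤ k s) (hX0 : ∀ t ∈ Icc 0 T, 0 ≤ X t)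
    (hXB : ∀ t ∈ Icc 0 T, X t ≤ B)
    (h : ∀ t ∈ Icc 0 T, X t ≤ A + ∫ s in Ioc 0 t, k s * X s) :
    ∀ t ∈ Icc 0 T, X t ≤ 2 * A * exp (2 * ∫ s in Ioc 0 t, k s) := by
  intro t₀ ht₀
  have hT : 0 ≤ T := ht₀.1.trans ht₀.2
  set k' : ℝ → ℝ := (Ioc 0 T).indicator fun s => 2 * k s
  have ik : Integrable k' := (integrable_indicator_iff measurableSet_Ioc).2 (hk.const_mul 2)
  have nk : ∀ s, 0 ≤ k' s := indicator_nonneg fun s hs => mul_nonneg zero_le_two (h0 s hs)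
  set K : ℝ → ℝ := fun s => ∫ y in (0:ℝ)..s, k' y
  have eK : ∀ t ∈ Icc 0 T, K t = 2 * ∫ s in Ioc 0 t, k s := by
    intro t ht
    simp only [K]
    rw [intervalIntegral.integral_of_le ht.1, ← integral_const_mul]
    refine setIntegral_congr_fun measurableSet_Ioc fun s hs => ?_
    exact indicator_of_mem (s := Ioc 0 T) (f := fun s => 2 * k s) ⟨hs.1, hs.2.trans ht.2⟩
  have Kn : ∀ t, 0 ≤ t → 0 ≤ K t := fun t ht => intervalIntegral.integral_nonneg ht fun s _ => nk s
  set G : Set ℝ := (fun t => X t * exp (-K t)) '' Icc 0 T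
  have hne : G.Nonempty := ⟨_, t₀, ht₀, rfl⟩
  have hbd : BddAbove G := by
    refine ⟨B, ?_⟩
    rintro _ ⟨t, ht, rfl⟩
    have : exp (-K t) ≤ 1 := Real.exp_le_one_iff.2 (by linarith [Kn t ht.1])
    exact (mul_le_of_le_one_right (hX0 t ht) this).trans (hXB t ht)
  set S := sSup G
  have hS : ∀ t ∈ Icc 0 T, X t ≤ S * exp (K t) := by
    intro t ht
    have h1 : X t * exp (-K t) ≤ S := le_csSup hbd ⟨t, ht, rfl⟩
    have h2 := mul_le_mul_of_nonneg_right h1 (Real.exp_pos (K t)).le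
    rwa [mul_assoc, ← Real.exp_add, neg_add_cancel, Real.exp_zero, mul_one] at h2
  have hS0 : 0 ≤ S := by
    have h1 : X t₀ * exp (-K t₀) ≤ S := le_csSup hbd ⟨t₀, ht₀, rfl⟩
    exact (mul_nonneg (hX0 t₀ ht₀) (Real.exp_pos _).le).trans h1
  have hA : 0 ≤ A := by
    have h1 := h 0 ⟨le_rfl, hT⟩
    have h2 := hX0 0 ⟨le_rfl, hT⟩
    simp at h1
    linarith
  have key : S ≤ A + S / 2 := by
    refine csSup_le hne ?_
    rintro _ ⟨t, ht, rfl⟩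
    obtain ⟨i1, i2⟩ := integral_mul_exp_le ik nk ht.1
    have h1 : ∫ s in Ioc 0 t, k s * X s
        ≤ ∫ s in Ioc 0 t, S / 2 * (k' s * exp (K s)) := by
      refine integral_mono_of_nonneg ?_ (i1.const_mul _) ?_
      · rw [EventuallyLE, ae_restrict_iff' measurableSet_Ioc]
        exact ae_of_all _ fun s hs => mul_nonneg (h0 s ⟨hs.1, hs.2.trans ht.2⟩)
          (hX0 s ⟨hs.1.le, hs.2.trans ht.2⟩)
      · rw [EventuallyLE, ae_restrict_iff' measurableSet_Ioc]
        refine ae_of_all _ fun s hs => ?_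
        have m : s ∈ Ioc 0 T := ⟨hs.1, hs.2.trans ht.2⟩
        have e : k' s = 2 * k s := indicator_of_mem m _
        have h2 := mul_le_mul_of_nonneg_left (hS s ⟨hs.1.le, hs.2.trans ht.2⟩) (h0 s m)
        rw [e]
        linarith
    rw [integral_const_mul] at h1
    have h3 : S / 2 * ∫ s in Ioc 0 t, k' s * exp (K s) ≤ S / 2 * (exp (K t) - 1) :=
      mul_le_mul_of_nonneg_left i2 (by linarith)
    have h4 := h t ht
    have h5 : exp (-K t) ≤ 1 := Real.exp_le_one_iff.2 (by linarith [Kn t ht.1])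
    have h6 : exp (K t) * exp (-K t) = 1 := by
      rw [← Real.exp_add, add_neg_cancel, Real.exp_zero]
    have h7 := mul_le_mul_of_nonneg_right
      (show X t ≤ A + S / 2 * (exp (K t) - 1) by linarith) (Real.exp_pos (-K t)).le
    have h8 := mul_le_mul_of_nonneg_left h5 hA
    have h9 : 0 ≤ S / 2 * exp (-K t) := by positivity
    simp only
    nlinarith
  have := hS t₀ ht₀
  rw [eK t₀ ht₀] at this
  refine this.trans (mul_le_mul_of_nonneg_right (by linarith) (Real.exp_pos _).le)

/-- Fatou's lemma for Bochner integrals of nonnegative functions. -/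
lemma integrable_of_fatou {α : Type*} [MeasurableSpace α] {μ : Measure α} {g : ℕ → α → ℝ}
    {G : α → ℝ} {a : ℕ → ℝ} {A : ℝ} (h0 : ∀ n, ∀ᵐ x ∂μ, 0 ≤ g n x) (hi : ∀ n, Integrable (g n) μ)
    (hl : ∀ᵐ x ∂μ, Tendsto (fun n => g n x) atTop (nhds (G x))) (ha : ∀ n, ∫ x, g n x ∂μ ≤ a n)
    (hA : Tendsto a atTop (nhds A)) : Integrable G μ ∧ ∫ x, G x ∂μ ≤ A := by
  have hm : AEStronglyMeasurable G μ :=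
    aestronglyMeasurable_of_tendsto_ae _ (fun n => (hi n).aestronglyMeasurable) hl
  have hG0 : 0 ≤ᵐ[μ] G := by
    filter_upwards [hl, ae_all_iff.2 h0] with x hx h
    exact ge_of_tendsto' hx h
  have h1 : ∫⁻ x, ofReal (G x) ∂μ ≤ ofReal A := by
    calc ∫⁻ x, ofReal (G x) ∂μ
        = ∫⁻ x, liminf (fun n => ofReal (g n x)) atTop ∂μ := by
          refine lintegral_congr_ae ?_
          filter_upwards [hl] with x hx
          exact ((ENNReal.continuous_ofReal.tendsto _).comp hx).liminf_eq.symm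
      _ ≤ liminf (fun n => ∫⁻ x, ofReal (g n x) ∂μ) atTop :=
          lintegral_liminf_le' fun n => (hi n).aestronglyMeasurable.aemeasurable.ennreal_ofReal
      _ ≤ liminf (fun n => ofReal (a n)) atTop := by
          refine liminf_le_liminf (Eventually.of_forall fun n => ?_)
          rw [← ofReal_integral_eq_lintegral_ofReal (hi n) (h0 n)]
          exact ENNReal.ofReal_le_ofReal (ha n)
      _ = ofReal A := ((ENNReal.continuous_ofReal.tendsto _).comp hA).liminf_eq
  have h2 : Integrable G μ :=
    (lintegral_ofReal_ne_top_iff_integrable hm hG0).1 (h1.trans_lt ENNReal.ofReal_lt_top).ne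
  refine ⟨h2, ?_⟩
  rw [← ofReal_integral_eq_lintegral_ofReal h2 hG0] at h1
  have hA0 : 0 ≤ A := ge_of_tendsto' hA fun n => (integral_nonneg_of_ae (h0 n)).trans (ha n)
  exact (ENNReal.ofReal_le_ofReal_iff hA0).1 h1

lemma tendsto_cut_sq_mul (f : V → ℝ) (x : V) :
    Tendsto (fun n : ℕ => cut ((n : ℝ) + 1) x ^ 2 * f x) atTop (nhds (f x)) := by
  have h1 := ((tendsto_cut x).pow 2).mul_const (f x)
  simpa using h1

lemma integrable_cut_sq_mul {f : V → ℝ} (hf : Integrable f) (r : ℝ) :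
    Integrable (fun x => cut r x ^ 2 * f x) :=
  hf.bdd_mul (c := 1) ((sm_cut r).pow 2).cont.aestronglyMeasurable (ae_of_all _ fun x => by
    rw [Real.norm_of_nonneg (sq_nonneg _)]
    exact pow_le_one₀ (cut_nonneg r x) (cut_le_one r x))

lemma tendsto_integral_cut {f : V → ℝ} (hf : Integrable f) :
    Tendsto (fun n : ℕ => ∫ x, cut ((n : ℝ) + 1) x ^ 2 * f x) atTop (nhds (∫ x, f x)) := by
  refine tendsto_integral_of_dominated_convergence (fun x => |f x|)
    (fun n => (integrable_cut_sq_mul hf _).aestronglyMeasurable) hf.abs (fun n => ae_of_all _ fun x => ?_)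
    (ae_of_all _ fun x => tendsto_cut_sq_mul f x)
  rw [Real.norm_eq_abs, abs_mul, abs_of_nonneg (sq_nonneg (cut ((n : ℝ) + 1) x))]
  exact mul_le_of_le_one_left (abs_nonneg _) (pow_le_one₀ (cut_nonneg _ x) (cut_le_one _ x))

lemma integral_cut_le {f : V → ℝ} (hf : Integrable f) (h0 : ∀ x, 0 ≤ f x) (r : ℝ) :
    ∫ x, cut r x ^ 2 * f x ≤ ∫ x, f x :=
  integral_mono (integrable_cut_sq_mul hf r) hf fun x =>
    mul_le_of_le_one_left (h0 x) (pow_le_one₀ (cut_nonneg _ x) (cut_le_one _ x))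

/-- Measurability in time of a spatial integral. -/
lemma STSm.measurable_integral {G : ℝ → V → ℝ} (hG : STSm G) :
    StronglyMeasurable (fun t => ∫ x, G t x) :=
  (ContDiff.continuous hG).stronglyMeasurable.integral_prod_right

lemma integral_div_eq_zero {Φ : Fin 2 → V → ℝ} (hs : ∀ j, Sm (Φ j))
    (hc : ∀ j, HasCompactSupport (Φ j)) : ∫ x, ∑ j, pd j (Φ j) x = 0 := by
  rw [integral_finsetSum _ fun j _ => ((hs j).pd j).integrable ((hc j).pd j)]
  exact Finset.sum_eq_zero fun j _ => integral_pd_eq_zero (hs j) j ((hs j).integrable (hc j))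
    (((hs j).pd j).integrable ((hc j).pd j))

lemma integral_lin_four {α : Type*} [MeasurableSpace α] {μ : Measure α} {f₁ f₂ f₃ f₄ : α → ℝ}
    (h₁ : Integrable f₁ μ) (h₂ : Integrable f₂ μ) (h₃ : Integrable f₃ μ) (h₄ : Integrable f₄ μ)
    {a b c d : ℝ} : ∫ x, a * f₁ x + b * f₂ x + c * f₃ x + d * f₄ x ∂μ
      = a * (∫ x, f₁ x ∂μ) + b * (∫ x, f₂ x ∂μ) + c * (∫ x, f₃ x ∂μ) + d * ∫ x, f₄ x ∂μ := by
  have e₁ : Integrable (fun x => a * f₁ x + b * f₂ x) μ := (h₁.const_mul a).add (h₂.const_mul b)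
  have e₂ : Integrable (fun x => a * f₁ x + b * f₂ x + c * f₃ x) μ := e₁.add (h₃.const_mul c)
  rw [integral_add e₂ (h₄.const_mul d), integral_add e₁ (h₃.const_mul c),
    integral_add (h₁.const_mul a) (h₂.const_mul b)]
  simp_rw [integral_const_mul]

/-- The lower-order terms in the localised energy balance. -/
def rem2 (u : Fin 2 → V → ℝ) (E : Fin 2 → Fin 2 → V → ℝ) (W : V → ℝ) (x : V) : ℝ :=
  -(∑ i, ∑ j, pd j (u i) x * u i x * pd j W x) - (∑ i, W x * (u i x * nn u i x))
    - (∑ i, ∑ j, (E i j x + ff E i j x) * u i x * pd j W x)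
    + 1 / 2 * (sqm E x * ∑ j, u j x * pd j W x)

/-- The lower-order terms in the localised balance for `|u|⁴`. -/
def rem4 (u : Fin 2 → V → ℝ) (E : Fin 2 → Fin 2 → V → ℝ) (W : V → ℝ) (x : V) : ℝ :=
  -(∑ i, ∑ j, pd j (u i) x * u i x * sqv u x * pd j W x)
    + 1 / 4 * (sqv u x ^ 2 * ∑ j, u j x * pd j W x)
    - ∑ i, ∑ j, (E i j x + ff E i j x) * (pd j W x * (sqv u x * u i x)
      + W x * (pd j (sqv u) x * u i x + sqv u x * pd j (u i) x))

section
variable {U : Fin 2 → ℝ → V → ℝ} {E : Fin 2 → Fin 2 → ℝ → V → ℝ} {P : ℝ → V → ℝ} {T : ℝ}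

lemma stsm_sqv (hU : ∀ i, STSm (U i)) : STSm (fun t => sqv (sl U t)) := STSm.sum fun i => (hU i).pow 2

lemma stsm_sqm (hE : ∀ i j, STSm (E i j)) : STSm (fun t => sqm (slm E t)) :=
  STSm.sum fun i => STSm.sum fun j => (hE i j).pow 2

lemma stsm_gr (hU : ∀ i, STSm (U i)) : STSm (fun t => gr (sl U t)) :=
  STSm.sum fun i => STSm.sum fun j => ((hU i).pd j).pow 2

lemma dt_sqv (hU : ∀ i, STSm (U i)) (t : ℝ) (x : V) :
    dt (fun t => sqv (sl U t)) t x = ∑ i, 2 * (U i t x * dt (U i) t x) := by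
  have h := HasDerivAt.fun_sum (u := Finset.univ) fun i (_ : i ∈ Finset.univ) =>
    ((hU i).hasDerivAt t x).pow 2
  refine h.deriv.trans (Finset.sum_congr rfl fun i _ => ?_)
  push_cast
  ring

lemma dt_sqm (hE : ∀ i j, STSm (E i j)) (t : ℝ) (x : V) :
    dt (fun t => sqm (slm E t)) t x = ∑ i, ∑ j, 2 * (E i j t x * dt (E i j) t x) := by
  have h := HasDerivAt.fun_sum (u := Finset.univ) fun i (_ : i ∈ Finset.univ) =>
    HasDerivAt.fun_sum (u := Finset.univ) fun j (_ : j ∈ Finset.univ) =>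
      ((hE i j).hasDerivAt t x).pow 2
  refine h.deriv.trans (Finset.sum_congr rfl fun i _ => Finset.sum_congr rfl fun j _ => ?_)
  push_cast
  ring

lemma pd_sqm {E : Fin 2 → Fin 2 → V → ℝ} (hE : ∀ i j, Sm (E i j)) (k : Fin 2) (x : V) :
    pd k (sqm E) x = ∑ i, ∑ j, 2 * E i j x * pd k (E i j) x := by
  have e : sqm E = fun y => ∑ i, ∑ j, E i j y ^ 2 := rfl
  rw [e, pd_sum _ fun i => Sm.sum fun j => (hE i j).pow 2]
  refine Finset.sum_congr rfl fun i _ => ?_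
  rw [pd_sum _ fun j => (hE i j).pow 2]
  exact Finset.sum_congr rfl fun j _ => pd_sq (hE i j) k x

lemma Sol.dt_energy (S : Sol U E P T) {W : V → ℝ} (t : ℝ) (x : V) :
    dt (fun t x => W x * (sqv (sl U t) x + sqm (slm E t) x)) t x
      = W x * ((∑ i, 2 * (U i t x * dt (U i) t x)) + ∑ i, ∑ j, 2 * (E i j t x * dt (E i j) t x)) := by
  rw [← dt_sqv S.su, ← dt_sqm S.sE]
  exact ((((stsm_sqv S.su).hasDerivAt t x).add ((stsm_sqm S.sE).hasDerivAt t x)).const_mul _).deriv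

lemma Sol.energy (S : Sol U E P T) {W : V → ℝ} (hW : Sm W) (hc : HasCompactSupport W)
    {t : ℝ} (ht : t ∈ Icc 0 T) :
    ∫ x, dt (fun t x => W x * (sqv (sl U t) x + sqm (slm E t) x)) t x
      = -2 * (∫ x, W x * gr (sl U t) x) - 2 * pr P (fun i x => W x * U i t x) t
        + 2 * ∫ x, rem2 (sl U t) (slm E t) W x := by
  have su := S.smU t
  have sE := S.smE t
  have sf : ∀ i j, Sm (ff (slm E t) i j) := Sm.ff sE
  set A : Fin 2 → V → ℝ := fun j y => (∑ i, U i t y * pd j (U i t) y)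
    + (∑ i, U i t y * (E i j t y + ff (slm E t) i j y)) - 1 / 2 * (U j t y * sqm (slm E t) y)
  have sA1 : ∀ j, Sm (fun y => ∑ i, U i t y * pd j (U i t) y) := fun j =>
    Sm.sum fun i => (su i).mul ((su i).pd j)
  have sA2 : ∀ j, Sm (fun y => ∑ i, U i t y * (E i j t y + ff (slm E t) i j y)) := fun j =>
    Sm.sum fun i => (su i).mul ((sE i j).add (sf i j))
  have sA3 : ∀ j, Sm (fun y => U j t y * sqm (slm E t) y) := fun j => (su j).mul (Sm.sqvm sE)
  have sA : ∀ j, Sm (A j) := fun j => ((sA1 j).add (sA2 j)).sub ((sA3 j).const_mul _)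
  have pA : ∀ j x, pd j (A j) x = (∑ i, (pd j (U i t) x * pd j (U i t) x
        + U i t x * pd j (pd j (U i t)) x))
      + (∑ i, (pd j (U i t) x * (E i j t x + ff (slm E t) i j x)
        + U i t x * (pd j (E i j t) x + pd j (ff (slm E t) i j) x)))
      - 1 / 2 * (pd j (U j t) x * sqm (slm E t) x + U j t x * pd j (sqm (slm E t)) x) := by
    intro j x
    simp only [A]
    rw [pd_sub ((sA1 j).add (sA2 j)) ((sA3 j).const_mul _), pd_add (sA1 j) (sA2 j),
      pd_sum _ fun i => (su i).mul ((su i).pd j),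
      pd_sum _ fun i => (su i).mul ((sE i j).add (sf i j)),
      pd_const_mul (sA3 j), pd_mul (su j) (Sm.sqvm sE)]
    congr 2
    · exact Finset.sum_congr rfl fun i _ => pd_mul (su i) ((su i).pd j) j x
    · refine Finset.sum_congr rfl fun i _ => ?_
      rw [pd_mul (su i) ((sE i j).add (sf i j)), pd_add (sE i j) (sf i j)]
  have key : ∀ x, dt (fun t x => W x * (sqv (sl U t) x + sqm (slm E t) x)) t x
      = 2 * (∑ j, pd j (fun y => W y * A j y) x) + -2 * (W x * gr (sl U t) x)
        + -2 * (∑ i, pd i (P t) x * (W x * U i t x)) + 2 * rem2 (sl U t) (slm E t) W x := by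
    intro x
    have m := fun i => S.mom t ht i x
    have tr := fun i j => S.tr t ht i j x
    have hu : ∑ i, pd i (U i t) x = 0 := S.du t ht x
    rw [S.dt_energy]
    simp_rw [pd_mul hW (sA _), pA, pd_sqm sE, rem2]
    simp only [A, sqm, gr, ff, nn, lap, Fin.sum_univ_two] at m tr hu ⊢
    have m0 := m 0
    have m1 := m 1
    have t00 := tr 0 0
    have t01 := tr 0 1
    have t10 := tr 1 0
    have t11 := tr 1 1
    linear_combination 2 * W x * (U 0 t x * m0 + U 1 t x * m1 + E 0 0 t x * t00 + E 0 1 t x * t01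
      + E 1 0 t x * t10 + E 1 1 t x * t11)
      + W x * (E 0 0 t x ^ 2 + E 0 1 t x ^ 2 + (E 1 0 t x ^ 2 + E 1 1 t x ^ 2)) * hu
  have sP := S.sP.slice t
  have hθ : ∀ i, Sm (fun x => pd i (P t) x * (W x * U i t x)) := fun i =>
    (sP.pd i).mul (hW.mul (su i))
  have cθ : ∀ i, HasCompactSupport (fun x => pd i (P t) x * (W x * U i t x)) := fun i =>
    HasCompactSupport.mul_left (HasCompactSupport.mul_right hc)
  have i1 : Integrable (fun x => ∑ j, pd j (fun y => W y * A j y) x) :=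
    integrable_finsetSum _ fun j _ => ((hW.mul (sA j)).pd j).integrable
      (HasCompactSupport.pd (HasCompactSupport.mul_right hc) j)
  have i2 : Integrable (fun x => W x * gr (sl U t) x) :=
    (hW.mul (Sm.gr su)).integrable (HasCompactSupport.mul_right hc)
  have i3 : Integrable (fun x => ∑ i, pd i (P t) x * (W x * U i t x)) :=
    integrable_finsetSum _ fun i _ => (hθ i).integrable (cθ i)
  have i4 : Integrable (rem2 (sl U t) (slm E t) W) := by
    have hcj : ∀ j, HasCompactSupport (pd j W) := fun j => hc.pd j
    refine (((Integrable.neg (integrable_finsetSum _ fun i _ => integrable_finsetSum _ fun j _ => ?_)).sub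
      (integrable_finsetSum _ fun i _ => ?_)).sub (integrable_finsetSum _ fun i _ =>
        integrable_finsetSum _ fun j _ => ?_)).add (Integrable.const_mul ?_ _)
    · exact ((((su i).pd j).mul (su i)).mul (hW.pd j)).integrable (HasCompactSupport.mul_left (hcj j))
    · exact (hW.mul ((su i).mul (Sm.nn su i))).integrable (HasCompactSupport.mul_right hc)
    · exact ((((sE i j).add (sf i j)).mul (su i)).mul (hW.pd j)).integrable
        (HasCompactSupport.mul_left (hcj j))
    · simp_rw [Finset.mul_sum]
      exact integrable_finsetSum _ fun j _ => ((Sm.sqvm sE).mul ((su j).mul (hW.pd j))).integrable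
        (HasCompactSupport.mul_left (HasCompactSupport.mul_left (hcj j)))
  simp_rw [key]
  rw [integral_lin_four i1 i2 i3 i4]
  rw [integral_div_eq_zero (fun j => hW.mul (sA j)) fun j => HasCompactSupport.mul_right hc,
    integral_finsetSum _ fun i _ => (hθ i).integrable (cθ i)]
  simp only [pr]
  ring

end

section
variable {U : Fin 2 → ℝ → V → ℝ} {E : Fin 2 → Fin 2 → ℝ → V → ℝ} {P : ℝ → V → ℝ} {T : ℝ}

lemma Sol.dt_four (S : Sol U E P T) {W : V → ℝ} (t : ℝ) (x : V) :
    dt (fun t x => W x * sqv (sl U t) x ^ 2) t x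
      = 4 * (W x * (sqv (sl U t) x * ∑ i, U i t x * dt (U i) t x)) := by
  have h := ((((stsm_sqv S.su).hasDerivAt t x).pow 2).const_mul (W x)).deriv
  refine h.trans ?_
  rw [dt_sqv S.su, Fin.sum_univ_two, Fin.sum_univ_two]
  push_cast
  ring

lemma Sol.four (S : Sol U E P T) {W : V → ℝ} (hW : Sm W) (hc : HasCompactSupport W)
    {t : ℝ} (ht : t ∈ Icc 0 T) :
    ∫ x, dt (fun t x => W x * sqv (sl U t) x ^ 2) t x
      = -4 * (∫ x, W x * (sqv (sl U t) x * gr (sl U t) x + 1 / 2 * ∑ j, pd j (sqv (sl U t)) x ^ 2))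
        - 4 * pr P (fun i x => W x * (sqv (sl U t) x * U i t x)) t
        + 4 * ∫ x, rem4 (sl U t) (slm E t) W x := by
  have su := S.smU t
  have sE := S.smE t
  have sv : Sm (sqv (sl U t)) := Sm.sqvv su
  have sf : ∀ i j, Sm (ff (slm E t) i j) := Sm.ff sE
  set A : Fin 2 → V → ℝ := fun j y => sqv (sl U t) y * ((∑ i, U i t y * pd j (U i t) y)
    + ∑ i, U i t y * (E i j t y + ff (slm E t) i j y)) - 1 / 4 * (U j t y * sqv (sl U t) y ^ 2)
  have sA1 : ∀ j, Sm (fun y => ∑ i, U i t y * pd j (U i t) y) := fun j =>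
    Sm.sum fun i => (su i).mul ((su i).pd j)
  have sA2 : ∀ j, Sm (fun y => ∑ i, U i t y * (E i j t y + ff (slm E t) i j y)) := fun j =>
    Sm.sum fun i => (su i).mul ((sE i j).add (sf i j))
  have sA3 : ∀ j, Sm (fun y => U j t y * sqv (sl U t) y ^ 2) := fun j => (su j).mul (sv.pow 2)
  have sA12 : ∀ j, Sm (fun y => (∑ i, U i t y * pd j (U i t) y)
      + ∑ i, U i t y * (E i j t y + ff (slm E t) i j y)) := fun j => (sA1 j).add (sA2 j)
  have sA : ∀ j, Sm (A j) := fun j => (sv.mul (sA12 j)).sub ((sA3 j).const_mul _)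
  have pA : ∀ j x, pd j (A j) x = pd j (sqv (sl U t)) x * ((∑ i, U i t x * pd j (U i t) x)
        + ∑ i, U i t x * (E i j t x + ff (slm E t) i j x))
      + sqv (sl U t) x * ((∑ i, (pd j (U i t) x * pd j (U i t) x
        + U i t x * pd j (pd j (U i t)) x))
      + (∑ i, (pd j (U i t) x * (E i j t x + ff (slm E t) i j x)
        + U i t x * (pd j (E i j t) x + pd j (ff (slm E t) i j) x))))
      - 1 / 4 * (pd j (U j t) x * sqv (sl U t) x ^ 2
        + U j t x * (2 * sqv (sl U t) x * pd j (sqv (sl U t)) x)) := by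
    intro j x
    simp only [A]
    rw [pd_sub (sv.mul (sA12 j)) ((sA3 j).const_mul _), pd_mul sv (sA12 j), pd_add (sA1 j) (sA2 j),
      pd_sum _ fun i => (su i).mul ((su i).pd j),
      pd_sum _ fun i => (su i).mul ((sE i j).add (sf i j)),
      pd_const_mul (sA3 j), pd_mul (su j) (sv.pow 2), pd_sq sv]
    congr 4
    · exact Finset.sum_congr rfl fun i _ => pd_mul (su i) ((su i).pd j) j x
    · refine Finset.sum_congr rfl fun i _ => ?_
      rw [pd_mul (su i) ((sE i j).add (sf i j)), pd_add (sE i j) (sf i j)]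
  have key : ∀ x, dt (fun t x => W x * sqv (sl U t) x ^ 2) t x
      = 4 * (∑ j, pd j (fun y => W y * A j y) x)
        + -4 * (W x * (sqv (sl U t) x * gr (sl U t) x + 1 / 2 * ∑ j, pd j (sqv (sl U t)) x ^ 2))
        + -4 * (∑ i, pd i (P t) x * (W x * (sqv (sl U t) x * U i t x)))
        + 4 * rem4 (sl U t) (slm E t) W x := by
    intro x
    have m := fun i => S.mom t ht i x
    have hu : ∑ i, pd i (U i t) x = 0 := S.du t ht x
    rw [S.dt_four]
    simp_rw [pd_mul hW (sA _), pA, rem4, pd_sq_field su]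
    simp only [A, gr, ff, nn, lap, Fin.sum_univ_two] at m hu ⊢
    have m0 := m 0
    have m1 := m 1
    have hv : sqv (sl U t) x = U 0 t x ^ 2 + U 1 t x ^ 2 := by
      simp only [sqv, Fin.sum_univ_two]
    generalize sqv (sl U t) x = v at hv ⊢
    linear_combination 4 * W x * v * (U 0 t x * m0 + U 1 t x * m1) + W x * v ^ 2 * hu
  have sP := S.sP.slice t
  have hθ : ∀ i, Sm (fun x => pd i (P t) x * (W x * (sqv (sl U t) x * U i t x))) := fun i =>
    (sP.pd i).mul (hW.mul (sv.mul (su i)))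
  have cθ : ∀ i, HasCompactSupport (fun x => pd i (P t) x * (W x * (sqv (sl U t) x * U i t x))) :=
    fun i => HasCompactSupport.mul_left (HasCompactSupport.mul_right hc)
  have i1 : Integrable (fun x => ∑ j, pd j (fun y => W y * A j y) x) :=
    integrable_finsetSum _ fun j _ => ((hW.mul (sA j)).pd j).integrable
      (HasCompactSupport.pd (HasCompactSupport.mul_right hc) j)
  have i2 : Integrable (fun x => W x * (sqv (sl U t) x * gr (sl U t) x
      + 1 / 2 * ∑ j, pd j (sqv (sl U t)) x ^ 2)) :=
    (hW.mul ((sv.mul (Sm.gr su)).add ((Sm.sum fun j => (sv.pd j).pow 2).const_mul _))).integrable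
      (HasCompactSupport.mul_right hc)
  have i3 : Integrable (fun x => ∑ i, pd i (P t) x * (W x * (sqv (sl U t) x * U i t x))) :=
    integrable_finsetSum _ fun i _ => (hθ i).integrable (cθ i)
  have i4 : Integrable (rem4 (sl U t) (slm E t) W) := by
    have hcj : ∀ j, HasCompactSupport (pd j W) := fun j => hc.pd j
    refine ((Integrable.neg (integrable_finsetSum _ fun i _ => integrable_finsetSum _ fun j _ => ?_)).add
      (Integrable.const_mul ?_ _)).sub (integrable_finsetSum _ fun i _ =>
        integrable_finsetSum _ fun j _ => ?_)
    · exact (((((su i).pd j).mul (su i)).mul sv).mul (hW.pd j)).integrable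
        (HasCompactSupport.mul_left (hcj j))
    · simp_rw [Finset.mul_sum]
      exact integrable_finsetSum _ fun j _ => ((sv.pow 2).mul ((su j).mul (hW.pd j))).integrable
        (HasCompactSupport.mul_left (HasCompactSupport.mul_left (hcj j)))
    · refine (((sE i j).add (sf i j)).mul (((hW.pd j).mul (sv.mul (su i))).add (hW.mul
        (((sv.pd j).mul (su i)).add (sv.mul ((su i).pd j)))))).integrable
        (HasCompactSupport.mul_left (HasCompactSupport.add ?_ ?_))
      · exact HasCompactSupport.mul_right (hcj j)
      · exact HasCompactSupport.mul_right hc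
  simp_rw [key]
  rw [integral_lin_four i1 i2 i3 i4]
  rw [integral_div_eq_zero (fun j => hW.mul (sA j)) fun j => HasCompactSupport.mul_right hc,
    integral_finsetSum _ fun i _ => (hθ i).integrable (cθ i)]
  simp only [pr]
  ring

/-- The convective term is a pure flux. -/
lemma Sol.integral_convect (S : Sol U E P T) {W : V → ℝ} (hW : Sm W) (hc : HasCompactSupport W)
    {t : ℝ} (ht : t ∈ Icc 0 T) :
    ∫ x, ∑ i, W x * (U i t x * nn (sl U t) i x)
      = ∫ x, -(1 / 2) * (sqv (sl U t) x * ∑ j, U j t x * pd j W x) := by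
  have su := S.smU t
  have sv : Sm (sqv (sl U t)) := Sm.sqvv su
  have hs : ∀ j, Sm (fun y => W y * (U j t y * sqv (sl U t) y)) := fun j => hW.mul ((su j).mul sv)
  have h := integral_div_eq_zero hs fun j => HasCompactSupport.mul_right hc
  have key : ∀ x, ∑ i, W x * (U i t x * nn (sl U t) i x)
      = 1 / 2 * (∑ j, pd j (fun y => W y * (U j t y * sqv (sl U t) y)) x)
        + -(1 / 2) * (sqv (sl U t) x * ∑ j, U j t x * pd j W x) := by
    intro x
    have hu : ∑ i, pd i (U i t) x = 0 := S.du t ht x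
    simp_rw [pd_mul hW ((su _).mul sv), pd_mul (su _) sv, pd_sq_field su]
    simp only [nn, sqv, Fin.sum_univ_two] at hu ⊢
    linear_combination -(1 / 2) * W x * (U 0 t x ^ 2 + U 1 t x ^ 2) * hu
  have i2 : Integrable (fun x => sqv (sl U t) x * ∑ j, U j t x * pd j W x) := by
    simp_rw [Finset.mul_sum]
    exact integrable_finsetSum _ fun j _ => (sv.mul ((su j).mul (hW.pd j))).integrable
        (HasCompactSupport.mul_left (HasCompactSupport.mul_left (hc.pd j)))
  have i1 : Integrable (fun x => ∑ j, pd j (fun y => W y * (U j t y * sqv (sl U t) y)) x) :=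
    integrable_finsetSum _ fun j _ => ((hs j).pd j).integrable
      (HasCompactSupport.pd (HasCompactSupport.mul_right hc) j)
  simp_rw [key]
  rw [integral_add (i1.const_mul _) (i2.const_mul _), integral_const_mul, h, mul_zero, zero_add]

end

/-- Squared gradient of the cutoff. -/
def qc (r : ℝ) (x : V) : ℝ := ∑ j, pd j (cut r) x ^ 2

lemma qc_nn (r : ℝ) (x : V) : 0 ≤ qc r x := Finset.sum_nonneg fun _ _ => sq_nonneg _

lemma pd_cut_sq_le {r : ℝ} (hr : 0 < r) (j : Fin 2) (x : V) : pd j (cut r) x ^ 2 ≤ (cX / r) ^ 2 :=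
  sq_le_sq' (abs_le.1 (abs_pd_cut_le hr j x)).1 (abs_le.1 (abs_pd_cut_le hr j x)).2

lemma qc_le {r : ℝ} (hr : 0 < r) (x : V) : qc r x ≤ 2 * (cX / r) ^ 2 := by
  rw [qc, Fin.sum_univ_two]
  linarith [pd_cut_sq_le hr 0 x, pd_cut_sq_le hr 1 x]

lemma cut_zero_of_lt {r : ℝ} (hr : 0 < r) {x : V} (hx : 2 * r < ‖x‖) : cut r x = 0 :=
  cut_eq_zero hr hx.le

lemma pd_cut_zero_of_lt {r : ℝ} (hr : 0 < r) (j : Fin 2) {x : V} (hx : 2 * r < ‖x‖) :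
    pd j (cut r) x = 0 :=
  pd_cut_eq_zero hr j fun h => absurd h.2 (not_le.2 hx)

lemma cut_sq_eq_zero (r : ℝ) : ∀ x ∉ tsupport (fun x => cut r x ^ 2), cut r x ^ 2 = 0 :=
  fun _ hx => image_eq_zero_of_notMem_tsupport (f := fun x => cut r x ^ 2) hx

lemma hasCompactSupport_cut_sq {r : ℝ} (hr : 0 < r) : HasCompactSupport (fun x => cut r x ^ 2) := by
  simp_rw [pow_two]
  exact (hasCompactSupport_cut hr).mul_left

lemma sm_cut_sq (r : ℝ) : Sm (fun x => cut r x ^ 2) := (sm_cut r).pow 2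

lemma integrable_qc {r : ℝ} (hr : 0 < r) : Integrable (qc r) :=
  integrable_finsetSum _ fun j _ => (((sm_cut r).pd j).pow 2).integrable (by
    simp_rw [pow_two]
    exact ((hasCompactSupport_cut hr).pd j).mul_left)

lemma integral_qc_le {r : ℝ} (hr : 0 < r) : ∫ x, qc r x ≤ 32 * cX ^ 2 := by
  have h := integral_abs_le_of_ball (f := qc r) (C := 2 * (cX / r) ^ 2) (ρ := 2 * r) (by positivity)
    (fun x => by rw [abs_of_nonneg (qc_nn r x)]; exact qc_le hr x)
    (fun x hx => by simp only [qc, pd_cut_zero_of_lt hr _ hx]; simp)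
  simp_rw [abs_of_nonneg (qc_nn r _)] at h
  refine h.trans (le_of_eq ?_)
  field_simp
  ring

lemma cut_sq_le_one (r : ℝ) (x : V) : cut r x ^ 2 ≤ 1 :=
  pow_le_one₀ (cut_nonneg r x) (cut_le_one r x)

lemma pd_cut_sq (r : ℝ) (j : Fin 2) (x : V) :
    pd j (fun y => cut r y ^ 2) x = 2 * cut r x * pd j (cut r) x := pd_sq (sm_cut r) j x

lemma dv_mul {u : Fin 2 → V → ℝ} {g : V → ℝ} (hg : Sm g) (hu : ∀ i, Sm (u i)) {x : V}
    (hd : ∑ i, pd i (u i) x = 0) : dv (fun i y => g y * u i y) x = ∑ j, pd j g x * u j x := by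
  simp only [dv, Fin.sum_univ_two] at hd ⊢
  rw [pd_mul hg (hu 0), pd_mul hg (hu 1)]
  linear_combination g x * hd

lemma abs_stress_le {E : Fin 2 → Fin 2 → V → ℝ} {x : V} (h : sqm E x ≤ 1 / 4) (i j : Fin 2) :
    |E i j x + ff E i j x| ≤ 3 / 4 := by
  have h1 := entry_sq_le E i j x
  have h2 := abs_ff_le E i j x
  have h3 : |E i j x| ≤ 1 / 2 := abs_le_of_sq_le_sq (by linarith) (by norm_num)
  linarith [abs_add_le (E i j x) (ff E i j x)]

/-- Crude bound for the lower-order terms in the energy balance. -/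
lemma abs_rem2_le {u : Fin 2 → V → ℝ} {E : Fin 2 → Fin 2 → V → ℝ} {x : V} (h : sqm E x ≤ 1 / 4)
    (r : ℝ) : |rem2 u E (fun y => cut r y ^ 2) x|
      ≤ 4 * (sqv u x * gr u x) + 3 * (cut r x ^ 2 * sqv u x) + 5 * qc r x := by
  have hη0 := cut_nonneg r x
  have hη1 := cut_le_one r x
  have hm := sqm_nn E x
  set η := cut r x
  set p : Fin 2 → ℝ := fun j => pd j (cut r) x
  have a1 : ∀ i j, |pd j (u i) x * u i x * (2 * η * p j)| ≤ sqv u x * pd j (u i) x ^ 2 + p j ^ 2 := by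
    intro i j
    have h1 := coord_sq_le u i x
    have h2 : (pd j (u i) x * u i x) ^ 2 ≤ sqv u x * pd j (u i) x ^ 2 := by
      rw [mul_pow, mul_comm]
      exact mul_le_mul_of_nonneg_right h1 (sq_nonneg _)
    have h3 : (η * p j) ^ 2 ≤ p j ^ 2 := by
      rw [mul_pow]
      exact mul_le_of_le_one_left (sq_nonneg _) (pow_le_one₀ hη0 hη1)
    rw [abs_le]
    constructor <;> nlinarith [sq_nonneg (pd j (u i) x * u i x - η * p j),
      sq_nonneg (pd j (u i) x * u i x + η * p j)]
  have a2 : ∀ i, |η ^ 2 * (u i x * nn u i x)| ≤ 1 / 2 * (η ^ 2 * u i x ^ 2)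
      + 1 / 2 * (sqv u x * gr u x) := by
    intro i
    have h1 := nn_sq_le u i x
    have h2 : (η * nn u i x) ^ 2 ≤ nn u i x ^ 2 := by
      rw [mul_pow]
      exact mul_le_of_le_one_left (sq_nonneg _) (pow_le_one₀ hη0 hη1)
    rw [abs_le]
    constructor <;> nlinarith [sq_nonneg (η * u i x - η * nn u i x),
      sq_nonneg (η * u i x + η * nn u i x)]
  have a3 : ∀ i j, |(E i j x + ff E i j x) * u i x * (2 * η * p j)| ≤ η ^ 2 * u i x ^ 2 + p j ^ 2 := by
    intro i j
    have h1 := abs_stress_le h i j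
    have e : (E i j x + ff E i j x) * u i x * (2 * η * p j)
      = (E i j x + ff E i j x) * (2 * (η * u i x) * p j) := by ring
    have h2 : |2 * (η * u i x) * p j| ≤ η ^ 2 * u i x ^ 2 + p j ^ 2 := by
      rw [abs_le]
      constructor <;> nlinarith [sq_nonneg (η * u i x - p j), sq_nonneg (η * u i x + p j)]
    rw [e, abs_mul]
    nlinarith [abs_nonneg (2 * (η * u i x) * p j), abs_nonneg (E i j x + ff E i j x)]
  have a4 : ∀ j, |sqm E x * (u j x * (2 * η * p j))| ≤ 1 / 4 * (η ^ 2 * u j x ^ 2 + p j ^ 2) := by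
    intro j
    have h2 : |u j x * (2 * η * p j)| ≤ η ^ 2 * u j x ^ 2 + p j ^ 2 := by
      rw [abs_le]
      constructor <;> nlinarith [sq_nonneg (η * u j x - p j), sq_nonneg (η * u j x + p j)]
    rw [abs_mul, abs_of_nonneg hm]
    exact mul_le_mul h h2 (abs_nonneg _) (by norm_num)
  have hg : sqv u x * gr u x = sqv u x * (pd 0 (u 0) x ^ 2 + pd 1 (u 0) x ^ 2
      + (pd 0 (u 1) x ^ 2 + pd 1 (u 1) x ^ 2)) := by simp only [gr, Fin.sum_univ_two]
  have hv : η ^ 2 * sqv u x = η ^ 2 * u 0 x ^ 2 + η ^ 2 * u 1 x ^ 2 := by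
    simp only [sqv, Fin.sum_univ_two]; ring
  have hq : qc r x = p 0 ^ 2 + p 1 ^ 2 := by simp only [qc, Fin.sum_univ_two, p]
  have hp : ∀ j, pd j (fun y => cut r y ^ 2) x = 2 * η * p j := fun j => pd_cut_sq r j x
  simp only [rem2, hp, Fin.sum_univ_two, hq, hv]
  have n0 : 0 ≤ η ^ 2 * u 0 x ^ 2 := by positivity
  have n1 : 0 ≤ η ^ 2 * u 1 x ^ 2 := by positivity
  have n2 := sq_nonneg (p 0)
  have n3 := sq_nonneg (p 1)
  have n4 := mul_nonneg (sq_nn u x) (gr_nn u x)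
  have b1 := fun i j => abs_le.1 (a1 i j)
  have b2 := fun i => abs_le.1 (a2 i)
  have b3 := fun i j => abs_le.1 (a3 i j)
  have b4 := fun j => abs_le.1 (a4 j)
  have := b1 0 0; have := b1 0 1; have := b1 1 0; have := b1 1 1
  have := b3 0 0; have := b3 0 1; have := b3 1 0; have := b3 1 1
  have := b2 0; have := b2 1; have := b4 0; have := b4 1
  rw [mul_add (sqm E x)]
  rw [abs_le]
  constructor <;> linarith

section
variable {U : Fin 2 → ℝ → V → ℝ} {E : Fin 2 → Fin 2 → ℝ → V → ℝ} {P : ℝ → V → ℝ} {T : ℝ}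

/-- The localised energy. -/
def yy (U : Fin 2 → ℝ → V → ℝ) (E : Fin 2 → Fin 2 → ℝ → V → ℝ) (r t : ℝ) : ℝ :=
  ∫ x, cut r x ^ 2 * (sqv (sl U t) x + sqm (slm E t) x)

lemma yy_nn (r t : ℝ) : 0 ≤ yy U E r t :=
  integral_nonneg fun x => mul_nonneg (sq_nonneg _) (add_nonneg (sq_nn _ x) (sqm_nn _ x))

lemma Sol.integrable_cut_sqv (S : Sol U E P T) {t : ℝ} (ht : t ∈ Icc 0 T) (r : ℝ) :
    Integrable (fun x => cut r x ^ 2 * sqv (sl U t) x) := integrable_cut_sq_mul (S.iu t ht) r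

lemma Sol.integral_cut_sqv_le (S : Sol U E P T) {t : ℝ} (ht : t ∈ Icc 0 T) (r : ℝ) :
    ∫ x, cut r x ^ 2 * sqv (sl U t) x ≤ yy U E r t := by
  refine integral_mono (S.integrable_cut_sqv ht r)
    (integrable_cut_sq_mul ((S.iu t ht).add (S.iE t ht)) r) fun x => ?_
  exact mul_le_mul_of_nonneg_left (le_add_of_nonneg_right (sqm_nn _ x)) (sq_nonneg _)

lemma Sol.tst_cut (S : Sol U E P T) {r : ℝ} (hr : 0 < r) (t : ℝ) :
    Tst (fun i x => cut r x ^ 2 * U i t x) :=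
  ⟨fun i => (sm_cut_sq r).mul (S.smU t i), fun _ => (hasCompactSupport_cut_sq hr).mul_right⟩

lemma Sol.integral_sqv_cut_le (S : Sol U E P T) {t : ℝ} (ht : t ∈ Icc 0 T) (r : ℝ) :
    ∫ x, sqv (fun i x => cut r x ^ 2 * U i t x) x ≤ yy U E r t := by
  refine le_trans (integral_mono_of_nonneg (ae_of_all _ fun x => sq_nn _ x)
    (S.integrable_cut_sqv ht r) (ae_of_all _ fun x => ?_)) (S.integral_cut_sqv_le ht r)
  have e : sqv (fun i x => cut r x ^ 2 * U i t x) x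
      = cut r x ^ 2 * (cut r x ^ 2 * sqv (sl U t) x) := by
    simp only [sqv, Fin.sum_univ_two]; ring
  simp only [e]
  exact mul_le_of_le_one_left (mul_nonneg (sq_nonneg _) (sq_nn _ x)) (cut_sq_le_one r x)

lemma Sol.dv_cut_sq_le (S : Sol U E P T) {t : ℝ} (ht : t ∈ Icc 0 T) {r : ℝ} (hr : 0 < r) (x : V) :
    dv (fun i x => cut r x ^ 2 * U i t x) x ^ 2
      ≤ 8 * (cX / r) ^ 2 * (cut r x ^ 2 * sqv (sl U t) x) := by
  rw [dv_mul (sm_cut_sq r) (S.smU t) (S.du t ht x), Fin.sum_univ_two, pd_cut_sq, pd_cut_sq]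
  have h0 := qc_le hr x
  rw [qc, Fin.sum_univ_two] at h0
  have h1 : (pd 0 (cut r) x * U 0 t x + pd 1 (cut r) x * U 1 t x) ^ 2
      ≤ (pd 0 (cut r) x ^ 2 + pd 1 (cut r) x ^ 2) * (U 0 t x ^ 2 + U 1 t x ^ 2) := by
    nlinarith [sq_nonneg (pd 0 (cut r) x * U 1 t x - pd 1 (cut r) x * U 0 t x)]
  have h2 : (pd 0 (cut r) x ^ 2 + pd 1 (cut r) x ^ 2) * (U 0 t x ^ 2 + U 1 t x ^ 2)
      ≤ 2 * (cX / r) ^ 2 * (U 0 t x ^ 2 + U 1 t x ^ 2) :=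
    mul_le_mul_of_nonneg_right h0 (by positivity)
  have e : sqv (sl U t) x = U 0 t x ^ 2 + U 1 t x ^ 2 := by simp only [sqv, Fin.sum_univ_two]
  rw [e]
  have := mul_le_mul_of_nonneg_left (h1.trans h2) (sq_nonneg (2 * cut r x))
  linarith

lemma Sol.integral_dv_cut_sq_le (S : Sol U E P T) {t : ℝ} (ht : t ∈ Icc 0 T) {r : ℝ} (hr : 0 < r) :
    ∫ x, dv (fun i x => cut r x ^ 2 * U i t x) x ^ 2 ≤ 8 * (cX / r) ^ 2 * yy U E r t := by
  refine (integral_mono_of_nonneg (ae_of_all _ fun x => sq_nonneg _)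
    ((S.integrable_cut_sqv ht r).const_mul _) (ae_of_all _ fun x => S.dv_cut_sq_le ht hr x)).trans ?_
  rw [integral_const_mul]
  exact mul_le_mul_of_nonneg_left (S.integral_cut_sqv_le ht r) (by positivity)

lemma Sol.integral_abs_cut_le (S : Sol U E P T) {t : ℝ} (ht : t ∈ Icc 0 T) {r : ℝ} (hr : 0 < r)
    (i : Fin 2) : ∫ x, |cut r x ^ 2 * U i t x| ≤ 8 * r * (1 + yy U E r t) := by
  set B := Metric.closedBall (0 : V) (2 * r)
  have hB : MeasurableSet B := measurableSet_closedBall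
  have iB : Integrable (B.indicator fun _ : V => 1 / (2 * r)) :=
    (integrable_indicator_iff hB).2 (integrableOn_const measure_closedBall_lt_top.ne)
  have iv := (S.integrable_cut_sqv ht r).const_mul (r / 2)
  have h : ∀ x, |cut r x ^ 2 * U i t x|
      ≤ r / 2 * (cut r x ^ 2 * sqv (sl U t) x) + B.indicator (fun _ => 1 / (2 * r)) x := by
    intro x
    by_cases hx : x ∈ B
    · rw [indicator_of_mem hx]
      have h1 := coord_sq_le (sl U t) i x
      have h2 := cut_sq_le_one r x
      have h3 := sq_nonneg (cut r x)
      have h4 : |U i t x| ≤ r / 2 * U i t x ^ 2 + 1 / (2 * r) := by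
        have : r / 2 * U i t x ^ 2 + 1 / (2 * r) - |U i t x| = (r * |U i t x| - 1) ^ 2 / (2 * r) := by
          rw [sub_sq, mul_pow, sq_abs]; field_simp; ring
        have h5 : 0 ≤ (r * |U i t x| - 1) ^ 2 / (2 * r) := by positivity
        linarith
      rw [abs_mul, abs_of_nonneg h3]
      have h5 := mul_le_mul_of_nonneg_left h4 h3
      have h6 := mul_le_mul_of_nonneg_left h1 (mul_nonneg h3 hr.le)
      have h7 : 0 ≤ 1 / (2 * r) := by positivity
      have h8 := mul_le_of_le_one_left h7 h2
      nlinarith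
    · have hx' : 2 * r < ‖x‖ := by simpa [B] using hx
      rw [indicator_of_notMem hx, cut_zero_of_lt hr hx']
      simp
  refine (integral_mono_of_nonneg (ae_of_all _ fun x => abs_nonneg _) (iv.add iB)
    (ae_of_all _ h)).trans ?_
  rw [integral_add' iv iB, integral_const_mul, integral_indicator hB, setIntegral_const,
    volume_real_ball (by positivity), smul_eq_mul]
  have h1 := mul_le_mul_of_nonneg_left (S.integral_cut_sqv_le ht r) (half_pos hr).le
  have h2 : (2 * (2 * r)) ^ 2 * (1 / (2 * r)) = 8 * r := by field_simp; ring
  have := mul_nonneg hr.le (yy_nn (U := U) (E := E) r t)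
  rw [h2]
  linarith

/-- Constant in the crude pressure bound. -/
def cA : ℝ := 4 + 24 * cX + 32 * (cK * cT)

lemma cA_nonneg : 0 ≤ cA := by
  have := cX_pos; have := cK_pos; have := cT_nonneg
  unfold cA; positivity

lemma sqrt_le_one_add {a : ℝ} (ha : 0 ≤ a) : √a ≤ 1 + a := by
  rw [Real.sqrt_le_left (by linarith)]
  nlinarith

lemma Sol.pr_ae_one (S : Sol U E P T) : ∀ᵐ s, s ∈ Ioo 0 T → ∀ r : ℝ, 1 ≤ r →
    |pr P (fun i x => cut r x ^ 2 * U i s x) s| ≤ cA * (1 + yy U E r s) * (1 + dis U s) := by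
  have hα : IntegrableOn (fun s => 1 + dis U s) (Ioc 0 T) :=
    (integrableOn_const (by simp)).add S.idt
  filter_upwards [S.pressure_ae hα] with s h hs r hr
  have hr0 : 0 < r := by linarith
  have ht : s ∈ Icc 0 T := Ioo_subset_Icc_self hs
  refine h hs _ (S.tst_cut hr0 s) _ ?_
  obtain ⟨C, R, -, hC, hl⟩ := (S.tst_cut hr0 s).exists_lam_le (ρ := 2 * r) (by positivity)
    fun i x hx => by simp only [cut_zero_of_lt hr0 hx]; simp
  refine ⟨fun r => C / r, tendsto_const_nhds.div_atTop tendsto_id, ?_⟩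
  filter_upwards [eventually_ge_atTop R] with q hq τ hτ
  refine (hl q hq _ _ (S.smU τ) (S.smE τ) (S.abs_ff_le hτ) (S.id τ hτ)).trans ?_
  have hd : 0 ≤ dis U τ := dis_nn U τ
  change _ * (1 + dis U τ) ≤ _
  rw [← add_mul]
  refine mul_le_mul_of_nonneg_right ?_ (by linarith)
  rw [← add_assoc]
  refine add_le_add ?_ le_rfl
  have hY := yy_nn (U := U) (E := E) r s
  set Y := yy U E r s
  have hX := cX_pos
  have hsq := sqrt_le_one_add hY
  have b1 : √(2 * ∫ x, sqv (fun i x => cut r x ^ 2 * U i s x) x) ≤ 2 * (1 + Y) := by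
    rw [Real.sqrt_le_left (by linarith)]
    have := S.integral_sqv_cut_le ht r
    nlinarith
  have b2 : √(∫ x, dv (fun i x => cut r x ^ 2 * U i s x) x ^ 2) ≤ 3 * (cX / r) * (1 + Y) := by
    rw [Real.sqrt_le_left (by positivity)]
    refine (S.integral_dv_cut_sq_le ht hr0).trans ?_
    have : 0 ≤ (cX / r) ^ 2 := sq_nonneg _
    have h2 : Y ≤ (1 + Y) ^ 2 := by nlinarith
    calc 8 * (cX / r) ^ 2 * Y ≤ 9 * (cX / r) ^ 2 * (1 + Y) ^ 2 := by gcongr; norm_num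
      _ = _ := by ring
  have b3 := S.integral_abs_cut_le ht hr0 0
  have b4 := S.integral_abs_cut_le ht hr0 1
  have hkt : 0 ≤ cK * cT := mul_nonneg cK_pos.le cT_nonneg
  have c2 : 4 * (2 * r) * √(∫ x, dv (fun i x => cut r x ^ 2 * U i s x) x ^ 2)
      ≤ 24 * cX * (1 + Y) := by
    calc _ ≤ 4 * (2 * r) * (3 * (cX / r) * (1 + Y)) := by gcongr
      _ = _ := by field_simp; ring
  have c3 : 4 * cK * cT * ((∫ x, |cut r x ^ 2 * U 0 s x|) + ∫ x, |cut r x ^ 2 * U 1 s x|) / (2 * r)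
      ≤ 32 * (cK * cT) * (1 + Y) := by
    rw [div_le_iff₀ (by positivity)]
    have := mul_le_mul_of_nonneg_left (add_le_add b3 b4) hkt
    linarith
  unfold cA
  linarith

/-- Integrating the localised energy balance in time. -/
lemma Sol.yy_add_le (S : Sol U E P T) {r : ℝ} (hr : 0 < r) {t : ℝ} (ht : t ∈ Icc 0 T)
    {D : ℝ → ℝ} (iD : IntegrableOn D (Ioc 0 t))
    (hD : ∀ᵐ s, s ∈ Ioo 0 T → -2 * pr P (fun i x => cut r x ^ 2 * U i s x) s
      + 2 * ∫ x, rem2 (sl U s) (slm E s) (fun x => cut r x ^ 2) x ≤ D s) :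
    yy U E r t + 2 * ∫ s in Ioc 0 t, ∫ x, cut r x ^ 2 * gr (sl U s) x
      ≤ yy U E r 0 + ∫ s in Ioc 0 t, D s := by
  set W : V → ℝ := fun x => cut r x ^ 2
  have hW : Sm W := sm_cut_sq r
  have hc : HasCompactSupport W := hasCompactSupport_cut_sq hr
  have h0 : ∀ x ∉ tsupport W, W x = 0 := fun x hx => image_eq_zero_of_notMem_tsupport hx
  have sY : STSm (fun t x => W x * (sqv (sl U t) x + sqm (slm E t) x)) :=
    (STSm.const hW).mul ((stsm_sqv S.su).add (stsm_sqm S.sE))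
  have sG : STSm (fun t x => W x * gr (sl U t) x) := (STSm.const hW).mul (stsm_gr S.su)
  have h1 := sY.integral_sub hc (fun t x hx => by simp only [h0 x hx, zero_mul]) ht.1
  have cG : Continuous (fun s => ∫ x, W x * gr (sl U s) x) :=
    sG.continuous_integral hc (fun t x hx => by simp only [h0 x hx, zero_mul])
  have iG : IntegrableOn (fun s => ∫ x, W x * gr (sl U s) x) (Ioc 0 t) :=
    cG.integrableOn_Ioc
  have hle : ∫ s in Ioc 0 t, ∫ x, dt (fun t x => W x * (sqv (sl U t) x + sqm (slm E t) x)) s x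
      ≤ ∫ s in Ioc 0 t, (D s - 2 * ∫ x, W x * gr (sl U s) x) := by
    refine integral_mono_ae ?_ (iD.sub (iG.const_mul 2)) ?_
    · exact (sY.dt.continuous_integral hc (fun t x hx => by
        unfold dt; simp only [h0 x hx, zero_mul, deriv_const])).integrableOn_Ioc
    · rw [EventuallyLE, ae_restrict_iff' measurableSet_Ioc]
      have hT' : ∀ᵐ s : ℝ, s ≠ T := by simp [ae_iff, measure_singleton]
      filter_upwards [hD, hT'] with s hp hsT hs
      have hs' : s ∈ Ioo 0 T := ⟨hs.1, lt_of_le_of_ne (hs.2.trans ht.2) hsT⟩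
      have := hp hs'
      rw [S.energy hW hc (Ioo_subset_Icc_self hs')]
      linarith
  rw [integral_sub iD (iG.const_mul 2), integral_const_mul, ← h1] at hle
  simp only [yy]
  linarith

/-- The crude localised energy inequality. -/
lemma Sol.energy_crude (S : Sol U E P T) : ∃ C : ℝ, 0 ≤ C ∧ ∀ r : ℝ, 1 ≤ r → ∀ t ∈ Icc 0 T,
    yy U E r t + 2 * ∫ s in Ioc 0 t, ∫ x, cut r x ^ 2 * gr (sl U s) x
      ≤ yy U E r 0 + ∫ s in Ioc 0 t, C * (1 + dis U s) * (1 + yy U E r s) := by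
  have hcA := cA_nonneg
  refine ⟨2 * cA + 8 + 320 * cX ^ 2, by positivity, fun r hr t ht => ?_⟩
  set C := 2 * cA + 8 + 320 * cX ^ 2
  have hr0 : 0 < r := by linarith
  have h0 := cut_sq_eq_zero r
  have cY : Continuous (yy U E r) :=
    ((STSm.const (sm_cut_sq r)).mul ((stsm_sqv S.su).add (stsm_sqm S.sE))).continuous_integral
      (hasCompactSupport_cut_sq hr0) (fun t x hx => by simp only [h0 x hx, zero_mul])
  have hsub : Ioc 0 t ⊆ Ioc 0 T := Ioc_subset_Ioc_right ht.2
  obtain ⟨B, hB⟩ := isCompact_Icc.exists_bound_of_continuousOn (s := Icc 0 T) cY.continuousOn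
  have iD : IntegrableOn (fun s => C * (1 + dis U s) * (1 + yy U E r s)) (Ioc 0 t) := by
    have iα : IntegrableOn (fun s => 1 + dis U s) (Ioc 0 t) :=
      (integrableOn_const (by simp)).add (S.idt.mono_set hsub)
    refine Integrable.mul_bdd (c := 1 + B) (iα.const_mul C)
      (continuous_const.add cY).aestronglyMeasurable ?_
    rw [ae_restrict_iff' measurableSet_Ioc]
    refine ae_of_all _ fun s hs => ?_
    exact (norm_add_le _ _).trans (add_le_add (by simp) (hB s ⟨hs.1.le, hs.2.trans ht.2⟩))
  refine S.yy_add_le hr0 ht iD ?_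
  filter_upwards [S.pr_ae_one] with s hp hs'
  have hst : s ∈ Icc 0 T := Ioo_subset_Icc_self hs'
  have hp1 := hp hs' r hr
  have id1 : Integrable (fun x => 4 * (sqv (sl U s) x * gr (sl U s) x)
      + 3 * (cut r x ^ 2 * sqv (sl U s) x)) :=
    ((S.id s hst).const_mul 4).add ((S.integrable_cut_sqv hst r).const_mul 3)
  have hrem : |∫ x, rem2 (sl U s) (slm E s) (fun x => cut r x ^ 2) x|
      ≤ 4 * dis U s + 3 * yy U E r s + 160 * cX ^ 2 := by
    rw [← Real.norm_eq_abs]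
    refine (norm_integral_le_of_norm_le (id1.add ((integrable_qc hr0).const_mul 5))
      (ae_of_all _ fun x => ?_)).trans ?_
    · rw [Real.norm_eq_abs]
      exact abs_rem2_le (S.bE s hst x) r
    · rw [integral_add' id1 ((integrable_qc hr0).const_mul 5),
        integral_add ((S.id s hst).const_mul 4) ((S.integrable_cut_sqv hst r).const_mul 3),
        integral_const_mul, integral_const_mul, integral_const_mul]
      have := S.integral_cut_sqv_le hst r
      have := integral_qc_le hr0
      simp only [dis]
      linarith
  have hd := dis_nn U s
  have hY := yy_nn (U := U) (E := E) r s
  have h3 := (abs_le.1 hp1).1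
  have h4 := (abs_le.1 hrem).2
  have hdY := mul_nonneg hd hY
  have hX2 := sq_nonneg cX
  have h5 : 4 * dis U s + 3 * yy U E r s + 160 * cX ^ 2
      ≤ (4 + 160 * cX ^ 2) * ((1 + yy U E r s) * (1 + dis U s)) := by
    nlinarith [mul_nonneg hX2 hd, mul_nonneg hX2 hY, mul_nonneg hX2 hdY]
  simp only [C]
  linarith

end

section
variable {U : Fin 2 → ℝ → V → ℝ} {E : Fin 2 → Fin 2 → ℝ → V → ℝ} {P : ℝ → V → ℝ} {T : ℝ}

/-- The total energy. -/
def en (U : Fin 2 → ℝ → V → ℝ) (E : Fin 2 → Fin 2 → ℝ → V → ℝ) (t : ℝ) : ℝ :=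
  (∫ x, sqv (sl U t) x) + ∫ x, sqm (slm E t) x

/-- The Dirichlet integral of the velocity. -/
def dd (U : Fin 2 → ℝ → V → ℝ) (t : ℝ) : ℝ := ∫ x, gr (sl U t) x

lemma en_nn (t : ℝ) : 0 ≤ en U E t :=
  add_nonneg (integral_nonneg fun x => sq_nn _ x) (integral_nonneg fun x => sqm_nn _ x)

lemma dd_nn (t : ℝ) : 0 ≤ dd U t := integral_nonneg fun x => gr_nn _ x

lemma Sol.yy_le (S : Sol U E P T) {t : ℝ} (ht : t ∈ Icc 0 T) (r : ℝ) : yy U E r t ≤ en U E t := by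
  refine (integral_cut_le (f := fun x => sqv (sl U t) x + sqm (slm E t) x)
    ((S.iu t ht).add (S.iE t ht))
    (fun x => add_nonneg (sq_nn _ x) (sqm_nn _ x)) r).trans ?_
  rw [integral_add (S.iu t ht) (S.iE t ht), en]

lemma Sol.tendsto_yy (S : Sol U E P T) {t : ℝ} (ht : t ∈ Icc 0 T) :
    Tendsto (fun n : ℕ => yy U E ((n : ℝ) + 1) t) atTop (nhds (en U E t)) := by
  have := tendsto_integral_cut (f := fun x => sqv (sl U t) x + sqm (slm E t) x)
    ((S.iu t ht).add (S.iE t ht))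
  rwa [integral_add (S.iu t ht) (S.iE t ht)] at this

lemma Sol.continuous_yy (S : Sol U E P T) {r : ℝ} (hr : 0 < r) : Continuous (yy U E r) := by
  have h0 := cut_sq_eq_zero r
  exact ((STSm.const (sm_cut_sq r)).mul ((stsm_sqv S.su).add (stsm_sqm S.sE))).continuous_integral
    (hasCompactSupport_cut_sq hr) (fun t x hx => by simp only [h0 x hx, zero_mul])

lemma Sol.continuous_cut_gr (S : Sol U E P T) {r : ℝ} (hr : 0 < r) :
    Continuous (fun s => ∫ x, cut r x ^ 2 * gr (sl U s) x) := by
  have h0 := cut_sq_eq_zero r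
  exact ((STSm.const (sm_cut_sq r)).mul (stsm_gr S.su)).continuous_integral
    (hasCompactSupport_cut_sq hr) (fun t x hx => by simp only [h0 x hx, zero_mul])

/-- Time-integrated dissipation from uniform bounds on the localised dissipation. -/
lemma Sol.integrable_dd_of (S : Sol U E P T) {t : ℝ} (ht : t ∈ Icc 0 T) {a : ℕ → ℝ} {A : ℝ}
    (ha : ∀ n : ℕ, ∫ s in Ioc 0 t, ∫ x, cut ((n : ℝ) + 1) x ^ 2 * gr (sl U s) x ≤ a n)
    (hA : Tendsto a atTop (nhds A)) :
    IntegrableOn (dd U) (Ioc 0 t) ∧ ∫ s in Ioc 0 t, dd U s ≤ A := by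
  refine integrable_of_fatou (g := fun (n : ℕ) s => ∫ x, cut ((n : ℝ) + 1) x ^ 2 * gr (sl U s) x)
    (fun n => ae_of_all _ fun s => integral_nonneg fun x => mul_nonneg (sq_nonneg _) (gr_nn _ x))
    (fun n => (S.continuous_cut_gr (by positivity)).integrableOn_Ioc) ?_ ha hA
  rw [ae_restrict_iff' measurableSet_Ioc]
  exact ae_of_all _ fun s hs => tendsto_integral_cut (S.ig s ⟨hs.1.le, hs.2.trans ht.2⟩)

/-- The energy stays bounded and the Dirichlet integral is integrable in time. -/
lemma Sol.exists_energy_bound (S : Sol U E P T) :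
    (∃ K : ℝ, 0 ≤ K ∧ ∀ t ∈ Icc 0 T, en U E t ≤ K) ∧ IntegrableOn (dd U) (Ioc 0 T) := by
  obtain ⟨C, hC, h⟩ := S.energy_crude
  have hT := S.hT.le
  have h0T : (0:ℝ) ∈ Icc 0 T := ⟨le_rfl, hT⟩
  have hTT : T ∈ Icc 0 T := ⟨hT, le_rfl⟩
  have iα : IntegrableOn (fun s => 1 + dis U s) (Ioc 0 T) :=
    (integrableOn_const (by simp)).add S.idt
  have ik : IntegrableOn (fun s => C * (1 + dis U s)) (Ioc 0 T) := iα.const_mul C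
  have k0 : ∀ s, 0 ≤ C * (1 + dis U s) := fun s =>
    mul_nonneg hC (add_nonneg zero_le_one (dis_nn U s))
  have hE0 := en_nn (U := U) (E := E) 0
  set J := ∫ s in Ioc 0 T, C * (1 + dis U s)
  have hJ : 0 ≤ J := integral_nonneg fun s => k0 s
  set K := 2 * (1 + en U E 0) * exp (2 * J)
  have hK : 0 ≤ K := by positivity
  have hg0 : ∀ (r t : ℝ), 0 ≤ ∫ s in Ioc 0 t, ∫ x, cut r x ^ 2 * gr (sl U s) x := fun r t =>
    integral_nonneg fun s => integral_nonneg fun x => mul_nonneg (sq_nonneg _) (gr_nn _ x)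
  have hY : ∀ r : ℝ, 1 ≤ r → ∀ t ∈ Icc 0 T, 1 + yy U E r t ≤ K := by
    intro r hr t ht
    obtain ⟨B, hB⟩ := isCompact_Icc.exists_bound_of_continuousOn (s := Icc 0 T)
      (S.continuous_yy (r := r) (by linarith)).continuousOn
    refine (gronwall_integral (X := fun t => 1 + yy U E r t) (A := 1 + en U E 0) (B := 1 + B) ik
      (fun s _ => k0 s) (fun t _ => add_nonneg zero_le_one (yy_nn r t))
      (fun t ht => add_le_add le_rfl ((le_abs_self _).trans (hB t ht))) (fun t ht => ?_) t ht).trans ?_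
    · have := h r hr t ht
      have := hg0 r t
      have := S.yy_le h0T r
      linarith
    · refine mul_le_mul_of_nonneg_left (Real.exp_le_exp.2 ?_) (by positivity)
      refine mul_le_mul_of_nonneg_left ?_ zero_le_two
      exact setIntegral_mono_set ik (ae_of_all _ k0) (Ioc_subset_Ioc_right ht.2).eventuallyLE
  refine ⟨⟨K, hK, fun t ht => le_of_tendsto' (S.tendsto_yy ht) fun n => ?_⟩, ?_⟩
  · have := hY ((n : ℝ) + 1) (by linarith [n.cast_nonneg (α := ℝ)]) t ht
    linarith
  · refine (S.integrable_dd_of hTT (a := fun _ => en U E 0 + J * K) (fun n => ?_)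
      tendsto_const_nhds).1
    have hr : (1:ℝ) ≤ (n : ℝ) + 1 := by linarith [n.cast_nonneg (α := ℝ)]
    have h1 := h _ hr T hTT
    have h2 := S.yy_le h0T ((n : ℝ) + 1)
    have h3 := hg0 ((n : ℝ) + 1) T
    have h4 := yy_nn (U := U) (E := E) ((n : ℝ) + 1) T
    have h5 : ∫ s in Ioc 0 T, C * (1 + dis U s) * (1 + yy U E ((n : ℝ) + 1) s) ≤ J * K := by
      rw [← integral_mul_const]
      refine integral_mono_of_nonneg (ae_of_all _ fun s => mul_nonneg (k0 s)
        (add_nonneg zero_le_one (yy_nn _ s))) (ik.mul_const K) ?_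
      rw [EventuallyLE, ae_restrict_iff' measurableSet_Ioc]
      exact ae_of_all _ fun s hs => mul_le_mul_of_nonneg_left
        (hY _ hr s (Ioc_subset_Icc_self hs)) (k0 s)
    linarith

end

lemma norm_fderiv_le_sum (f : V → ℝ) (x : V) : ‖fderiv ℝ f x‖ ≤ |pd 0 f x| + |pd 1 f x| := by
  refine ContinuousLinearMap.opNorm_le_bound _ (by positivity) fun v => ?_
  have e : v = v 0 • (Pi.single 0 1 : V) + v 1 • (Pi.single 1 1 : V) := by
    ext i; fin_cases i <;> simp
  have h0 : |v 0| ≤ ‖v‖ := norm_le_pi_norm v 0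
  have h1 : |v 1| ≤ ‖v‖ := norm_le_pi_norm v 1
  have e2 : fderiv ℝ f x v = v 0 * pd 0 f x + v 1 * pd 1 f x := by
    conv_lhs => rw [e]
    simp [pd, smul_eq_mul]
  rw [e2, Real.norm_eq_abs]
  refine (abs_add_le _ _).trans ?_
  rw [abs_mul, abs_mul]
  nlinarith [mul_le_mul_of_nonneg_right h0 (abs_nonneg (pd 0 f x)),
    mul_le_mul_of_nonneg_right h1 (abs_nonneg (pd 1 f x))]

lemma integral_sq_le_of_cpt {g : V → ℝ} (hg : Sm g) (hc : HasCompactSupport g) :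
    ∫ x, g x ^ 2 ≤ ((∫ x, |pd 0 g x|) + ∫ x, |pd 1 g x|) ^ 2 := by
  have hp : Real.HolderConjugate (Fintype.card (Fin 2)) 2 := by
    rw [Fintype.card_fin]; exact_mod_cast Real.HolderConjugate.two_two
  have h := lintegral_pow_le_pow_lintegral_fderiv_aux (ι := Fin 2) hp (u := g)
    (hg.of_le (by exact_mod_cast le_top)) hc
  have ip : ∀ i, Integrable (fun x => |pd i g x|) := fun i =>
    ((hg.pd i).integrable (HasCompactSupport.pd hc i)).abs
  have is : Integrable (fun x => |pd 0 g x| + |pd 1 g x|) := (ip 0).add (ip 1)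
  have hn : ∫⁻ x, ‖fderiv ℝ g x‖ₑ ≤ ofReal (∫ x, (|pd 0 g x| + |pd 1 g x|)) := by
    rw [ofReal_integral_eq_lintegral_ofReal is (ae_of_all _ fun x => by positivity)]
    refine lintegral_mono fun x => ?_
    rw [← ofReal_norm]
    exact ENNReal.ofReal_le_ofReal (norm_fderiv_le_sum g x)
  have ig : Integrable (fun x => g x ^ 2) :=
    (hg.pow 2).integrable (by simp_rw [pow_two]; exact hc.mul_left)
  have hl : ofReal (∫ x, g x ^ 2) = ∫⁻ x, ‖g x‖ₑ ^ (2:ℝ) := by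
    rw [ofReal_integral_eq_lintegral_ofReal ig (ae_of_all _ fun x => sq_nonneg _)]
    refine lintegral_congr fun x => ?_
    rw [← ofReal_norm, ENNReal.rpow_ofNat, ← ENNReal.ofReal_pow (norm_nonneg _),
      Real.norm_eq_abs, sq_abs]
  have hI : 0 ≤ ∫ x, (|pd 0 g x| + |pd 1 g x|) := integral_nonneg fun x => by positivity
  rw [← integral_add (ip 0) (ip 1)]
  refine (ENNReal.ofReal_le_ofReal_iff (by positivity)).1 ?_
  rw [hl, ENNReal.ofReal_pow hI]
  refine h.trans ?_
  rw [ENNReal.rpow_ofNat]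
  exact pow_le_pow_left' hn 2

/-- Ladyzhenskaya's inequality in the plane. -/
lemma ladyzhenskaya {h : V → ℝ} (hh : Sm h) (h2 : Integrable (fun x => h x ^ 2))
    (hd : ∀ i, Integrable (fun x => pd i h x ^ 2)) :
    Integrable (fun x => h x ^ 4) ∧
      ∫ x, h x ^ 4 ≤ 8 * (∫ x, h x ^ 2) * ((∫ x, pd 0 h x ^ 2) + ∫ x, pd 1 h x ^ 2) := by
  set A := ∫ x, h x ^ 2
  have hA : 0 ≤ A := integral_nonneg fun x => sq_nonneg _
  set D : Fin 2 → ℝ := fun i => ∫ x, pd i h x ^ 2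
  have hD : ∀ i, 0 ≤ D i := fun i => integral_nonneg fun x => sq_nonneg _
  set b : ℕ → Fin 2 → ℝ := fun n i => 2 * (cX / ((n:ℝ) + 1)) * A + 2 * (√A * √(D i))
  have hb : ∀ (n : ℕ) i, ∫ x, |pd i (fun x => cut ((n:ℝ)+1) x ^ 2 * h x ^ 2) x| ≤ b n i := by
    intro n i
    have hr : (0:ℝ) < (n:ℝ) + 1 := by positivity
    have im : Integrable (fun x => |h x * pd i h x|) :=
      (integrable_mul_of_sq hh.cont.aestronglyMeasurable (hh.pd i).cont.aestronglyMeasurable h2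
        (hd i)).abs
    have hm : ∫ x, |h x * pd i h x| ≤ √A * √(D i) := by
      have := abs_integral_mul_le (f := fun x => |h x|) (g := fun x => |pd i h x|)
        hh.cont.abs.aestronglyMeasurable (hh.pd i).cont.abs.aestronglyMeasurable
        (by simpa only [sq_abs] using h2) (by simpa only [sq_abs] using hd i)
      simp only [sq_abs, ← abs_mul] at this
      exact (le_abs_self _).trans this
    have hpt : ∀ x, |pd i (fun x => cut ((n:ℝ)+1) x ^ 2 * h x ^ 2) x|
        ≤ 2 * (cX / ((n:ℝ) + 1)) * h x ^ 2 + 2 * |h x * pd i h x| := by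
      intro x
      rw [pd_mul (sm_cut_sq _) (hh.pow 2), pd_sq hh]
      refine (abs_add_le _ _).trans (add_le_add ?_ ?_)
      · rw [abs_mul, abs_of_nonneg (sq_nonneg (h x))]
        refine mul_le_mul_of_nonneg_right ?_ (sq_nonneg _)
        rw [pd_cut_sq, abs_mul, abs_mul, abs_two, abs_of_nonneg (cut_nonneg _ x)]
        have h1 := abs_pd_cut_le hr i x
        have h2 := cut_le_one ((n:ℝ)+1) x
        have h3 := cut_nonneg ((n:ℝ)+1) x
        nlinarith [abs_nonneg (pd i (cut ((n:ℝ)+1)) x)]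
      · have e : cut ((n:ℝ)+1) x ^ 2 * (2 * h x * pd i h x)
            = cut ((n:ℝ)+1) x ^ 2 * (2 * (h x * pd i h x)) := by ring
        rw [e, abs_mul, abs_of_nonneg (sq_nonneg _), abs_mul 2, abs_two]
        exact mul_le_of_le_one_left (by positivity) (cut_sq_le_one _ x)
    refine (integral_mono_of_nonneg (ae_of_all _ fun x => abs_nonneg _)
      ((h2.const_mul _).add (im.const_mul 2)) (ae_of_all _ hpt)).trans ?_
    rw [integral_add' (h2.const_mul _) (im.const_mul 2), integral_const_mul, integral_const_mul]
    simp only [b]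
    linarith
  have ht : Tendsto (fun n => (b n 0 + b n 1) ^ 2) atTop
      (nhds (((0 + 2 * (√A * √(D 0))) + (0 + 2 * (√A * √(D 1)))) ^ 2)) := by
    have hz : Tendsto (fun n : ℕ => 2 * (cX / ((n:ℝ) + 1)) * A) atTop (nhds 0) := by
      have h1 : Tendsto (fun n : ℕ => cX / ((n:ℝ) + 1)) atTop (nhds 0) :=
        tendsto_const_nhds.div_atTop
          (tendsto_atTop_add_const_right _ _ tendsto_natCast_atTop_atTop)
      simpa using (h1.const_mul 2).mul_const A
    exact ((hz.add_const _).add (hz.add_const _)).pow 2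
  have hf := integrable_of_fatou (μ := volume)
    (g := fun (n : ℕ) x => (cut ((n:ℝ)+1) x ^ 2 * h x ^ 2) ^ 2) (G := fun x => (h x ^ 2) ^ 2)
    (fun n => ae_of_all _ fun x => sq_nonneg _) (fun n => ?_)
    (ae_of_all _ fun x => (tendsto_cut_sq_mul (fun x => h x ^ 2) x).pow 2)
    (a := fun n => (b n 0 + b n 1) ^ 2) (fun n => ?_) ht
  · have e : (fun x => h x ^ 4) = fun x => (h x ^ 2) ^ 2 := by ext x; ring
    rw [e]
    refine ⟨hf.1, hf.2.trans ?_⟩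
    have e2 : ((0 + 2 * (√A * √(D 0))) + (0 + 2 * (√A * √(D 1)))) ^ 2
        = 4 * √A ^ 2 * (√(D 0) + √(D 1)) ^ 2 := by ring
    rw [e2, Real.sq_sqrt hA]
    have h3 : (√(D 0) + √(D 1)) ^ 2 ≤ 2 * (D 0 + D 1) := by
      have := Real.sq_sqrt (hD 0)
      have := Real.sq_sqrt (hD 1)
      nlinarith [sq_nonneg (√(D 0) - √(D 1))]
    change _ ≤ 8 * A * (D 0 + D 1)
    nlinarith [mul_le_mul_of_nonneg_left h3 hA]
  · have hr : (0:ℝ) < (n:ℝ) + 1 := by positivity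
    refine (((sm_cut_sq _).mul (hh.pow 2)).pow 2).integrable ?_
    simp_rw [pow_two (_ * _)]
    exact ((hasCompactSupport_cut_sq hr).mul_right).mul_left
  · have hr : (0:ℝ) < (n:ℝ) + 1 := by positivity
    refine (integral_sq_le_of_cpt ((sm_cut_sq _).mul (hh.pow 2))
      (hasCompactSupport_cut_sq hr).mul_right).trans ?_
    refine pow_le_pow_left₀ ?_ (add_le_add (hb n 0) (hb n 1)) 2
    exact add_nonneg (integral_nonneg fun x => abs_nonneg _) (integral_nonneg fun x => abs_nonneg _)

section
variable {U : Fin 2 → ℝ → V → ℝ} {E : Fin 2 → Fin 2 → ℝ → V → ℝ} {P : ℝ → V → ℝ} {T : ℝ}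

lemma Sol.xx_le (S : Sol U E P T) {t : ℝ} (ht : t ∈ Icc 0 T) :
    xx U t ≤ 16 * en U E t * dd U t := by
  have hg := S.ig t ht
  have i1 : ∀ i j, Integrable (fun x => pd j (U i t) x ^ 2) := fun i j => by
    refine hg.mono' (((S.smU t i).pd j).cont.pow 2).aestronglyMeasurable (ae_of_all _ fun x => ?_)
    rw [Real.norm_of_nonneg (sq_nonneg _)]
    exact grad_sq_le (sl U t) i j x
  have i0 : ∀ i, Integrable (fun x => U i t x ^ 2) := fun i => S.integrable_sq ht i
  have L := fun i => ladyzhenskaya (S.smU t i) (i0 i) (i1 i)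
  have hle : ∀ x, sqv (sl U t) x ^ 2 ≤ 2 * U 0 t x ^ 4 + 2 * U 1 t x ^ 4 := fun x => by
    simp only [sqv, Fin.sum_univ_two]
    nlinarith [sq_nonneg (U 0 t x ^ 2 - U 1 t x ^ 2)]
  have h1 : xx U t ≤ 2 * (∫ x, U 0 t x ^ 4) + 2 * ∫ x, U 1 t x ^ 4 := by
    refine (integral_mono (S.iuu t ht)
      (((L 0).1.const_mul 2).add ((L 1).1.const_mul 2)) hle).trans ?_
    rw [integral_add' ((L 0).1.const_mul 2) ((L 1).1.const_mul 2), integral_const_mul,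
      integral_const_mul]
  have e1 : ∫ x, sqv (sl U t) x = (∫ x, U 0 t x ^ 2) + ∫ x, U 1 t x ^ 2 := by
    rw [← integral_add (i0 0) (i0 1)]; simp only [sqv, Fin.sum_univ_two]
  have i2 : ∀ i, Integrable (fun x => pd 0 (U i t) x ^ 2 + pd 1 (U i t) x ^ 2) := fun i =>
    (i1 i 0).add (i1 i 1)
  have e2 : dd U t = ((∫ x, pd 0 (U 0 t) x ^ 2) + ∫ x, pd 1 (U 0 t) x ^ 2)
      + ((∫ x, pd 0 (U 1 t) x ^ 2) + ∫ x, pd 1 (U 1 t) x ^ 2) := by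
    rw [← integral_add (i1 0 0) (i1 0 1), ← integral_add (i1 1 0) (i1 1 1),
      ← integral_add (i2 0) (i2 1)]
    simp only [dd, gr, Fin.sum_univ_two]
  have hn : ∀ i, 0 ≤ ∫ x, U i t x ^ 2 := fun i => integral_nonneg fun x => sq_nonneg _
  have hp : ∀ i j, 0 ≤ ∫ x, pd j (U i t) x ^ 2 := fun i j => integral_nonneg fun x => sq_nonneg _
  have h2 : 16 * (∫ x, sqv (sl U t) x) * dd U t ≤ 16 * en U E t * dd U t := by
    refine mul_le_mul_of_nonneg_right (mul_le_mul_of_nonneg_left ?_ (by norm_num)) (dd_nn t)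
    exact le_add_of_nonneg_right (integral_nonneg fun x => sqm_nn _ x)
  have h3 := (L 0).2
  have h4 := (L 1).2
  have m1 := mul_nonneg (hn 0) (add_nonneg (hp 1 0) (hp 1 1))
  have m2 := mul_nonneg (hn 1) (add_nonneg (hp 0 0) (hp 0 1))
  rw [e1, e2] at h2
  rw [e2]
  linarith

lemma Sol.sqv_four (S : Sol U E P T) {t : ℝ} (ht : t ∈ Icc 0 T) :
    Integrable (fun x => sqv (sl U t) x ^ 4) ∧
      ∫ x, sqv (sl U t) x ^ 4 ≤ 32 * xx U t * dis U t := by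
  have L := ladyzhenskaya (Sm.sqvv (S.smU t)) (S.iuu t ht) (S.integrable_pd_sq ht)
  refine ⟨L.1, L.2.trans ?_⟩
  have := S.integral_pd_sq_le ht
  rw [Fin.sum_univ_two] at this
  have h := mul_le_mul_of_nonneg_left this (mul_nonneg (by norm_num : (0:ℝ) ≤ 8) (xx_nn (U := U) t))
  change 8 * xx U t * _ ≤ _
  linarith

/-- The spatial `L⁴` norm is integrable in time. -/
lemma Sol.integrable_xx (S : Sol U E P T) : IntegrableOn (xx U) (Ioc 0 T) := by
  obtain ⟨⟨K, hK, hE⟩, iD⟩ := S.exists_energy_bound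
  refine Integrable.mono' (iD.const_mul (16 * K)) ?_ ?_
  · exact ((stsm_sqv S.su).pow 2).measurable_integral.aestronglyMeasurable
  · rw [ae_restrict_iff' measurableSet_Ioc]
    refine ae_of_all _ fun s hs => ?_
    have hs' := Ioc_subset_Icc_self hs
    rw [Real.norm_of_nonneg (xx_nn U s)]
    refine (S.xx_le hs').trans ?_
    exact mul_le_mul_of_nonneg_right (mul_le_mul_of_nonneg_left (hE s hs') (by norm_num)) (dd_nn s)

end

lemma abs_mul_mul_le {a b w δ : ℝ} (hw : |w| ≤ δ) : |a * b * w| ≤ δ / 2 * (a ^ 2 + b ^ 2) := by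
  rw [abs_mul]
  have h1 : |a * b| ≤ (a ^ 2 + b ^ 2) / 2 := by
    rw [abs_le]
    constructor <;> nlinarith [sq_nonneg (a - b), sq_nonneg (a + b)]
  have := mul_le_mul h1 hw (abs_nonneg _) (by positivity)
  linarith

lemma stress_sq_le {E : Fin 2 → Fin 2 → V → ℝ} {x : V} (h : sqm E x ≤ 1 / 4) (i j : Fin 2) :
    (E i j x + ff E i j x) ^ 2 ≤ 2 * E i j x ^ 2 + 1 / 2 * sqm E x := by
  have h1 := abs_ff_le E i j x
  have h2 : ff E i j x ^ 2 ≤ sqm E x ^ 2 := by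
    rw [← sq_abs]; exact pow_le_pow_left₀ (abs_nonneg _) h1 2
  have h3 := sqm_nn E x
  nlinarith [sq_nonneg (E i j x - ff E i j x)]

lemma abs_flux_le {u : Fin 2 → V → ℝ} {E : Fin 2 → Fin 2 → V → ℝ} {W : V → ℝ} {x : V} {δ : ℝ}
    (h : sqm E x ≤ 1 / 4) (hW : ∀ j, |pd j W x| ≤ δ) :
    |-(∑ i, ∑ j, pd j (u i) x * u i x * pd j W x)
      - (∑ i, ∑ j, (E i j x + ff E i j x) * u i x * pd j W x)
      + 1 / 2 * (sqm E x * ∑ j, u j x * pd j W x)| ≤ δ * (gr u x + 3 * sqv u x + 3 * sqm E x) := by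
  have hδ : 0 ≤ δ := (abs_nonneg _).trans (hW 0)
  have hm := sqm_nn E x
  have hg := gr_nn u x
  have a1 := fun i j => abs_mul_mul_le (a := pd j (u i) x) (b := u i x) (hW j)
  have a3 : ∀ i j, |(E i j x + ff E i j x) * u i x * pd j W x|
      ≤ δ / 2 * (2 * E i j x ^ 2 + 1 / 2 * sqm E x + u i x ^ 2) := fun i j =>
    (abs_mul_mul_le (hW j)).trans (mul_le_mul_of_nonneg_left
      (add_le_add (stress_sq_le h i j) le_rfl) (by linarith))
  have a4 : ∀ j, |sqm E x * u j x * pd j W x| ≤ δ / 2 * (sqm E x + u j x ^ 2) := fun j =>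
    (abs_mul_mul_le (hW j)).trans (mul_le_mul_of_nonneg_left
      (add_le_add (by nlinarith) le_rfl) (by linarith))
  have hgd := mul_nonneg hδ hg
  have hmd := mul_nonneg hδ hm
  have hvd := mul_nonneg hδ (sq_nn u x)
  simp only [gr, sqv, sqm, Fin.sum_univ_two, abs_le] at *
  constructor
  · linarith [(a1 0 0).2, (a1 0 1).2, (a1 1 0).2, (a1 1 1).2, (a3 0 0).2, (a3 0 1).2, (a3 1 0).2,
      (a3 1 1).2, (a4 0).1, (a4 1).1]
  · linarith [(a1 0 0).1, (a1 0 1).1, (a1 1 0).1, (a1 1 1).1, (a3 0 0).1, (a3 0 1).1, (a3 1 0).1,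
      (a3 1 1).1, (a4 0).2, (a4 1).2]

lemma abs_transport_le {u : Fin 2 → V → ℝ} {W : V → ℝ} {x : V} {δ : ℝ}
    (hW : ∀ j, |pd j W x| ≤ δ) :
    |-(1 / 2) * (sqv u x * ∑ j, u j x * pd j W x)| ≤ δ * (sqv u x + sqv u x ^ 2) := by
  have hδ : 0 ≤ δ := (abs_nonneg _).trans (hW 0)
  have hv := sq_nn u x
  have a := fun j => abs_mul_mul_le (a := sqv u x) (b := u j x) (hW j)
  have e : -(1 / 2) * (sqv u x * ∑ j, u j x * pd j W x)
      = -(1 / 2) * (sqv u x * u 0 x * pd 0 W x + sqv u x * u 1 x * pd 1 W x) := by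
    rw [Fin.sum_univ_two]; ring
  have e2 : u 0 x ^ 2 + u 1 x ^ 2 = sqv u x := by rw [sqv, Fin.sum_univ_two]
  have hvd := mul_nonneg hδ hv
  have hvd2 := mul_nonneg hδ (sq_nonneg (sqv u x))
  have e3 : δ * sqv u x = δ * u 0 x ^ 2 + δ * u 1 x ^ 2 := by rw [← e2]; ring
  rw [e, abs_mul]
  have := abs_add_le (sqv u x * u 0 x * pd 0 W x) (sqv u x * u 1 x * pd 1 W x)
  have := a 0
  have := a 1
  norm_num
  linarith

lemma abs_pd_cut_sq_le {r : ℝ} (hr : 0 < r) (j : Fin 2) (x : V) :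
    |pd j (fun y => cut r y ^ 2) x| ≤ 2 * (cX / r) := by
  rw [pd_cut_sq, abs_mul, abs_mul, abs_two, abs_of_nonneg (cut_nonneg r x)]
  nlinarith [abs_pd_cut_le hr j x, cut_le_one r x, cut_nonneg r x, abs_nonneg (pd j (cut r) x)]

section
variable {U : Fin 2 → ℝ → V → ℝ} {E : Fin 2 → Fin 2 → ℝ → V → ℝ} {P : ℝ → V → ℝ} {T : ℝ}

lemma Sol.abs_integral_rem2_le (S : Sol U E P T) {t : ℝ} (ht : t ∈ Icc 0 T) {r : ℝ} (hr : 0 < r) :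
    |∫ x, rem2 (sl U t) (slm E t) (fun x => cut r x ^ 2) x|
      ≤ 2 * (cX / r) * (dd U t + 4 * en U E t + xx U t) := by
  set W : V → ℝ := fun x => cut r x ^ 2
  set δ := 2 * (cX / r)
  have hW : Sm W := sm_cut_sq r
  have hc : HasCompactSupport W := hasCompactSupport_cut_sq hr
  have hd : ∀ j x, |pd j W x| ≤ δ := abs_pd_cut_sq_le hr
  have su := S.smU t
  have hδ : 0 ≤ δ := (abs_nonneg _).trans (hd 0 0)
  set Q : V → ℝ := fun x => -(∑ i, ∑ j, pd j (U i t) x * U i t x * pd j W x)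
      - (∑ i, ∑ j, (E i j t x + ff (slm E t) i j x) * U i t x * pd j W x)
      + 1 / 2 * (sqm (slm E t) x * ∑ j, U j t x * pd j W x)
  set A : V → ℝ := fun x => ∑ i, W x * (U i t x * nn (sl U t) i x)
  have sQ : Sm Q := by
    refine Sm.add (Sm.sub (Sm.neg (Sm.sum fun i => Sm.sum fun j => ?_))
      (Sm.sum fun i => Sm.sum fun j => ?_))
      (((Sm.sqvm (S.smE t)).mul (Sm.sum fun j => (su j).mul (hW.pd j))).const_mul (1 / 2))
    · exact (((su i).pd j).mul (su i)).mul (hW.pd j)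
    · exact (((S.smE t i j).add (Sm.ff (S.smE t) i j)).mul (su i)).mul (hW.pd j)
  have iA : Integrable A := integrable_finsetSum _ fun i _ =>
    (hW.mul ((su i).mul (Sm.nn su i))).integrable hc.mul_right
  have i1 : Integrable (fun x => gr (sl U t) x + 3 * sqv (sl U t) x) :=
    (S.ig t ht).add ((S.iu t ht).const_mul 3)
  have i2 : Integrable (fun x => gr (sl U t) x + 3 * sqv (sl U t) x + 3 * sqm (slm E t) x) :=
    i1.add ((S.iE t ht).const_mul 3)
  have bQ : ∀ x, |Q x| ≤ δ * (gr (sl U t) x + 3 * sqv (sl U t) x + 3 * sqm (slm E t) x) :=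
    fun x => abs_flux_le (S.bE t ht x) fun j => hd j x
  have iQ : Integrable Q := (i2.const_mul δ).mono' sQ.cont.aestronglyMeasurable (ae_of_all _ bQ)
  have hQ : |∫ x, Q x| ≤ δ * (dd U t + 3 * en U E t) := by
    rw [← Real.norm_eq_abs]
    refine (norm_integral_le_of_norm_le (i2.const_mul δ) (ae_of_all _ bQ)).trans (le_of_eq ?_)
    rw [integral_const_mul, integral_add i1 ((S.iE t ht).const_mul 3),
      integral_add (S.ig t ht) ((S.iu t ht).const_mul 3), integral_const_mul, integral_const_mul]
    simp only [dd, en]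
    ring
  have hA : |∫ x, A x| ≤ δ * (en U E t + xx U t) := by
    rw [S.integral_convect hW hc ht, ← Real.norm_eq_abs]
    have i3 : Integrable (fun x => sqv (sl U t) x + sqv (sl U t) x ^ 2) :=
      (S.iu t ht).add (S.iuu t ht)
    refine (norm_integral_le_of_norm_le (i3.const_mul δ)
      (ae_of_all _ fun x => abs_transport_le fun j => hd j x)).trans ?_
    rw [integral_const_mul, integral_add (S.iu t ht) (S.iuu t ht)]
    refine mul_le_mul_of_nonneg_left ?_ hδ
    simp only [en, xx]
    have : 0 ≤ ∫ x, sqm (slm E t) x := integral_nonneg fun x => sqm_nn _ x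
    linarith
  have e : ∫ x, rem2 (sl U t) (slm E t) W x = (∫ x, Q x) - ∫ x, A x := by
    rw [← integral_sub iQ iA]
    refine integral_congr_ae (ae_of_all _ fun x => ?_)
    simp only [rem2, Q, A]
    ring
  rw [e]
  have := abs_sub (∫ x, Q x) (∫ x, A x)
  linarith

/-- The energy inequality. -/
lemma Sol.energy_le (S : Sol U E P T) {t : ℝ} (ht : t ∈ Icc 0 T) :
    en U E t + 2 * ∫ s in Ioc 0 t, dd U s ≤ en U E 0 := by
  obtain ⟨⟨K, hK, hE⟩, iD⟩ := S.exists_energy_bound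
  have h0T : (0:ℝ) ∈ Icc 0 T := ⟨le_rfl, S.hT.le⟩
  have iX := S.integrable_xx
  have iα : IntegrableOn (fun s => 1 + xx U s) (Ioc 0 T) :=
    (integrableOn_const (by simp)).add iX
  have hX := cX_pos
  set C1 := 24 * (2 + K) * (1 + K)
  have hpr : ∀ᵐ s, s ∈ Ioo 0 T → ∀ r : ℝ, 0 < r →
      |pr P (fun i x => cut r x ^ 2 * U i s x) s| ≤ C1 * (cX / r) * (1 + xx U s) := by
    filter_upwards [S.pressure_ae iα] with s h hs r hr
    have ht : s ∈ Icc 0 T := Ioo_subset_Icc_self hs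
    refine h hs _ (S.tst_cut hr s) _ ?_
    obtain ⟨κ, h1, h2⟩ := S.exists_lam_two hE (S.tst_cut hr s)
    refine ⟨κ, h1, h2.mono fun q hq τ hτ => (hq τ hτ).trans ?_⟩
    have hx := xx_nn U τ
    refine add_le_add (mul_le_mul_of_nonneg_right ?_ (by linarith)) le_rfl
    have b2 : √(∫ x, dv (fun i x => cut r x ^ 2 * U i s x) x ^ 2) ≤ 6 * (cX / r) * (1 + K) := by
      rw [Real.sqrt_le_left (by positivity)]
      refine (S.integral_dv_cut_sq_le ht hr).trans ?_
      have hY := (S.yy_le ht r).trans (hE s ht)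
      have h2 : yy U E r s ≤ (1 + K) ^ 2 := by nlinarith
      calc 8 * (cX / r) ^ 2 * yy U E r s ≤ 36 * (cX / r) ^ 2 * (1 + K) ^ 2 := by
            have := yy_nn (U := U) (E := E) r s
            gcongr; norm_num
        _ = _ := by ring
    calc 4 * (2 + K) * √(∫ x, dv (fun i x => cut r x ^ 2 * U i s x) x ^ 2)
        ≤ 4 * (2 + K) * (6 * (cX / r) * (1 + K)) := by gcongr
      _ = C1 * (cX / r) := by simp only [C1]; ring
  set G : ℝ → ℝ := fun s => 2 * C1 * (1 + xx U s) + 4 * (dd U s + 4 * K + xx U s)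
  have iG : IntegrableOn G (Ioc 0 t) := by
    have i4 : IntegrableOn (fun s => dd U s + 4 * K + xx U s) (Ioc 0 T) :=
      (iD.add (integrableOn_const (by simp))).add iX
    have i5 : IntegrableOn G (Ioc 0 T) := (iα.const_mul (2 * C1)).add (i4.const_mul 4)
    exact i5.mono_set (Ioc_subset_Ioc_right ht.2)
  have hr : ∀ n : ℕ, (0:ℝ) < (n:ℝ) + 1 := fun n => by positivity
  have key : ∀ n : ℕ, yy U E ((n:ℝ)+1) t
      + 2 * ∫ s in Ioc 0 t, ∫ x, cut ((n:ℝ)+1) x ^ 2 * gr (sl U s) x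
      ≤ yy U E ((n:ℝ)+1) 0 + cX / ((n:ℝ)+1) * ∫ s in Ioc 0 t, G s := by
    intro n
    rw [← integral_const_mul (cX / ((n:ℝ)+1))]
    refine S.yy_add_le (hr n) ht (iG.const_mul _) ?_
    filter_upwards [hpr] with s hp hs
    have hs' : s ∈ Icc 0 T := Ioo_subset_Icc_self hs
    have h1 := (abs_le.1 (hp hs _ (hr n))).1
    have h2 := (abs_le.1 (S.abs_integral_rem2_le hs' (hr n))).2
    have h3 : 0 ≤ cX / ((n:ℝ)+1) := (div_pos hX (hr n)).le
    have h4 := mul_le_mul_of_nonneg_left (hE s hs') h3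
    simp only [G]
    linarith
  have hz : Tendsto (fun n : ℕ => cX / ((n:ℝ) + 1) * ∫ s in Ioc 0 t, G s) atTop (nhds 0) := by
    have h1 : Tendsto (fun n : ℕ => cX / ((n:ℝ) + 1)) atTop (nhds 0) :=
      tendsto_const_nhds.div_atTop
        (tendsto_atTop_add_const_right _ _ tendsto_natCast_atTop_atTop)
    simpa using h1.mul_const (∫ s in Ioc 0 t, G s)
  have := (S.integrable_dd_of ht
    (a := fun n : ℕ => (yy U E ((n:ℝ)+1) 0 + cX / ((n:ℝ)+1) * (∫ s in Ioc 0 t, G s)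
      - yy U E ((n:ℝ)+1) t) / 2) (fun n => by have := key n; linarith)
    ((((S.tendsto_yy h0T).add hz).sub (S.tendsto_yy ht)).div_const 2)).2
  linarith

end

section
variable {U : Fin 2 → ℝ → V → ℝ} {E : Fin 2 → Fin 2 → ℝ → V → ℝ} {P : ℝ → V → ℝ} {T : ℝ}

/-- The localised fourth power integral of the velocity. -/
def xr (U : Fin 2 → ℝ → V → ℝ) (r t : ℝ) : ℝ := ∫ x, cut r x ^ 2 * sqv (sl U t) x ^ 2

lemma xr_nn (U : Fin 2 → ℝ → V → ℝ) (r t : ℝ) : 0 ≤ xr U r t :=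
  integral_nonneg fun _ => mul_nonneg (sq_nonneg _) (sq_nonneg _)

lemma Sol.xr_le (S : Sol U E P T) {t : ℝ} (ht : t ∈ Icc 0 T) (r : ℝ) : xr U r t ≤ xx U t :=
  integral_cut_le (S.iuu t ht) (fun _ => sq_nonneg _) r

lemma Sol.tst_four (S : Sol U E P T) {r : ℝ} (hr : 0 < r) (t : ℝ) :
    Tst (fun i x => cut r x ^ 2 * (sqv (sl U t) x * U i t x)) :=
  ⟨fun i => (sm_cut_sq r).mul ((Sm.sqvv (S.smU t)).mul (S.smU t i)),
    fun _ => (hasCompactSupport_cut_sq hr).mul_right⟩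

lemma Sol.abs_dv_four_le (S : Sol U E P T) {t : ℝ} (ht : t ∈ Icc 0 T) {r : ℝ} (hr : 0 < r) (x : V) :
    |dv (fun i x => cut r x ^ 2 * (sqv (sl U t) x * U i t x)) x|
      ≤ |√(cut r x * sqv (sl U t) x) * (|pd 0 (sqv (sl U t)) x| + |pd 1 (sqv (sl U t)) x|
        + 4 * (cX / r) * sqv (sl U t) x)| := by
  have sv := Sm.sqvv (S.smU t)
  have e : (fun (i : Fin 2) (x : V) => cut r x ^ 2 * (sqv (sl U t) x * U i t x))
      = fun i x => (cut r x ^ 2 * sqv (sl U t) x) * U i t x := by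
    ext i x; ring
  rw [e, dv_mul ((sm_cut_sq r).mul sv) (S.smU t) (S.du t ht x)]
  have hv := sq_nn (sl U t) x
  have hη0 := cut_nonneg r x
  have hη1 := cut_le_one r x
  have hX := cX_pos
  have hu : ∀ j, |U j t x| ≤ √(sqv (sl U t) x) := fun j =>
    Real.abs_le_sqrt (coord_sq_le (sl U t) j x)
  have hη : cut r x ≤ √(cut r x) := Real.le_sqrt_of_sq_le (by nlinarith)
  set η := cut r x
  set v := sqv (sl U t) x
  have hp : ∀ j, |pd j (fun y => cut r y ^ 2 * sqv (sl U t) y) x * U j t x|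
      ≤ √η * √v * (2 * (cX / r) * v + |pd j (sqv (sl U t)) x|) := by
    intro j
    have h1 := abs_pd_cut_le hr j x
    have e1 : pd j (fun y => cut r y ^ 2 * sqv (sl U t) y) x
        = η * (2 * pd j (cut r) x * v + η * pd j (sqv (sl U t)) x) := by
      rw [pd_mul (sm_cut_sq r) sv, pd_cut_sq]
      ring
    have h2 : |2 * pd j (cut r) x * v + η * pd j (sqv (sl U t)) x|
        ≤ 2 * (cX / r) * v + |pd j (sqv (sl U t)) x| := by
      refine (abs_add_le _ _).trans (add_le_add ?_ ?_)
      · rw [abs_mul, abs_mul, abs_two, abs_of_nonneg hv]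
        gcongr
      · rw [abs_mul, abs_of_nonneg hη0]
        exact mul_le_of_le_one_left (abs_nonneg _) hη1
    rw [e1, abs_mul, abs_mul, abs_of_nonneg hη0]
    calc η * |2 * pd j (cut r) x * v + η * pd j (sqv (sl U t)) x| * |U j t x|
        ≤ √η * (2 * (cX / r) * v + |pd j (sqv (sl U t)) x|) * √v := by
          gcongr
          exact hu j
      _ = _ := by ring
  rw [Fin.sum_univ_two, Real.sqrt_mul hη0, abs_of_nonneg (a := √η * √v * _) (by positivity)]
  refine (abs_add_le _ _).trans ((add_le_add (hp 0) (hp 1)).trans (le_of_eq ?_))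
  ring

lemma Sol.integrable_sqm_sq (S : Sol U E P T) {t : ℝ} (ht : t ∈ Icc 0 T) :
    Integrable (fun x => sqm (slm E t) x ^ 2) := by
  refine (S.iE t ht).mono' ((Sm.sqvm (S.smE t)).pow 2).cont.aestronglyMeasurable
    (ae_of_all _ fun x => ?_)
  rw [Real.norm_of_nonneg (sq_nonneg _)]
  nlinarith [S.bE t ht x, sqm_nn (slm E t) x]

lemma Sol.gg_four (S : Sol U E P T) {t : ℝ} (ht : t ∈ Icc 0 T) {β : ℝ}
    (hβ : ∫ x, sqm (slm E t) x ^ 2 ≤ β) (i j : Fin 2) :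
    Integrable (fun x => gg (sl U t) (slm E t) i j x ^ 4) ∧
      ∫ x, gg (sl U t) (slm E t) i j x ^ 4 ≤ 256 * (xx U t * dis U t + β) := by
  have h4 := S.sqv_four ht
  have im := S.integrable_sqm_sq ht
  have hle : ∀ x, gg (sl U t) (slm E t) i j x ^ 4
      ≤ 8 * sqv (sl U t) x ^ 4 + sqm (slm E t) x ^ 2 := by
    intro x
    have h1 := abs_gg_le (sl U t) (slm E t) i j x
    have h2 := S.bE t ht x
    have h3 := sqm_nn (slm E t) x
    have h4 := sq_nn (sl U t) x
    have h5 : gg (sl U t) (slm E t) i j x ^ 4 ≤ (sqv (sl U t) x + sqm (slm E t) x) ^ 4 := by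
      rw [← (by decide : Even 4).pow_abs]
      exact pow_le_pow_left₀ (abs_nonneg _) h1 4
    set a := sqv (sl U t) x
    set b := sqm (slm E t) x
    have h6 : (a + b) ^ 4 ≤ 8 * (a ^ 4 + b ^ 4) := by
      have h7 : (a + b) ^ 2 ≤ 2 * (a ^ 2 + b ^ 2) := by nlinarith [sq_nonneg (a - b)]
      have h8 : ((a + b) ^ 2) ^ 2 ≤ (2 * (a ^ 2 + b ^ 2)) ^ 2 :=
        pow_le_pow_left₀ (sq_nonneg _) h7 2
      nlinarith [sq_nonneg (a ^ 2 - b ^ 2)]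
    have h10 : b ^ 2 ≤ 1 / 16 := by nlinarith
    have h9 : b ^ 4 ≤ 1 / 16 * b ^ 2 := by
      calc b ^ 4 = b ^ 2 * b ^ 2 := by ring
        _ ≤ _ := mul_le_mul_of_nonneg_right h10 (sq_nonneg b)
    linarith [sq_nonneg b]
  have ig := ((h4.1.const_mul 8).add im)
  refine ⟨ig.mono' ((Sm.gg (S.smU t) (S.smE t) i j).pow 4).cont.aestronglyMeasurable
    (ae_of_all _ fun x => ?_), ?_⟩
  · rw [Real.norm_of_nonneg (by positivity)]; exact hle x
  · refine (integral_mono_of_nonneg (ae_of_all _ fun x => by positivity) ig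
      (ae_of_all _ hle)).trans ?_
    rw [integral_add' (h4.1.const_mul 8) im, integral_const_mul]
    have : 0 ≤ ∫ x, sqm (slm E t) x ^ 2 := integral_nonneg fun _ => sq_nonneg _
    linarith [h4.2]

lemma sqrt_sqrt_le_one_add {a : ℝ} (ha : 0 ≤ a) : √√a ≤ 1 + a := by
  rw [Real.sqrt_le_left (by linarith)]
  refine (sqrt_le_one_add ha).trans ?_
  nlinarith

lemma sqrt_sqrt_mul_add_le {a b c : ℝ} (ha : 0 ≤ a) (hb : 0 ≤ b) (hc : 0 ≤ c) :
    √√(a * b + c) ≤ 1 + a + b + c := by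
  rw [Real.sqrt_le_left (by positivity), Real.sqrt_le_left (by positivity)]
  have h1 : a * b + c ≤ (1 + a + b + c) ^ 2 := by
    nlinarith [mul_nonneg ha hc, mul_nonneg hb hc, mul_nonneg ha hb]
  have h2 : (1:ℝ) ≤ (1 + a + b + c) ^ 2 := by
    nlinarith [mul_nonneg ha hc, mul_nonneg hb hc, mul_nonneg ha hb]
  refine h1.trans ?_
  nlinarith

/-- Pressure bound in the localised balance for `|u|⁴`. -/
lemma Sol.pr_ae_four (S : Sol U E P T) (hE0 : en U E 0 ≤ 1) {β : ℝ} (hβ0 : 0 ≤ β)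
    (hβ : ∀ t ∈ Icc 0 T, ∫ x, sqm (slm E t) x ^ 2 ≤ β) :
    ∀ᵐ s, s ∈ Ioo 0 T → ∀ r : ℝ, 0 < r →
      |pr P (fun i x => cut r x ^ 2 * (sqv (sl U s) x * U i s x)) s|
        ≤ 16 * √√cR * (√√(xr U r s) * √(12 * dis U s + 48 * (cX / r) ^ 2 * xx U s))
          * √√(xx U s * dis U s + β) := by
  have iX := S.integrable_xx
  have i1 : IntegrableOn (fun s => 1 + xx U s) (Ioc 0 T) :=
    (integrableOn_const (by simp)).add iX
  have i2 : IntegrableOn (fun s => 1 + xx U s + dis U s) (Ioc 0 T) := i1.add S.idt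
  have i3 : IntegrableOn (fun s => 1 + xx U s + dis U s + β) (Ioc 0 T) :=
    i2.add (integrableOn_const (by simp))
  have iα : IntegrableOn (fun s => √√(xx U s * dis U s + β)) (Ioc 0 T) := by
    refine i3.mono' ?_ (ae_of_all _ fun s => ?_)
    · exact (Real.continuous_sqrt.comp Real.continuous_sqrt).comp_aestronglyMeasurable
        ((iX.aestronglyMeasurable.mul S.idt.aestronglyMeasurable).add aestronglyMeasurable_const)
    · rw [Real.norm_of_nonneg (Real.sqrt_nonneg _)]
      exact sqrt_sqrt_mul_add_le (xx_nn U s) (dis_nn U s) hβ0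
  filter_upwards [S.pressure_ae iα] with s h hs r hr
  have ht : s ∈ Icc 0 T := Ioo_subset_Icc_self hs
  refine h hs _ (S.tst_four hr s) _ ?_
  have sv := Sm.sqvv (S.smU s)
  set p : V → ℝ := fun x => √(cut r x * sqv (sl U s) x)
  set q : V → ℝ := fun x => |pd 0 (sqv (sl U s)) x| + |pd 1 (sqv (sl U s)) x|
    + 4 * (cX / r) * sqv (sl U s) x
  have cp : Continuous p := Real.continuous_sqrt.comp ((sm_cut r).cont.mul sv.cont)
  have cq : Continuous q := ((sv.pd 0).cont.abs.add (sv.pd 1).cont.abs).add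
    (continuous_const.mul sv.cont)
  have ep : ∀ x, p x ^ 4 = cut r x ^ 2 * sqv (sl U s) x ^ 2 := fun x => by
    have : p x ^ 2 = cut r x * sqv (sl U s) x :=
      Real.sq_sqrt (mul_nonneg (cut_nonneg r x) (sq_nn _ x))
    calc p x ^ 4 = (p x ^ 2) ^ 2 := by ring
      _ = _ := by rw [this]; ring
  have ip4 : Integrable (fun x => p x ^ 4) := by
    simp_rw [ep]; exact integrable_cut_sq_mul (S.iuu s ht) r
  have ipd := S.integrable_pd_sq ht
  have im : Integrable (fun x => 3 * pd 0 (sqv (sl U s)) x ^ 2 + 3 * pd 1 (sqv (sl U s)) x ^ 2) :=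
    ((ipd 0).const_mul 3).add ((ipd 1).const_mul 3)
  have iu := (S.iuu s ht).const_mul (48 * (cX / r) ^ 2)
  have hq : ∀ x, q x ^ 2 ≤ 3 * pd 0 (sqv (sl U s)) x ^ 2 + 3 * pd 1 (sqv (sl U s)) x ^ 2
      + 48 * (cX / r) ^ 2 * sqv (sl U s) x ^ 2 := by
    intro x
    rw [← sq_abs (pd 0 _ _), ← sq_abs (pd 1 _ _)]
    simp only [q]
    set a := |pd 0 (sqv (sl U s)) x|
    set b := |pd 1 (sqv (sl U s)) x|
    have e : 48 * (cX / r) ^ 2 * sqv (sl U s) x ^ 2 = 3 * (4 * (cX / r) * sqv (sl U s) x) ^ 2 := by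
      ring
    rw [e]
    nlinarith [sq_nonneg (a - b), sq_nonneg (a - 4 * (cX / r) * sqv (sl U s) x),
      sq_nonneg (b - 4 * (cX / r) * sqv (sl U s) x)]
  have iq2 : Integrable (fun x => q x ^ 2) := (im.add iu).mono'
    (cq.pow 2).aestronglyMeasurable (ae_of_all _ fun x => by
      rw [Real.norm_of_nonneg (sq_nonneg _)]; exact hq x)
  have hqi : ∫ x, q x ^ 2 ≤ 12 * dis U s + 48 * (cX / r) ^ 2 * xx U s := by
    refine (integral_mono iq2 (im.add iu) hq).trans ?_
    rw [integral_add' im iu, integral_add ((ipd 0).const_mul 3) ((ipd 1).const_mul 3),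
      integral_const_mul, integral_const_mul, integral_const_mul]
    have := S.integral_pd_sq_le ht
    rw [Fin.sum_univ_two] at this
    simp only [xx]
    linarith
  obtain ⟨κ, h1, h2⟩ := S.exists_lam_four (K := 1)
    (fun t ht => by
      have := S.energy_le ht
      have h3 : 0 ≤ ∫ s in Ioc 0 t, dd U s := integral_nonneg fun s => dd_nn s
      change en U E t ≤ 1
      linarith)
    (S.tst_four hr s) cp.aestronglyMeasurable cq.aestronglyMeasurable ip4 iq2
    (S.abs_dv_four_le ht hr) (γ := fun τ => 256 * (xx U τ * dis U τ + β))
    (fun τ hτ i j => S.gg_four hτ (hβ τ hτ) i j)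
  refine ⟨κ, h1, h2.mono fun q' hq' τ hτ => (hq' τ hτ).trans (add_le_add ?_ le_rfl)⟩
  have e256 : √√(256 * (xx U τ * dis U τ + β)) = 4 * √√(xx U τ * dis U τ + β) := by
    rw [Real.sqrt_mul (by norm_num), Real.sqrt_mul (by positivity)]
    congr 1
    rw [show (256:ℝ) = (4 ^ 2) ^ 2 by norm_num, Real.sqrt_sq (by norm_num),
      Real.sqrt_sq (by norm_num)]
  have exr : ∫ x, p x ^ 4 = xr U r s := by simp_rw [ep]; rfl
  rw [e256, exr]
  calc 4 * √√cR * (√√(xr U r s) * √(∫ x, q x ^ 2)) * (4 * √√(xx U τ * dis U τ + β))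
      ≤ 4 * √√cR * (√√(xr U r s) * √(12 * dis U s + 48 * (cX / r) ^ 2 * xx U s))
        * (4 * √√(xx U τ * dis U τ + β)) := by gcongr
    _ = _ := by ring

end

lemma abs_double_sum_le {f g : Fin 2 → Fin 2 → ℝ} (h : ∀ i j, |f i j| ≤ g i j) :
    |∑ i, ∑ j, f i j| ≤ ∑ i, ∑ j, g i j :=
  (Finset.abs_sum_le_sum_abs _ _).trans (Finset.sum_le_sum fun i _ =>
    (Finset.abs_sum_le_sum_abs _ _).trans (Finset.sum_le_sum fun j _ => h i j))

lemma abs_mul_le_add_sq (a b : ℝ) : |a * b| ≤ 1 / 36 * a ^ 2 + 9 * b ^ 2 := by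
  rw [abs_le]
  constructor <;> nlinarith [sq_nonneg (a - 18 * b), sq_nonneg (a + 18 * b)]

lemma abs_rem4_le {u : Fin 2 → V → ℝ} {E : Fin 2 → Fin 2 → V → ℝ} {W : V → ℝ} {x : V} {δ a η : ℝ}
    (h : sqm E x ≤ 1 / 4) (hη1 : η ≤ 1) (hW : W x = η ^ 2)
    (hd : ∀ j, |pd j W x| ≤ δ * η) (hδ : 0 ≤ δ) (ha : 0 < a)
    (hG : ∑ j, pd j (sqv u) x ^ 2 ≤ 4 * (sqv u x * gr u x)) :
    |rem4 u E W x| ≤ W x * (1 / 4 * (sqv u x * gr u x) + 36 * (sqv u x ^ 2 + sqm E x ^ 2))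
      + δ * (1 / 2 * (sqv u x * gr u x) + 4 * sqv u x ^ 2 + sqv u x
        + a * (W x * sqv u x ^ 2) + a⁻¹ * (sqv u x ^ 2 + sqv u x ^ 4)) := by
  have hm := sqm_nn E x
  have hv := sq_nn u x
  have hg := gr_nn u x
  have hd' : ∀ j, |pd j W x| ≤ δ := fun j => (hd j).trans (mul_le_of_le_one_right hδ hη1)
  have hw : ∀ j, |sqv u x * pd j W x| ≤ sqv u x * δ := fun j => by
    rw [abs_mul, abs_of_nonneg hv]; exact mul_le_mul_of_nonneg_left (hd' j) hv
  have hW0 : 0 ≤ W x := hW ▸ sq_nonneg η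
  have hS := fun i j => stress_sq_le h i j
  have hu := fun i => coord_sq_le u i x
  have ev : u 0 x ^ 2 + u 1 x ^ 2 = sqv u x := by rw [sqv, Fin.sum_univ_two]
  have em : E 0 0 x ^ 2 + E 0 1 x ^ 2 + (E 1 0 x ^ 2 + E 1 1 x ^ 2) = sqm E x := by
    simp only [sqm, Fin.sum_univ_two]
  have eg : pd 0 (u 0) x ^ 2 + pd 1 (u 0) x ^ 2 + (pd 0 (u 1) x ^ 2 + pd 1 (u 1) x ^ 2)
      = gr u x := by simp only [gr, Fin.sum_univ_two]
  rw [Fin.sum_univ_two] at hG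
  have t1 : |∑ i, ∑ j, pd j (u i) x * u i x * sqv u x * pd j W x|
      ≤ δ * (1 / 2 * (sqv u x * gr u x) + sqv u x ^ 2) := by
    refine (abs_double_sum_le (g := fun i j => sqv u x * δ / 2 * (pd j (u i) x ^ 2 + u i x ^ 2))
      fun i j => ?_).trans (le_of_eq ?_)
    · rw [mul_assoc (pd j (u i) x * u i x)]; exact abs_mul_mul_le (hw j)
    · simp only [Fin.sum_univ_two]
      rw [← eg]
      linear_combination (sqv u x * δ) * ev
  have t3 : |∑ i, ∑ j, (E i j x + ff E i j x) * (pd j W x * (sqv u x * u i x))|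
      ≤ δ * (sqv u x ^ 2 + sqv u x) := by
    refine (abs_double_sum_le (g := fun i j => sqv u x * δ / 2
      * ((2 * E i j x ^ 2 + 1 / 2 * sqm E x) + u i x ^ 2)) fun i j => ?_).trans ?_
    · rw [show (E i j x + ff E i j x) * (pd j W x * (sqv u x * u i x))
        = (E i j x + ff E i j x) * u i x * (sqv u x * pd j W x) by ring]
      exact (abs_mul_mul_le (hw j)).trans (mul_le_mul_of_nonneg_left
        (add_le_add (hS i j) le_rfl) (by positivity))
    · have e : ∑ i, ∑ j, sqv u x * δ / 2 * ((2 * E i j x ^ 2 + 1 / 2 * sqm E x) + u i x ^ 2)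
          = δ * (sqv u x ^ 2 + 2 * (sqv u x * sqm E x)) := by
        simp only [Fin.sum_univ_two]
        linear_combination (sqv u x * δ) * ev + (sqv u x * δ) * em
      rw [e]
      refine mul_le_mul_of_nonneg_left ?_ hδ
      nlinarith
  have t4 : |∑ i, ∑ j, (E i j x + ff E i j x) * (W x * (pd j (sqv u) x * u i x))|
      ≤ W x * (2 / 9 * (sqv u x * gr u x) + 36 * (sqm E x * sqv u x)) := by
    refine (abs_double_sum_le (g := fun i j => W x * (1 / 36 * pd j (sqv u) x ^ 2
      + 9 * ((2 * E i j x ^ 2 + 1 / 2 * sqm E x) * sqv u x))) fun i j => ?_).trans ?_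
    · rw [show (E i j x + ff E i j x) * (W x * (pd j (sqv u) x * u i x))
        = W x * (pd j (sqv u) x * ((E i j x + ff E i j x) * u i x)) by ring, abs_mul,
        abs_of_nonneg hW0]
      refine mul_le_mul_of_nonneg_left ((abs_mul_le_add_sq _ _).trans ?_) hW0
      rw [mul_pow]
      have := mul_le_mul (hS i j) (hu i) (sq_nonneg _) (by positivity)
      linarith
    · have e : ∑ i, ∑ j, W x * (1 / 36 * pd j (sqv u) x ^ 2
          + 9 * ((2 * E i j x ^ 2 + 1 / 2 * sqm E x) * sqv u x))
          = W x * (1 / 18 * (pd 0 (sqv u) x ^ 2 + pd 1 (sqv u) x ^ 2)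
            + 36 * (sqm E x * sqv u x)) := by
        simp only [Fin.sum_univ_two]
        linear_combination (18 * W x * sqv u x) * em
      rw [e]
      refine mul_le_mul_of_nonneg_left ?_ hW0
      linarith
  have t5 : |∑ i, ∑ j, (E i j x + ff E i j x) * (W x * (sqv u x * pd j (u i) x))|
      ≤ W x * (1 / 36 * (sqv u x * gr u x) + 36 * (sqm E x * sqv u x)) := by
    refine (abs_double_sum_le (g := fun i j => W x * sqv u x * (1 / 36 * pd j (u i) x ^ 2
      + 9 * (2 * E i j x ^ 2 + 1 / 2 * sqm E x))) fun i j => ?_).trans (le_of_eq ?_)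
    · rw [show (E i j x + ff E i j x) * (W x * (sqv u x * pd j (u i) x))
        = W x * sqv u x * (pd j (u i) x * (E i j x + ff E i j x)) by ring, abs_mul,
        abs_of_nonneg (mul_nonneg hW0 hv)]
      refine mul_le_mul_of_nonneg_left ((abs_mul_le_add_sq _ _).trans ?_) (mul_nonneg hW0 hv)
      linarith [hS i j]
    · simp only [Fin.sum_univ_two]
      linear_combination (18 * W x * sqv u x) * em + 1 / 36 * (W x * sqv u x) * eg
  have t2 : |sqv u x ^ 2 * ∑ j, u j x * pd j W x|
      ≤ δ * (a * (W x * sqv u x ^ 2) + a⁻¹ * (sqv u x ^ 2 + sqv u x ^ 4)) := by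
    have hj : ∀ j, |u j x * pd j W x| ≤ δ / 2 * (a * η ^ 2 + a⁻¹ * u j x ^ 2) := by
      intro j
      have h1 : |u j x * pd j W x| ≤ |u j x| * (δ * η) := by
        rw [abs_mul]; exact mul_le_mul_of_nonneg_left (hd j) (abs_nonneg _)
      have h2 : 2 * (η * |u j x|) ≤ a * η ^ 2 + a⁻¹ * u j x ^ 2 := by
        have : a * η ^ 2 + a⁻¹ * u j x ^ 2 - 2 * (η * |u j x|) = a⁻¹ * (a * η - |u j x|) ^ 2 := by
          rw [sub_sq, mul_pow, sq_abs]; field_simp; ring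
        have : 0 ≤ a⁻¹ * (a * η - |u j x|) ^ 2 := by positivity
        linarith
      have := mul_le_mul_of_nonneg_left h2 (div_nonneg hδ zero_le_two)
      linarith
    have h3 : |∑ j, u j x * pd j W x| ≤ δ * (a * η ^ 2 + 1 / 2 * (a⁻¹ * sqv u x)) := by
      rw [Fin.sum_univ_two, ← ev]
      linarith [abs_add_le (u 0 x * pd 0 W x) (u 1 x * pd 1 W x), hj 0, hj 1]
    rw [abs_mul, abs_of_nonneg (sq_nonneg (sqv u x)), hW]
    refine (mul_le_mul_of_nonneg_left h3 (sq_nonneg _)).trans ?_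
    have h4 : sqv u x ^ 2 * sqv u x ≤ sqv u x ^ 2 + sqv u x ^ 4 := by
      nlinarith [sq_nonneg (sqv u x * (sqv u x - 1)), sq_nonneg (sqv u x), sq_nonneg (sqv u x ^ 2)]
    have h5 : 0 ≤ sqv u x ^ 2 * sqv u x := by positivity
    have h6 := mul_le_mul_of_nonneg_left h4 (mul_nonneg hδ (inv_nonneg.2 ha.le))
    have h7 := mul_nonneg (mul_nonneg hδ (inv_nonneg.2 ha.le)) h5
    linarith
  have h2n : 0 ≤ δ * (a * (W x * sqv u x ^ 2) + a⁻¹ * (sqv u x ^ 2 + sqv u x ^ 4)) := by positivity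
  have e : rem4 u E W x = -(∑ i, ∑ j, pd j (u i) x * u i x * sqv u x * pd j W x)
      + 1 / 4 * (sqv u x ^ 2 * ∑ j, u j x * pd j W x)
      - (∑ i, ∑ j, (E i j x + ff E i j x) * (pd j W x * (sqv u x * u i x)))
      - (∑ i, ∑ j, (E i j x + ff E i j x) * (W x * (pd j (sqv u) x * u i x)))
      - (∑ i, ∑ j, (E i j x + ff E i j x) * (W x * (sqv u x * pd j (u i) x))) := by
    simp only [rem4, Fin.sum_univ_two]
    ring
  have h8 : 72 * (W x * (sqm E x * sqv u x)) ≤ W x * (36 * (sqv u x ^ 2 + sqm E x ^ 2)) := by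
    nlinarith [mul_nonneg hW0 (sq_nonneg (sqv u x - sqm E x))]
  have h9 : 0 ≤ δ * sqv u x ^ 2 := by positivity
  rw [e]
  rw [abs_le] at t1 t2 t3 t4 t5 ⊢
  constructor
  · linarith [t1.2, t2.1, t3.2, t4.2, t5.2]
  · linarith [t1.1, t2.2, t3.1, t4.1, t5.1]

section
variable {U : Fin 2 → ℝ → V → ℝ} {E : Fin 2 → Fin 2 → ℝ → V → ℝ} {P : ℝ → V → ℝ} {T : ℝ}

/-- The localised dissipation of the fourth power integral. -/
def zr (U : Fin 2 → ℝ → V → ℝ) (r t : ℝ) : ℝ := ∫ x, cut r x ^ 2 * (sqv (sl U t) x * gr (sl U t) x)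

lemma zr_nn (U : Fin 2 → ℝ → V → ℝ) (r t : ℝ) : 0 ≤ zr U r t :=
  integral_nonneg fun x => mul_nonneg (sq_nonneg _) (mul_nonneg (sq_nn _ x) (gr_nn _ x))

lemma Sol.stsm_cut_four (S : Sol U E P T) (r : ℝ) :
    STSm (fun t x => cut r x ^ 2 * sqv (sl U t) x ^ 2) :=
  (STSm.const (sm_cut_sq r)).mul ((stsm_sqv S.su).pow 2)

lemma Sol.continuous_xr (S : Sol U E P T) {r : ℝ} (hr : 0 < r) : Continuous (xr U r) := by
  have h0 := cut_sq_eq_zero r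
  exact (S.stsm_cut_four r).continuous_integral
    (hasCompactSupport_cut_sq hr) (fun t x hx => by simp only [h0 x hx, zero_mul])

lemma Sol.continuous_zr (S : Sol U E P T) {r : ℝ} (hr : 0 < r) : Continuous (zr U r) := by
  have h0 := cut_sq_eq_zero r
  exact ((STSm.const (sm_cut_sq r)).mul ((stsm_sqv S.su).mul (stsm_gr S.su))).continuous_integral
    (hasCompactSupport_cut_sq hr) (fun t x hx => by simp only [h0 x hx, zero_mul])

/-- Integrating the localised balance for `|u|⁴` in time. -/
lemma Sol.xr_add_le (S : Sol U E P T) {r : ℝ} (hr : 0 < r) {t : ℝ} (ht : t ∈ Icc 0 T)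
    {D : ℝ → ℝ} (iD : IntegrableOn D (Ioc 0 t))
    (hD : ∀ᵐ s, s ∈ Ioo 0 T →
      4 * |pr P (fun i x => cut r x ^ 2 * (sqv (sl U s) x * U i s x)) s|
      + 4 * |∫ x, rem4 (sl U s) (slm E s) (fun x => cut r x ^ 2) x| ≤ D s + zr U r s) :
    xr U r t + 3 * ∫ s in Ioc 0 t, zr U r s ≤ xr U r 0 + ∫ s in Ioc 0 t, D s := by
  have hc := hasCompactSupport_cut_sq hr
  have h0 := cut_sq_eq_zero r
  have sY := S.stsm_cut_four r
  have h1 := sY.integral_sub hc (fun t x hx => by simp only [h0 x hx, zero_mul]) ht.1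
  have iG : IntegrableOn (zr U r) (Ioc 0 t) := (S.continuous_zr hr).integrableOn_Ioc
  have hle : ∫ s in Ioc 0 t, ∫ x, dt (fun t x => cut r x ^ 2 * sqv (sl U t) x ^ 2) s x
      ≤ ∫ s in Ioc 0 t, (D s - 3 * zr U r s) := by
    refine integral_mono_ae ?_ (iD.sub (iG.const_mul 3)) ?_
    · exact (sY.dt.continuous_integral hc (fun t x hx => by
        unfold dt; simp only [h0 x hx, zero_mul, deriv_const])).integrableOn_Ioc
    · rw [EventuallyLE, ae_restrict_iff' measurableSet_Ioc]
      have hT' : ∀ᵐ s : ℝ, s ≠ T := by simp [ae_iff, measure_singleton]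
      filter_upwards [hD, hT'] with s hp hsT hs
      have hs' : s ∈ Ioo 0 T := ⟨hs.1, lt_of_le_of_ne (hs.2.trans ht.2) hsT⟩
      have hsI : s ∈ Icc 0 T := Ioo_subset_Icc_self hs'
      have h2 := hp hs'
      rw [S.four (sm_cut_sq r) hc hsI]
      have ip : Integrable (fun x => 1 / 2 * ∑ j, pd j (sqv (sl U s)) x ^ 2) :=
        (integrable_finsetSum _ fun j _ => S.integrable_pd_sq hsI j).const_mul _
      have h3 : zr U r s ≤ ∫ x, cut r x ^ 2 * (sqv (sl U s) x * gr (sl U s) x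
          + 1 / 2 * ∑ j, pd j (sqv (sl U s)) x ^ 2) :=
        integral_mono (integrable_cut_sq_mul (S.id s hsI) r)
          (integrable_cut_sq_mul ((S.id s hsI).add ip) r) fun x =>
            mul_le_mul_of_nonneg_left (le_add_of_nonneg_right (mul_nonneg (by norm_num)
              (Finset.sum_nonneg fun j _ => sq_nonneg _))) (sq_nonneg _)
      have h4 := neg_abs_le (pr P (fun i x => cut r x ^ 2 * (sqv (sl U s) x * U i s x)) s)
      have h5 := le_abs_self (∫ x, rem4 (sl U s) (slm E s) (fun x => cut r x ^ 2) x)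
      linarith
  rw [integral_sub iD (iG.const_mul 3), integral_const_mul, ← h1] at hle
  simp only [xr] at hle ⊢
  linarith

lemma Sol.abs_integral_rem4_le (S : Sol U E P T) {t : ℝ} (ht : t ∈ Icc 0 T) {r β : ℝ}
    (hr : 0 < r) (hE : en U E t ≤ 1) (hβ : ∫ x, sqm (slm E t) x ^ 2 ≤ β) :
    |∫ x, rem4 (sl U t) (slm E t) (fun x => cut r x ^ 2) x|
      ≤ 1 / 4 * zr U r t + 36 * (xr U r t + β)
        + 80 * (cX / r) * ((1 + xx U t + dis U t) * (1 + xr U r t)) := by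
  have hX := xx_nn U t
  have hd := dis_nn U t
  have hx := xr_nn U r t
  have hcX := cX_pos
  set a := 1 + xx U t + dis U t with ha_def
  have ha : 0 < a := by positivity
  have i4 := S.sqv_four ht
  have im := S.integrable_sqm_sq ht
  have iuu := S.iuu t ht
  have iz := integrable_cut_sq_mul (S.id t ht) r
  have ix := integrable_cut_sq_mul iuu r
  have imc := integrable_cut_sq_mul im r
  have j1 : Integrable (fun x => cut r x ^ 2 * (1 / 4 * (sqv (sl U t) x * gr (sl U t) x)
      + 36 * (sqv (sl U t) x ^ 2 + sqm (slm E t) x ^ 2))) :=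
    integrable_cut_sq_mul (((S.id t ht).const_mul (1 / 4)).add ((iuu.add im).const_mul 36)) r
  have k1 : Integrable (fun x => 1 / 2 * (sqv (sl U t) x * gr (sl U t) x)
      + 4 * sqv (sl U t) x ^ 2) := ((S.id t ht).const_mul (1 / 2)).add (iuu.const_mul 4)
  have k2 : Integrable (fun x => 1 / 2 * (sqv (sl U t) x * gr (sl U t) x)
      + 4 * sqv (sl U t) x ^ 2 + sqv (sl U t) x) := k1.add (S.iu t ht)
  have k3 : Integrable (fun x => 1 / 2 * (sqv (sl U t) x * gr (sl U t) x)
      + 4 * sqv (sl U t) x ^ 2 + sqv (sl U t) x + a * (cut r x ^ 2 * sqv (sl U t) x ^ 2)) :=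
    k2.add (ix.const_mul a)
  have k4 : Integrable (fun x => sqv (sl U t) x ^ 2 + sqv (sl U t) x ^ 4) := iuu.add i4.1
  have k5 : Integrable (fun x => 1 / 2 * (sqv (sl U t) x * gr (sl U t) x)
      + 4 * sqv (sl U t) x ^ 2 + sqv (sl U t) x + a * (cut r x ^ 2 * sqv (sl U t) x ^ 2)
      + a⁻¹ * (sqv (sl U t) x ^ 2 + sqv (sl U t) x ^ 4)) := k3.add (k4.const_mul a⁻¹)
  rw [← Real.norm_eq_abs]
  refine (norm_integral_le_of_norm_le (j1.add (k5.const_mul (2 * (cX / r))))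
    (ae_of_all _ fun x => ?_)).trans ?_
  · refine abs_rem4_le (S.bE t ht x) (cut_le_one r x) rfl (fun j => ?_) (by positivity) ha
      (sum_pd_sq_le (S.smU t) x)
    rw [pd_cut_sq, abs_mul, abs_mul, abs_two, abs_of_nonneg (cut_nonneg r x)]
    have := mul_le_mul_of_nonneg_left (abs_pd_cut_le hr j x) (cut_nonneg r x)
    linarith
  · have e1 : ∫ x, cut r x ^ 2 * (1 / 4 * (sqv (sl U t) x * gr (sl U t) x)
        + 36 * (sqv (sl U t) x ^ 2 + sqm (slm E t) x ^ 2))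
        ≤ 1 / 4 * zr U r t + 36 * (xr U r t + β) := by
      have l1 : Integrable (fun x => 1 / 4 * (cut r x ^ 2 * (sqv (sl U t) x * gr (sl U t) x))
          + 36 * (cut r x ^ 2 * sqv (sl U t) x ^ 2)) := (iz.const_mul _).add (ix.const_mul _)
      have e : ∀ x, cut r x ^ 2 * (1 / 4 * (sqv (sl U t) x * gr (sl U t) x)
        + 36 * (sqv (sl U t) x ^ 2 + sqm (slm E t) x ^ 2))
        = 1 / 4 * (cut r x ^ 2 * (sqv (sl U t) x * gr (sl U t) x))
          + 36 * (cut r x ^ 2 * sqv (sl U t) x ^ 2)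
          + 36 * (cut r x ^ 2 * sqm (slm E t) x ^ 2) := fun x => by ring
      simp_rw [e]
      rw [integral_add l1 (imc.const_mul _), integral_add (iz.const_mul _) (ix.const_mul _),
        integral_const_mul, integral_const_mul, integral_const_mul]
      have := (integral_cut_le im (fun x => sq_nonneg _) r).trans hβ
      simp only [zr, xr]
      linarith
    have e2 : ∫ x, (1 / 2 * (sqv (sl U t) x * gr (sl U t) x)
        + 4 * sqv (sl U t) x ^ 2 + sqv (sl U t) x + a * (cut r x ^ 2 * sqv (sl U t) x ^ 2)
        + a⁻¹ * (sqv (sl U t) x ^ 2 + sqv (sl U t) x ^ 4)) ≤ 40 * (a * (1 + xr U r t)) := by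
      rw [integral_add k3 (k4.const_mul _), integral_add k2 (ix.const_mul _),
        integral_add k1 (S.iu t ht), integral_add ((S.id t ht).const_mul _) (iuu.const_mul _),
        integral_const_mul, integral_const_mul, integral_const_mul, integral_const_mul,
        integral_add iuu i4.1]
      have hv : ∫ x, sqv (sl U t) x ≤ 1 := by
        have : 0 ≤ ∫ x, sqm (slm E t) x := integral_nonneg fun x => sqm_nn _ x
        simp only [en] at hE
        linarith
      have h4 : a⁻¹ * (xx U t + ∫ x, sqv (sl U t) x ^ 4) ≤ 32 * a := by
        rw [inv_mul_le_iff₀ ha]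
        nlinarith [i4.2, mul_nonneg hX hd, mul_nonneg hX hX, mul_nonneg hd hd]
      have h5 := mul_nonneg ha.le hx
      change 1 / 2 * dis U t + 4 * xx U t + _ + a * xr U r t
        + a⁻¹ * (xx U t + ∫ x, sqv (sl U t) x ^ 4) ≤ _
      linarith
    rw [integral_add' j1 (k5.const_mul _), integral_const_mul]
    have := mul_le_mul_of_nonneg_left e2 (show 0 ≤ 2 * (cX / r) by positivity)
    linarith

end

section
variable {U : Fin 2 → ℝ → V → ℝ} {E : Fin 2 → Fin 2 → ℝ → V → ℝ} {P : ℝ → V → ℝ} {T : ℝ}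

lemma Sol.en_le_one (S : Sol U E P T) (hE0 : en U E 0 ≤ 1) {t : ℝ} (ht : t ∈ Icc 0 T) :
    en U E t ≤ 1 := by
  have := S.energy_le ht
  have : 0 ≤ ∫ s in Ioc 0 t, dd U s := integral_nonneg fun s => dd_nn s
  linarith

lemma Sol.integrable_one_add (S : Sol U E P T) :
    IntegrableOn (fun s => 1 + xx U s + dis U s) (Ioc 0 T) := by
  have i1 : IntegrableOn (fun s => 1 + xx U s) (Ioc 0 T) :=
    (integrableOn_const (by simp)).add S.integrable_xx
  exact i1.add S.idt

lemma Sol.tendsto_xr (S : Sol U E P T) {t : ℝ} (ht : t ∈ Icc 0 T) :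
    Tendsto (fun n : ℕ => xr U ((n : ℝ) + 1) t) atTop (nhds (xx U t)) :=
  tendsto_integral_cut (S.iuu t ht)

/-- The localised inequality in the form needed for Gronwall's lemma. -/
lemma Sol.four_crude (S : Sol U E P T) (hE0 : en U E 0 ≤ 1) {β : ℝ} (hβ0 : 0 ≤ β) (hβ1 : β ≤ 1)
    (hβ : ∀ t ∈ Icc 0 T, ∫ x, sqm (slm E t) x ^ 2 ≤ β) :
    ∃ C : ℝ, 0 ≤ C ∧ ∀ r : ℝ, 1 ≤ r → ∀ t ∈ Icc 0 T,
      xr U r t ≤ xr U r 0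
        + ∫ s in Ioc 0 t, C * (1 + xx U s + dis U s) * (1 + xr U r s) := by
  have hX := cX_pos
  set C₁ := √(12 + 48 * cX ^ 2)
  refine ⟨64 * √√cR * C₁ + 288 + 320 * cX, by positivity, fun r hr t ht => ?_⟩
  set C := 64 * √√cR * C₁ + 288 + 320 * cX
  have hr0 : 0 < r := by linarith
  have hcr : cX / r ≤ cX := div_le_self hX.le hr
  have hcr0 : 0 < cX / r := div_pos hX hr0
  obtain ⟨B, hB⟩ := isCompact_Icc.exists_bound_of_continuousOn (s := Icc 0 T)
    (S.continuous_xr hr0).continuousOn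
  have iD : IntegrableOn (fun s => C * (1 + xx U s + dis U s) * (1 + xr U r s)) (Ioc 0 t) := by
    refine Integrable.mul_bdd (c := 1 + B)
      ((S.integrable_one_add.mono_set (Ioc_subset_Ioc_right ht.2)).const_mul C)
      (continuous_const.add (S.continuous_xr hr0)).aestronglyMeasurable ?_
    rw [ae_restrict_iff' measurableSet_Ioc]
    refine ae_of_all _ fun s hs => ?_
    exact (norm_add_le _ _).trans (add_le_add (by simp) (hB s ⟨hs.1.le, hs.2.trans ht.2⟩))
  have h0 : 0 ≤ ∫ s in Ioc 0 t, zr U r s := integral_nonneg fun s => zr_nn U r s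
  refine le_trans ?_ (S.xr_add_le hr0 ht iD ?_)
  · linarith
  filter_upwards [S.pr_ae_four hE0 hβ0 hβ] with s hp hs
  have hst : s ∈ Icc 0 T := Ioo_subset_Icc_self hs
  have h1 := hp hs r hr0
  have h2 := S.abs_integral_rem4_le hst hr0 (S.en_le_one hE0 hst) (hβ s hst)
  have hx := xx_nn U s
  have hd := dis_nn U s
  have hy := xr_nn U r s
  set X := xx U s
  set d := dis U s
  set y := xr U r s
  have ha1 : 1 ≤ (1 + X + d) * (1 + y) := by nlinarith [mul_nonneg hx hy, mul_nonneg hd hy]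
  have hay : y ≤ (1 + X + d) * (1 + y) := by nlinarith [mul_nonneg hx hy, mul_nonneg hd hy]
  have h3 : √√y * √(12 * d + 48 * (cX / r) ^ 2 * X) * √√(X * d + β)
      ≤ C₁ * ((1 + X + d) * (1 + y)) := by
    have g1 := sqrt_sqrt_le_one_add hy
    have g2 : √(12 * d + 48 * (cX / r) ^ 2 * X) ≤ C₁ * √(1 + X + d) := by
      rw [← Real.sqrt_mul (by positivity)]
      refine Real.sqrt_le_sqrt ?_
      have : (cX / r) ^ 2 ≤ cX ^ 2 := pow_le_pow_left₀ hcr0.le hcr 2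
      nlinarith [sq_nonneg cX, mul_nonneg (sq_nonneg cX) hd, mul_le_mul_of_nonneg_right this hx]
    have g3 : √√(X * d + β) ≤ √(1 + X + d) := by
      refine Real.sqrt_le_sqrt ?_
      rw [Real.sqrt_le_left (by positivity)]
      nlinarith [mul_nonneg hx hd]
    calc _ ≤ (1 + y) * (C₁ * √(1 + X + d)) * √(1 + X + d) := by gcongr
      _ = C₁ * (√(1 + X + d) * √(1 + X + d) * (1 + y)) := by ring
      _ = _ := by rw [Real.mul_self_sqrt (by positivity)]
  have hR : 0 ≤ 64 * √√cR := by positivity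
  have h4 := mul_le_mul_of_nonneg_left h3 hR
  have h5 := mul_le_mul_of_nonneg_right hcr (zero_le_one.trans ha1)
  simp only [C]
  linarith

/-- The `L⁴` norm of the velocity stays bounded. -/
lemma Sol.exists_xx_bound (S : Sol U E P T) (hE0 : en U E 0 ≤ 1) {β : ℝ} (hβ0 : 0 ≤ β) (hβ1 : β ≤ 1)
    (hβ : ∀ t ∈ Icc 0 T, ∫ x, sqm (slm E t) x ^ 2 ≤ β) :
    ∃ K : ℝ, 0 ≤ K ∧ ∀ t ∈ Icc 0 T, xx U t ≤ K := by
  obtain ⟨C, hC, h⟩ := S.four_crude hE0 hβ0 hβ1 hβ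
  have h0T : (0:ℝ) ∈ Icc 0 T := ⟨le_rfl, S.hT.le⟩
  have ik := S.integrable_one_add.const_mul C
  have k0 : ∀ s, 0 ≤ C * (1 + xx U s + dis U s) := fun s => by
    have := xx_nn U s; have := dis_nn U s; positivity
  have hx0 := xx_nn U 0
  refine ⟨2 * (1 + xx U 0) * exp (2 * ∫ s in Ioc 0 T, C * (1 + xx U s + dis U s)),
    by positivity, fun t ht => le_of_tendsto' (S.tendsto_xr ht) fun n => ?_⟩
  have hr : (1:ℝ) ≤ (n : ℝ) + 1 := by linarith [n.cast_nonneg (α := ℝ)]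
  set r := (n : ℝ) + 1
  obtain ⟨B, hB⟩ := isCompact_Icc.exists_bound_of_continuousOn (s := Icc 0 T)
    (S.continuous_xr (r := r) (by linarith)).continuousOn
  have := gronwall_integral (X := fun t => 1 + xr U r t) (A := 1 + xx U 0) (B := 1 + B) ik
    (fun s _ => k0 s) (fun t _ => add_nonneg zero_le_one (xr_nn U r t))
    (fun t ht => add_le_add le_rfl ((le_abs_self _).trans (hB t ht))) (fun t ht => by
      have := h r hr t ht
      have := S.xr_le h0T r
      linarith) t ht
  have h2 : exp (2 * ∫ s in Ioc 0 t, C * (1 + xx U s + dis U s))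
      ≤ exp (2 * ∫ s in Ioc 0 T, C * (1 + xx U s + dis U s)) := by
    refine Real.exp_le_exp.2 (mul_le_mul_of_nonneg_left ?_ zero_le_two)
    exact setIntegral_mono_set ik (ae_of_all _ k0) (Ioc_subset_Ioc_right ht.2).eventuallyLE
  have h3 := mul_le_mul_of_nonneg_left h2 (show 0 ≤ 2 * (1 + xx U 0) by positivity)
  linarith

end

lemma young_four {C a e b : ℝ} :
    C * (a ^ 2 * e ^ 3) + C * (a * b * e ^ 2)
      ≤ e ^ 4 + C ^ 4 * a ^ 8 + C ^ 2 * (a ^ 4 + b ^ 4) := by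
  nlinarith [sq_nonneg (e ^ 2 - 2 * (C * a ^ 2 * e)), sq_nonneg (e ^ 2 - 2 * (C ^ 2 * a ^ 4)),
    sq_nonneg (e ^ 2 - C * (a * b)), mul_nonneg (sq_nonneg C) (sq_nonneg (a ^ 2 - b ^ 2)),
    mul_nonneg (sq_nonneg C) (sq_nonneg (a ^ 2 + b ^ 2)), sq_nonneg (e ^ 2)]

lemma sqrt_add_le_add {a b : ℝ} (ha : 0 ≤ a) (hb : 0 ≤ b) : √(a + b) ≤ √a + √b := by
  rw [Real.sqrt_le_left (by positivity)]
  nlinarith [Real.sq_sqrt ha, Real.sq_sqrt hb, Real.sqrt_nonneg a, Real.sqrt_nonneg b,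
    mul_nonneg (Real.sqrt_nonneg a) (Real.sqrt_nonneg b)]

lemma sqrt_young {C X d β : ℝ} (hX : 0 ≤ X) (hd : 0 ≤ d) (hβ : 0 ≤ β) (hC : 0 ≤ C) :
    C * (√√X * √d * √√(X * d + β)) ≤ d + C ^ 4 * X ^ 2 + C ^ 2 * (X + β) := by
  have h1 : √√(X * d + β) ≤ √√X * √√d + √√β := by
    refine (Real.sqrt_le_sqrt (sqrt_add_le_add (mul_nonneg hX hd) hβ)).trans ?_
    refine (sqrt_add_le_add (Real.sqrt_nonneg _) (Real.sqrt_nonneg _)).trans ?_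
    rw [Real.sqrt_mul hX, Real.sqrt_mul (Real.sqrt_nonneg X)]
  have f : ∀ {z : ℝ}, 0 ≤ z → √√z ^ 4 = z := fun {z} hz => by
    calc √√z ^ 4 = (√√z ^ 2) ^ 2 := by ring
      _ = z := by rw [Real.sq_sqrt (Real.sqrt_nonneg z), Real.sq_sqrt hz]
  have hdd : √d = √√d ^ 2 := (Real.sq_sqrt (Real.sqrt_nonneg d)).symm
  have h2 := young_four (C := C) (a := √√X) (e := √√d) (b := √√β)
  have h8 : √√X ^ 8 = X ^ 2 := by
    calc √√X ^ 8 = (√√X ^ 4) ^ 2 := by ring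
      _ = X ^ 2 := by rw [f hX]
  rw [f hX, f hd, f hβ, h8] at h2
  refine le_trans (mul_le_mul_of_nonneg_left (mul_le_mul_of_nonneg_left h1 (by positivity)) hC) ?_
  refine le_trans (le_of_eq ?_) h2
  rw [hdd]
  simp only [Real.sqrt_sq (Real.sqrt_nonneg (√d))]
  ring

section
variable {U : Fin 2 → ℝ → V → ℝ} {E : Fin 2 → Fin 2 → ℝ → V → ℝ} {P : ℝ → V → ℝ} {T : ℝ}

/-- Constant in front of the pressure term in the balance for `|u|⁴`. -/
def cP : ℝ := 64 * √√cR * √12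

/-- Gronwall constant in the `L⁴` estimate. -/
def cG : ℝ := 144 + cP ^ 2 + 16 * cP ^ 4

lemma Sol.integrable_dis_of (S : Sol U E P T) {t : ℝ} (ht : t ∈ Icc 0 T) {a : ℕ → ℝ} {A : ℝ}
    (ha : ∀ n : ℕ, ∫ s in Ioc 0 t, zr U ((n : ℝ) + 1) s ≤ a n)
    (hA : Tendsto a atTop (nhds A)) : ∫ s in Ioc 0 t, dis U s ≤ A := by
  refine (integrable_of_fatou (g := fun (n : ℕ) s => zr U ((n : ℝ) + 1) s)
    (fun n => ae_of_all _ fun s => zr_nn U _ s)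
    (fun n => (S.continuous_zr (by positivity)).integrableOn_Ioc) ?_ ha hA).2
  rw [ae_restrict_iff' measurableSet_Ioc]
  exact ae_of_all _ fun s hs => tendsto_integral_cut (S.id s ⟨hs.1.le, hs.2.trans ht.2⟩)

/-- The `L⁴` balance on the whole plane. -/
lemma Sol.xx_add_le (S : Sol U E P T) (hE0 : en U E 0 ≤ 1) {β : ℝ} (hβ0 : 0 ≤ β) (hβ1 : β ≤ 1)
    (hβ : ∀ t ∈ Icc 0 T, ∫ x, sqm (slm E t) x ^ 2 ≤ β) {t : ℝ} (ht : t ∈ Icc 0 T) :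
    IntegrableOn (fun s => cG * (1 + dd U s) * xx U s) (Ioc 0 T) ∧
    xx U t + 2 * ∫ s in Ioc 0 t, dis U s
      ≤ xx U 0 + cG * β * T + ∫ s in Ioc 0 t, cG * (1 + dd U s) * xx U s := by
  obtain ⟨K, hK, hXK⟩ := S.exists_xx_bound hE0 hβ0 hβ1 hβ
  have hX := cX_pos
  have h0T : (0:ℝ) ∈ Icc 0 T := ⟨le_rfl, S.hT.le⟩
  have hsub : Ioc 0 t ⊆ Ioc 0 T := Ioc_subset_Ioc_right ht.2
  have iXT := S.integrable_xx
  have i1 : IntegrableOn (fun s => 1 + dd U s) (Ioc 0 T) :=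
    (integrableOn_const (by simp)).add S.exists_energy_bound.2
  have iK : IntegrableOn (fun s => cG * (1 + dd U s) * xx U s) (Ioc 0 T) := by
    refine Integrable.mul_bdd (c := K) (i1.const_mul cG) iXT.aestronglyMeasurable ?_
    rw [ae_restrict_iff' measurableSet_Ioc]
    refine ae_of_all _ fun s hs => ?_
    rw [Real.norm_of_nonneg (xx_nn U s)]
    exact hXK s (Ioc_subset_Icc_self hs)
  refine ⟨iK, ?_⟩
  set L := 128 * √√cR * √48 * cX * (1 + K) ^ 2 + 320 * cX * (1 + K)
  set a : ℝ → ℝ := fun s => 1 + xx U s + dis U s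
  have ia : IntegrableOn a (Ioc 0 t) := S.integrable_one_add.mono_set hsub
  have id' : IntegrableOn (dis U) (Ioc 0 t) := S.idt.mono_set hsub
  have iK' : IntegrableOn (fun s => cG * (1 + dd U s) * xx U s) (Ioc 0 t) := iK.mono_set hsub
  have ic : IntegrableOn (fun _ : ℝ => cG * β) (Ioc 0 t) := integrableOn_const (by simp)
  have i2 : IntegrableOn (fun s => dis U s + cG * (1 + dd U s) * xx U s) (Ioc 0 t) :=
    id'.add iK'
  have i3 : IntegrableOn (fun s => dis U s + cG * (1 + dd U s) * xx U s + cG * β) (Ioc 0 t) :=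
    i2.add ic
  have key : ∀ n : ℕ, xr U ((n:ℝ)+1) t + 3 * ∫ s in Ioc 0 t, zr U ((n:ℝ)+1) s
      ≤ xr U ((n:ℝ)+1) 0 + ∫ s in Ioc 0 t,
        ((dis U s + cG * (1 + dd U s) * xx U s + cG * β) + L / ((n:ℝ)+1) * a s) := by
    intro n
    have hr : (0:ℝ) < (n:ℝ) + 1 := by positivity
    refine S.xr_add_le hr ht (i3.add (ia.const_mul _)) ?_
    filter_upwards [S.pr_ae_four hE0 hβ0 hβ] with s hp hs
    set r := (n:ℝ) + 1
    have hst : s ∈ Icc 0 T := Ioo_subset_Icc_self hs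
    have h1 := hp hs r hr
    have h2 := S.abs_integral_rem4_le hst hr (S.en_le_one hE0 hst) (hβ s hst)
    have hx := xx_nn U s
    have hd := dis_nn U s
    have hg := dd_nn (U := U) s
    have hy := xr_nn U r s
    have hyX := S.xr_le hst r
    have hXK' := hXK s hst
    have hXd := S.xx_le hst
    have hE := S.en_le_one hE0 hst
    set X := xx U s
    set d := dis U s
    set g := dd U s
    have hXd' : X ≤ 16 * g := hXd.trans (by nlinarith)
    have hcr : 0 < cX / r := div_pos hX hr
    have b1 : √(12 * d + 48 * (cX / r) ^ 2 * X) ≤ √12 * √d + √48 * (cX / r) * √X := by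
      refine (sqrt_add_le_add (by positivity) (by positivity)).trans (le_of_eq ?_)
      rw [Real.sqrt_mul (by norm_num), Real.sqrt_mul (by positivity), Real.sqrt_mul (by norm_num),
        Real.sqrt_sq hcr.le]
    have b2 : √√(xr U r s) ≤ √√X := Real.sqrt_le_sqrt (Real.sqrt_le_sqrt hyX)
    have b3 : √√X ≤ 1 + K := (sqrt_sqrt_le_one_add hx).trans (by linarith)
    have b4 : √X ≤ 1 + K := (sqrt_le_one_add hx).trans (by linarith)
    have b5 : √√(X * d + β) ≤ 2 * (1 + X + d) :=
      (sqrt_sqrt_mul_add_le hx hd hβ0).trans (by linarith)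
    have b6 : 4 * |pr P (fun i x => cut r x ^ 2 * (sqv (sl U s) x * U i s x)) s|
        ≤ cP * (√√X * √d * √√(X * d + β))
          + 128 * √√cR * √48 * (cX / r) * ((1 + K) ^ 2 * (1 + X + d)) := by
      calc _ ≤ 4 * (16 * √√cR * (√√(xr U r s) * √(12 * d + 48 * (cX / r) ^ 2 * X))
              * √√(X * d + β)) := by linarith
        _ ≤ 4 * (16 * √√cR * (√√X * (√12 * √d + √48 * (cX / r) * √X)) * √√(X * d + β)) := by
          gcongr
        _ = cP * (√√X * √d * √√(X * d + β))
            + 64 * √√cR * √48 * (cX / r) * (√√X * √X * √√(X * d + β)) := by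
          simp only [cP]; ring
        _ ≤ cP * (√√X * √d * √√(X * d + β))
            + 64 * √√cR * √48 * (cX / r) * ((1 + K) * (1 + K) * (2 * (1 + X + d))) := by gcongr
        _ = _ := by ring
    have b7 := sqrt_young hx hd hβ0 (C := cP) (by unfold cP; positivity)
    have b8 : X ^ 2 ≤ 16 * (g * X) := by nlinarith
    have b9 := mul_le_mul_of_nonneg_left b8 (show 0 ≤ cP ^ 4 by positivity)
    have b10 : (1 + X + d) * (1 + xr U r s) ≤ (1 + X + d) * (1 + K) := by gcongr; linarith
    have b11 := mul_le_mul_of_nonneg_left b10 hcr.le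
    have b12 : 0 ≤ (144 + cP ^ 2) * (g * X) + 16 * cP ^ 4 * X + 16 * cP ^ 4 * β := by positivity
    have e : L / r * a s = 128 * √√cR * √48 * (cX / r) * ((1 + K) ^ 2 * (1 + X + d))
        + 320 * (cX / r * ((1 + X + d) * (1 + K))) := by
      simp only [L, a, X, d]; ring
    rw [e]
    simp only [cG]
    linarith
  have hz : Tendsto (fun n : ℕ => L / ((n:ℝ) + 1) * ∫ s in Ioc 0 t, a s) atTop (nhds 0) := by
    have h1 : Tendsto (fun n : ℕ => L / ((n:ℝ) + 1)) atTop (nhds 0) :=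
      tendsto_const_nhds.div_atTop
        (tendsto_atTop_add_const_right _ _ tendsto_natCast_atTop_atTop)
    simpa using h1.mul_const (∫ s in Ioc 0 t, a s)
  have hG0 : 0 ≤ cG * β := mul_nonneg (by unfold cG; positivity) hβ0
  have hc : ∫ _ in Ioc 0 t, cG * β ≤ cG * β * T := by
    rw [setIntegral_const, smul_eq_mul, Real.volume_real_Ioc_of_le ht.1]
    nlinarith [ht.1, ht.2]
  set J := ∫ s in Ioc 0 t, (dis U s + cG * (1 + dd U s) * xx U s + cG * β)
  have hJ : J = (∫ s in Ioc 0 t, dis U s) + (∫ s in Ioc 0 t, cG * (1 + dd U s) * xx U s)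
      + ∫ _ in Ioc 0 t, cG * β := by
    rw [← integral_add id' iK', ← integral_add i2 ic]
  have := S.integrable_dis_of ht
    (a := fun n : ℕ => (xr U ((n:ℝ)+1) 0 + (J + L / ((n:ℝ)+1) * (∫ s in Ioc 0 t, a s))
      - xr U ((n:ℝ)+1) t) / 3) (fun n => by
        have h1 := key n
        rw [integral_add i3 (ia.const_mul _), integral_const_mul] at h1
        linarith)
    ((((S.tendsto_xr h0T).add (tendsto_const_nhds.add hz)).sub (S.tendsto_xr ht)).div_const 3)
  linarith

/-- The constant in the `L⁴` estimate. -/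
def cM (T : ℝ) : ℝ :=
  (1 + cG * T) * (2 * exp (2 * (cG * (T + 1))) * (1 + cG * (T + 1)) + 1)

lemma Sol.xx_add_dis_le (S : Sol U E P T) (hE0 : en U E 0 ≤ 1) {β : ℝ} (hβ0 : 0 ≤ β) (hβ1 : β ≤ 1)
    (hβ : ∀ t ∈ Icc 0 T, ∫ x, sqm (slm E t) x ^ 2 ≤ β) {t : ℝ} (ht : t ∈ Icc 0 T) :
    xx U t + ∫ s in Ioc 0 T, dis U s ≤ cM T * (xx U 0 + β) := by
  have hT := S.hT
  have h0T : (0:ℝ) ∈ Icc 0 T := ⟨le_rfl, hT.le⟩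
  have hTT : T ∈ Icc 0 T := ⟨hT.le, le_rfl⟩
  have hG : 0 ≤ cG := by unfold cG; positivity
  obtain ⟨K, -, hXK⟩ := S.exists_xx_bound hE0 hβ0 hβ1 hβ
  have id' := S.exists_energy_bound.2
  have i1 : IntegrableOn (fun s => 1 + dd U s) (Ioc 0 T) :=
    (integrableOn_const (by simp)).add id'
  have hk0 : ∀ s, 0 ≤ cG * (1 + dd U s) := fun s => by
    have := dd_nn (U := U) s; positivity
  have hd0 : 0 ≤ ∫ s in Ioc 0 T, dis U s := integral_nonneg fun s => dis_nn U s
  have hk : ∫ s in Ioc 0 T, cG * (1 + dd U s) ≤ cG * (T + 1) := by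
    have ic : IntegrableOn (fun _ : ℝ => (1:ℝ)) (Ioc 0 T) := integrableOn_const (by simp)
    rw [integral_const_mul, integral_add ic id', setIntegral_const,
      smul_eq_mul, Real.volume_real_Ioc_of_le hT.le]
    refine mul_le_mul_of_nonneg_left ?_ hG
    have := S.energy_le hTT
    have := en_nn (U := U) (E := E) T
    linarith
  set A := xx U 0 + cG * β * T
  have hx0 := xx_nn U 0
  have hA : 0 ≤ A := by positivity
  set N := exp (2 * (cG * (T + 1)))
  have hX : ∀ t ∈ Icc 0 T, xx U t ≤ 2 * A * N := by
    intro t ht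
    refine (gronwall_integral (i1.const_mul cG) (fun s _ => hk0 s) (fun t _ => xx_nn U t) hXK
      (A := A) (fun t ht => ?_) t ht).trans ?_
    · have := (S.xx_add_le hE0 hβ0 hβ1 hβ ht).2
      have : 0 ≤ ∫ s in Ioc 0 t, dis U s := integral_nonneg fun s => dis_nn U s
      linarith
    · refine mul_le_mul_of_nonneg_left (Real.exp_le_exp.2 ?_) (by positivity)
      refine mul_le_mul_of_nonneg_left (le_trans ?_ hk) zero_le_two
      exact setIntegral_mono_set (i1.const_mul cG) (ae_of_all _ hk0)
        (Ioc_subset_Ioc_right ht.2).eventuallyLE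
  have h1 := S.xx_add_le hE0 hβ0 hβ1 hβ hTT
  have h2 : ∫ s in Ioc 0 T, cG * (1 + dd U s) * xx U s ≤ cG * (T + 1) * (2 * A * N) := by
    refine le_trans ?_ (mul_le_mul_of_nonneg_right hk (by positivity))
    rw [← integral_mul_const]
    refine setIntegral_mono_on h1.1 ((i1.const_mul cG).mul_const _) measurableSet_Ioc fun s hs => ?_
    exact mul_le_mul_of_nonneg_left (hX s (Ioc_subset_Icc_self hs)) (hk0 s)
  have h3 := hX t ht
  have h4 := xx_nn U T
  have h5 : A ≤ (1 + cG * T) * (xx U 0 + β) := by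
    have := mul_nonneg (mul_nonneg hG hT.le) hx0
    simp only [A]
    linarith
  have h6 : 0 ≤ 2 * N * (1 + cG * (T + 1)) + 1 := by positivity
  have h7 := mul_le_mul_of_nonneg_right h5 h6
  simp only [cM]
  linarith

end

/-- The components of a velocity field. -/
def cmpU (u : ℝ → V → V) (i : Fin 2) (t : ℝ) (x : V) : ℝ := u t x i

/-- The components of `F - I`. -/
def cmpE (F : ℝ → V → M2) (i j : Fin 2) (t : ℝ) (x : V) : ℝ := F t x i j - idM i j

lemma cmpE_smooth {F : ℝ → V → M2} (hF : ContDiff ℝ (⊤ : ℕ∞) (Function.uncurry F)) (i j : Fin 2) :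
    STSm (cmpE F i j) := by
  have h := contDiff_pi.1 (contDiff_pi.1 hF i) j
  exact h.sub contDiff_const

lemma pd_sub_const {f : V → ℝ} (hf : Sm f) (c : ℝ) (i : Fin 2) (x : V) :
    pd i (fun y => f y - c) x = pd i f x := by
  rw [pd_sub hf contDiff_const, pd_const, sub_zero]

/-- Expansion of `div (F Fᵀ)` in terms of `F - I`. -/
lemma sum_pd_mul_transpose {G : Fin 2 → Fin 2 → V → ℝ} (hG : ∀ i j, Sm (G i j))
    (hd : ∀ j x, ∑ i, pd i (G i j) x = 0) (i : Fin 2) (x : V) :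
    ∑ j, pd j (fun y => ∑ k, (G i k y + idM i k) * (G j k y + idM j k)) x
      = (∑ j, pd j (G i j) x) + ∑ j, pd j (ff G i j) x := by
  have key : ∀ j, pd j (fun y => ∑ k, (G i k y + idM i k) * (G j k y + idM j k)) x
      = pd j (G i j) x + pd j (G j i) x + pd j (ff G i j) x := by
    intro j
    have hff : Sm (ff G i j) := Sm.sum fun k => (hG i k).mul (hG j k)
    have : (fun y => ∑ k, (G i k y + idM i k) * (G j k y + idM j k))
        = fun y => (G i j y + G j i y + ff G i j y) + ∑ k, idM i k * idM j k := by
      funext y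
      fin_cases i <;> fin_cases j <;> simp [ff, idM, Fin.sum_univ_two] <;> ring
    rw [this, pd_add (((hG i j).add (hG j i)).add hff) contDiff_const, pd_const, add_zero,
      pd_add ((hG i j).add (hG j i)) hff, pd_add (hG i j) (hG j i)]
  simp only [key, Finset.sum_add_distrib, hd i x, add_zero]

lemma nsq_nonneg (A : M2) : 0 ≤ nsq A :=
  Finset.sum_nonneg fun _ _ => Finset.sum_nonneg fun _ _ => sq_nonneg _

lemma le_Bfun {F : ℝ → V → M2} {T : ℝ}
    (hb : ∀ t ∈ Icc (0:ℝ) T, ∀ x : V, nsq (F t x - idM) ≤ 1 / 4)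
    {t : ℝ} (ht : t ∈ Icc (0:ℝ) T) (x : V) : nsq (F t x - idM) ≤ Bfun F T := by
  have h1 : ∀ s, (⨆ _ : s ∈ Icc (0:ℝ) T, ⨆ x : V, nsq (F s x - idM)) ≤ 1 / 4 := fun s =>
    Real.iSup_le (fun hs => Real.iSup_le (fun x => hb s hs x) (by norm_num)) (by norm_num)
  have h2 : nsq (F t x - idM) ≤ ⨆ x : V, nsq (F t x - idM) :=
    le_ciSup (f := fun x : V => nsq (F t x - idM)) ⟨1 / 4, by rintro _ ⟨y, rfl⟩; exact hb t ht y⟩ x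
  refine h2.trans (le_trans ?_ (le_ciSup ⟨1 / 4, by rintro _ ⟨s, rfl⟩; exact h1 s⟩ t))
  exact le_ciSup (f := fun _ : t ∈ Icc (0:ℝ) T => ⨆ x : V, nsq (F t x - idM))
    (finite_range _).bddAbove ht

lemma Bfun_mem_unit {F : ℝ → V → M2} {T : ℝ}
    (hb : ∀ t ∈ Icc (0:ℝ) T, ∀ x : V, nsq (F t x - idM) ≤ 1 / 4) :
    0 ≤ Bfun F T ∧ Bfun F T ≤ 1 := by
  refine ⟨Real.iSup_nonneg fun _ => Real.iSup_nonneg fun _ => Real.iSup_nonneg fun _ => nsq_nonneg _, ?_⟩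
  exact Real.iSup_le (fun s => Real.iSup_le (fun hs =>
    Real.iSup_le (fun x => (hb s hs x).trans (by norm_num)) zero_le_one) zero_le_one) zero_le_one

lemma sol_of_isSolution {T : ℝ} (hT : 0 < T) {u : ℝ → V → V} {F : ℝ → V → M2} {P : ℝ → V → ℝ}
    (hu : ContDiff ℝ (⊤ : ℕ∞) (Function.uncurry u)) (hF : ContDiff ℝ (⊤ : ℕ∞) (Function.uncurry F))
    (hP : ContDiff ℝ (⊤ : ℕ∞) (Function.uncurry P)) (h : IsSolution u F P T)
    (hd : ∀ t ∈ Icc (0:ℝ) T, ∀ (x : V) (j : Fin 2), ∑ i, pd i (fun y => F t y i j) x = 0)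
    (hb : ∀ t ∈ Icc (0:ℝ) T, ∀ x : V, nsq (F t x - idM) ≤ 1 / 4)
    (hi : ∀ t ∈ Icc (0:ℝ) T,
      Integrable (fun x : V => vnsq (u t x)) ∧
      Integrable (fun x : V => (vnsq (u t x)) ^ 2) ∧
      Integrable (fun x : V => nsq (F t x - idM)) ∧
      Integrable (fun x : V => nsq (gradU (u t) x)) ∧
      Integrable (fun x : V => vnsq (u t x) * nsq (gradU (u t) x)))
    (hit : IntegrableOn (fun t => ∫ x : V, vnsq (u t x) * nsq (gradU (u t) x)) (Ioc (0:ℝ) T)) :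
    Sol (cmpU u) (cmpE F) P T := by
  have hFs : ∀ t i j, Sm (fun y => F t y i j) := fun t i j =>
    STSm.slice (u := fun t y => F t y i j) (contDiff_pi.1 (contDiff_pi.1 hF i) j) t
  have hpd : ∀ t k i j x, pd k (cmpE F i j t) x = pd k (fun y => F t y i j) x :=
    fun t k i j x => pd_sub_const (hFs t i j) _ k x
  have hdE : ∀ t ∈ Icc (0:ℝ) T, ∀ j x, ∑ i, pd i (cmpE F i j t) x = 0 := by
    intro t ht j x
    simp only [hpd]
    exact hd t ht x j
  refine ⟨hT, fun i => contDiff_pi.1 hu i, cmpE_smooth hF, hP, ?_, ?_, h.2.2, hdE, hb,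
    fun t ht => (hi t ht).1, fun t ht => (hi t ht).2.1, fun t ht => (hi t ht).2.2.1,
    fun t ht => (hi t ht).2.2.2.1, fun t ht => (hi t ht).2.2.2.2, hit⟩
  · intro t ht i x
    rw [← sum_pd_mul_transpose (G := slm (cmpE F) t) (fun i j => (cmpE_smooth hF i j).slice t)
      (hdE t ht) i x]
    refine (h.1 t ht x i).trans ?_
    simp only [slm, cmpE, sub_add_cancel]
  · intro t ht i j x
    have h1 := h.2.1 t ht x i j
    have h2 : dt (cmpE F i j) t x = deriv (fun s => F s x i j) t := deriv_sub_const _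
    simp only [hpd, h2]
    refine h1.trans ?_
    have h3 : ∀ k, F t x k j = cmpE F k j t x + idM k j := fun k => (sub_add_cancel _ _).symm
    simp only [h3, mul_add, Finset.sum_add_distrib]
    rw [add_comm]
    congr 1
    simp [idM]
    rfl

lemma cM_pos {T : ℝ} (hT : 0 < T) : 0 < cM T := by
  have hG : 0 ≤ cG := by unfold cG; positivity
  unfold cM
  positivity

end

/-- Lemma 3.3: if moreover `u₀ ∈ L⁴(ℝ²)`, then for every `T > 0`
there is a constant `M(T)`, depending only on `T`, with
`sup_{0≤t≤T} ∫|u|⁴dx + ∫₀ᵀ∫|u|²|∇u|²dxdt ≤ M(T)(∫|u₀|⁴dx + ε₀ B(T))`. -/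
theorem statement_9 :
    ∀ T : ℝ, 0 < T →
      ∃ M : ℝ, 0 < M ∧
        ∀ (u : ℝ → V → V) (F : ℝ → V → M2) (P : ℝ → V → ℝ),
          ContDiff ℝ (⊤ : ℕ∞) (Function.uncurry u) →
          ContDiff ℝ (⊤ : ℕ∞) (Function.uncurry F) →
          ContDiff ℝ (⊤ : ℕ∞) (Function.uncurry P) →
          IsSolution u F P T →
          (∀ t ∈ Set.Icc (0:ℝ) T, ∀ (x : V) (j : Fin 2),
            ∑ i, pd i (fun y => F t y i j) x = 0) →
          (∀ t ∈ Set.Icc (0:ℝ) T, ∀ x : V, Matrix.det (Matrix.of (F t x)) = 1) →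
          (∀ t ∈ Set.Icc (0:ℝ) T, ∀ x : V, nsq (F t x - idM) ≤ 1/4) →
          -- u₀ ∈ L⁴
          Integrable (fun x : V => (vnsq (u 0 x)) ^ 2) →
          (∀ t ∈ Set.Icc (0:ℝ) T,
            Integrable (fun x : V => vnsq (u t x)) ∧
            Integrable (fun x : V => (vnsq (u t x)) ^ 2) ∧
            Integrable (fun x : V => nsq (F t x - idM)) ∧
            Integrable (fun x : V => nsq (gradU (u t) x)) ∧
            Integrable (fun x : V => vnsq (u t x) * nsq (gradU (u t) x))) →
          IntegrableOn (fun t => ∫ x : V, vnsq (u t x) * nsq (gradU (u t) x))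
            (Set.Ioc (0:ℝ) T) →
          Integrable (fun x : V =>
            (nsq (F 0 x - idM) + vnsq (u 0 x)) * (1 + vnsq x)) →
          eps0 (u 0) (F 0) ≤ 1 →
          (⨆ t ∈ Set.Icc (0:ℝ) T, ∫ x : V, (vnsq (u t x)) ^ 2)
              + (∫ t in Set.Ioc (0:ℝ) T, ∫ x : V, vnsq (u t x) * nsq (gradU (u t) x))
            ≤ M * ((∫ x : V, (vnsq (u 0 x)) ^ 2) + eps0 (u 0) (F 0) * Bfun F T) := by
  intro T hT
  refine ⟨cM T, cM_pos hT, ?_⟩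
  intro u F P hu hF hP h hd _ hb _ hi hit hw heps
  have S := sol_of_isSolution hT hu hF hP h hd hb hi hit
  have h0 : (0:ℝ) ∈ Set.Icc 0 T := ⟨le_rfl, hT.le⟩
  obtain ⟨hB0, hB1⟩ := Bfun_mem_unit hb
  have hen : en (cmpU u) (cmpE F) 0 ≤ eps0 (u 0) (F 0) := by
    have i1 := (hi 0 h0).1
    have i2 := (hi 0 h0).2.2.1
    have e : en (cmpU u) (cmpE F) 0 = ∫ x : V, (nsq (F 0 x - idM) + vnsq (u 0 x)) := by
      rw [integral_add i2 i1, add_comm]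
      rfl
    have h1 : ∫ x : V, (nsq (F 0 x - idM) + vnsq (u 0 x))
        ≤ ∫ x : V, (nsq (F 0 x - idM) + vnsq (u 0 x)) * (1 + vnsq x) :=
      integral_mono (i2.add i1) hw fun x =>
        le_mul_of_one_le_right (add_nonneg (nsq_nonneg _) (vnsq_nonneg _))
          (le_add_of_nonneg_right (vnsq_nonneg _))
    have h2 : 0 ≤ ⨆ x : V, nsq (F 0 x - idM) := Real.iSup_nonneg fun _ => nsq_nonneg _
    rw [e, eps0]
    linarith
  have heps0 : 0 ≤ eps0 (u 0) (F 0) := (en_nn 0).trans hen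
  have hE0 := hen.trans heps
  have hβ : ∀ t ∈ Set.Icc 0 T,
      ∫ x, sqm (slm (cmpE F) t) x ^ 2 ≤ eps0 (u 0) (F 0) * Bfun F T := by
    intro t ht
    calc ∫ x, sqm (slm (cmpE F) t) x ^ 2 ≤ ∫ x, sqm (slm (cmpE F) t) x * Bfun F T := by
          refine integral_mono (S.integrable_sqm_sq ht) ((S.iE t ht).mul_const _) fun x => ?_
          simp only [sq]
          exact mul_le_mul_of_nonneg_left (le_Bfun hb ht x) (sqm_nn _ x)
      _ = (∫ x, sqm (slm (cmpE F) t) x) * Bfun F T := integral_mul_const _ _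
      _ ≤ eps0 (u 0) (F 0) * Bfun F T := by
          refine mul_le_mul_of_nonneg_right ?_ hB0
          have h1 := S.energy_le ht
          have h2 : 0 ≤ ∫ s in Set.Ioc 0 t, dd (cmpU u) s := integral_nonneg fun s => dd_nn s
          have h3 : 0 ≤ ∫ x, sqv (sl (cmpU u) t) x := integral_nonneg fun x => sq_nn _ x
          simp only [en] at h1 hen
          linarith
  have main : ∀ t ∈ Set.Icc 0 T, xx (cmpU u) t
      ≤ cM T * (xx (cmpU u) 0 + eps0 (u 0) (F 0) * Bfun F T)
        - ∫ s in Set.Ioc 0 T, dis (cmpU u) s := fun t ht =>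
    le_sub_iff_add_le.2
      (S.xx_add_dis_le hE0 (mul_nonneg heps0 hB0) (mul_le_one₀ heps hB0 hB1) hβ ht)
  have hR := (xx_nn (cmpU u) 0).trans (main 0 h0)
  exact le_sub_iff_add_le.1 (Real.iSup_le (fun t => Real.iSup_le (fun ht => main t ht) hR) hR)
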